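/- Let u : ℝ² → (0,1] be Lipschitz with Lipschitz constant at most 1 (with respect to the Euclidean metric on ℝ²), and define v : ℝ² → (0,1] by v(x,y) = 2^{⌊log₂ u(x,y)⌋}, where ⌊·⌋ denotes the integer floor. Then for every p ∈ (1,∞) there is a constant C_p depending only on p such that for every Schwartz function f on ℝ², the truncated directional Hilbert transform H_v f(x,y) = p.v. ∫_{-1}^{1} f(x−t, y − v(x,y)t) (dt/t) = lim_{ε→0⁺} ∫_{ε≤|t|≤1} f(x−t, y − v(x,y)t) (dt/t) satisfies ‖H_v f‖_{L^p(ℝ²)} ≤ C_p ‖f‖_{L^p(ℝ²)}. -/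

import Mathlib

open MeasureTheory Filter

set_option linter.unusedSectionVars false
set_option linter.unusedSimpArgs false
set_option linter.unusedVariables false

namespace LacHilbert

noncomputable section

open scoped ENNReal NNReal ContDiff
open ENNReal (ofReal mul_iSup ofReal_div_of_pos ofReal_le_ofReal ofReal_ne_top ofReal_mul
  ofReal_ofNat inv_mul_le_iff ofReal_rpow_of_nonneg mul_top toReal_nonneg mul_rpow_of_nonneg
  rpow_one rpow_mul rpow_add_of_nonneg ofReal_inv_of_pos toReal_ofReal toReal_zero rpow_le_rpow
  rpow_ne_top_of_nonneg coe_ne_top zero_rpow_of_pos rpow_natCast rpow_two mul_ne_top rpow_add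
  coe_rpow_of_nonneg coe_mul ofReal_pow coe_one coe_pow coe_inv coe_le_coe one_rpow coe_add)
open Real (norm_eq_abs dist_eq enorm_eq_ofReal_abs rpow_nonneg sqrt_nonneg sq_sqrt enorm_of_nonneg
  HolderConjugate volume_Icc smoothTransition toNNReal_one logb)
open Finset (induction_on sum_insert mul_sum sum_nonneg sum_congr single_le_sum range
  sum_range_succ sum_mul sum_sub_distrib mem_product mem_range sum_product sum_le_sum
  sum_add_distrib measurable_sum sum_singleton sum_le_sum_of_subset sum_comm sum_image coe_filter
  mem_image mem_filter Ico mem_Ico mem_insert sum_const mem_image_of_mem mem_Icc)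
open Set (Icc indicator indicator_of_mem indicator_of_notMem mem_ofPred_eq Ioi Ioc uIoc)
open Metric (closedBall isClosed_closedBall mem_closedBall)

/-- The plane. -/
local notation "ℝ²" => ℝ × ℝ

variable {Q R W a g h w Ω α α₁ α₂ β γ γ₁ γ₂ θ₁ θ₂ κ κ' κ₁ κ₂ κ₃ ψ : ℝ → ℝ} {A B B₁ B₂ b c l p p' r
  s s' t x y δ ρ τ : ℝ} {F : ℝ² → ℝ≥0∞} {G : ℤ → ℝ² → ℝ} {k m n : ℤ} {f u : ℝ² → ℝ} {N : ℕ} {e q :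
  ℝ²} {D : Finset ℝ²} {C C' K₀ K₁ K₂ : ℝ≥0} {K M Y : ℝ≥0∞} {S T : Finset ℤ}

section Basic

variable {E : Type*} [NormedAddCommGroup E] [NormedSpace ℝ E] [MeasureSpace E] [BorelSpace E]
variable {f g : E → ℝ}

/-- Bounded measurable functions vanishing outside a ball. -/
structure Nice (f : E → ℝ) : Prop where
  meas : Measurable f
  bdd : ∃ C : ℝ, 0 ≤ C ∧ ∀ q, |f q| ≤ C
  supp : ∃ R : ℝ, 0 ≤ R ∧ ∀ q, R < ‖q‖ → f q = 0

/-- Convolution of `f` with the kernel `κ` along the direction `e`. -/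
def cv (κ : ℝ → ℝ) (e : E) (f : E → ℝ) (q : E) : ℝ := ∫ t, κ t * f (q - t • e)

/-- The `L¹`-normalised dilation of a kernel to scale `2 ^ (-j)`. -/
def dil (j : ℤ) (κ : ℝ → ℝ) (t : ℝ) : ℝ := (2 : ℝ) ^ j * κ ((2 : ℝ) ^ j * t)

lemma Nice.zero : Nice (fun _ : E => (0 : ℝ)) :=
  ⟨measurable_const, ⟨0, le_rfl, by simp⟩, ⟨0, le_rfl, by simp⟩⟩

lemma Nice.add (hf : Nice f) (hg : Nice g) : Nice (fun q => f q + g q) := by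
  obtain ⟨A, hA, hA'⟩ := hf.bdd
  obtain ⟨B, hB, hB'⟩ := hg.bdd
  obtain ⟨R, hR, hR'⟩ := hf.supp
  obtain ⟨S, hS, hS'⟩ := hg.supp
  refine ⟨hf.meas.add hg.meas, ⟨A + B, by positivity, fun q => ?_⟩, ⟨max R S, by positivity, ?_⟩⟩
  · exact (abs_add_le _ _).trans (add_le_add (hA' q) (hB' q))
  · intro q hq
    simp [hR' q (lt_of_le_of_lt (le_max_left _ _) hq), hS' q (lt_of_le_of_lt (le_max_right _ _) hq)]

/-- Multiplication of a nice function by a bounded measurable one. -/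
lemma Nice.mul_bdd (hf : Nice f) (hg : Measurable g) (C : ℝ)
    (hC : ∀ q, |g q| ≤ C) : Nice (fun q => f q * g q) := by
  obtain ⟨A, hA, hA'⟩ := hf.bdd
  obtain ⟨R, hR, hR'⟩ := hf.supp
  have hC0 : 0 ≤ C := (abs_nonneg _).trans (hC 0)
  refine ⟨hf.meas.mul hg, ⟨A * C, by positivity, fun q => ?_⟩, ⟨R, hR, ?_⟩⟩
  · rw [abs_mul]
    exact mul_le_mul (hA' q) (hC q) (abs_nonneg _) hA
  · intro q hq
    simp [hR' q hq]

lemma Nice.mul (hf : Nice f) (hg : Nice g) : Nice (fun q => f q * g q) := by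
  obtain ⟨B, hB, hB'⟩ := hg.bdd
  exact hf.mul_bdd hg.meas B hB'

lemma Nice.const_mul (hf : Nice f) (c : ℝ) : Nice (fun q => c * f q) := by
  have := hf.mul_bdd (g := fun _ => c) measurable_const |c| (fun _ => le_rfl)
  simpa [mul_comm] using this

lemma Nice.neg (hf : Nice f) : Nice (fun q => - f q) := by
  simpa using hf.const_mul (-1)

lemma Nice.sub (hf : Nice f) (hg : Nice g) : Nice (fun q => f q - g q) := by
  simpa [sub_eq_add_neg] using hf.add hg.neg

lemma Nice.sum {ι : Type*} (s : Finset ι) {f : ι → E → ℝ} (hf : ∀ i ∈ s, Nice (f i)) :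
    Nice (fun q => ∑ i ∈ s, f i q) := by
  classical
  induction s using induction_on with
  | empty => simpa using Nice.zero
  | insert a s ha ih =>
    simp only [sum_insert ha]
    exact (hf a (by simp)).add (ih fun i hi => hf i (by simp [hi]))

lemma Nice.abs (hf : Nice f) : Nice (fun q => |f q|) := by
  obtain ⟨A, hA, hA'⟩ := hf.bdd
  obtain ⟨R, hR, hR'⟩ := hf.supp
  refine ⟨by simpa using hf.meas.norm, ⟨A, hA, fun q => by simpa using hA' q⟩,
    ⟨R, hR, fun q hq => by simp [hR' q hq]⟩⟩

lemma Nice.of_cc [FiniteDimensional ℝ E] (hf : Continuous f)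
    (hs : HasCompactSupport f) : Nice f := by
  obtain ⟨C, hC⟩ := hs.exists_bound_of_continuous hf
  obtain ⟨R, hR⟩ := hs.isCompact.isBounded.exists_norm_le
  refine ⟨hf.measurable, ⟨C, (abs_nonneg _).trans (hC 0), hC⟩, ⟨max R 0, le_max_right _ _, ?_⟩⟩
  intro q hq
  by_contra h
  have := hR q (subset_tsupport f h)
  exact absurd (this.trans (le_max_left R 0)) (not_le.2 hq)

lemma Nice.integrable [FiniteDimensional ℝ E] [(volume : Measure E).IsAddHaarMeasure]
    (hf : Nice f) : Integrable f := by
  obtain ⟨A, hA, hA'⟩ := hf.bdd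
  obtain ⟨R, hR, hR'⟩ := hf.supp
  have : Integrable (indicator (closedBall (0 : E) R) (fun _ => A)) := by
    rw [integrable_indicator_iff measurableSet_closedBall]
    exact integrableOn_const (measure_closedBall_lt_top.ne)
  refine this.mono' hf.meas.aestronglyMeasurable (.of_forall fun q => ?_)
  by_cases hq : q ∈ closedBall (0 : E) R
  · simpa [hq] using hA' q
  · have : R < ‖q‖ := by simpa using hq
    simp [hR' q this, hq]

end Basic

section Cv

variable {E : Type*} [NormedAddCommGroup E] [NormedSpace ℝ E] [MeasureSpace E] [BorelSpace E]
  [FiniteDimensional ℝ E] [(volume : Measure E).IsAddHaarMeasure]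
variable {f g : E → ℝ} {F G : E → ℝ≥0∞}

lemma Nice.translate (hf : Nice f) (a : E) : Nice (fun q => f (q - a)) := by
  obtain ⟨A, hA, hA'⟩ := hf.bdd
  obtain ⟨R, hR, hR'⟩ := hf.supp
  refine ⟨hf.meas.comp (measurable_id.sub_const a), ⟨A, hA, fun q => hA' _⟩,
    ⟨R + ‖a‖, by positivity, fun q hq => hR' _ ?_⟩⟩
  have := norm_sub_norm_le q a
  linarith

lemma Nice.reflect (hκ : Nice κ) : Nice (fun t => κ (-t)) := by
  obtain ⟨A, hA, hA'⟩ := hκ.bdd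
  obtain ⟨R, hR, hR'⟩ := hκ.supp
  exact ⟨hκ.meas.comp measurable_neg, ⟨A, hA, fun q => hA' _⟩,
    ⟨R, hR, fun q hq => hR' _ (by simpa using hq)⟩⟩

lemma Nice.scale (hf : Nice f) (hc : 0 < c) : Nice (fun q => f (c • q)) := by
  obtain ⟨A, hA, hA'⟩ := hf.bdd
  obtain ⟨R, hR, hR'⟩ := hf.supp
  refine ⟨hf.meas.comp (measurable_const_smul c), ⟨A, hA, fun q => hA' _⟩,
    ⟨R / c, by positivity, fun q hq => hR' _ ?_⟩⟩
  rw [norm_smul, norm_eq_abs, abs_of_pos hc]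
  rwa [div_lt_iff₀' hc] at hq

lemma Nice.dil (hκ : Nice κ) (j : ℤ) : Nice (dil j κ) :=
  (hκ.scale (c := (2 : ℝ) ^ j) (by positivity)).const_mul _

lemma meas_cv_aux (hκ : Nice κ) (hf : Nice f) (e : E) :
    Measurable (fun x : E × ℝ => κ x.2 * f (x.1 - x.2 • e)) :=
  (hκ.meas.comp measurable_snd).mul
    (hf.meas.comp (measurable_fst.sub (measurable_snd.smul_const e)))

lemma Nice.cv (hκ : Nice κ) (hf : Nice f) (e : E) : Nice (cv κ e f) := by
  obtain ⟨A, hA, hA'⟩ := hf.bdd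
  obtain ⟨R, hR, hR'⟩ := hf.supp
  obtain ⟨r, hr, hr'⟩ := hκ.supp
  refine ⟨?_, ⟨(∫ t, |κ t|) * A, by positivity, fun q => ?_⟩,
    ⟨R + r * ‖e‖, by positivity, fun q hq => ?_⟩⟩
  · exact ((meas_cv_aux hκ hf e).stronglyMeasurable.integral_prod_right').measurable
  · rw [← integral_mul_const]
    refine (norm_integral_le_integral_norm (fun t => κ t * f (q - t • e))).trans ?_
    refine integral_mono_of_nonneg (.of_forall fun t => norm_nonneg _)
      (hκ.abs.integrable.mul_const A) (.of_forall fun t => ?_)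
    simp only [norm_mul, norm_eq_abs]
    exact mul_le_mul_of_nonneg_left (hA' _) (abs_nonneg _)
  · rw [LacHilbert.cv]
    refine integral_eq_zero_of_ae (.of_forall fun t => ?_)
    by_cases ht : r < |t|
    · simp [hr' t ht]
    · have h1 : ‖t • e‖ ≤ r * ‖e‖ := by
        rw [norm_smul]; exact mul_le_mul_of_nonneg_right (not_lt.1 ht) (norm_nonneg _)
      have := norm_sub_norm_le q (t • e)
      have : f (q - t • e) = 0 := hR' _ (by linarith)
      simp [this]

lemma Nice.cv_integrand (hκ : Nice κ) (hf : Nice f) (e q : E) :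
    Nice (fun t => κ t * f (q - t • e)) := by
  obtain ⟨A, hA, hA'⟩ := hf.bdd
  exact hκ.mul_bdd (hf.meas.comp (measurable_const.sub (measurable_id.smul_const e))) A
    fun t => hA' _

lemma Nice.two_kernels (hκ : Nice κ) (hκ' : Nice κ') {g : ℝ² → ℝ}
    (hg : Measurable g) (A : ℝ) (hA : ∀ q, |g q| ≤ A) :
    Nice (fun x : ℝ² => κ x.1 * κ' x.2 * g x) := by
  have hn : Nice (fun x : ℝ² => κ x.1 * κ' x.2) := by
    obtain ⟨B, hB, hB'⟩ := hκ.bdd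
    obtain ⟨C, hC, hC'⟩ := hκ'.bdd
    obtain ⟨r, hr, hr'⟩ := hκ.supp
    obtain ⟨s, hs, hs'⟩ := hκ'.supp
    refine ⟨(hκ.meas.comp measurable_fst).mul (hκ'.meas.comp measurable_snd),
      ⟨B * C, by positivity, fun q => ?_⟩, ⟨max r s, by positivity, fun q hq => ?_⟩⟩
    · rw [abs_mul]
      exact mul_le_mul (hB' _) (hC' _) (abs_nonneg _) hB
    · rw [Prod.norm_def] at hq
      rcases lt_max_iff.1 hq with h | h
      · rw [hr' _ ((le_max_left _ _).trans_lt h), zero_mul]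
      · rw [hs' _ ((le_max_right _ _).trans_lt h), mul_zero]
  exact hn.mul_bdd hg A hA

lemma cv_comm (hκ : Nice κ) (hκ' : Nice κ') (hf : Nice f) (e e' : E) :
    cv κ e (cv κ' e' f) = cv κ' e' (cv κ e f) := by
  obtain ⟨A, hA, hA'⟩ := hf.bdd
  funext q
  have h := integral_integral_swap (μ := (volume : Measure ℝ)) (ν := (volume : Measure ℝ))
    (f := fun t s => κ t * κ' s * f (q - t • e - s • e'))
    ((hκ.two_kernels hκ' (g := fun x => f (q - x.1 • e - x.2 • e'))
      (hf.meas.comp (((measurable_const.sub (measurable_fst.smul_const e))).sub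
        (measurable_snd.smul_const e'))) A (fun _ => hA' _)).integrable)
  simp only [cv, ← integral_const_mul]
  convert h using 1
  · simp only [mul_assoc]
  · refine integral_congr_ae (.of_forall fun s => ?_)
    refine integral_congr_ae (.of_forall fun t => ?_)
    simp only [sub_right_comm q (t • e)]
    ring

lemma cv_cv (hκ : Nice κ) (hκ' : Nice κ') (hf : Nice f) (e : E) :
    cv (cv κ 1 κ') e f = cv κ e (cv κ' e f) := by
  obtain ⟨A, hA, hA'⟩ := hf.bdd
  obtain ⟨B, hB, hB'⟩ := hκ'.bdd
  obtain ⟨C, hC, hC'⟩ := hκ.bdd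
  obtain ⟨r, hr, hr'⟩ := hκ.supp
  obtain ⟨s, hs, hs'⟩ := hκ'.supp
  funext q
  have hN : Nice (fun x : ℝ² => κ x.2 * κ' (x.1 - x.2) * f (q - x.1 • e)) := by
    have h1 : Nice (fun x : ℝ² => κ x.2 * κ' (x.1 - x.2)) := by
      refine ⟨(hκ.meas.comp measurable_snd).mul (hκ'.meas.comp (measurable_fst.sub measurable_snd)),
        ⟨C * B, by positivity, fun q => ?_⟩, ⟨r + s, by positivity, fun q hq => ?_⟩⟩
      · rw [abs_mul]
        exact mul_le_mul (hC' _) (hB' _) (abs_nonneg _) hC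
      · by_cases h : r < |q.2|
        · rw [hr' _ h, zero_mul]
        · rw [hs', mul_zero]
          rw [Prod.norm_def] at hq
          rcases lt_max_iff.1 hq with h' | h'
          · have := abs_sub_abs_le_abs_sub q.1 q.2
            simp only [norm_eq_abs] at *
            linarith
          · simp only [norm_eq_abs] at *
            linarith
    exact h1.mul_bdd (hf.meas.comp ((measurable_const.sub (measurable_fst.smul_const e)))) A
      (fun _ => hA' _)
  have h := integral_integral_swap (μ := (volume : Measure ℝ)) (ν := (volume : Measure ℝ))
    (f := fun t s => κ s * κ' (t - s) * f (q - t • e)) hN.integrable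
  simp only [cv, ← integral_mul_const, ← integral_const_mul]
  convert h using 1
  · simp
  · refine integral_congr_ae (.of_forall fun s => ?_)
    simp only
    rw [← integral_sub_right_eq_self _ s]
    refine integral_congr_ae (.of_forall fun t => ?_)
    simp only [sub_smul, mul_assoc]
    congr 3
    abel_nf

lemma integral_cv_mul (hκ : Nice κ) (hf : Nice f) (hg : Nice g) (e : E) :
    ∫ q, cv κ e f q * g q = ∫ q, f q * cv (fun t => κ (-t)) e g q := by
  obtain ⟨A, hA, hA'⟩ := hf.bdd
  have hi : Integrable (fun x : E × ℝ => κ x.2 * f (x.1 - x.2 • e) * g x.1)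
      (volume.prod volume) := by
    have h1 : Integrable (fun x : E × ℝ => g x.1 * κ x.2) (volume.prod volume) :=
      hg.integrable.mul_prod hκ.integrable
    have h2 := h1.mul_bdd (c := A) (g := fun x : E × ℝ => f (x.1 - x.2 • e))
      ((hf.meas.comp (measurable_fst.sub (measurable_snd.smul_const e))).aestronglyMeasurable)
      (.of_forall fun x => hA' _)
    refine h2.congr (.of_forall fun x => ?_)
    simp only
    ring
  simp only [cv, ← integral_mul_const, ← integral_const_mul]
  rw [integral_integral_swap (f := fun (x : E) (t : ℝ) => κ t * f (x - t • e) * g x) hi,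
    integral_integral_swap (f := fun (x : E) (t : ℝ) => f x * (κ (-t) * g (x - t • e)))]
  · conv_rhs => rw [← integral_neg_eq_self]
    refine integral_congr_ae (.of_forall fun t => ?_)
    beta_reduce
    rw [← integral_sub_right_eq_self (fun q => f q * (κ (- -t) * g (q - -t • e))) (t • e)]
    refine integral_congr_ae (.of_forall fun q => ?_)
    simp only [neg_smul, sub_neg_eq_add, sub_add_cancel, neg_neg]
    ring
  · obtain ⟨B, hB, hB'⟩ := hg.bdd
    have h1 : Integrable (fun x : E × ℝ => f x.1 * κ (- x.2)) (volume.prod volume) :=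
      hf.integrable.mul_prod hκ.reflect.integrable
    have h2 := h1.mul_bdd (c := B) (g := fun x : E × ℝ => g (x.1 - x.2 • e))
      ((hg.meas.comp (measurable_fst.sub (measurable_snd.smul_const e))).aestronglyMeasurable)
      (.of_forall fun x => hB' _)
    refine h2.congr (.of_forall fun x => ?_)
    simp only [Function.uncurry]
    ring

lemma cv_add (hκ : Nice κ) (hf : Nice f) (hg : Nice g) (e q : E) :
    cv κ e (fun q => f q + g q) q = cv κ e f q + cv κ e g q := by
  simp only [cv, mul_add]
  exact integral_add (hκ.cv_integrand hf e q).integrable (hκ.cv_integrand hg e q).integrable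

lemma cv_sub (hκ : Nice κ) (hf : Nice f) (hg : Nice g) (e q : E) :
    cv κ e (fun q => f q - g q) q = cv κ e f q - cv κ e g q := by
  simp only [cv, mul_sub]
  exact integral_sub (hκ.cv_integrand hf e q).integrable (hκ.cv_integrand hg e q).integrable

lemma cv_sum {ι : Type*} (s : Finset ι) {f : ι → E → ℝ} (hκ : Nice κ)
    (hf : ∀ i ∈ s, Nice (f i)) (e q : E) :
    cv κ e (fun q => ∑ i ∈ s, f i q) q = ∑ i ∈ s, cv κ e (f i) q := by
  simp only [cv, mul_sum]
  exact integral_finsetSum s fun i hi => (hκ.cv_integrand (hf i hi) e q).integrable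

lemma cv_const_mul (κ : ℝ → ℝ) (f : E → ℝ) (c : ℝ) (e q : E) :
    cv κ e (fun q => c * f q) q = c * cv κ e f q := by
  simp only [cv, ← integral_const_mul]
  congr 1; ext t; ring

lemma cv_sub_left (hκ : Nice κ) (hκ' : Nice κ') (hf : Nice f) (e q : E) :
    cv (fun t => κ t - κ' t) e f q = cv κ e f q - cv κ' e f q := by
  simp only [cv, sub_mul]
  exact integral_sub (hκ.cv_integrand hf e q).integrable (hκ'.cv_integrand hf e q).integrable

lemma cv_const_mul_left (κ : ℝ → ℝ) (f : E → ℝ) (c : ℝ) (e q : E) :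
    cv (fun t => c * κ t) e f q = c * cv κ e f q := by
  simp only [cv, ← integral_const_mul]
  congr 1; ext t; ring

lemma cv_dil (j : ℤ) (κ : ℝ → ℝ) (f : E → ℝ) (e q : E) :
    cv (dil j κ) e f q = ∫ t, κ t * f (q - ((2 : ℝ) ^ (-j) * t) • e) := by
  have h2 : (0 : ℝ) < 2 ^ j := by positivity
  have := Measure.integral_comp_mul_left
    (fun t => κ t * f (q - ((2 : ℝ) ^ (-j) * t) • e)) ((2 : ℝ) ^ j)
  rw [abs_of_pos (by positivity), smul_eq_mul, eq_comm, inv_mul_eq_iff_eq_mul₀ h2.ne',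
    ← integral_const_mul] at this
  rw [this]
  simp only [cv, dil]
  congr 1; ext t
  rw [zpow_neg, inv_mul_cancel_left₀ h2.ne', mul_assoc]

lemma dil_cv (j : ℤ) (κ κ' : ℝ → ℝ) : dil j (cv κ 1 κ') = cv (dil j κ) 1 (dil j κ') := by
  funext x
  rw [cv_dil]
  simp only [dil, cv, ← integral_const_mul]
  congr 1; ext t
  have h2 : (2 : ℝ) ^ j ≠ 0 := by positivity
  simp only [smul_eq_mul, mul_one, zpow_neg, mul_sub]
  rw [mul_inv_cancel_left₀ h2]; ring

lemma dil_dil (i j : ℤ) (κ : ℝ → ℝ) : dil i (dil j κ) = dil (i + j) κ := by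
  funext x
  simp only [dil]
  rw [zpow_add₀ (by norm_num)]
  ring_nf

lemma integral_dil (j : ℤ) (κ : ℝ → ℝ) : ∫ t, dil j κ t = ∫ t, κ t := by
  have := cv_dil (E := ℝ) j κ (fun _ => 1) 1 0
  simpa [cv] using this

/-- Smooth compactly supported kernels. -/
structure SK (κ : ℝ → ℝ) : Prop where
  smooth : ContDiff ℝ ∞ κ
  cs : HasCompactSupport κ

lemma SK.nice (h : SK κ) : Nice κ := Nice.of_cc h.smooth.continuous h.cs

lemma SK.deriv (h : SK κ) : SK (deriv κ) :=
  ⟨((contDiff_infty_iff_deriv (𝕜 := ℝ)).1 h.smooth).2, h.cs.deriv⟩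

lemma SK.hasDerivAt (h : SK κ) (t : ℝ) : HasDerivAt κ (_root_.deriv κ t) t :=
  ((h.smooth.differentiable (by simp)) t).hasDerivAt

lemma SK.add (h : SK κ) (h' : SK κ') : SK (fun t => κ t + κ' t) :=
  ⟨h.smooth.add h'.smooth, h.cs.add h'.cs⟩

lemma SK.const_mul (h : SK κ) (c : ℝ) : SK (fun t => c * κ t) :=
  ⟨contDiff_const.mul h.smooth, h.cs.mul_left⟩

lemma SK.sub (h : SK κ) (h' : SK κ') : SK (fun t => κ t - κ' t) := by
  have := h.add (h'.const_mul (-1))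
  simpa [sub_eq_add_neg] using this

lemma SK.comp_affine (h : SK κ) (hc : c ≠ 0) (d : ℝ) :
    SK (fun t => κ (c * t + d)) := by
  refine ⟨h.smooth.comp ((contDiff_const.mul contDiff_id).add contDiff_const), ?_⟩
  exact h.cs.comp_homeomorph ((Homeomorph.mulLeft₀ c hc).trans (Homeomorph.addRight d))

lemma SK.dil (h : SK κ) (j : ℤ) : SK (dil j κ) := by
  have := (h.comp_affine (c := (2 : ℝ) ^ j) (by positivity) 0).const_mul ((2 : ℝ) ^ j)
  simp only [add_zero] at this
  exact this

lemma deriv_dil (h : SK κ) (j : ℤ) :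
    deriv (dil j κ) = fun t => (2 : ℝ) ^ j * dil j (deriv κ) t := by
  funext t
  have h1 : HasDerivAt (fun t : ℝ => (2 : ℝ) ^ j * t) ((2 : ℝ) ^ j) t := by
    simpa using (hasDerivAt_id t).const_mul ((2 : ℝ) ^ j)
  have := ((h.hasDerivAt ((2 : ℝ) ^ j * t)).comp t h1).const_mul ((2 : ℝ) ^ j)
  have h2 : HasDerivAt (dil j κ) _ t := this
  rw [h2.deriv]
  simp only [dil]; ring

lemma cv_one_eq_conv (κ κ' : ℝ → ℝ) :
    cv κ 1 κ' = convolution κ κ' (ContinuousLinearMap.mul ℝ ℝ) volume := by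
  funext x
  simp [cv, convolution_def]

lemma SK.cv (h : SK κ) (h' : SK κ') : SK (cv κ 1 κ') := by
  rw [cv_one_eq_conv]
  exact ⟨h'.cs.contDiff_convolution_right _ h.nice.integrable.locallyIntegrable h'.smooth,
    h.cs.convolution _ h'.cs⟩

lemma deriv_cv (h : Nice κ) (h' : SK κ') :
    _root_.deriv (cv κ 1 κ') = cv κ 1 (_root_.deriv κ') := by
  funext x
  rw [cv_one_eq_conv, cv_one_eq_conv]
  exact (h'.cs.hasDerivAt_convolution_right _ h.integrable.locallyIntegrable
    (h'.smooth.of_le (by simp)) x).deriv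

lemma cv_one_comm (κ κ' : ℝ → ℝ) : cv κ 1 κ' = cv κ' 1 κ := by
  funext x
  simp only [cv, smul_eq_mul, mul_one]
  rw [← integral_sub_left_eq_self _ _ x]
  congr 1; ext t
  simp [mul_comm]

lemma deriv_cv' (h : SK κ) (h' : Nice κ') :
    _root_.deriv (cv κ 1 κ') = cv (_root_.deriv κ) 1 κ' := by
  rw [cv_one_comm, deriv_cv h' h, cv_one_comm]

lemma integral_cv_one (h : Nice κ) (h' : Nice κ') :
    ∫ t, cv κ 1 κ' t = (∫ t, κ t) * ∫ t, κ' t := by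
  rw [cv_one_eq_conv, integral_convolution _ h.integrable h'.integrable]
  simp

lemma SK.integral_deriv (h : SK κ) : ∫ t, _root_.deriv κ t = 0 :=
  integral_eq_zero_of_hasDerivAt_of_integrable h.hasDerivAt h.deriv.nice.integrable h.nice.integrable

/-- Kernels which are Lipschitz and vanish outside an interval. -/
structure LK (κ : ℝ → ℝ) : Prop where
  lip : ∃ K : ℝ, 0 ≤ K ∧ ∀ s t, |κ s - κ t| ≤ K * |s - t|
  supp : ∃ R : ℝ, 0 ≤ R ∧ ∀ t, R < |t| → κ t = 0

lemma LK.nice (h : LK κ) : Nice κ := by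
  obtain ⟨K, hK, hK'⟩ := h.lip
  obtain ⟨R, hR, hR'⟩ := h.supp
  have hc : LipschitzWith K.toNNReal κ := by
    refine LipschitzWith.of_dist_le_mul fun s t => ?_
    rw [dist_eq, dist_eq, Real.coe_toNNReal _ hK]
    exact hK' s t
  refine Nice.of_cc hc.continuous ?_
  refine HasCompactSupport.intro (isCompact_closedBall (0 : ℝ) R) fun t ht => hR' t ?_
  simpa using ht

lemma SK.lk (h : SK κ) : LK κ := by
  obtain ⟨C, hC⟩ := (h.smooth.of_le (by simp)).lipschitzWith_of_hasCompactSupport h.cs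
    (𝕂 := ℝ) one_ne_zero
  obtain ⟨R, hR, hR'⟩ := h.nice.supp
  refine ⟨⟨C, C.2, fun s t => ?_⟩, ⟨R, hR, hR'⟩⟩
  simpa [dist_eq] using hC.dist_le_mul s t

/-- `κ` is bounded by `B / r` and vanishes outside `[-r, r]`. -/
structure Bd (κ : ℝ → ℝ) (B r : ℝ) : Prop where
  pos : 0 < r
  nonneg : 0 ≤ B
  le : ∀ t, |κ t| ≤ B / r
  supp : ∀ t, r < |t| → κ t = 0

lemma Nice.bd (h : Nice κ) : ∃ B r, Bd κ B r := by
  obtain ⟨A, hA, hA'⟩ := h.bdd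
  obtain ⟨r, hr, hr'⟩ := h.supp
  refine ⟨A * (r + 1), r + 1, by positivity, by positivity, fun t => ?_, fun t ht => ?_⟩
  · rw [mul_div_cancel_right₀ _ (by positivity)]; exact hA' t
  · exact hr' t (by simp only [norm_eq_abs]; linarith)

lemma Bd.dil (h : Bd κ B r) (j : ℤ) :
    Bd (dil j κ) B (r * (2 : ℝ) ^ (-j)) := by
  have h2 : (0 : ℝ) < 2 ^ j := by positivity
  refine ⟨mul_pos h.pos (by positivity), h.nonneg, fun t => ?_, fun t ht => ?_⟩
  · rw [LacHilbert.dil, abs_mul, abs_of_pos h2, zpow_neg, ← div_eq_mul_inv, div_div_eq_mul_div,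
      mul_comm B, mul_div_assoc]
    exact mul_le_mul_of_nonneg_left (h.le _) h2.le
  · rw [LacHilbert.dil, h.supp, mul_zero]
    rw [abs_mul, abs_of_pos h2]
    rw [zpow_neg, ← div_eq_mul_inv, div_lt_iff₀ h2] at ht
    linarith

/-- Convolution of a dilated kernel with a coarser Lipschitz kernel. -/
lemma cv_dil_dil_bound (hΩ : Nice Ω) (hα : LK α) :
    ∃ C c : ℝ, 0 ≤ C ∧ 0 < c ∧ ∀ m n : ℤ, n ≤ m →
      Bd (fun x => cv (dil m Ω) 1 (dil n α) x - (∫ t, Ω t) * dil n α x)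
        (C * (2 : ℝ) ^ (n - m)) (c * (2 : ℝ) ^ (-n)) := by
  obtain ⟨K, hK, hK'⟩ := hα.lip
  obtain ⟨R, hR, hR'⟩ := hα.supp
  obtain ⟨r, hr, hr'⟩ := hΩ.supp
  set c := R + r + 1 with hc
  have hc0 : 0 < c := by positivity
  refine ⟨K * (∫ t, |Ω t|) * r * c, c, by positivity, hc0, fun m n hnm => ?_⟩
  have hn : (0 : ℝ) < 2 ^ n := by positivity
  have hm : (0 : ℝ) < 2 ^ m := by positivity
  have hle : (2 : ℝ) ^ n * 2 ^ (-m) ≤ 1 := by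
    rw [← zpow_add₀ (by norm_num)]
    exact zpow_le_one_of_nonpos₀ (by norm_num) (by linarith)
  have key : ∀ x, cv (dil m Ω) 1 (dil n α) x - (∫ t, Ω t) * dil n α x
      = ∫ t, Ω t * (dil n α (x - (2 : ℝ) ^ (-m) * t) - dil n α x) := by
    intro x
    rw [cv_dil, ← integral_mul_const, ← integral_sub]
    · congr 1; ext t; simp; ring
    · obtain ⟨A, hA, hA'⟩ := (hα.nice.dil n).bdd
      exact (hΩ.mul_bdd (g := fun t => dil n α (x - ((2 : ℝ) ^ (-m) * t) • (1 : ℝ)))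
        ((hα.nice.dil n).meas.comp (by fun_prop)) A (fun _ => hA' _)).integrable
    · exact hΩ.integrable.mul_const _
  refine ⟨by positivity, by positivity, fun x => ?_, fun x hx => ?_⟩
  · rw [key]
    have hb : K * (∫ t, |Ω t|) * r * c * (2 : ℝ) ^ (n - m) / (c * 2 ^ (-n))
        = (∫ t, |Ω t| * ((2 : ℝ) ^ n * (K * ((2 : ℝ) ^ n * (2 ^ (-m) * r))))) := by
      rw [integral_mul_const, zpow_sub₀ (by norm_num), zpow_neg, zpow_neg]
      field_simp
    rw [hb]
    refine (norm_integral_le_integral_norm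
      (fun t => Ω t * (dil n α (x - (2 : ℝ) ^ (-m) * t) - dil n α x))).trans ?_
    refine integral_mono_of_nonneg (.of_forall fun t => norm_nonneg _)
      (hΩ.abs.integrable.mul_const _) (.of_forall fun t => ?_)
    simp only [norm_mul, norm_eq_abs]
    by_cases ht : r < |t|
    · simp [hr' t ht]
    · refine mul_le_mul_of_nonneg_left ?_ (abs_nonneg _)
      simp only [dil]
      rw [← mul_sub, abs_mul, abs_of_pos hn]
      refine mul_le_mul_of_nonneg_left ((hK' _ _).trans ?_) hn.le
      refine mul_le_mul_of_nonneg_left ?_ hK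
      rw [← mul_sub, abs_mul, abs_of_pos hn, sub_sub_cancel_left, abs_neg, abs_mul,
        abs_of_pos (by positivity : (0 : ℝ) < 2 ^ (-m))]
      gcongr
      exact not_lt.1 ht
  · rw [key]
    have hx' : c < 2 ^ n * |x| := by
      rw [zpow_neg, ← div_eq_mul_inv, div_lt_iff₀ hn] at hx
      linarith
    refine integral_eq_zero_of_ae (.of_forall fun t => ?_)
    by_cases ht : r < |t|
    · simp [hr' t ht]
    · have h1 : dil n α x = 0 := by
        rw [dil, hR', mul_zero]
        rw [abs_mul, abs_of_pos hn]; linarith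
      have h2 : dil n α (x - (2 : ℝ) ^ (-m) * t) = 0 := by
        rw [dil, hR', mul_zero]
        rw [abs_mul, abs_of_pos hn]
        have h3 := abs_sub_abs_le_abs_sub x ((2 : ℝ) ^ (-m) * t)
        rw [abs_mul ((2 : ℝ) ^ (-m)), abs_of_pos (by positivity : (0 : ℝ) < 2 ^ (-m))] at h3
        have h4 : (2 : ℝ) ^ n * (2 ^ (-m) * |t|) ≤ 1 * r := by
          rw [← mul_assoc]
          exact mul_le_mul hle (not_lt.1 ht) (abs_nonneg _) zero_le_one
        have h5 := mul_le_mul_of_nonneg_left h3 hn.le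
        rw [mul_sub] at h5
        linarith
      simp only [h1, h2, sub_self, mul_zero, Pi.zero_apply]

instance : (volume : Measure (ℝ × ℝ²)).IsAddHaarMeasure :=
  inferInstanceAs ((volume : Measure ℝ).prod (volume : Measure ℝ²)).IsAddHaarMeasure

lemma Nice.three_kernels (h₁ : Nice κ₁) (h₂ : Nice κ₂) (h₃ : Nice κ₃) (b : ℝ)
    {g : ℝ² → ℝ} (hg : Measurable g) (A : ℝ) (hA : ∀ q, |g q| ≤ A) :
    Nice (fun x : ℝ × ℝ² => κ₁ x.1 * (κ₂ (x.2.1 - x.1) * κ₃ (x.2.2 - b * x.1)) * g x.2) := by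
  obtain ⟨A1, hA1, hA1'⟩ := h₁.bdd
  obtain ⟨A2, hA2, hA2'⟩ := h₂.bdd
  obtain ⟨A3, hA3, hA3'⟩ := h₃.bdd
  obtain ⟨r1, hr1, hr1'⟩ := h₁.supp
  obtain ⟨r2, hr2, hr2'⟩ := h₂.supp
  obtain ⟨r3, hr3, hr3'⟩ := h₃.supp
  have hn : Nice (fun x : ℝ × ℝ² => κ₁ x.1 * (κ₂ (x.2.1 - x.1) * κ₃ (x.2.2 - b * x.1))) := by
    refine ⟨(h₁.meas.comp measurable_fst).mul ((h₂.meas.comp (by fun_prop)).mul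
      (h₃.meas.comp (by fun_prop))), ⟨A1 * (A2 * A3), by positivity, fun q => ?_⟩,
      ⟨r1 + r2 + r3 + |b| * r1, by positivity, fun q hq => ?_⟩⟩
    · rw [abs_mul, abs_mul]
      exact mul_le_mul (hA1' _) (mul_le_mul (hA2' _) (hA3' _) (abs_nonneg _) hA2)
        (by positivity) hA1
    · by_contra hne
      have e1 : |q.1| ≤ r1 := by
        by_contra h; exact hne (by rw [hr1' _ (not_le.1 h)]; simp)
      have e2 : |q.2.1 - q.1| ≤ r2 := by
        by_contra h; exact hne (by rw [hr2' _ (not_le.1 h)]; simp)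
      have e3 : |q.2.2 - b * q.1| ≤ r3 := by
        by_contra h; exact hne (by rw [hr3' _ (not_le.1 h)]; simp)
      have f2 := abs_sub_abs_le_abs_sub q.2.1 q.1
      have f3 := abs_sub_abs_le_abs_sub q.2.2 (b * q.1)
      rw [abs_mul] at f3
      have f4 := mul_le_mul_of_nonneg_left e1 (abs_nonneg b)
      have f5 : 0 ≤ |b| * r1 := by positivity
      rw [Prod.norm_def, Prod.norm_def] at hq
      simp only [norm_eq_abs] at hq
      rcases lt_max_iff.1 hq with h | h
      · linarith
      · rcases lt_max_iff.1 h with h | h <;> linarith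
  exact hn.mul_bdd (hg.comp measurable_snd) A (fun _ => hA _)

lemma cv_three_eq (h₁ : Nice κ₁) (h₂ : Nice κ₂) (h₃ : Nice κ₃) (b : ℝ) (hf : Nice f) (e e' q : E) :
    cv κ₁ (e + b • e') (cv κ₂ e (cv κ₃ e' f)) q =
      ∫ x : ℝ², (∫ t, κ₁ t * (κ₂ (x.1 - t) * κ₃ (x.2 - b * t))) * f (q - x.1 • e - x.2 • e') := by
  obtain ⟨A, hA, hA'⟩ := hf.bdd
  have hg : Measurable (fun x : ℝ² => f (q - x.1 • e - x.2 • e')) :=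
    hf.meas.comp ((measurable_const.sub (measurable_fst.smul_const e)).sub
        (measurable_snd.smul_const e'))
  have hN := (h₁.three_kernels h₂ h₃ b hg A (fun _ => hA' _)).integrable
  simp only [← integral_mul_const]
  rw [← integral_integral_swap (f := fun (t : ℝ) (x : ℝ²) =>
    κ₁ t * (κ₂ (x.1 - t) * κ₃ (x.2 - b * t)) * f (q - x.1 • e - x.2 • e')) hN, cv]
  congr 1; ext t
  simp only [mul_assoc, integral_const_mul]
  congr 1
  have hN2 : Integrable (fun x : ℝ² => κ₂ (x.1 - t) *
      (κ₃ (x.2 - b * t) * f (q - x.1 • e - x.2 • e'))) (volume.prod volume) := by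
    have := ((h₂.translate t).two_kernels (h₃.translate (b * t)) hg A
      (fun _ => hA' _)).integrable
    simp only [mul_assoc] at this
    exact this
  rw [Measure.volume_eq_prod, integral_prod _ hN2]
  simp only [cv, integral_const_mul]
  rw [← integral_sub_right_eq_self _ t]
  congr 1; ext a
  congr 1
  rw [← integral_sub_right_eq_self _ (b * t)]
  congr 1; ext c
  congr 2
  simp only [sub_smul, smul_add, smul_smul, mul_comm b t]
  abel

/-- Integration by parts along the direction `e + b • e'`. -/
lemma cv_deriv_by_parts (h₁ : SK κ₁) (h₂ : SK κ₂) (h₃ : SK κ₃) (b : ℝ) (hf : Nice f) (e e' q : E) :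
    cv (deriv κ₁) (e + b • e') (cv κ₂ e (cv κ₃ e' f)) q =
      cv κ₁ (e + b • e') (cv (deriv κ₂) e (cv κ₃ e' f)) q +
      b * cv κ₁ (e + b • e') (cv κ₂ e (cv (deriv κ₃) e' f)) q := by
  obtain ⟨A, hA, hA'⟩ := hf.bdd
  have hg : Measurable (fun x : ℝ² => f (q - x.1 • e - x.2 • e')) :=
    hf.meas.comp ((measurable_const.sub (measurable_fst.smul_const e)).sub
        (measurable_snd.smul_const e'))
  have hI : ∀ {k₁ k₂ k₃ : ℝ → ℝ}, Nice k₁ → Nice k₂ → Nice k₃ → Integrable (fun x : ℝ² =>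
      (∫ t, k₁ t * (k₂ (x.1 - t) * k₃ (x.2 - b * t))) * f (q - x.1 • e - x.2 • e')) := by
    intro k₁ k₂ k₃ h₁ h₂ h₃
    have := (h₁.three_kernels h₂ h₃ b hg A (fun _ => hA' _)).integrable.integral_prod_right
    simpa only [integral_mul_const] using this
  have hJ : ∀ {k₁ k₂ k₃ : ℝ → ℝ}, Nice k₁ → Nice k₂ → Nice k₃ → ∀ x : ℝ², Integrable
      (fun t => k₁ t * (k₂ (x.1 - t) * k₃ (x.2 - b * t))) := by
    intro k₁ k₂ k₃ h₁ h₂ h₃ x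
    obtain ⟨A2, hA2, hA2'⟩ := h₂.bdd
    obtain ⟨A3, hA3, hA3'⟩ := h₃.bdd
    refine (h₁.mul_bdd (g := fun t => k₂ (x.1 - t) * k₃ (x.2 - b * t))
      ((h₂.meas.comp (by fun_prop)).mul (h₃.meas.comp (by fun_prop))) (A2 * A3) ?_).integrable
    intro t
    rw [abs_mul]
    exact mul_le_mul (hA2' _) (hA3' _) (abs_nonneg _) hA2
  rw [cv_three_eq h₁.deriv.nice h₂.nice h₃.nice b hf, cv_three_eq h₁.nice h₂.deriv.nice h₃.nice b hf,
    cv_three_eq h₁.nice h₂.nice h₃.deriv.nice b hf, ← integral_const_mul, ← integral_add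
      (hI h₁.nice h₂.deriv.nice h₃.nice) ((hI h₁.nice h₂.nice h₃.deriv.nice).const_mul b)]
  congr 1; ext x
  rw [← mul_assoc, ← add_mul]
  congr 1
  have hK : Integrable (fun t => κ₁ t * (deriv κ₂ (x.1 - t) * κ₃ (x.2 - b * t)) +
      b * (κ₁ t * (κ₂ (x.1 - t) * deriv κ₃ (x.2 - b * t)))) :=
    (hJ h₁.nice h₂.deriv.nice h₃.nice x).add ((hJ h₁.nice h₂.nice h₃.deriv.nice x).const_mul b)
  rw [← sub_eq_zero, ← integral_const_mul, ← integral_add (hJ h₁.nice h₂.deriv.nice h₃.nice x)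
    ((hJ h₁.nice h₂.nice h₃.deriv.nice x).const_mul b), ← integral_sub
    (hJ h₁.deriv.nice h₂.nice h₃.nice x) hK]
  refine integral_eq_zero_of_hasDerivAt_of_integrable
    (f := fun t => κ₁ t * (κ₂ (x.1 - t) * κ₃ (x.2 - b * t))) (fun t => ?_)
    ((hJ h₁.deriv.nice h₂.nice h₃.nice x).sub ((hJ h₁.nice h₂.deriv.nice h₃.nice x).add
    ((hJ h₁.nice h₂.nice h₃.deriv.nice x).const_mul b))) (hJ h₁.nice h₂.nice h₃.nice x)
  have d2 : HasDerivAt (fun t => κ₂ (x.1 - t)) (deriv κ₂ (x.1 - t) * (-1)) t :=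
    (h₂.hasDerivAt _).comp t ((hasDerivAt_id t).const_sub x.1)
  have d3 : HasDerivAt (fun t => κ₃ (x.2 - b * t)) (deriv κ₃ (x.2 - b * t) * (-(b * 1))) t :=
    (h₃.hasDerivAt _).comp t (((hasDerivAt_id t).const_mul b).const_sub x.2)
  refine ((h₁.hasDerivAt t).mul (d2.mul d3)).congr_deriv ?_
  simp only [Pi.mul_apply]
  ring

/-- Average (up to a factor two) over the segment of half-length `r` in the direction `e`. -/
def av (r : ℝ) (e : E) (F : E → ℝ≥0∞) (q : E) : ℝ≥0∞ :=
  (ofReal r)⁻¹ * ∫⁻ t in Icc (-r) r, F (q - t • e)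

/-- The directional maximal function over dyadic scales. -/
def MM (e : E) (F : E → ℝ≥0∞) (q : E) : ℝ≥0∞ := ⨆ l : ℤ, av ((2 : ℝ) ^ l) e F q

/-- The pointwise absolute value of a function, with values in `ℝ≥0∞`. -/
def en (f : E → ℝ) (q : E) : ℝ≥0∞ := ‖f q‖ₑ

lemma Nice.en_meas (hf : Nice f) : Measurable (en f) := hf.meas.enorm

lemma meas_av (hF : Measurable F) (r : ℝ) (e : E) : Measurable (av r e F) := by
  unfold av
  refine Measurable.const_mul ?_ _
  have : Measurable (fun x : E × ℝ => F (x.1 - x.2 • e)) :=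
    hF.comp (measurable_fst.sub (measurable_snd.smul_const e))
  exact this.lintegral_prod_right'

lemma meas_MM (hF : Measurable F) (e : E) : Measurable (MM e F) :=
  Measurable.iSup fun l => meas_av hF _ e

lemma av_mono (h : ∀ q, F q ≤ G q) (r : ℝ) (e q : E) : av r e F q ≤ av r e G q := by
  unfold av
  gcongr
  exact h _

lemma MM_mono (h : ∀ q, F q ≤ G q) (e q : E) : MM e F q ≤ MM e G q :=
  iSup_mono fun l => av_mono h _ e q

lemma MM_const_mul (F : E → ℝ≥0∞) {c : ℝ≥0∞} (hc : c ≠ ⊤) (e q : E) :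
    MM e (fun q => c * F q) q = c * MM e F q := by
  simp only [MM, av]
  rw [mul_iSup]
  congr 1; ext l
  rw [lintegral_const_mul' _ _ hc, mul_left_comm]

lemma ofReal_ratio_mul (hr : 0 < r) (hs : 0 < s) (I : ℝ≥0∞) :
    ofReal (s / r) * ((ofReal s)⁻¹ * I) = (ofReal r)⁻¹ * I := by
  rw [← mul_assoc, ofReal_div_of_pos hr, div_eq_mul_inv,
    mul_right_comm (ofReal s) (ofReal r)⁻¹,
    ENNReal.mul_inv_cancel (by simpa using hs) (by simp), one_mul]

lemma av_le_av (hr : 0 < r) (hrs : r ≤ s) (e q : E) :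
    av r e F q ≤ ofReal (s / r) * av s e F q := by
  unfold av
  rw [ofReal_ratio_mul hr (hr.trans_le hrs)]
  gcongr

lemma av_le_MM (hr : 0 < r) (e q : E) : av r e F q ≤ 2 * MM e F q := by
  obtain ⟨n, hn1, hn2⟩ := exists_mem_Ico_zpow hr (one_lt_two : (1 : ℝ) < 2)
  refine (av_le_av hr hn2.le e q).trans ?_
  gcongr
  · rw [show (2 : ℝ≥0∞) = ofReal 2 by simp]
    refine ofReal_le_ofReal ?_
    rw [div_le_iff₀ hr, zpow_add₀ (by norm_num)]
    linarith
  · exact le_iSup (fun l : ℤ => av ((2 : ℝ) ^ l) e F q) (n + 1)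

lemma av_shift (hr : 0 < r) (s : ℝ) (e q : E) :
    av r e F (q - s • e) ≤ ofReal ((r + |s|) / r) * av (r + |s|) e F q := by
  have hrs : 0 < r + |s| := by positivity
  unfold av
  rw [ofReal_ratio_mul hr hrs]
  refine mul_le_mul_right ?_ _
  rw [← lintegral_indicator measurableSet_Icc, ← lintegral_indicator measurableSet_Icc,
    ← lintegral_sub_right_eq_self _ s]
  refine lintegral_mono fun t => ?_
  by_cases ht : t - s ∈ Icc (-r) r
  · have ht' : t ∈ Icc (-(r + |s|)) (r + |s|) := by
      have := neg_abs_le s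
      have := le_abs_self s
      constructor <;> linarith [ht.1, ht.2]
    rw [indicator_of_mem ht, indicator_of_mem ht', sub_smul]
    exact le_of_eq (by congr 1; abel)
  · simp [ht]

lemma av_shift_le_MM (hr : 0 < r) (hs : |s| ≤ τ * r) (e q : E) :
    av r e F (q - s • e) ≤ ofReal (1 + τ) * (2 * MM e F q) := by
  refine (av_shift hr s e q).trans ?_
  gcongr
  · rw [div_le_iff₀ hr]; linarith
  · exact av_le_MM (by positivity) e q

lemma enorm_cv_le_av (h : Bd κ B r) (e : E)
    (hF : ∀ q, ‖f q‖ₑ ≤ F q) (q : E) : ‖cv κ e f q‖ₑ ≤ ofReal B * av r e F q := by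
  unfold cv av
  refine (enorm_integral_le_lintegral_enorm _).trans ?_
  rw [← mul_assoc, ← div_eq_mul_inv, ← ofReal_div_of_pos h.pos,
    ← lintegral_const_mul' _ _ ofReal_ne_top, ← lintegral_indicator measurableSet_Icc]
  refine lintegral_mono fun t => ?_
  by_cases ht : t ∈ Icc (-r) r
  · rw [indicator_of_mem ht, enorm_mul]
    refine mul_le_mul' ?_ (hF _)
    rw [enorm_eq_ofReal_abs]
    exact ofReal_le_ofReal (h.le t)
  · have : r < |t| := by
      by_contra h'
      exact ht (abs_le.1 (not_lt.1 h'))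
    rw [h.supp t this]
    simp

lemma enorm_cv_shift_le (h : Bd κ B r) (e : E)
    (hF : ∀ q, ‖f q‖ₑ ≤ F q) (hs : |s| ≤ τ * r) (q : E) :
    ‖cv κ e f (q - s • e)‖ₑ ≤ ofReal (2 * (1 + τ) * B) * MM e F q := by
  refine (enorm_cv_le_av h e hF _).trans ?_
  refine (mul_le_mul_right (av_shift_le_MM h.pos hs e q) _).trans ?_
  have hτ : 0 ≤ τ := by
    by_contra hh
    have := mul_neg_of_neg_of_pos (not_le.1 hh) h.pos
    linarith [abs_nonneg s]
  rw [ofReal_mul (by positivity), ofReal_mul (by norm_num)]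
  simp only [ofReal_ofNat]
  exact le_of_eq (by ring)

lemma enorm_cv_le_MM (h : Bd κ B r) (e : E)
    (hF : ∀ q, ‖f q‖ₑ ≤ F q) (q : E) :
    ‖cv κ e f q‖ₑ ≤ ofReal (2 * B) * MM e F q := by
  have := enorm_cv_shift_le (τ := 0) (s := 0) h e hF (by simp) q
  simpa using this

lemma cv_translate (κ : ℝ → ℝ) (e a : E) (f : E → ℝ) (q : E) :
    cv κ e (fun q => f (q - a)) q = cv κ e f (q - a) := by
  simp only [cv, sub_right_comm]

/-- Pointwise bound of iterated directional convolutions near a point. -/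
lemma enorm_cv_cv_shift_le {r₁ r₂ : ℝ} (h₁ : Bd κ₁ B₁ r₁) (h₂ : Bd κ₂ B₂ r₂)
    (e e' : E) (hF : ∀ q, ‖f q‖ₑ ≤ F q) (hs : |s| ≤ τ * r₁)
    (hs' : |s'| ≤ τ * r₂) (q : E) :
    ‖cv κ₁ e (cv κ₂ e' f) (q - s • e - s' • e')‖ₑ ≤
      ofReal (2 * (1 + τ) * B₁) * ofReal (2 * (1 + τ) * B₂) *
        MM e (MM e' F) q := by
  have h := enorm_cv_shift_le (τ := τ) h₁ e (f := fun q => cv κ₂ e' f (q - s' • e'))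
    (F := fun q => ofReal (2 * (1 + τ) * B₂) * MM e' F q)
    (fun q => enorm_cv_shift_le h₂ e' hF hs' q) hs q
  rw [cv_translate, MM_const_mul _ ofReal_ne_top, ← mul_assoc] at h
  exact h

end Cv

lemma av_one_eq (r : ℝ) (F : ℝ → ℝ≥0∞) (x : ℝ) :
    av r 1 F x = (ofReal r)⁻¹ * ∫⁻ y in closedBall x r, F y := by
  unfold av
  congr 1
  rw [← lintegral_indicator measurableSet_Icc, ← lintegral_indicator
    isClosed_closedBall.measurableSet, ← lintegral_sub_left_eq_self _ x]
  congr 1; ext t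
  have : x - t ∈ Icc (-r) r ↔ t ∈ closedBall x r := by
    rw [mem_closedBall, dist_comm, dist_eq, abs_le, Set.mem_Icc]
  by_cases h : t ∈ closedBall x r
  · rw [indicator_of_mem h, indicator_of_mem (this.2 h)]
    simp
  · rw [indicator_of_notMem h, indicator_of_notMem (fun h' => h (this.1 h'))]

lemma setLIntegral_closedBall_le_MM {w : ℝ → ℝ≥0∞} (hr : 0 < r)
    (hy : y ∈ closedBall b r) :
    ∫⁻ z in closedBall b (5 * r), w z ≤ 12 * ofReal r * MM 1 w y := by
  have hsub : closedBall b (5 * r) ⊆ closedBall y (6 * r) := by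
    refine Metric.closedBall_subset_closedBall' ?_
    rw [dist_comm]
    have := mem_closedBall.1 hy
    linarith
  refine (lintegral_mono_set hsub).trans ?_
  have h6 : (0 : ℝ) < 6 * r := by positivity
  have h := av_le_MM (F := w) h6 1 y
  rw [av_one_eq, inv_mul_le_iff (by simpa using hr) ofReal_ne_top] at h
  refine h.trans (Eq.le ?_)
  rw [ofReal_mul (by norm_num)]
  simp only [ofReal_ofNat]
  ring

lemma weak_type_aux {F w : ℝ → ℝ≥0∞} (hF : Measurable F) (hw : Measurable w) (lam : ℝ≥0∞) (R : ℝ) :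
    lam * ∫⁻ x in {x | ∃ l : ℤ, (2 : ℝ) ^ l ≤ R ∧ lam < av ((2 : ℝ) ^ l) 1 F x}, w x ≤
      12 * ∫⁻ x, F x * MM 1 w x := by
  set S := {x | ∃ l : ℤ, (2 : ℝ) ^ l ≤ R ∧ lam < av ((2 : ℝ) ^ l) 1 F x} with hS
  have hex : ∀ x : ℝ, ∃ l : ℤ, x ∈ S → (2 : ℝ) ^ l ≤ R ∧ lam < av ((2 : ℝ) ^ l) 1 F x := by
    intro x
    by_cases hx : x ∈ S
    · obtain ⟨l, hl⟩ := hx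
      exact ⟨l, fun _ => hl⟩
    · exact ⟨0, fun h => absurd h hx⟩
  choose l hl using hex
  obtain ⟨u, hut, hdisj, hcov⟩ := Vitali.exists_disjoint_subfamily_covering_enlargement_closedBall
    S (fun x => x) (fun x => (2 : ℝ) ^ l x) R (fun a ha => (hl a ha).1) 5 (by norm_num)
  have hucount : u.Countable := by
    refine Set.PairwiseDisjoint.countable_of_nonempty_interior hdisj fun x hx => ?_
    refine Set.Nonempty.mono Metric.ball_subset_interior_closedBall ?_
    exact Metric.nonempty_ball.2 (by positivity)
  have hcovS : S ⊆ ⋃ b ∈ u, closedBall b (5 * (2 : ℝ) ^ l b) := by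
    intro x hx
    obtain ⟨b, hb, hsub⟩ := hcov x hx
    exact Set.mem_biUnion hb (hsub (Metric.mem_closedBall_self (by positivity)))
  have hone : ∀ b ∈ u, lam * ∫⁻ x in closedBall b (5 * (2 : ℝ) ^ l b), w x ≤
      ∫⁻ x in closedBall b ((2 : ℝ) ^ l b), 12 * (F x * MM 1 w x) := by
    intro b hb
    have hr : (0 : ℝ) < 2 ^ l b := by positivity
    have h1 := (hl b (hut hb)).2.le
    rw [av_one_eq] at h1
    refine (mul_le_mul_left h1 _).trans ?_
    rw [mul_assoc, inv_mul_le_iff (by simpa using hr) (by simp),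
      ← lintegral_mul_const _ hF, ← lintegral_const_mul' _ _ (by simp)]
    refine setLIntegral_mono' isClosed_closedBall.measurableSet fun y hy => ?_
    refine (mul_le_mul_right (setLIntegral_closedBall_le_MM hr hy) _).trans (Eq.le ?_)
    ring
  have : Countable u := hucount.to_subtype
  calc lam * ∫⁻ x in S, w x
      ≤ lam * ∑' b : u, ∫⁻ x in closedBall b.1 (5 * (2 : ℝ) ^ l b), w x := by
        gcongr
        refine (lintegral_mono_set hcovS).trans ?_
        rw [Set.biUnion_eq_iUnion]
        exact lintegral_iUnion_le _ _
    _ = ∑' b : u, lam * ∫⁻ x in closedBall b.1 (5 * (2 : ℝ) ^ l b), w x :=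
        ENNReal.tsum_mul_left.symm
    _ ≤ ∑' b : u, ∫⁻ x in closedBall b.1 ((2 : ℝ) ^ l b), 12 * (F x * MM 1 w x) :=
        ENNReal.tsum_le_tsum fun b => hone b b.2
    _ = ∫⁻ x in ⋃ b : u, closedBall b.1 ((2 : ℝ) ^ l b), 12 * (F x * MM 1 w x) := by
        rw [lintegral_iUnion (fun b => isClosed_closedBall.measurableSet)]
        intro a b hab
        exact hdisj a.2 b.2 (fun h => hab (Subtype.ext h))
    _ ≤ ∫⁻ x, 12 * (F x * MM 1 w x) := setLIntegral_le_lintegral _ _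
    _ = 12 * ∫⁻ x, F x * MM 1 w x := lintegral_const_mul' _ _ (by simp)

lemma weak_type {F w : ℝ → ℝ≥0∞} (hF : Measurable F) (hw : Measurable w) (lam : ℝ≥0∞) :
    lam * (volume.withDensity w) {x | lam < MM 1 F x} ≤ 12 * ∫⁻ x, F x * MM 1 w x := by
  have hset : {x | lam < MM 1 F x} =
      ⋃ n : ℕ, {x | ∃ l : ℤ, (2 : ℝ) ^ l ≤ (n : ℝ) ∧ lam < av ((2 : ℝ) ^ l) 1 F x} := by
    ext x
    simp only [MM, mem_ofPred_eq, Set.mem_iUnion, lt_iSup_iff]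
    constructor
    · rintro ⟨l, hl⟩
      obtain ⟨n, hn⟩ := exists_nat_ge ((2 : ℝ) ^ l)
      exact ⟨n, l, hn, hl⟩
    · rintro ⟨n, l, hn, hl⟩
      exact ⟨l, hl⟩
  have hmono : Monotone fun n : ℕ =>
      {x | ∃ l : ℤ, (2 : ℝ) ^ l ≤ (n : ℝ) ∧ lam < av ((2 : ℝ) ^ l) 1 F x} := by
    intro m n hmn x
    rintro ⟨l, hl, h⟩
    exact ⟨l, hl.trans (by exact_mod_cast hmn), h⟩
  rw [hset, hmono.measure_iUnion, mul_iSup]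
  refine iSup_le fun n => ?_
  rw [withDensity_apply]
  · exact weak_type_aux hF hw lam n
  · have : {x | ∃ l : ℤ, (2 : ℝ) ^ l ≤ (n : ℝ) ∧ lam < av ((2 : ℝ) ^ l) 1 F x} =
        ⋃ l : ℤ, {x | (2 : ℝ) ^ l ≤ (n : ℝ) ∧ lam < av ((2 : ℝ) ^ l) 1 F x} := by
      ext x; simp
    rw [this]
    exact MeasurableSet.iUnion fun l => (MeasurableSet.const _).inter
      (measurableSet_lt measurable_const (meas_av hF _ _))

lemma layer_cake_ofReal (hp : 0 < p) (hA : 0 ≤ A) :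
    ∫⁻ l in Ioi (0 : ℝ), (if ofReal l < ofReal A then
      ofReal (l ^ (p - 1)) else 0) = ofReal (1 / p) * ofReal A ^ p := by
  have h1 : ∀ l ∈ Ioi (0 : ℝ), (if ofReal l < ofReal A then
      ofReal (l ^ (p - 1)) else 0) =
      (Set.Iio A).indicator (fun l => ofReal (l ^ (p - 1))) l := by
    intro l hl
    simp only [indicator, Set.mem_Iio, ENNReal.ofReal_lt_ofReal_iff_of_nonneg (le_of_lt hl)]
  rw [setLIntegral_congr_fun measurableSet_Ioi h1, lintegral_indicator measurableSet_Iio,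
    Measure.restrict_restrict measurableSet_Iio, Set.inter_comm, Set.Ioi_inter_Iio,
    ← ofReal_integral_eq_lintegral_ofReal, ← integral_Ioc_eq_integral_Ioo,
    ← intervalIntegral.integral_of_le hA, integral_rpow (Or.inl (by linarith))]
  · rw [sub_add_cancel, Real.zero_rpow hp.ne', sub_zero, ofReal_rpow_of_nonneg hA hp.le,
      ← ofReal_mul (by positivity)]
    congr 1; ring
  · rw [← IntegrableOn, ← integrableOn_Ioc_iff_integrableOn_Ioo,
      ← intervalIntegrable_iff_integrableOn_Ioc_of_le hA]
    exact intervalIntegral.intervalIntegrable_rpow' (by linarith)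
  · filter_upwards [self_mem_ae_restrict measurableSet_Ioo] with l hl
    exact rpow_nonneg hl.1.le _

lemma layer_cake (hp : 0 < p) (a : ℝ≥0∞) :
    ∫⁻ l in Ioi (0 : ℝ), (if ofReal l < a then
      ofReal (l ^ (p - 1)) else 0) = ofReal (1 / p) * a ^ p := by
  by_cases ha : a = ⊤
  · subst ha
    rw [ENNReal.top_rpow_of_pos hp, mul_top (by simpa using hp)]
    refine ENNReal.eq_top_of_forall_nnreal_le fun r => ?_
    have h := layer_cake_ofReal hp (A := (r * p) ^ (1 / p)) (by positivity)
    rw [ofReal_rpow_of_nonneg (by positivity) hp.le,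
      ← ofReal_mul (by positivity), ← Real.rpow_mul (by positivity),
      one_div_mul_cancel hp.ne', Real.rpow_one] at h
    calc (r : ℝ≥0∞) = ofReal (1 / p * (r * p)) := by
          rw [show 1 / p * (r * p) = (r : ℝ) by field_simp, ENNReal.ofReal_coe_nnreal]
      _ ≤ _ := by
          rw [← h]
          refine lintegral_mono fun l => ?_
          split_ifs with h1 h2
          · exact le_rfl
          · exact absurd ENNReal.ofReal_lt_top h2
          · exact bot_le
          · exact le_rfl
  · have := layer_cake_ofReal hp (A := a.toReal) toReal_nonneg
    rwa [ENNReal.ofReal_toReal ha] at this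

lemma measurable_layer {F : ℝ → ℝ≥0∞} (hF : Measurable F) (p : ℝ) :
    Measurable (fun x : ℝ² => if ofReal x.2 < F x.1 then
      ofReal (x.2 ^ (p - 1)) else 0) := by
  refine Measurable.ite (measurableSet_lt ?_ (hF.comp measurable_fst)) ?_ measurable_const
  · exact ENNReal.measurable_ofReal.comp measurable_snd
  · exact ENNReal.measurable_ofReal.comp (measurable_snd.pow_const _)

/-- Layer cake representation of a weighted integral. -/
lemma lintegral_rpow_mul_eq {F w : ℝ → ℝ≥0∞} (hF : Measurable F) (hw : Measurable w)
    (hp : 0 < p) : ∫⁻ x, F x ^ p * w x = ofReal p * ∫⁻ l in Ioi (0 : ℝ),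
      ofReal (l ^ (p - 1)) * ∫⁻ x in {x | ofReal l < F x}, w x := by
  have h1 : ∀ x, F x ^ p * w x = ofReal p * ∫⁻ l in Ioi (0 : ℝ),
      (if ofReal l < F x then ofReal (l ^ (p - 1)) else 0) * w x := by
    intro x
    have hm : Measurable (fun l : ℝ => if ofReal l < F x then
        ofReal (l ^ (p - 1)) else 0) :=
      (measurable_layer hF p).comp (measurable_prodMk_left (x := x))
    rw [lintegral_mul_const _ hm, layer_cake hp,
      ← mul_assoc, ← mul_assoc, ← ofReal_mul hp.le, mul_one_div_cancel hp.ne']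
    simp
  simp_rw [h1]
  rw [lintegral_const_mul' _ _ ofReal_ne_top, lintegral_lintegral_swap]
  · congr 1
    refine lintegral_congr fun l => ?_
    rw [← lintegral_indicator (measurableSet_lt measurable_const hF),
      ← lintegral_const_mul' _ _ ofReal_ne_top]
    refine lintegral_congr fun x => ?_
    simp only [indicator, mem_ofPred_eq]
    split_ifs <;> simp
  · exact ((measurable_layer hF p).mul (hw.comp measurable_fst)).aemeasurable

lemma MM_one_const (c : ℝ≥0∞) (x : ℝ) : MM 1 (fun _ => c) x ≤ 2 * c := by
  refine iSup_le fun l => ?_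
  have h : (0 : ℝ) < 2 ^ l := by positivity
  rw [av_one_eq, setLIntegral_const, Real.volume_closedBall, inv_mul_le_iff
    (by simpa using h) ofReal_ne_top, ofReal_mul (by norm_num)]
  simp only [ofReal_ofNat]
  exact le_of_eq (by ring)

lemma av_add_le {F G : ℝ → ℝ≥0∞} (hF : Measurable F) (r : ℝ) (e x : ℝ) :
    av r e (fun x => F x + G x) x = av r e F x + av r e G x := by
  unfold av
  have hm : Measurable (fun t : ℝ => F (x - t • e)) := hF.comp (by fun_prop)
  rw [lintegral_add_left hm, mul_add]

lemma MM_add_le {F G : ℝ → ℝ≥0∞} (hF : Measurable F) (e x : ℝ) :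
    MM e (fun x => F x + G x) x ≤ MM e F x + MM e G x := by
  refine iSup_le fun l => ?_
  rw [av_add_le hF]
  exact add_le_add (le_iSup (fun l : ℤ => av ((2 : ℝ) ^ l) e F x) l)
    (le_iSup (fun l : ℤ => av ((2 : ℝ) ^ l) e G x) l)

lemma weak_type_trunc {F w : ℝ → ℝ≥0∞} (hF : Measurable F) (hw : Measurable w)
    (hl : 0 < l) : ∫⁻ x in {x | ofReal l < MM 1 F x}, w x ≤
      ofReal (24 / l) * ∫⁻ x in {x | ofReal l < 4 * F x}, F x * MM 1 w x := by
  set S := {x | ofReal l < 4 * F x} with hS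
  have hSm : MeasurableSet S := measurableSet_lt measurable_const (hF.const_mul _)
  have h1 := weak_type (hF.indicator hSm) hw (ofReal (l / 2))
  have h2 : {x | ofReal l < MM 1 F x} ⊆
      {x | ofReal (l / 2) < MM 1 (S.indicator F) x} := by
    intro x hx
    have h3 : ∀ y, F y ≤ S.indicator F y + ofReal (l / 4) := by
      intro y
      by_cases hy : y ∈ S
      · simp [hy]
      · rw [indicator_of_notMem hy, zero_add, ofReal_div_of_pos (by norm_num)]
        simp only [hS, mem_ofPred_eq, not_lt] at hy
        rw [ENNReal.le_div_iff_mul_le (by simp) (by simp), mul_comm]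
        simpa using hy
    have h4 := (MM_mono h3 1 x).trans (MM_add_le (hF.indicator hSm) 1 x)
    have h5 := h4.trans (add_le_add le_rfl (MM_one_const (ofReal (l / 4)) x))
    rw [show (2 : ℝ≥0∞) * ofReal (l / 4) = ofReal (l / 2) by
      rw [← ofReal_ofNat, ← ofReal_mul (by norm_num)]; congr 1; ring] at h5
    simp only [mem_ofPred_eq] at hx ⊢
    by_contra h6
    have h7 := hx.trans_le (h5.trans (add_le_add (not_lt.1 h6) le_rfl))
    rw [← ENNReal.ofReal_add (by positivity) (by positivity), add_halves] at h7
    exact lt_irrefl _ h7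
  have h8 : ∫⁻ x in {x | ofReal l < MM 1 F x}, w x ≤
      (volume.withDensity w) {x | ofReal (l / 2) < MM 1 (S.indicator F) x} := by
    rw [withDensity_apply _ (measurableSet_lt measurable_const (meas_MM (hF.indicator hSm) 1))]
    exact lintegral_mono_set h2
  refine h8.trans ?_
  have h9 : ofReal (24 / l) * ofReal (l / 2) = 12 := by
    rw [← ofReal_mul (by positivity),
      show 24 / l * (l / 2) = 12 by field_simp; norm_num]
    simp
  have h10 : ofReal (2 / l) * ofReal (l / 2) = 1 := by
    rw [← ofReal_mul (by positivity), show 2 / l * (l / 2) = 1 by field_simp]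
    simp
  have h11 := mul_le_mul_right h1 (ofReal (2 / l))
  rw [← mul_assoc, h10, one_mul, ← mul_assoc] at h11
  refine h11.trans (Eq.le ?_)
  rw [show ofReal (2 / l) * 12 = ofReal (24 / l) by
      rw [show (12 : ℝ≥0∞) = ofReal 12 by simp, ← ofReal_mul (by positivity)]
      congr 1; ring,
    ← lintegral_indicator hSm]
  congr 2; ext x
  simp only [indicator]
  split_ifs <;> simp

/-- Weighted strong type inequality for the one-dimensional maximal function. -/
lemma strong_type (hp : 1 < p) : ∃ C : ℝ≥0, ∀ F w : ℝ → ℝ≥0∞, Measurable F →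
    Measurable w → ∫⁻ x, MM 1 F x ^ p * w x ≤ C * ∫⁻ x, F x ^ p * MM 1 w x := by
  refine ⟨Real.toNNReal (24 * p / (p - 1) * 4 ^ (p - 1)), fun F w hF hw => ?_⟩
  have hp0 : 0 < p := by linarith
  have hp1 : 0 < p - 1 := by linarith
  rw [lintegral_rpow_mul_eq (meas_MM hF 1) hw hp0]
  have h1 : ∀ l ∈ Ioi (0 : ℝ), ofReal (l ^ (p - 1)) *
      ∫⁻ x in {x | ofReal l < MM 1 F x}, w x ≤ 24 * (ofReal (l ^ (p - 1 - 1)) *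
        ∫⁻ x in {x | ofReal l < 4 * F x}, F x * MM 1 w x) := by
    intro l hl
    have hl : (0 : ℝ) < l := hl
    refine (mul_le_mul_right (weak_type_trunc hF hw hl) _).trans (Eq.le ?_)
    rw [← mul_assoc, ← mul_assoc]
    congr 1
    rw [← ofReal_mul (by positivity), Real.rpow_sub_one hl.ne' (p - 1),
      show (24 : ℝ≥0∞) = ofReal 24 by simp, ← ofReal_mul (by norm_num)]
    congr 1; ring
  refine (mul_le_mul_right (setLIntegral_mono' measurableSet_Ioi h1) _).trans ?_
  have h2 := lintegral_rpow_mul_eq (F := fun x => 4 * F x) (w := fun x => F x * MM 1 w x)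
    (hF.const_mul _) (hF.mul (meas_MM hw 1)) hp1
  rw [lintegral_const_mul' _ _ (by simp)]
  have h3 : ∫⁻ l in Ioi (0 : ℝ), ofReal (l ^ (p - 1 - 1)) *
      ∫⁻ x in {x | ofReal l < 4 * F x}, F x * MM 1 w x =
      ofReal (1 / (p - 1)) * ∫⁻ x, (4 * F x) ^ (p - 1) * (F x * MM 1 w x) := by
    rw [h2, ← mul_assoc, ← ofReal_mul (by positivity), one_div_mul_cancel hp1.ne']
    simp
  rw [h3]
  have h4 : ∀ x, (4 * F x) ^ (p - 1) * (F x * MM 1 w x) =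
      ofReal (4 ^ (p - 1)) * (F x ^ p * MM 1 w x) := by
    intro x
    rw [mul_rpow_of_nonneg _ _ hp1.le, ← ENNReal.ofReal_rpow_of_pos (by norm_num)]
    have : F x ^ p = F x ^ (p - 1) * F x := by
      conv_rhs => rw [← rpow_one (F x), ← rpow_mul, one_mul,
        ← rpow_add_of_nonneg _ _ hp1.le zero_le_one, sub_add_cancel]
    rw [this]
    simp only [ofReal_ofNat]
    ring
  simp_rw [h4]
  rw [lintegral_const_mul' _ _ ofReal_ne_top, ← ofReal, ← mul_assoc, ← mul_assoc,
    ← mul_assoc]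
  refine le_of_eq ?_
  congr 1
  rw [show (24 : ℝ≥0∞) = ofReal 24 by simp, ← ofReal_mul (by positivity),
    ← ofReal_mul (by positivity), ← ofReal_mul (by positivity)]
  congr 1; ring

/-- Kernel of the conditional expectation onto the dyadic intervals of length `2 ^ (-n)`. -/
def dyK (n : ℤ) (x y : ℝ) : ℝ :=
  if ⌊(2 : ℝ) ^ n * x⌋ = ⌊(2 : ℝ) ^ n * y⌋ then (2 : ℝ) ^ n else 0

/-- Dyadic conditional expectation. -/
def dyE (n : ℤ) (f : ℝ → ℝ) (x : ℝ) : ℝ := ∫ y, dyK n x y * f y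

/-- Functions constant on dyadic intervals of length `2 ^ (-n)`. -/
def DyConst (n : ℤ) (h : ℝ → ℝ) : Prop :=
  ∀ x y, ⌊(2 : ℝ) ^ n * x⌋ = ⌊(2 : ℝ) ^ n * y⌋ → h x = h y

lemma dyK_nonneg (n : ℤ) (x y : ℝ) : 0 ≤ dyK n x y := by
  unfold dyK; split_ifs <;> positivity

lemma dyK_le (n : ℤ) (x y : ℝ) : dyK n x y ≤ (2 : ℝ) ^ n := by
  unfold dyK; split_ifs
  · exact le_rfl
  · positivity

lemma dyK_comm (n : ℤ) (x y : ℝ) : dyK n x y = dyK n y x := by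
  unfold dyK; simp only [eq_comm]

lemma meas_dyK (n : ℤ) : Measurable (fun x : ℝ² => dyK n x.1 x.2) := by
  unfold dyK
  refine Measurable.ite (measurableSet_eq_fun ?_ ?_) measurable_const measurable_const
  · exact Int.measurable_floor.comp (by fun_prop)
  · exact Int.measurable_floor.comp (by fun_prop)

lemma dyK_supp (n : ℤ) (h : (2 : ℝ) ^ (-n) < |x - y|) : dyK n x y = 0 := by
  unfold dyK
  rw [if_neg]
  intro he
  have h1 := Int.abs_sub_lt_one_of_floor_eq_floor he
  have hn : (0 : ℝ) < 2 ^ n := by positivity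
  rw [← mul_sub, abs_mul, abs_of_pos hn] at h1
  rw [zpow_neg, inv_lt_iff_one_lt_mul₀ hn] at h
  linarith

lemma dyK_floor_succ (h : ⌊(2 : ℝ) ^ (n + 1) * x⌋ = ⌊(2 : ℝ) ^ (n + 1) * y⌋) :
    ⌊(2 : ℝ) ^ n * x⌋ = ⌊(2 : ℝ) ^ n * y⌋ := by
  have h1 : ∀ z : ℝ, (2 : ℝ) ^ n * z = (2 : ℝ) ^ (n + 1) * z / (2 : ℕ) := by
    intro z
    rw [zpow_add₀ (by norm_num)]
    push_cast
    ring
  rw [h1, h1, Int.floor_div_natCast, Int.floor_div_natCast, h]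

lemma DyConst.succ (hh : DyConst n h) : DyConst (n + 1) h :=
  fun x y hxy => hh x y (dyK_floor_succ hxy)

lemma dyK_succ_le (n : ℤ) (x y : ℝ) : dyK (n + 1) x y ≤ 2 * dyK n x y := by
  by_cases h : ⌊(2 : ℝ) ^ (n + 1) * x⌋ = ⌊(2 : ℝ) ^ (n + 1) * y⌋
  · rw [dyK, dyK, if_pos h, if_pos (dyK_floor_succ h), zpow_add₀ (by norm_num)]
    exact le_of_eq (by ring)
  · rw [dyK, if_neg h]
    exact mul_nonneg zero_le_two (dyK_nonneg _ _ _)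

lemma integral_dyK (n : ℤ) (x : ℝ) : ∫ y, dyK n x y = 1 := by
  have hn : (0 : ℝ) < 2 ^ n := by positivity
  have h1 : (fun y => dyK n x y) = (Set.Ico (⌊(2 : ℝ) ^ n * x⌋ / (2 : ℝ) ^ n)
      ((⌊(2 : ℝ) ^ n * x⌋ + 1) / (2 : ℝ) ^ n)).indicator fun _ => (2 : ℝ) ^ n := by
    funext y
    have : ⌊(2 : ℝ) ^ n * x⌋ = ⌊(2 : ℝ) ^ n * y⌋ ↔ y ∈ Set.Ico (⌊(2 : ℝ) ^ n * x⌋ / (2 : ℝ) ^ n)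
      ((⌊(2 : ℝ) ^ n * x⌋ + 1) / (2 : ℝ) ^ n) := by
      rw [eq_comm, Int.floor_eq_iff, Set.mem_Ico, div_le_iff₀' hn, lt_div_iff₀' hn]
    simp only [dyK, indicator, this]
  rw [h1, integral_indicator measurableSet_Ico, setIntegral_const, Real.volume_real_Ico_of_le
    (by gcongr; linarith), smul_eq_mul]
  field_simp
  ring

lemma Nice.dy_integrand {f : ℝ → ℝ} (hf : Nice f) (n : ℤ) (x : ℝ) :
    Nice (fun y => dyK n x y * f y) := by
  have := hf.mul_bdd (g := fun y => dyK n x y) ((meas_dyK n).comp measurable_prodMk_left)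
    ((2 : ℝ) ^ n) (fun y => by rw [abs_of_nonneg (dyK_nonneg _ _ _)]; exact dyK_le _ _ _)
  simpa only [mul_comm] using this

lemma dyE_mono {f : ℝ → ℝ} (hf : Nice f) (hg : Nice g) (h : ∀ x, f x ≤ g x) (n : ℤ) (x : ℝ) :
    dyE n f x ≤ dyE n g x :=
  integral_mono (hf.dy_integrand n x).integrable (hg.dy_integrand n x).integrable
    fun y => mul_le_mul_of_nonneg_left (h y) (dyK_nonneg _ _ _)

lemma dyE_const_mul (n : ℤ) (c : ℝ) (f : ℝ → ℝ) (x : ℝ) :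
    dyE n (fun y => c * f y) x = c * dyE n f x := by
  simp only [dyE, ← integral_const_mul]
  congr 1; ext y; ring

lemma dyE_sum {ι : Type*} (s : Finset ι) {f : ι → ℝ → ℝ} (hf : ∀ i ∈ s, Nice (f i)) (n : ℤ)
    (x : ℝ) : dyE n (fun y => ∑ i ∈ s, f i y) x = ∑ i ∈ s, dyE n (f i) x := by
  simp only [dyE, mul_sum]
  exact integral_finsetSum s fun i hi => ((hf i hi).dy_integrand n x).integrable

lemma dyE_nonneg {f : ℝ → ℝ} (h : ∀ x, 0 ≤ f x) (n : ℤ) (x : ℝ) : 0 ≤ dyE n f x :=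
  integral_nonneg fun y => mul_nonneg (dyK_nonneg _ _ _) (h y)

lemma dyE_succ_le {f : ℝ → ℝ} (hf : Nice f) (h : ∀ x, 0 ≤ f x) (n : ℤ) (x : ℝ) :
    dyE (n + 1) f x ≤ 2 * dyE n f x := by
  simp only [dyE, ← integral_const_mul, ← mul_assoc]
  refine integral_mono (hf.dy_integrand _ x).integrable ?_ fun y =>
    mul_le_mul_of_nonneg_right (dyK_succ_le _ _ _) (h y)
  simpa only [mul_assoc] using ((hf.dy_integrand n x).const_mul 2).integrable

lemma dyConst_dyE (n : ℤ) (f : ℝ → ℝ) : DyConst n (dyE n f) := by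
  intro x y hxy
  simp only [dyE, dyK, hxy]

lemma nice_dyE {f : ℝ → ℝ} (hf : Nice f) (n : ℤ) : Nice (dyE n f) := by
  obtain ⟨A, hA, hA'⟩ := hf.bdd
  obtain ⟨R, hR, hR'⟩ := hf.supp
  have hi : ∀ x, Integrable (fun y => dyK n x y) := by
    intro x
    by_contra h
    have := integral_undef h
    rw [integral_dyK] at this
    exact one_ne_zero this
  refine ⟨?_, ⟨A, hA, fun x => ?_⟩, ⟨R + 2 ^ (-n), by positivity, fun x hx => ?_⟩⟩
  · have h1 : Measurable (fun x : ℝ² => dyK n x.1 x.2 * f x.2) :=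
      (meas_dyK n).mul (hf.meas.comp measurable_snd)
    exact h1.stronglyMeasurable.integral_prod_right'.measurable
  · refine (norm_integral_le_integral_norm (fun y => dyK n x y * f y)).trans ?_
    have : A = ∫ y, dyK n x y * A := by rw [integral_mul_const, integral_dyK, one_mul]
    conv_rhs => rw [this]
    refine integral_mono (hf.dy_integrand n x).abs.integrable ((hi x).mul_const A) fun y => ?_
    simp only [norm_mul, norm_eq_abs, abs_of_nonneg (dyK_nonneg n x y)]
    exact mul_le_mul_of_nonneg_left (hA' y) (dyK_nonneg _ _ _)
  · refine integral_eq_zero_of_ae (.of_forall fun y => ?_)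
    by_cases hy : (2 : ℝ) ^ (-n) < |x - y|
    · simp only [dyK_supp n hy, zero_mul, Pi.zero_apply]
    · have := abs_sub_abs_le_abs_sub x y
      rw [norm_eq_abs] at hx
      have h2 : f y = 0 := hR' y (by rw [norm_eq_abs]; linarith)
      simp only [h2, mul_zero, Pi.zero_apply]

lemma integral_dyE_mul {f : ℝ → ℝ} (hf : Nice f) (hh : Nice h) (hc : DyConst n h) :
    ∫ x, dyE n f x * h x = ∫ x, f x * h x := by
  have hi : Integrable (fun x : ℝ² => dyK n x.1 x.2 * f x.2 * h x.1) (volume.prod volume) := by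
    have h1 : Integrable (fun x : ℝ² => h x.1 * f x.2) (volume.prod volume) :=
      hh.integrable.mul_prod hf.integrable
    have h2 := h1.mul_bdd (c := (2 : ℝ) ^ n) (g := fun x : ℝ² => dyK n x.1 x.2)
      (meas_dyK n).aestronglyMeasurable
      (.of_forall fun x => by
        rw [norm_eq_abs, abs_of_nonneg (dyK_nonneg _ _ _)]; exact dyK_le _ _ _)
    refine h2.congr (.of_forall fun x => ?_)
    simp only
    ring
  simp only [dyE, ← integral_mul_const]
  rw [integral_integral_swap (f := fun x y => dyK n x y * f y * h x) hi]
  congr 1; ext y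
  have h1 : ∀ x, dyK n x y * f y * h x = f y * h y * dyK n y x := by
    intro x
    rw [dyK_comm n y x]
    by_cases hxy : ⌊(2 : ℝ) ^ n * x⌋ = ⌊(2 : ℝ) ^ n * y⌋
    · rw [hc x y hxy]; ring
    · simp [dyK, hxy]
  simp only [h1]
  rw [integral_const_mul, integral_dyK, mul_one]

lemma sum_dyE_sq_le {ι : Type*} (s : Finset ι) {f : ι → ℝ → ℝ} (hf : ∀ i ∈ s, Nice (f i))
    {F : ℝ → ℝ} (hF : Nice F) (hF0 : ∀ x, 0 ≤ F x) (h : ∀ x, ∑ i ∈ s, f i x ^ 2 ≤ F x ^ 2) (n : ℤ)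
    (x : ℝ) : ∑ i ∈ s, dyE n (f i) x ^ 2 ≤ dyE n F x ^ 2 := by
  set c := fun i => dyE n (f i) x with hc
  set S := ∑ i ∈ s, c i ^ 2 with hS
  have hS0 : 0 ≤ S := sum_nonneg fun i _ => sq_nonneg _
  have h1 : S = dyE n (fun y => ∑ i ∈ s, c i * f i y) x := by
    rw [dyE_sum s fun i hi => (hf i hi).const_mul _]
    refine sum_congr rfl fun i _ => ?_
    rw [dyE_const_mul, sq]
  have h2 : S ≤ √S * dyE n F x := by
    conv_lhs => rw [h1]
    rw [← dyE_const_mul]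
    refine dyE_mono (Nice.sum s fun i hi => (hf i hi).const_mul _) (hF.const_mul _) (fun y => ?_) n x
    refine le_of_sq_le_sq ?_ (mul_nonneg (sqrt_nonneg _) (hF0 y))
    refine (Finset.sum_mul_sq_le_sq_mul_sq s _ _).trans ?_
    rw [mul_pow, sq_sqrt hS0]
    exact mul_le_mul_of_nonneg_left (h y) hS0
  have hE := dyE_nonneg hF0 n x
  by_cases h0 : S = 0
  · rw [h0]; positivity
  · have hsq : 0 < √S := Real.sqrt_pos.2 (lt_of_le_of_ne hS0 (Ne.symm h0))
    have h3 : √S ≤ dyE n F x := by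
      nlinarith [Real.mul_self_sqrt hS0]
    calc S = √S ^ 2 := (sq_sqrt hS0).symm
      _ ≤ _ := by gcongr

/-- Running maximum of the dyadic conditional expectations. -/
def dyMax (l : ℤ) (F : ℝ → ℝ) : ℕ → ℝ → ℝ
  | 0, x => dyE l F x
  | n + 1, x => max (dyMax l F n x) (dyE (l + (n + 1 : ℕ)) F x)

lemma dyMax_mono_succ (l : ℤ) (F : ℝ → ℝ) (n : ℕ) (x : ℝ) : dyMax l F n x ≤ dyMax l F (n + 1) x :=
  le_max_left _ _

lemma dyE_le_dyMax (l : ℤ) (F : ℝ → ℝ) (n : ℕ) (x : ℝ) : dyE (l + n) F x ≤ dyMax l F n x := by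
  cases n with
  | zero => simp [dyMax]
  | succ n => exact le_max_right _ _

lemma dyMax_nonneg {F : ℝ → ℝ} (h : ∀ x, 0 ≤ F x) (l : ℤ) (n : ℕ) (x : ℝ) : 0 ≤ dyMax l F n x :=
  (dyE_nonneg h _ x).trans (dyE_le_dyMax l F n x)

lemma dyMax_succ_le {F : ℝ → ℝ} (hF : Nice F) (h : ∀ x, 0 ≤ F x) (l : ℤ) (n : ℕ) (x : ℝ) :
    dyMax l F (n + 1) x ≤ 2 * dyMax l F n x := by
  refine max_le ?_ ?_
  · linarith [dyMax_nonneg h l n x]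
  · have h1 := dyE_succ_le hF h (l + n) x
    have h2 := dyE_le_dyMax l F n x
    rw [add_assoc] at h1
    push_cast
    linarith

lemma dyConst_dyMax (l : ℤ) (F : ℝ → ℝ) (n : ℕ) : DyConst (l + n) (dyMax l F n) := by
  induction n with
  | zero => simpa [dyMax] using dyConst_dyE l F
  | succ n ih =>
    intro x y hxy
    have h1 := ih.succ x y (by simpa [add_assoc] using hxy)
    have h2 := dyConst_dyE (l + (n + 1 : ℕ)) F x y hxy
    simp only [dyMax, h1, h2]

lemma Nice.max {f : ℝ → ℝ} (hf : Nice f) (hg : Nice g) : Nice (fun x => max (f x) (g x)) := by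
  obtain ⟨A, hA, hA'⟩ := hf.bdd
  obtain ⟨B, hB, hB'⟩ := hg.bdd
  obtain ⟨R, hR, hR'⟩ := hf.supp
  obtain ⟨S, hS, hS'⟩ := hg.supp
  refine ⟨hf.meas.max hg.meas, ⟨Max.max A B, by positivity, fun q => ?_⟩,
    ⟨Max.max R S, by positivity, ?_⟩⟩
  · exact abs_max_le_max_abs_abs.trans (max_le_max (hA' q) (hB' q))
  · intro q hq
    simp [hR' q (lt_of_le_of_lt (le_max_left _ _) hq), hS' q (lt_of_le_of_lt (le_max_right _ _) hq)]

lemma nice_dyMax {F : ℝ → ℝ} (hF : Nice F) (l : ℤ) (n : ℕ) : Nice (dyMax l F n) := by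
  induction n with
  | zero => exact nice_dyE hF l
  | succ n ih => exact ih.max (nice_dyE hF _)

lemma enorm_dyE_le_MM {f : ℝ → ℝ} (n : ℤ) (x : ℝ) : ‖dyE n f x‖ₑ ≤ MM 1 (en f) x := by
  refine le_trans ?_ (le_iSup (fun l : ℤ => av ((2 : ℝ) ^ l) 1 (en f) x) (-n))
  have hn : (0 : ℝ) < 2 ^ n := by positivity
  rw [av_one_eq, ← ofReal_inv_of_pos (by positivity), zpow_neg, inv_inv,
    ← lintegral_const_mul' _ _ ofReal_ne_top,
    ← lintegral_indicator isClosed_closedBall.measurableSet]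
  refine (enorm_integral_le_lintegral_enorm _).trans (lintegral_mono fun y => ?_)
  by_cases hy : y ∈ closedBall x ((2 : ℝ) ^ n)⁻¹
  · rw [indicator_of_mem hy, enorm_mul, enorm_of_nonneg (dyK_nonneg _ _ _)]
    exact mul_le_mul_left (ofReal_le_ofReal (dyK_le _ _ _)) _
  · rw [dyK_supp n, zero_mul, enorm_zero]
    · exact bot_le
    · rw [mem_closedBall, dist_comm, dist_eq, not_le] at hy
      rwa [zpow_neg]

lemma enorm_dyMax_le_MM {F : ℝ → ℝ} (l : ℤ) (n : ℕ) (x : ℝ) :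
    ‖dyMax l F n x‖ₑ ≤ MM 1 (en F) x := by
  induction n with
  | zero => exact enorm_dyE_le_MM l x
  | succ n ih =>
    simp only [dyMax]
    rcases max_choice (dyMax l F n x) (dyE (l + (n + 1 : ℕ)) F x) with h | h
    · rw [h]; exact ih
    · rw [h]; exact enorm_dyE_le_MM _ x

lemma Nice.of_abs_le {E : Type*} [NormedAddCommGroup E] [NormedSpace ℝ E] [MeasureSpace E]
    [BorelSpace E] {f g : E → ℝ} (hg : Nice g) (hf : Measurable f) (h : ∀ q, |f q| ≤ |g q|) :
    Nice f := by
  obtain ⟨C, hC, hC'⟩ := hg.bdd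
  obtain ⟨R, hR, hR'⟩ := hg.supp
  refine ⟨hf, ⟨C, hC, fun q => (h q).trans (hC' q)⟩, ⟨R, hR, fun q hq => ?_⟩⟩
  have := h q
  rw [hR' q hq, abs_zero] at this
  exact abs_eq_zero.1 (le_antisymm this (abs_nonneg _))

/-- Dyadic martingale difference. -/
def dyD (n : ℤ) (f : ℝ → ℝ) (x : ℝ) : ℝ := dyE (n + 1) f x - dyE n f x

lemma nice_dyD {f : ℝ → ℝ} (hf : Nice f) (n : ℤ) : Nice (dyD n f) :=
  (nice_dyE hf _).sub (nice_dyE hf _)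

lemma dyConst_dyD (n : ℤ) (f : ℝ → ℝ) : DyConst (n + 1) (dyD n f) := fun x y h => by
  simp only [dyD, dyConst_dyE (n + 1) f x y h, (dyConst_dyE n f).succ x y h]

lemma DyConst.mul {f : ℝ → ℝ} (hf : DyConst n f) (hg : DyConst n g) :
    DyConst n (fun x => f x * g x) := fun x y h => by simp only [hf x y h, hg x y h]

lemma DyConst.div {f : ℝ → ℝ} (hf : DyConst n f) (hg : DyConst n g) :
    DyConst n (fun x => f x / g x) := fun x y h => by simp only [hf x y h, hg x y h]

lemma integral_dyE_succ_mul {f : ℝ → ℝ} (hf : Nice f) (hh : Nice h) (hc : DyConst n h) :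
    ∫ x, dyE (n + 1) f x * h x = ∫ x, dyE n f x * h x := by
  rw [integral_dyE_mul hf hh hc, integral_dyE_mul hf hh hc.succ]

lemma integral_dyD_mul {f : ℝ → ℝ} (hf : Nice f) (hg : Nice g) (n : ℤ) :
    ∫ x, dyD n f x * g x = ∫ x, dyD n f x * dyD n g x := by
  have h1 : ∫ x, dyD n f x * dyE (n + 1) g x = ∫ x, dyD n f x * g x := by
    have := integral_dyE_mul hg (nice_dyD hf n) (dyConst_dyD n f)
    simpa only [mul_comm] using this
  have h2 : ∫ x, dyD n f x * dyE n g x = 0 := by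
    simp only [dyD, sub_mul]
    rw [integral_sub ((nice_dyE hf _).mul (nice_dyE hg _)).integrable
      ((nice_dyE hf _).mul (nice_dyE hg _)).integrable,
      integral_dyE_succ_mul hf (nice_dyE hg n) (dyConst_dyE n g), sub_self]
  have h3 : (fun x => dyD n f x * dyD n g x) =
      fun x => dyD n f x * dyE (n + 1) g x - dyD n f x * dyE n g x := by
    ext x; rw [← mul_sub]; rfl
  rw [h3, integral_sub ((nice_dyD hf _).mul (nice_dyE hg _)).integrable
      ((nice_dyD hf _).mul (nice_dyE hg _)).integrable, h1, h2, sub_zero]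

section Weighted

variable {ι : Type*} {s : Finset ι} {f : ι → ℝ → ℝ} {F G : ℝ → ℝ}

lemma abs_dyE_le (hf : ∀ i ∈ s, Nice (f i)) (hF : Nice F) (hF0 : ∀ x, 0 ≤ F x)
    (h : ∀ x, ∑ i ∈ s, f i x ^ 2 ≤ F x ^ 2) {i : ι} (hi : i ∈ s) (n : ℤ) (x : ℝ) :
    |dyE n (f i) x| ≤ dyE n F x := by
  refine abs_le_of_sq_le_sq ?_ (dyE_nonneg hF0 n x)
  exact (single_le_sum (f := fun i => dyE n (f i) x ^ 2) (fun _ _ => sq_nonneg _) hi).trans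
    (sum_dyE_sq_le s hf hF hF0 h n x)

lemma abs_dyD_le (hf : ∀ i ∈ s, Nice (f i)) (hF : Nice F) (hF0 : ∀ x, 0 ≤ F x)
    (h : ∀ x, ∑ i ∈ s, f i x ^ 2 ≤ F x ^ 2) {i : ι} (hi : i ∈ s) (n : ℤ) (x : ℝ) :
    |dyD n (f i) x| ≤ 3 * dyE n F x := by
  have h1 := abs_dyE_le hf hF hF0 h hi n x
  have h2 := abs_dyE_le hf hF hF0 h hi (n + 1) x
  have h3 := dyE_succ_le hF hF0 n x
  exact (abs_sub _ _).trans (by linarith)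

lemma abs_mul_ratio_le {a F G c : ℝ} (hF : 0 ≤ F) (hG : 0 ≤ G) (hc : 0 ≤ c) (h : |a| ≤ c * F) :
    |a * (G / F)| ≤ |c * G| := by
  rw [abs_mul, abs_of_nonneg (div_nonneg hG hF), abs_of_nonneg (mul_nonneg hc hG)]
  rcases hF.eq_or_lt with h0 | h0
  · rw [← h0]; simp; positivity
  · rw [← mul_div_assoc, div_le_iff₀ h0]
    nlinarith

lemma ratio_step {q F F' G G' : ℝ} (hF : 0 ≤ F) (hFF : F ≤ F') (hF2 : F' ≤ 2 * F) (hG : 0 ≤ G)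
    (hGG : G ≤ G') (hq0 : 0 ≤ q) (hq : q ≤ F' ^ 2) :
    q * (G / F) + 2 * (F * G) ≤ q * (G' / F') + 2 * (F' * G') := by
  rcases hF.eq_or_lt with h0 | h0
  · have : F' = 0 := by linarith
    rw [← h0, this]; simp
  · have h0' : 0 < F' := by linarith
    have h1 : q * (G / F) - q * (G' / F') ≤ 2 * (G' * (F' - F)) := by
      have e1 : G / F - G' / F' ≤ G' * (F' - F) / (F * F') := by
        rw [div_sub_div _ _ h0.ne' h0'.ne']
        gcongr
        nlinarith
      calc q * (G / F) - q * (G' / F') = q * (G / F - G' / F') := by ring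
        _ ≤ q * (G' * (F' - F) / (F * F')) := by gcongr
        _ ≤ F' ^ 2 * (G' * (F' - F) / (F * F')) := by
          gcongr
          have : 0 ≤ G' := hG.trans hGG
          have : 0 ≤ F' - F := by linarith
          positivity
        _ = (F' / F) * (G' * (F' - F)) := by field_simp
        _ ≤ 2 * (G' * (F' - F)) := by
          have : 0 ≤ G' := hG.trans hGG
          have : 0 ≤ F' - F := by linarith
          have : F' / F ≤ 2 := by rw [div_le_iff₀ h0]; exact hF2
          gcongr
    nlinarith [mul_nonneg hF (sub_nonneg.2 hGG)]

lemma nice_mul_ratio {e : ℝ → ℝ} {c : ℝ} (hc : 0 ≤ c) (he : Nice e) (hF : Nice F)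
    (hF0 : ∀ x, 0 ≤ F x) (hG : Nice G) (hG0 : ∀ x, 0 ≤ G x) (h : ∀ x, |e x| ≤ c * F x) :
    Nice (fun x => e x * (G x / F x)) :=
  (hG.const_mul c).of_abs_le (he.meas.mul (hG.meas.div hF.meas)) fun x =>
    abs_mul_ratio_le (hF0 x) (hG0 x) hc (h x)

lemma weighted_dyD (hf : ∀ i ∈ s, Nice (f i)) (hF : Nice F) (hF0 : ∀ x, 0 ≤ F x)
    (h : ∀ x, ∑ i ∈ s, f i x ^ 2 ≤ F x ^ 2) (hG : Nice G) (hG0 : ∀ x, 0 ≤ G x) (l : ℤ) (N : ℕ) :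
    ∑ n ∈ range N, ∑ i ∈ s,
        ∫ x, dyD (l + n) (f i) x ^ 2 * (dyMax l G n x / dyMax l F n x) ≤
      3 * ∫ x, dyMax l F N x * dyMax l G N x := by
  have hFs := fun n => nice_dyMax hF l n
  have hGs := fun n => nice_dyMax hG l n
  have hFs0 := fun n x => dyMax_nonneg hF0 l n x
  have hGs0 := fun n x => dyMax_nonneg hG0 l n x
  have hE : ∀ i ∈ s, ∀ n : ℕ, ∀ x, |dyE (l + n) (f i) x| ≤ 1 * dyMax l F n x := fun i hi n x => by
    rw [one_mul]
    exact (abs_dyE_le hf hF hF0 h hi _ x).trans (dyE_le_dyMax l F n x)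
  have hE' : ∀ i ∈ s, ∀ n : ℕ, ∀ x, |dyE (l + n + 1) (f i) x| ≤ 2 * dyMax l F n x :=
      fun i hi n x => by
    have h1 := abs_dyE_le hf hF hF0 h hi (l + n + 1) x
    have h2 := dyE_succ_le hF hF0 (l + n) x
    have h3 := dyE_le_dyMax l F n x
    linarith
  set ρ : ℕ → ℝ → ℝ := fun n x => dyMax l G n x / dyMax l F n x
  change ∑ n ∈ range N, ∑ i ∈ s, ∫ x, dyD (l + n) (f i) x ^ 2 * ρ n x ≤ _
  have hH : ∀ i ∈ s, ∀ n : ℕ, Nice fun x => dyE (l + n) (f i) x * ρ n x := fun i hi n =>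
    nice_mul_ratio zero_le_one (nice_dyE (hf i hi) _) (hFs n) (hFs0 n) (hGs n) (hGs0 n) (hE i hi n)
  have hH' : ∀ i ∈ s, ∀ n : ℕ, Nice fun x => dyE (l + n + 1) (f i) x * ρ n x := fun i hi n =>
    nice_mul_ratio zero_le_two (nice_dyE (hf i hi) _) (hFs n) (hFs0 n) (hGs n) (hGs0 n) (hE' i hi n)
  have i3 : ∀ n : ℕ, ∀ i ∈ s, Integrable fun x =>
      (dyE (l + n + 1) (f i) x ^ 2 - dyE (l + n) (f i) x ^ 2) * ρ n x := by
    intro n i hi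
    refine (((nice_dyE (hf i hi) (l + n + 1)).mul (hH' i hi n)).integrable.sub
      ((nice_dyE (hf i hi) (l + n)).mul (hH i hi n)).integrable).congr
      (.of_forall fun x => ?_)
    simp only [Pi.sub_apply]; ring
  have key : ∀ i ∈ s, ∀ n : ℕ, ∫ x, dyD (l + n) (f i) x ^ 2 * ρ n x =
      ∫ x, (dyE (l + n + 1) (f i) x ^ 2 - dyE (l + n) (f i) x ^ 2) * ρ n x := by
    intro i hi n
    have i1 := ((nice_dyE (hf i hi) (l + n + 1)).mul (hH i hi n)).integrable
    have i2 := ((nice_dyE (hf i hi) (l + n)).mul (hH i hi n)).integrable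
    have e1 : (fun x => dyD (l + n) (f i) x ^ 2 * ρ n x) = fun x =>
        (dyE (l + n + 1) (f i) x ^ 2 - dyE (l + n) (f i) x ^ 2) * ρ n x -
        2 * (dyE (l + n + 1) (f i) x * (dyE (l + n) (f i) x * ρ n x) -
          dyE (l + n) (f i) x * (dyE (l + n) (f i) x * ρ n x)) := by
      ext x; simp only [dyD]; ring
    rw [e1]
    refine (integral_sub (i3 n i hi) ((i1.sub i2).const_mul 2)).trans ?_
    rw [integral_const_mul, integral_sub' i1 i2, integral_dyE_succ_mul (hf i hi) (hH i hi n) ((dyConst_dyE _ _).mul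
        ((dyConst_dyMax l G n).div (dyConst_dyMax l F n))), sub_self, mul_zero, sub_zero]
  rw [sum_congr rfl fun n _ => sum_congr rfl fun i hi => key i hi n,
    sum_congr rfl fun n _ => (integral_finsetSum s (i3 n)).symm,
    ← integral_finsetSum _ fun n _ => integrable_finsetSum _ (i3 n), ← integral_const_mul]
  refine integral_mono (integrable_finsetSum _ fun n _ => integrable_finsetSum _ (i3 n))
    (((hFs N).mul (hGs N)).integrable.const_mul 3) fun x => ?_
  have claim : ∀ N : ℕ, ∑ n ∈ range N, ∑ i ∈ s,
      (dyE (l + n + 1) (f i) x ^ 2 - dyE (l + n) (f i) x ^ 2) * ρ n x ≤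
      (∑ i ∈ s, dyE (l + N) (f i) x ^ 2) * ρ N x +
        2 * (dyMax l F N x * dyMax l G N x) := by
    intro N
    induction N with
    | zero =>
      rw [Finset.sum_range_zero]
      have := hFs0 0 x
      have := hGs0 0 x
      have : 0 ≤ ∑ i ∈ s, dyE (l + (0 : ℕ)) (f i) x ^ 2 := sum_nonneg fun _ _ => sq_nonneg _
      positivity
    | succ N ih =>
      rw [sum_range_succ]
      have h1 := sum_dyE_sq_le s hf hF hF0 h (l + N + 1) x
      have h2 := dyE_le_dyMax l F (N + 1) x
      have h3 : ∑ i ∈ s, dyE (l + N + 1) (f i) x ^ 2 ≤ dyMax l F (N + 1) x ^ 2 := by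
        refine h1.trans (pow_le_pow_left₀ (dyE_nonneg hF0 _ x) ?_ 2)
        simpa [add_assoc] using h2
      have h4 := ratio_step (hFs0 N x) (dyMax_mono_succ l F N x) (dyMax_succ_le hF hF0 l N x)
        (hGs0 N x) (dyMax_mono_succ l G N x) (sum_nonneg fun _ _ => sq_nonneg _) h3
      rw [← sum_mul, sum_sub_distrib]
      push_cast
      simp only [← add_assoc]
      linarith
  refine (claim N).trans ?_
  have h1 : (∑ i ∈ s, dyE (l + N) (f i) x ^ 2) * ρ N x ≤ dyMax l F N x ^ 2 * ρ N x :=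
    mul_le_mul_of_nonneg_right ((sum_dyE_sq_le s hf hF hF0 h _ x).trans
      (pow_le_pow_left₀ (dyE_nonneg hF0 _ x) (dyE_le_dyMax l F N x) 2))
      (div_nonneg (hGs0 N x) (hFs0 N x))
  have h2 : dyMax l F N x ^ 2 * ρ N x ≤ dyMax l F N x * dyMax l G N x := by
    rcases (hFs0 N x).eq_or_lt with h0 | h0
    · rw [← h0]; simp
    · apply le_of_eq; simp only [ρ]; field_simp
  linarith

lemma abs_mul_le_ratio {a b F G : ℝ} (hF : 0 ≤ F) (hG : 0 ≤ G) (ha : |a| ≤ 3 * F)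
    (hb : |b| ≤ 3 * G) : |a * b| ≤ 2⁻¹ * (a ^ 2 * (G / F) + b ^ 2 * (F / G)) := by
  rcases hF.eq_or_lt with h0 | h0
  · have : a = 0 := abs_eq_zero.1 (le_antisymm (by rw [← h0] at ha; simpa using ha) (abs_nonneg _))
    rw [this, ← h0]; simp
  rcases hG.eq_or_lt with h1 | h1
  · have : b = 0 := abs_eq_zero.1 (le_antisymm (by rw [← h1] at hb; simpa using hb) (abs_nonneg _))
    rw [this, ← h1]; simp
  rw [abs_mul]
  have h2 : |a| * |b| * (2 * F * G) ≤ (a ^ 2 * G ^ 2 + b ^ 2 * F ^ 2) := by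
    have := two_mul_le_add_sq (|a| * G) (|b| * F)
    nlinarith [sq_abs a, sq_abs b]
  have h3 : 2⁻¹ * (a ^ 2 * (G / F) + b ^ 2 * (F / G)) =
      (a ^ 2 * G ^ 2 + b ^ 2 * F ^ 2) / (2 * F * G) := by field_simp
  rw [h3, le_div_iff₀ (by positivity)]
  exact h2

/-- Duality estimate for martingale differences. -/
lemma pair_dyD {g : ι → ℕ → ℝ → ℝ} {N : ℕ} (hf : ∀ i ∈ s, Nice (f i))
    (hg : ∀ i ∈ s, ∀ n < N, Nice (g i n)) (hF : Nice F) (hF0 : ∀ x, 0 ≤ F x)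
    (h : ∀ x, ∑ i ∈ s, f i x ^ 2 ≤ F x ^ 2) (hG : Nice G) (hG0 : ∀ x, 0 ≤ G x)
    (h' : ∀ x, ∑ i ∈ s, ∑ n ∈ range N, g i n x ^ 2 ≤ G x ^ 2) (l : ℤ) :
    |∑ n ∈ range N, ∑ i ∈ s, ∫ x, dyD (l + n) (f i) x * g i n x| ≤
      3 * ∫ x, dyMax l F N x * dyMax l G N x := by
  set S := s ×ˢ range N with hS
  set g' : ι × ℕ → ℝ → ℝ := fun a => g a.1 a.2 with hg'
  have hg'' : ∀ a ∈ S, Nice (g' a) := fun a ha => by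
    rw [hS, mem_product, mem_range] at ha
    exact hg _ ha.1 _ ha.2
  have hsum : ∀ x, ∑ a ∈ S, g' a x ^ 2 ≤ G x ^ 2 := fun x => by
    rw [hS, sum_product]; exact h' x
  have A := weighted_dyD hf hF hF0 h hG hG0 l N
  have B := weighted_dyD hg'' hG hG0 hsum hF hF0 l N
  have hFs := fun n => nice_dyMax hF l n
  have hGs := fun n => nice_dyMax hG l n
  have hFs0 := fun n x => dyMax_nonneg hF0 l n x
  have hGs0 := fun n x => dyMax_nonneg hG0 l n x
  have hDf : ∀ i ∈ s, ∀ n : ℕ, ∀ x, |dyD (l + n) (f i) x| ≤ 3 * dyMax l F n x := fun i hi n x =>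
    (abs_dyD_le hf hF hF0 h hi _ x).trans (by gcongr; exact dyE_le_dyMax l F n x)
  have hDg : ∀ a ∈ S, ∀ n : ℕ, ∀ x, |dyD (l + n) (g' a) x| ≤ 3 * dyMax l G n x := fun i hi n x =>
    (abs_dyD_le hg'' hG hG0 hsum hi _ x).trans (by gcongr; exact dyE_le_dyMax l G n x)
  have If : ∀ i ∈ s, ∀ n : ℕ, Integrable fun x =>
      dyD (l + n) (f i) x ^ 2 * (dyMax l G n x / dyMax l F n x) := fun i hi n => by
    have := ((nice_dyD (hf i hi) (l + n)).mul (nice_mul_ratio (by norm_num : (0 : ℝ) ≤ 3)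
      (nice_dyD (hf i hi) (l + n)) (hFs n) (hFs0 n) (hGs n) (hGs0 n) (hDf i hi n))).integrable
    simpa only [sq, mul_assoc] using this
  have Ig : ∀ a ∈ S, ∀ n : ℕ, Integrable fun x =>
      dyD (l + n) (g' a) x ^ 2 * (dyMax l F n x / dyMax l G n x) := fun i hi n => by
    have := ((nice_dyD (hg'' i hi) (l + n)).mul (nice_mul_ratio (by norm_num : (0 : ℝ) ≤ 3)
      (nice_dyD (hg'' i hi) (l + n)) (hGs n) (hGs0 n) (hFs n) (hFs0 n) (hDg i hi n))).integrable
    simpa only [sq, mul_assoc] using this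
  have step : ∀ n ∈ range N, ∀ i ∈ s, |∫ x, dyD (l + n) (f i) x * g i n x| ≤
      2⁻¹ * ((∫ x, dyD (l + n) (f i) x ^ 2 * (dyMax l G n x / dyMax l F n x)) +
        ∫ x, dyD (l + n) (g' (i, n)) x ^ 2 * (dyMax l F n x / dyMax l G n x)) := by
    intro n hn i hi
    have ha : (i, n) ∈ S := mem_product.2 ⟨hi, hn⟩
    rw [integral_dyD_mul (hf i hi) (hg i hi n (mem_range.1 hn)),
      ← integral_add (If i hi n) (Ig _ ha n), ← integral_const_mul]
    refine (abs_integral_le_integral_abs).trans (integral_mono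
      ((nice_dyD (hf i hi) _).mul (nice_dyD (hg'' _ ha) _)).abs.integrable
      (((If i hi n).add (Ig _ ha n)).const_mul _) fun x => ?_)
    exact abs_mul_le_ratio (hFs0 n x) (hGs0 n x) (hDf i hi n x) (hDg _ ha n x)
  have B' : ∑ n ∈ range N, ∑ i ∈ s,
      ∫ x, dyD (l + n) (g' (i, n)) x ^ 2 * (dyMax l F n x / dyMax l G n x) ≤
      3 * ∫ x, dyMax l G N x * dyMax l F N x := by
    refine le_trans (sum_le_sum fun n hn => ?_) B
    rw [hS, sum_product]
    refine sum_le_sum fun i hi => ?_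
    refine single_le_sum (f := fun m => ∫ x, dyD (l + n) (g' (i, m)) x ^ 2 *
      (dyMax l F n x / dyMax l G n x)) (fun m _ => integral_nonneg fun x => ?_) hn
    exact mul_nonneg (sq_nonneg _) (div_nonneg (hFs0 n x) (hGs0 n x))
  simp only [mul_comm (dyMax l G N _)] at B'
  calc _ ≤ ∑ n ∈ range N, ∑ i ∈ s, |∫ x, dyD (l + n) (f i) x * g i n x| :=
        (Finset.abs_sum_le_sum_abs _ _).trans
          (sum_le_sum fun n _ => Finset.abs_sum_le_sum_abs _ _)
    _ ≤ ∑ n ∈ range N, ∑ i ∈ s, 2⁻¹ *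
      ((∫ x, dyD (l + n) (f i) x ^ 2 * (dyMax l G n x / dyMax l F n x)) +
        ∫ x, dyD (l + n) (g' (i, n)) x ^ 2 * (dyMax l F n x / dyMax l G n x)) :=
      sum_le_sum fun n hn => sum_le_sum fun i hi => step n hn i hi
    _ ≤ _ := by
      simp only [← mul_sum, sum_add_distrib]
      linarith

end Weighted

/-- The triangle kernel. -/
def tri (t : ℝ) : ℝ := max 0 (1 - |t|)

lemma tri_nonneg (t : ℝ) : 0 ≤ tri t := le_max_left _ _

lemma tri_le_one (t : ℝ) : tri t ≤ 1 := max_le zero_le_one (by linarith [abs_nonneg t])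

lemma tri_supp (h : 1 ≤ |t|) : tri t = 0 := max_eq_left (by linarith)

lemma continuous_tri : Continuous tri := by unfold tri; fun_prop

lemma nice_tri : Nice tri :=
  ⟨continuous_tri.measurable, ⟨1, zero_le_one, fun t => by
    rw [abs_of_nonneg (tri_nonneg t)]; exact tri_le_one t⟩,
    ⟨1, zero_le_one, fun t ht => tri_supp (by rw [norm_eq_abs] at ht; exact ht.le)⟩⟩

/-- Indicator that two shifted points have the same integer part. -/
def sameFloor (a b s : ℝ) : ℝ := if ⌊a + s⌋ = ⌊b + s⌋ then 1 else 0

lemma sameFloor_periodic (a b : ℝ) : Function.Periodic (sameFloor a b) 1 := fun s => by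
  simp only [sameFloor, ← add_assoc, Int.floor_add_one, add_left_inj]

lemma intervalIntegral_sameFloor (a b : ℝ) : ∫ s in (0 : ℝ)..1, sameFloor a b s = tri (a - b) := by
  have h1 : ∫ s in (0 : ℝ)..1, sameFloor a b s = ∫ s in (0 : ℝ)..1, sameFloor 0 (b - a) s := by
    have := (sameFloor_periodic a b).intervalIntegral_add_eq 0 (-a)
    rw [zero_add] at this
    have h0 := intervalIntegral.integral_comp_add_right (a := 0) (b := 1) (sameFloor a b) (-a)
    rw [zero_add, add_comm 1 (-a)] at h0
    rw [this, ← h0]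
    refine intervalIntegral.integral_congr fun s _ => ?_
    simp only [sameFloor]
    rw [show a + (s + -a) = 0 + s by ring, show b + (s + -a) = b - a + s by ring]
  rw [h1, intervalIntegral.integral_of_le zero_le_one, ← integral_Ico_eq_integral_Ioc]
  set c := b - a with hc
  have h2 : ∀ s ∈ Set.Ico (0 : ℝ) 1, sameFloor 0 c s =
      (Set.Ico (max 0 (-c)) (min 1 (1 - c))).indicator (fun _ => (1 : ℝ)) s := by
    intro s hs
    have h3 : ⌊0 + s⌋ = 0 := by rw [zero_add, Int.floor_eq_zero_iff]; exact hs
    have h4 : (⌊0 + s⌋ = ⌊c + s⌋) ↔ s ∈ Set.Ico (max 0 (-c)) (min 1 (1 - c)) := by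
      rw [h3, eq_comm, Int.floor_eq_zero_iff, Set.mem_Ico, Set.mem_Ico, max_le_iff, lt_min_iff]
      constructor
      · rintro ⟨h5, h6⟩; exact ⟨⟨hs.1, by linarith⟩, hs.2, by linarith⟩
      · rintro ⟨h5, h6⟩; exact ⟨by linarith, by linarith⟩
    simp only [sameFloor, h4, indicator]
  rw [setIntegral_congr_fun measurableSet_Ico h2, setIntegral_indicator measurableSet_Ico]
  have h5 : Set.Ico (0 : ℝ) 1 ∩ Set.Ico (max 0 (-c)) (min 1 (1 - c)) =
      Set.Ico (max 0 (-c)) (min 1 (1 - c)) :=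
    Set.inter_eq_right.2 (Set.Ico_subset_Ico (le_max_left _ _) (min_le_left _ _))
  rw [h5, setIntegral_const, smul_eq_mul, mul_one, Measure.real, Real.volume_Ico]
  have h6 : a - b = -c := by ring
  rw [h6, tri, abs_neg]
  rcases le_total 0 c with h | h
  · rw [abs_of_nonneg h, max_eq_left (by linarith : -c ≤ 0), min_eq_right (by linarith), sub_zero]
    rcases le_total 0 (1 - c) with h' | h'
    · rw [max_eq_right h', toReal_ofReal h']
    · rw [max_eq_left h', ENNReal.ofReal_of_nonpos h', toReal_zero]
  · rw [abs_of_nonpos h, max_eq_right (by linarith : 0 ≤ -c), min_eq_left (by linarith)]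
    rcases le_total 0 (1 - -c) with h' | h'
    · rw [max_eq_right h', toReal_ofReal h']
    · rw [max_eq_left h', ENNReal.ofReal_of_nonpos h', toReal_zero]

lemma sameFloor_integrable (a b : ℝ) : ∀ t₁ t₂ : ℝ,
    IntervalIntegrable (sameFloor a b) volume t₁ t₂ := fun t₁ t₂ => by
  rw [intervalIntegrable_iff]
  refine Measure.integrableOn_of_bounded (M := 1) measure_Ioc_lt_top.ne ?_ ?_
  · refine Measurable.aestronglyMeasurable ?_
    unfold sameFloor
    exact Measurable.ite (measurableSet_eq_fun (Int.measurable_floor.comp (by fun_prop))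
      (Int.measurable_floor.comp (by fun_prop))) measurable_const measurable_const
  · refine .of_forall fun s => ?_
    unfold sameFloor; split_ifs <;> simp

lemma setIntegral_dyK_shift (l : ℤ) (m : ℕ) (x y : ℝ) :
    ∫ v in Ioc 0 ((2 : ℝ) ^ (-l)), dyK (l + m) (x + v) (y + v) =
      (2 : ℝ) ^ (-l) * dil (l + m) tri (x - y) := by
  set c : ℝ := (2 : ℝ) ^ (l + m) with hc
  have hc0 : 0 < c := by positivity
  have h1 : ∀ v, dyK (l + m) (x + v) (y + v) = c * sameFloor (c * x) (c * y) (c * v) := by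
    intro v
    simp only [dyK, sameFloor, mul_add, ← hc]
    split_ifs <;> simp
  simp only [h1]
  rw [← intervalIntegral.integral_of_le (by positivity), intervalIntegral.integral_const_mul,
    intervalIntegral.integral_comp_mul_left _ hc0.ne', mul_zero]
  have h2 : c * 2 ^ (-l) = 0 + (2 ^ m : ℕ) • (1 : ℝ) := by
    rw [hc, zpow_add₀ two_ne_zero, zpow_neg]
    rw [nsmul_eq_mul]
    push_cast
    field_simp
    simp
  rw [h2, ← natCast_zsmul, (sameFloor_periodic _ _).intervalIntegral_add_zsmul_eq _ _
    (sameFloor_integrable _ _), zero_add, intervalIntegral_sameFloor, dil, ← hc, ← mul_sub]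
  have h3 : (2 : ℝ) ^ (-l) * c = 2 ^ m := by
    rw [hc, zpow_add₀ two_ne_zero, zpow_neg]; field_simp; simp
  rw [smul_eq_mul, zsmul_eq_mul]
  push_cast
  rw [← mul_assoc ((2 : ℝ) ^ (-l)), h3]
  field_simp

lemma integral_sub_shift (h : ℝ → ℝ) (v : ℝ) : ∫ x, h x = ∫ x, h (x + v) :=
  (integral_add_right_eq_self h v).symm

lemma dyE_pair_eq {f : ℝ → ℝ} (hf : Nice f) (hg : Nice g) (n : ℤ) (v : ℝ) :
    ∫ x, dyE n (fun y => f (y - v)) x * g (x - v) =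
      ∫ z : ℝ², dyK n (z.1 + v) (z.2 + v) * (g z.1 * f z.2) := by
  have hi : Integrable (fun z : ℝ² => dyK n (z.1 + v) (z.2 + v) * (g z.1 * f z.2))
      (volume.prod volume) := by
    refine (hg.integrable.mul_prod hf.integrable).bdd_mul (c := (2 : ℝ) ^ n) ?_
      (.of_forall fun x => by
        rw [norm_eq_abs, abs_of_nonneg (dyK_nonneg _ _ _)]; exact dyK_le _ _ _)
    exact ((meas_dyK n).comp ((measurable_fst.add_const v).prodMk
      (measurable_snd.add_const v))).aestronglyMeasurable
  rw [integral_sub_shift _ v, Measure.volume_eq_prod, integral_prod _ hi]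
  congr 1; ext x
  simp only [add_sub_cancel_right, dyE]
  rw [integral_sub_shift _ v, ← integral_mul_const]
  congr 1; ext y
  simp only [add_sub_cancel_right]
  ring

lemma cv_one_pair_eq {f : ℝ → ℝ} (hκ : Nice κ) (hf : Nice f) (hg : Nice g) :
    ∫ x, cv κ 1 f x * g x = ∫ z : ℝ², κ (z.1 - z.2) * (g z.1 * f z.2) := by
  obtain ⟨A, hA, hA'⟩ := hκ.bdd
  have hi : Integrable (fun z : ℝ² => κ (z.1 - z.2) * (g z.1 * f z.2))
      (volume.prod volume) := by
    refine (hg.integrable.mul_prod hf.integrable).bdd_mul (c := A) ?_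
      (.of_forall fun x => hA' _)
    exact (hκ.meas.comp (measurable_fst.sub measurable_snd)).aestronglyMeasurable
  rw [Measure.volume_eq_prod, integral_prod _ hi]
  congr 1; ext x
  simp only [cv, smul_eq_mul, mul_one]
  rw [← integral_sub_left_eq_self _ _ x, ← integral_mul_const]
  congr 1; ext y
  simp only [sub_sub_cancel]
  ring

lemma dyE_shift_average {f : ℝ → ℝ} (hf : Nice f) (hg : Nice g) (l : ℤ) (m : ℕ) :
    IntegrableOn (fun v => ∫ x, dyE (l + m) (fun y => f (y - v)) x * g (x - v))
      (Ioc 0 ((2 : ℝ) ^ (-l))) ∧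
    ∫ v in Ioc 0 ((2 : ℝ) ^ (-l)), ∫ x, dyE (l + m) (fun y => f (y - v)) x * g (x - v) =
      (2 : ℝ) ^ (-l) * ∫ x, cv (dil (l + m) tri) 1 f x * g x := by
  simp only [dyE_pair_eq hf hg, cv_one_pair_eq (nice_tri.dil _) hf hg]
  set I := Ioc (0 : ℝ) ((2 : ℝ) ^ (-l)) with hI
  have : IsFiniteMeasure (volume.restrict I) := ⟨by
    rw [Measure.restrict_apply_univ]; exact measure_Ioc_lt_top⟩
  have hi : Integrable (fun z : ℝ × ℝ² =>
      dyK (l + m) (z.2.1 + z.1) (z.2.2 + z.1) * (1 * (g z.2.1 * f z.2.2)))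
      ((volume.restrict I).prod volume) := by
    refine ((integrable_const (1 : ℝ)).mul_prod
      (hg.integrable.mul_prod hf.integrable)).bdd_mul (c := (2 : ℝ) ^ (l + m)) ?_
      (.of_forall fun x => by
        rw [norm_eq_abs, abs_of_nonneg (dyK_nonneg _ _ _)]; exact dyK_le _ _ _)
    exact ((meas_dyK _).comp (((measurable_fst.comp measurable_snd).add measurable_fst).prodMk
      ((measurable_snd.comp measurable_snd).add measurable_fst))).aestronglyMeasurable
  simp only [one_mul] at hi
  refine ⟨hi.integral_prod_left, ?_⟩
  rw [integral_integral_swap (f := fun v (z : ℝ²) =>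
    dyK (l + m) (z.1 + v) (z.2 + v) * (g z.1 * f z.2)) hi, ← integral_const_mul]
  congr 1; ext z
  rw [integral_mul_const, hI, setIntegral_dyK_shift, mul_assoc]

/-- Littlewood-Paley kernels built from the triangle function. -/
def triD (l : ℤ) (t : ℝ) : ℝ := dil (l + 1) tri t - dil l tri t

lemma nice_triD (l : ℤ) : Nice (triD l) := (nice_tri.dil _).sub (nice_tri.dil _)

lemma dyD_shift_average {f : ℝ → ℝ} (hf : Nice f) (hg : Nice g) (l : ℤ) (m : ℕ) :
    IntegrableOn (fun v => ∫ x, dyD (l + m) (fun y => f (y - v)) x * g (x - v))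
      (Ioc 0 ((2 : ℝ) ^ (-l))) ∧
    ∫ v in Ioc 0 ((2 : ℝ) ^ (-l)), ∫ x, dyD (l + m) (fun y => f (y - v)) x * g (x - v) =
      (2 : ℝ) ^ (-l) * ∫ x, cv (triD (l + m)) 1 f x * g x := by
  obtain ⟨h1, h2⟩ := dyE_shift_average hf hg l (m + 1)
  obtain ⟨h3, h4⟩ := dyE_shift_average hf hg l m
  have h5 : ∀ v, ∫ x, dyD (l + m) (fun y => f (y - v)) x * g (x - v) =
      (∫ x, dyE (l + (m + 1 : ℕ)) (fun y => f (y - v)) x * g (x - v)) -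
      ∫ x, dyE (l + m) (fun y => f (y - v)) x * g (x - v) := by
    intro v
    rw [← integral_sub ((nice_dyE (hf.translate v) _).mul (hg.translate v)).integrable
      ((nice_dyE (hf.translate v) _).mul (hg.translate v)).integrable]
    congr 1; ext x
    simp only [dyD]; push_cast; rw [add_assoc]; ring
  simp only [h5]
  refine ⟨h1.sub h3, ?_⟩
  rw [integral_sub h1 h3, h2, h4, ← mul_sub,
    ← integral_sub (((nice_tri.dil _).cv hf 1).mul hg).integrable
      (((nice_tri.dil _).cv hf 1).mul hg).integrable]
  congr 2; ext x
  have : cv (triD (l + m)) 1 f x = _ :=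
    cv_sub_left (nice_tri.dil (l + m + 1)) (nice_tri.dil (l + m)) hf 1 x
  rw [this]; push_cast; rw [add_assoc]; ring

lemma MM_translate {E : Type*} [NormedAddCommGroup E] [NormedSpace ℝ E] [MeasureSpace E]
    (e : E) (F : E → ℝ≥0∞) (a q : E) : MM e (fun y => F (y - a)) q = MM e F (q - a) := by
  simp only [MM, av, sub_right_comm]

/-- One-dimensional Littlewood-Paley duality estimate for the triangle kernels. -/
lemma pair_triD {ι : Type*} {s : Finset ι} {f : ι → ℝ → ℝ} {F G : ℝ → ℝ} {g : ι → ℕ → ℝ → ℝ}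
    (hf : ∀ i ∈ s, Nice (f i)) (hg : ∀ i ∈ s, ∀ n < N, Nice (g i n)) (hF : Nice F)
    (hF0 : ∀ x, 0 ≤ F x) (h : ∀ x, ∑ i ∈ s, f i x ^ 2 ≤ F x ^ 2) (hG : Nice G)
    (hG0 : ∀ x, 0 ≤ G x)
    (h' : ∀ x, ∑ i ∈ s, ∑ n ∈ range N, g i n x ^ 2 ≤ G x ^ 2) (l : ℤ) :
    ‖∑ n ∈ range N, ∑ i ∈ s, ∫ x, cv (triD (l + n)) 1 (f i) x * g i n x‖ₑ ≤
      3 * ∫⁻ x, MM 1 (en F) x * MM 1 (en G) x := by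
  set H : ℝ := (2 : ℝ) ^ (-l) with hH
  have hH0 : 0 < H := by positivity
  set T := ∑ n ∈ range N, ∑ i ∈ s, ∫ x, cv (triD (l + n)) 1 (f i) x * g i n x with hT
  set P : ℝ → ℝ := fun v => ∑ n ∈ range N, ∑ i ∈ s,
    ∫ x, dyD (l + n) (fun y => f i (y - v)) x * g i n (x - v) with hP
  have h1 : H * T = ∫ v in Ioc 0 H, P v := by
    rw [hT, hP, integral_finsetSum _ fun n hn => integrable_finsetSum _ fun i hi =>
      (dyD_shift_average (hf i hi) (hg i hi n (mem_range.1 hn)) l n).1, mul_sum]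
    refine sum_congr rfl fun n hn => ?_
    rw [integral_finsetSum _ fun i hi =>
      (dyD_shift_average (hf i hi) (hg i hi n (mem_range.1 hn)) l n).1, mul_sum]
    exact sum_congr rfl fun i hi =>
      (dyD_shift_average (hf i hi) (hg i hi n (mem_range.1 hn)) l n).2.symm
  have h2 : ∀ v, ‖P v‖ₑ ≤ 3 * ∫⁻ x, MM 1 (en F) x * MM 1 (en G) x := by
    intro v
    have hFv := hF.translate v
    have hGv := hG.translate v
    have h3 := pair_dyD (s := s) (N := N) (f := fun i y => f i (y - v))
      (g := fun i n y => g i n (y - v))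
      (F := fun y => F (y - v)) (G := fun y => G (y - v)) (fun i hi => (hf i hi).translate v)
      (fun i hi n hn => (hg i hi n hn).translate v) hFv (fun x => hF0 _)
      (fun x => h _) hGv (fun x => hG0 _) (fun x => h' _) l
    have h4 := ((nice_dyMax hFv l N).mul (nice_dyMax hGv l N))
    rw [← norm_eq_abs] at h3
    calc ‖P v‖ₑ = ofReal ‖P v‖ := (ofReal_norm _).symm
      _ ≤ _ := ofReal_le_ofReal h3
      _ = 3 * ofReal (∫ x, dyMax l (fun y => F (y - v)) N x *
          dyMax l (fun y => G (y - v)) N x) := by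
        rw [ofReal_mul (by norm_num)]; norm_num
      _ ≤ 3 * ∫⁻ x, ‖dyMax l (fun y => F (y - v)) N x * dyMax l (fun y => G (y - v)) N x‖ₑ := by
        gcongr
        refine le_trans ?_ (enorm_integral_le_lintegral_enorm _)
        rw [← ofReal_norm]
        exact ofReal_le_ofReal (le_abs_self _)
      _ ≤ 3 * ∫⁻ x, MM 1 (en F) (x - v) * MM 1 (en G) (x - v) := by
        gcongr with x
        rw [enorm_mul]
        have a1 := enorm_dyMax_le_MM (F := fun y => F (y - v)) l N x
        have a2 := enorm_dyMax_le_MM (F := fun y => G (y - v)) l N x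
        have a3 := MM_translate 1 (en F) v x
        have a4 := MM_translate 1 (en G) v x
        rw [← a3, ← a4]
        exact mul_le_mul' a1 a2
      _ = _ := by
        rw [lintegral_sub_right_eq_self (fun x => MM 1 (en F) x * MM 1 (en G) x) v]
  have h5 : ofReal H * ‖T‖ₑ ≤
      ofReal H * (3 * ∫⁻ x, MM 1 (en F) x * MM 1 (en G) x) := by
    calc ofReal H * ‖T‖ₑ = ‖H * T‖ₑ := by
          rw [enorm_mul, enorm_of_nonneg hH0.le]
      _ ≤ ∫⁻ v in Ioc 0 H, ‖P v‖ₑ := by rw [h1]; exact enorm_integral_le_lintegral_enorm _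
      _ ≤ ∫⁻ v in Ioc 0 H, 3 * ∫⁻ x, MM 1 (en F) x * MM 1 (en G) x :=
        lintegral_mono fun v => h2 v
      _ = _ := by rw [setLIntegral_const, Real.volume_Ioc, sub_zero, mul_comm]
  exact (ENNReal.mul_le_mul_iff_right (by simpa using hH0) ofReal_ne_top).1 h5

section Norms

variable {X : Type*} [MeasureSpace X]

/-- The `L^p` norm of a nonnegative function. -/
def nrm (p : ℝ) (F : X → ℝ≥0∞) : ℝ≥0∞ := (∫⁻ q, F q ^ p) ^ (1 / p)

/-- The pointwise `ℓ²` norm of a family of nonnegative functions. -/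
def vsq {ι : Type*} (s : Finset ι) (F : ι → X → ℝ≥0∞) (q : X) : ℝ≥0∞ :=
  (∑ a ∈ s, F a q ^ 2) ^ (1 / 2 : ℝ)

variable {ι κ : Type*} {s : Finset ι} {F G : ι → X → ℝ≥0∞} {p p' : ℝ} {A B : X → ℝ≥0∞}

lemma nrm_mono (hp : 0 < p) (h : ∀ q, A q ≤ B q) : nrm p A ≤ nrm p B :=
  rpow_le_rpow (lintegral_mono fun q => rpow_le_rpow (h q) hp.le) (by positivity)

lemma nrm_const_mul (hp : 0 < p) (c : ℝ≥0) (A : X → ℝ≥0∞) :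
    nrm p (fun q => c * A q) = c * nrm p A := by
  simp only [nrm, mul_rpow_of_nonneg _ _ hp.le]
  rw [lintegral_const_mul' _ _ (rpow_ne_top_of_nonneg hp.le coe_ne_top),
    mul_rpow_of_nonneg _ _ (by positivity), ← rpow_mul, mul_one_div_cancel hp.ne',
    rpow_one]

lemma nrm_rpow (hp : 0 < p) (A : X → ℝ≥0∞) : nrm p A ^ p = ∫⁻ q, A q ^ p := by
  rw [nrm, ← rpow_mul, one_div_mul_cancel hp.ne', rpow_one]

lemma nrm_add_le (hp : 1 ≤ p) (hA : Measurable A) (hB : Measurable B) :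
    nrm p (fun q => A q + B q) ≤ nrm p A + nrm p B :=
  ENNReal.lintegral_Lp_add_le hA.aemeasurable hB.aemeasurable hp

lemma nrm_zero (hp : 0 < p) : nrm p (fun _ : X => 0) = 0 := by
  simp [nrm, zero_rpow_of_pos hp, hp]

lemma nrm_sum_le (hp : 1 ≤ p) (hF : ∀ i, Measurable (F i)) (s : Finset ι) :
    nrm p (fun q => ∑ i ∈ s, F i q) ≤ ∑ i ∈ s, nrm p (F i) := by
  classical
  induction s using induction_on with
  | empty => simp [nrm_zero (by linarith : 0 < p)]
  | insert i s hi ih =>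
    simp only [sum_insert hi]
    exact (nrm_add_le hp (hF i) (measurable_sum s fun i _ => hF i)).trans
      (add_le_add_right ih _)

lemma meas_vsq (hF : ∀ i, Measurable (F i)) (s : Finset ι) : Measurable (vsq s F) :=
  (measurable_sum s fun i _ => (hF i).pow_const 2).pow_const _

lemma vsq_sq (s : Finset ι) (F : ι → X → ℝ≥0∞) (q : X) : vsq s F q ^ 2 = ∑ a ∈ s, F a q ^ 2 := by
  rw [vsq, ← rpow_natCast, ← rpow_mul]; norm_num

lemma le_of_sq_le_sq_ennreal {a b : ℝ≥0∞} (h : a ^ 2 ≤ b ^ 2) : a ≤ b := by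
  by_contra h'
  exact absurd h (not_le.2 (ENNReal.pow_lt_pow_left two_ne_zero (not_le.1 h')))

lemma vsq_mono (h : ∀ i ∈ s, ∀ q, F i q ≤ G i q) (q : X) : vsq s F q ≤ vsq s G q :=
  rpow_le_rpow (sum_le_sum fun i hi => pow_le_pow_left' (h i hi q) 2) (by norm_num)

lemma vsq_const_mul (c : ℝ≥0∞) (s : Finset ι) (F : ι → X → ℝ≥0∞) (q : X) :
    vsq s (fun i q => c * F i q) q = c * vsq s F q := by
  simp only [vsq, mul_pow, ← mul_sum]
  rw [mul_rpow_of_nonneg _ _ (by norm_num), ← rpow_natCast, ← rpow_mul]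
  norm_num

lemma vsq_add_le (s : Finset ι) (F G : ι → X → ℝ≥0∞) (q : X) :
    vsq s (fun i q => F i q + G i q) q ≤ vsq s F q + vsq s G q := by
  have := ENNReal.Lp_add_le s (fun i => F i q) (fun i => G i q) (p := 2) (by norm_num)
  simpa only [vsq, rpow_two] using this

lemma vsq_zero (s : Finset ι) (q : X) : vsq s (fun _ _ => 0) q = 0 := by simp [vsq]

lemma vsq_sum_le (s : Finset ι) (t : Finset κ) (F : κ → ι → X → ℝ≥0∞) (q : X) :
    vsq s (fun i q => ∑ n ∈ t, F n i q) q ≤ ∑ n ∈ t, vsq s (F n) q := by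
  classical
  induction t using induction_on with
  | empty => simp [vsq_zero]
  | insert i t hi ih =>
    simp only [sum_insert hi]
    exact (vsq_add_le _ _ _ q).trans (add_le_add_right ih _)

lemma vsq_prod (s : Finset ι) (t : Finset κ) (F : ι × κ → X → ℝ≥0∞) (q : X) :
    vsq (s ×ˢ t) F q = vsq s (fun i => vsq t (fun n => F (i, n))) q := by
  have : ∀ i, vsq t (fun n => F (i, n)) q ^ 2 = ∑ n ∈ t, F (i, n) q ^ 2 := fun i => vsq_sq _ _ _
  rw [vsq, vsq, sum_product, sum_congr rfl fun i _ => (this i).symm]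

lemma le_vsq {i : ι} (hi : i ∈ s) (F : ι → X → ℝ≥0∞) (q : X) : F i q ≤ vsq s F q :=
  le_of_sq_le_sq_ennreal (by
    rw [vsq_sq]; exact single_le_sum (f := fun i => F i q ^ 2) (fun _ _ => bot_le) hi)

lemma vsq_singleton (i : ι) (F : ι → X → ℝ≥0∞) (q : X) : vsq {i} F q = F i q := by
  rw [vsq, sum_singleton, ← rpow_natCast, ← rpow_mul]; norm_num

lemma sum_mul_le_vsq (s : Finset ι) (F G : ι → X → ℝ≥0∞) (q : X) :
    ∑ i ∈ s, F i q * G i q ≤ vsq s F q * vsq s G q := by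
  have := ENNReal.inner_le_Lp_mul_Lq s (fun i => F i q) (fun i => G i q)
    (p := 2) (q := 2) HolderConjugate.two_two
  simpa only [vsq, rpow_two] using this

lemma lintegral_mul_le_nrm (hpq : p.HolderConjugate p') (hA : Measurable A) (hB : Measurable B) :
    ∫⁻ q, A q * B q ≤ nrm p A * nrm p' B :=
  ENNReal.lintegral_mul_le_Lp_mul_Lq volume hpq hA.aemeasurable hB.aemeasurable

lemma sum_lintegral_mul_le (hpq : p.HolderConjugate p') (hF : ∀ i, Measurable (F i))
    (hG : ∀ i, Measurable (G i)) (s : Finset ι) :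
    ∑ i ∈ s, ∫⁻ q, F i q * G i q ≤ nrm p (vsq s F) * nrm p' (vsq s G) := by
  have e1 := lintegral_finsetSum (μ := volume) (f := fun i q => F i q * G i q) s
    fun i _ => (hF i).mul (hG i)
  rw [← e1]
  exact (lintegral_mono fun q => sum_mul_le_vsq s F G q).trans
    (lintegral_mul_le_nrm hpq (meas_vsq hF s) (meas_vsq hG s))

lemma schur_sq {t : Finset κ} (c : ι → κ → ℝ≥0∞) (K : ℝ≥0∞) (h1 : ∀ i ∈ s, ∑ j ∈ t, c i j ≤ K)
    (h2 : ∀ j ∈ t, ∑ i ∈ s, c i j ≤ K) (H : κ → X → ℝ≥0∞) (q : X) :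
    vsq s (fun i q => ∑ j ∈ t, c i j * H j q) q ≤ K * vsq t H q := by
  apply le_of_sq_le_sq_ennreal
  rw [vsq_sq, mul_pow, vsq_sq]
  have cs : ∀ i ∈ s, (∑ j ∈ t, c i j * H j q) ^ 2 ≤ K * ∑ j ∈ t, c i j * H j q ^ 2 := by
    intro i hi
    have := ENNReal.inner_le_Lp_mul_Lq t (fun j => c i j ^ (1 / 2 : ℝ))
      (fun j => c i j ^ (1 / 2 : ℝ) * H j q) (p := 2) (q := 2) HolderConjugate.two_two
    have e1 : ∀ j, c i j ^ (1 / 2 : ℝ) * (c i j ^ (1 / 2 : ℝ) * H j q) = c i j * H j q := fun j => by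
      rw [← mul_assoc, ← rpow_add_of_nonneg _ _ (by norm_num) (by norm_num)]; norm_num
    have e2 : ∀ j, (c i j ^ (1 / 2 : ℝ)) ^ (2 : ℝ) = c i j := fun j => by
      rw [← rpow_mul]; norm_num
    have e3 : ∀ j, (c i j ^ (1 / 2 : ℝ) * H j q) ^ (2 : ℝ) = c i j * H j q ^ 2 := fun j => by
      rw [mul_rpow_of_nonneg _ _ (by norm_num), e2, rpow_two]
    simp only [e1, e2, e3] at this
    calc (∑ j ∈ t, c i j * H j q) ^ 2 ≤ ((∑ j ∈ t, c i j) ^ (1 / 2 : ℝ) *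
          (∑ j ∈ t, c i j * H j q ^ 2) ^ (1 / 2 : ℝ)) ^ 2 := pow_le_pow_left' this 2
      _ = (∑ j ∈ t, c i j) * (∑ j ∈ t, c i j * H j q ^ 2) := by
        rw [mul_pow, ← rpow_natCast, ← rpow_natCast, ← rpow_mul,
          ← rpow_mul]
        norm_num
      _ ≤ _ := mul_le_mul_left (h1 i hi) _
  calc ∑ i ∈ s, (∑ j ∈ t, c i j * H j q) ^ 2 ≤ ∑ i ∈ s, K * ∑ j ∈ t, c i j * H j q ^ 2 :=
        sum_le_sum cs
    _ = K * ∑ j ∈ t, (∑ i ∈ s, c i j) * H j q ^ 2 := by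
      rw [← mul_sum, sum_comm]; simp only [sum_mul]
    _ ≤ K * ∑ j ∈ t, K * H j q ^ 2 := by
      gcongr with j hj; exact h2 j hj
    _ = _ := by rw [← mul_sum, ← mul_assoc, sq]

end Norms

/-- Geometric weights. -/
def geo (n : ℤ) : ℝ≥0∞ := 2⁻¹ ^ n.natAbs

lemma geo_neg (n : ℤ) : geo (-n) = geo n := by simp [geo]

lemma geo_sum_inj {ι : Type*} (s : Finset ι) (f : ι → ℕ) (hf : Set.InjOn f s) :
    ∑ i ∈ s, (2⁻¹ : ℝ≥0∞) ^ f i ≤ 2 := by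
  classical
  rw [← sum_image (f := fun m => (2⁻¹ : ℝ≥0∞) ^ m) hf]
  refine (ENNReal.sum_le_tsum _).trans ?_
  rw [ENNReal.tsum_geometric, ENNReal.one_sub_inv_two, inv_inv]

lemma geo_sum_le (s : Finset ℤ) (n : ℤ) : ∑ j ∈ s, geo (n - j) ≤ 4 := by
  rw [← Finset.sum_filter_add_sum_filter_not s (fun j => n ≤ j)]
  have h4 : (4 : ℝ≥0∞) = 2 + 2 := by norm_num
  rw [h4]
  refine add_le_add (geo_sum_inj _ _ ?_) (geo_sum_inj _ _ ?_)
  · intro a ha b hb hab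
    simp only [coe_filter, mem_ofPred_eq] at ha hb
    simp only at hab
    omega
  · intro a ha b hb hab
    simp only [coe_filter, mem_ofPred_eq] at ha hb
    simp only at hab
    omega

lemma geo_sum_le' (s : Finset ℤ) (n : ℤ) : ∑ j ∈ s, geo (j - n) ≤ 4 := by
  refine le_trans (le_of_eq (sum_congr rfl fun j _ => ?_)) (geo_sum_le s n)
  rw [← geo_neg, neg_sub]

section Duality

variable {E : Type*} [NormedAddCommGroup E] [NormedSpace ℝ E] [MeasureSpace E] [BorelSpace E]
  [FiniteDimensional ℝ E] [(volume : Measure E).IsAddHaarMeasure]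
variable {f : E → ℝ} {p p' : ℝ} {K : ℝ≥0∞}

lemma Nice.nrm_lt_top (hf : Nice f) (hp : 0 < p) : nrm p (en f) < ⊤ := by
  obtain ⟨C, hC, hC'⟩ := hf.bdd
  obtain ⟨R, hR, hR'⟩ := hf.supp
  have : ∫⁻ q, en f q ^ p ≤ ∫⁻ q in closedBall (0 : E) R, ofReal C ^ p := by
    rw [← lintegral_indicator isClosed_closedBall.measurableSet]
    refine lintegral_mono fun q => ?_
    by_cases hq : q ∈ closedBall (0 : E) R
    · rw [indicator_of_mem hq]
      refine rpow_le_rpow ?_ hp.le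
      rw [en, ← ofReal_norm]
      exact ofReal_le_ofReal (hC' q)
    · rw [mem_closedBall_zero_iff, not_le] at hq
      simp [en, hR' q hq, zero_rpow_of_pos hp]
  refine ENNReal.rpow_lt_top_of_nonneg (by positivity) (ne_top_of_le_ne_top ?_ this)
  rw [setLIntegral_const]
  exact mul_ne_top (rpow_ne_top_of_nonneg hp.le ofReal_ne_top)
    measure_closedBall_lt_top.ne

lemma Nice.sqrt_sum {ι : Type*} {s : Finset ι} {f : ι → E → ℝ} (hf : ∀ i, Nice (f i)) :
    Nice (fun q => √(∑ i ∈ s, f i q ^ 2)) := by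
  refine (Nice.sum s fun i _ => (hf i).abs).of_abs_le
    (measurable_sum s fun i _ => (hf i).meas.pow_const 2).sqrt fun q => ?_
  have h0 : 0 ≤ ∑ i ∈ s, |f i q| := sum_nonneg fun _ _ => abs_nonneg _
  rw [abs_of_nonneg (sqrt_nonneg _), abs_of_nonneg h0, Real.sqrt_le_left h0]
  calc ∑ i ∈ s, f i q ^ 2 = ∑ i ∈ s, |f i q| ^ 2 := by simp only [sq_abs]
    _ ≤ _ := Finset.sum_sq_le_sq_sum_of_nonneg fun _ _ => abs_nonneg _

lemma vsq_en {ι : Type*} (s : Finset ι) (f : ι → E → ℝ) (q : E) :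
    vsq s (fun i => en (f i)) q = en (fun q => √(∑ i ∈ s, f i q ^ 2)) q := by
  have h0 : 0 ≤ ∑ i ∈ s, f i q ^ 2 := sum_nonneg fun _ _ => sq_nonneg _
  have h1 : ∀ i, en (f i) q ^ 2 = ofReal (f i q ^ 2) := fun i => by
    rw [en, ← enorm_pow, enorm_of_nonneg (sq_nonneg _)]
  rw [vsq, sum_congr rfl fun i _ => h1 i,
    ← ENNReal.ofReal_sum_of_nonneg fun i _ => sq_nonneg _, en,
    enorm_of_nonneg (sqrt_nonneg _), Real.sqrt_eq_rpow,
    ofReal_rpow_of_nonneg h0 (by norm_num)]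

lemma rpow_division {X : ℝ≥0∞} (hpq : p.HolderConjugate p') (hX : X ≠ ⊤)
    (h : X ≤ K * X ^ (1 / p')) : X ^ (1 / p) ≤ K := by
  by_cases h0 : X = 0
  · rw [h0, zero_rpow_of_pos (one_div_pos.2 hpq.pos)]; exact bot_le
  have h1 : X ^ (1 / p) * X ^ (1 / p') = X := by
    rw [← rpow_add _ _ h0 hX, one_div, one_div, hpq.inv_add_inv_eq_one, rpow_one]
  have h2 : X ^ (1 / p') ≠ 0 := by
    simp only [ne_eq, ENNReal.rpow_eq_zero_iff, h0, hX, false_and, or_self, not_false_eq_true]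
  have h3 : X ^ (1 / p') ≠ ⊤ := rpow_ne_top_of_nonneg (one_div_pos.2 hpq.symm.pos).le hX
  have h4 : X ^ (1 / p) * X ^ (1 / p') ≤ K * X ^ (1 / p') := h1.trans_le h
  rwa [ENNReal.mul_le_mul_iff_left h2 h3] at h4

/-- Duality characterisation of the norm of a square function. -/
lemma nrm_vsq_le_of_dual {ι : Type*} {s : Finset ι} {U : ι → E → ℝ} (hU : ∀ i, Nice (U i))
    (hpq : p.HolderConjugate p')
    (h : ∀ g : ι → E → ℝ, (∀ i, Nice (g i)) →
      ‖∑ i ∈ s, ∫ q, U i q * g i q‖ₑ ≤ K * nrm p' (vsq s fun i => en (g i))) :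
    nrm p (vsq s fun i => en (U i)) ≤ K := by
  classical
  set Φ : E → ℝ := fun q => √(∑ i ∈ s, U i q ^ 2) with hΦ
  have hΦN : Nice Φ := Nice.sqrt_sum hU
  have hΦ0 : ∀ q, 0 ≤ Φ q := fun q => sqrt_nonneg _
  have h0p : ∀ q (a : ℝ), 0 ≤ Φ q ^ a := fun q a => rpow_nonneg (hΦ0 q) a
  have hsum : ∀ q, ∑ i ∈ s, U i q ^ 2 = Φ q ^ 2 := fun q =>
    (sq_sqrt (sum_nonneg fun _ _ => sq_nonneg _)).symm
  have hle : ∀ i ∈ s, ∀ q, |U i q| ≤ Φ q := fun i hi q => by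
    refine abs_le_of_sq_le_sq ?_ (hΦ0 q)
    rw [← hsum]
    exact single_le_sum (f := fun i => U i q ^ 2) (fun _ _ => sq_nonneg _) hi
  obtain ⟨C, hC, hC'⟩ := hΦN.bdd
  obtain ⟨R, hR, hR'⟩ := hΦN.supp
  set g : ι → E → ℝ := fun i q => if i ∈ s then U i q * Φ q ^ (p - 2) else 0 with hg
  have hp1 : 0 < p - 1 := by linarith [hpq.lt]
  have pw : ∀ q, Φ q * Φ q ^ (p - 2) = Φ q ^ (p - 1) := fun q => by
    rcases (hΦ0 q).eq_or_lt with h0 | h0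
    · rw [← h0, zero_mul, Real.zero_rpow hp1.ne']
    · rw [← Real.rpow_one_add' (hΦ0 q) (by linarith)]; congr 1; ring
  have hgN : ∀ i, Nice (g i) := by
    intro i
    by_cases hi : i ∈ s
    · simp only [hg, hi, if_true]
      refine ⟨(hU i).meas.mul (hΦN.meas.pow_const _), ⟨C ^ (p - 1), by positivity, fun q => ?_⟩,
        ⟨R, hR, fun q hq => ?_⟩⟩
      · rw [abs_mul, abs_of_nonneg (h0p q _)]
        calc |U i q| * Φ q ^ (p - 2) ≤ Φ q * Φ q ^ (p - 2) :=
              mul_le_mul_of_nonneg_right (hle i hi q) (h0p q _)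
          _ = Φ q ^ (p - 1) := pw q
          _ ≤ _ := Real.rpow_le_rpow (hΦ0 q) ((le_abs_self _).trans (hC' q)) hp1.le
      · have : U i q = 0 := abs_eq_zero.1 (le_antisymm (by
          have := hle i hi q; rwa [hR' q hq] at this) (abs_nonneg _))
        rw [this, zero_mul]
    · simp only [hg, hi, if_false]; exact Nice.zero
  have e1 : vsq s (fun i => en (U i)) = en Φ := funext fun q => vsq_en s U q
  have e2 : ∀ q, vsq s (fun i => en (g i)) q ^ p' = en Φ q ^ p := by
    intro q
    rw [vsq_en]
    have : ∑ i ∈ s, g i q ^ 2 = (Φ q ^ (p - 1)) ^ 2 := by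
      rw [← pw q, mul_pow, ← hsum, sum_mul]
      refine sum_congr rfl fun i hi => ?_
      simp only [hg, hi, if_true, mul_pow]
    simp only [en, this]
    rw [Real.sqrt_sq (h0p q _), enorm_of_nonneg (h0p q _),
      enorm_of_nonneg (hΦ0 q), ← ofReal_rpow_of_nonneg (hΦ0 q) hp1.le,
      ← rpow_mul, hpq.sub_one_mul_conj]
  have e3 : ‖∑ i ∈ s, ∫ q, U i q * g i q‖ₑ = ∫⁻ q, en Φ q ^ p := by
    rw [← integral_finsetSum s fun i _ => ((hU i).mul (hgN i)).integrable]
    have : ∀ q, ∑ i ∈ s, U i q * g i q = Φ q ^ p := by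
      intro q
      have a1 : Φ q ^ p = Φ q * Φ q ^ (p - 1) := by
        rw [← Real.rpow_one_add' (hΦ0 q) (by linarith)]; congr 1; ring
      rw [a1, ← pw q, ← mul_assoc, ← sq, ← hsum, sum_mul]
      refine sum_congr rfl fun i hi => ?_
      simp only [hg, hi, if_true]; ring
    simp only [this]
    have hint : Integrable fun q => Φ q ^ p := by
      refine (integrable_finsetSum s fun i _ => ((hU i).mul (hgN i)).integrable).congr
        (.of_forall this)
    have h0 : 0 ≤ ∫ q, Φ q ^ p := integral_nonneg (h0p · _)
    rw [enorm_of_nonneg h0, ofReal_integral_eq_lintegral_ofReal hint (.of_forall fun q => h0p q _)]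
    refine lintegral_congr fun q => ?_
    rw [en, enorm_of_nonneg (hΦ0 q), ofReal_rpow_of_nonneg (hΦ0 q) hpq.pos.le]
  have h1 := h g hgN
  rw [e3, nrm, lintegral_congr e2] at h1
  rw [e1, nrm]
  refine rpow_division hpq ?_ h1
  have := hΦN.nrm_lt_top hpq.pos
  rw [← nrm_rpow hpq.pos]
  exact rpow_ne_top_of_nonneg hpq.pos.le this.ne

end Duality

/-- Directions along which the plane can be sliced into lines. -/
structure Sl (e : ℝ²) : Prop where
  ne : e ≠ 0
  ex : ∃ bs : ℝ → ℝ², Measurable bs ∧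
    MeasurePreserving (fun c : ℝ² => bs c.1 + c.2 • e) volume volume

lemma sl_one (b : ℝ) : Sl (1, b) := by
  refine ⟨by simp, fun c => (0, c), by fun_prop, ?_⟩
  have h1 : MeasurePreserving (fun z : ℝ² => (z.1, z.2 + z.1 * b))
      ((volume : Measure ℝ).prod (volume : Measure ℝ)) (volume.prod volume) :=
    (MeasurePreserving.id (volume : Measure ℝ)).skew_product
      (g := fun t c => c + t * b) (by fun_prop)
      (.of_forall fun t => (measurePreserving_add_right volume (t * b)).map_eq)
  have h2 := h1.comp (Measure.measurePreserving_swap (μ := (volume : Measure ℝ))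
    (ν := (volume : Measure ℝ)))
  rw [Measure.volume_eq_prod]
  have h3 : (fun c : ℝ² => ((0 : ℝ), c.1) + c.2 • ((1 : ℝ), b)) =
      (fun z : ℝ² => (z.1, z.2 + z.1 * b)) ∘ Prod.swap := by
    funext z; simp
  rw [h3]
  exact h2

lemma sl_y : Sl (0, 1) := by
  refine ⟨by simp, fun c => (c, 0), by fun_prop, ?_⟩
  have h3 : (fun c : ℝ² => (c.1, (0 : ℝ)) + c.2 • ((0 : ℝ), (1 : ℝ))) = id := by
    funext z; simp
  rw [h3]
  exact MeasurePreserving.id _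

section Slices

variable {e : ℝ²} {bs : ℝ → ℝ²}

lemma slice_lintegral (h : MeasurePreserving (fun c : ℝ² => bs c.1 + c.2 • e) volume volume)
    {F : ℝ² → ℝ≥0∞} (hF : Measurable F) : ∫⁻ q, F q = ∫⁻ c : ℝ, ∫⁻ t : ℝ, F (bs c + t • e) := by
  rw [← h.lintegral_comp hF, Measure.volume_eq_prod]
  exact lintegral_prod _ (hF.comp h.measurable).aemeasurable

lemma slice_integral (h : MeasurePreserving (fun c : ℝ² => bs c.1 + c.2 • e) volume volume)
    {f : ℝ² → ℝ} (hf : Nice f) :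
    Integrable (fun c : ℝ => ∫ t : ℝ, f (bs c + t • e)) ∧ ∫ q, f q = ∫ c : ℝ, ∫ t : ℝ, f (bs c + t • e) := by
  have hi : Integrable (fun c : ℝ² => f (bs c.1 + c.2 • e)) (volume.prod volume) :=
    (h.integrable_comp hf.meas.aestronglyMeasurable).2 hf.integrable
  refine ⟨hi.integral_prod_left, ?_⟩
  have h1 : ∫ q, f q = ∫ c : ℝ², f (bs c.1 + c.2 • e) := by
    conv_lhs => rw [← h.map_eq]
    rw [integral_map h.measurable.aemeasurable hf.meas.aestronglyMeasurable]
  rw [h1, Measure.volume_eq_prod, integral_prod _ hi]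

lemma Nice.slice {f : ℝ² → ℝ} (hf : Nice f) (he : e ≠ 0) (b : ℝ²) :
    Nice (fun t : ℝ => f (b + t • e)) := by
  obtain ⟨C, hC, hC'⟩ := hf.bdd
  obtain ⟨R, hR, hR'⟩ := hf.supp
  have he' : 0 < ‖e‖ := norm_pos_iff.2 he
  refine ⟨hf.meas.comp (by fun_prop), ⟨C, hC, fun t => hC' _⟩, ⟨(R + ‖b‖) / ‖e‖, by positivity,
    fun t ht => hR' _ ?_⟩⟩
  rw [div_lt_iff₀ he', ← norm_smul] at ht
  have := norm_sub_norm_le (t • e) (-b)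
  rw [norm_neg, sub_neg_eq_add, add_comm (t • e)] at this
  linarith

lemma MM_slice (F : ℝ² → ℝ≥0∞) (b : ℝ²) (t : ℝ) :
    MM e F (b + t • e) = MM 1 (fun t => F (b + t • e)) t := by
  simp only [MM, av, smul_eq_mul, mul_one, sub_smul, add_sub_assoc]

lemma cv_slice (κ : ℝ → ℝ) (f : ℝ² → ℝ) (b : ℝ²) (t : ℝ) :
    cv κ e f (b + t • e) = cv κ 1 (fun t => f (b + t • e)) t := by
  simp only [cv, smul_eq_mul, mul_one, sub_smul, add_sub_assoc]

end Slices

lemma strong_type_dir (hp : 1 < p) : ∃ C : ℝ≥0, ∀ e, Sl e → ∀ F w : ℝ² → ℝ≥0∞,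
    Measurable F → Measurable w →
    ∫⁻ x, MM e F x ^ p * w x ≤ C * ∫⁻ x, F x ^ p * MM e w x := by
  obtain ⟨C, hC⟩ := strong_type hp
  refine ⟨C, fun e he F w hF hw => ?_⟩
  obtain ⟨bs, hbs, hmp⟩ := he.ex
  rw [slice_lintegral (F := fun x => MM e F x ^ p * w x) hmp (((meas_MM hF e).pow_const p).mul hw),
    slice_lintegral (F := fun x => F x ^ p * MM e w x) hmp ((hF.pow_const p).mul (meas_MM hw e)),
    ← lintegral_const_mul' _ _ coe_ne_top]
  refine lintegral_mono fun c => ?_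
  simp only [MM_slice]
  exact hC _ _ (hF.comp (by fun_prop)) (hw.comp (by fun_prop))

lemma pair_triD_dir (he : Sl e) {g : ℕ → ℝ² → ℝ} (N : ℕ)
    (hf : Nice f) (hg : ∀ n, Nice (g n)) (l : ℤ) :
    ‖∑ n ∈ range N, ∫ q, cv (triD (l + n)) e f q * g n q‖ₑ ≤
      3 * ∫⁻ q, MM e (en f) q * MM e (vsq (range N) fun n => en (g n)) q := by
  obtain ⟨bs, hbs, hmp⟩ := he.ex
  have hN : ∀ n : ℕ, Nice fun q => cv (triD (l + n)) e f q * g n q := fun n =>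
    ((nice_triD _).cv hf e).mul (hg n)
  have hm : Measurable (vsq (range N) fun n => en (g n)) :=
    meas_vsq (fun n => (hg n).en_meas) _
  rw [sum_congr rfl fun n _ => (slice_integral hmp (hN n)).2,
    ← integral_finsetSum _ fun n _ => (slice_integral hmp (hN n)).1,
    slice_lintegral (F := fun q => MM e (en f) q *
      MM e (vsq (range N) fun n => en (g n)) q) hmp
      ((meas_MM hf.en_meas e).mul (meas_MM hm e)),
    ← lintegral_const_mul' _ _ (by norm_num)]
  refine (enorm_integral_le_lintegral_enorm _).trans (lintegral_mono fun c => ?_)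
  simp only [MM_slice, cv_slice]
  have hG : Nice fun t : ℝ => √(∑ n ∈ range N, g n (bs c + t • e) ^ 2) :=
    Nice.sqrt_sum fun n => (hg n).slice he.ne (bs c)
  have := pair_triD (s := {()}) (f := fun _ t => f (bs c + t • e)) (F := fun t => |f (bs c + t • e)|)
    (G := fun t => √(∑ n ∈ range N, g n (bs c + t • e) ^ 2))
    (g := fun _ n t => g n (bs c + t • e)) (N := N)
    (fun _ _ => hf.slice he.ne _) (fun _ _ n _ => (hg n).slice he.ne _) (hf.slice he.ne _).abs
    (fun _ => abs_nonneg _) (fun x => by simp [sq_abs]) hG (fun _ => sqrt_nonneg _)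
    (fun x => by
      rw [sum_singleton, sq_sqrt (sum_nonneg fun _ _ => sq_nonneg _)]) l
  simp only [sum_singleton] at this
  refine this.trans (Eq.le ?_)
  congr 2
  ext t
  congr 1
  · congr 1; ext t; simp [en]
  · congr 1; ext t; rw [vsq_en]; simp only [en]

/-- Bounded measurable nonnegative functions on the plane. -/
structure BM (F : ℝ² → ℝ≥0∞) : Prop where
  meas : Measurable F
  bdd : ∃ B : ℝ≥0, ∀ q, F q ≤ B

lemma Nice.bm (hf : Nice f) : BM (en f) := by
  obtain ⟨C, hC, hC'⟩ := hf.bdd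
  refine ⟨hf.en_meas, C.toNNReal, fun q => ?_⟩
  rw [en, ← ofReal_norm]
  exact ofReal_le_ofReal (hC' q)

lemma MM_le_const {B : ℝ≥0∞} (h : ∀ q, F q ≤ B) (q : ℝ²) :
    MM e F q ≤ 2 * B := by
  refine iSup_le fun l => ?_
  have hl : (0 : ℝ) < 2 ^ l := by positivity
  calc av ((2 : ℝ) ^ l) e F q ≤ (ofReal (2 ^ l))⁻¹ *
        ∫⁻ t in Icc (-(2 : ℝ) ^ l) (2 ^ l), B := by
        unfold av; gcongr with t; exact h _
    _ = 2 * B := by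
      rw [setLIntegral_const, volume_Icc, sub_neg_eq_add, ← two_mul,
        ofReal_mul zero_le_two, mul_comm B, ← mul_assoc, ← mul_assoc,
        mul_comm (ofReal (2 ^ l))⁻¹, mul_assoc (ofReal 2),
        ENNReal.inv_mul_cancel (by simpa using hl) ofReal_ne_top, mul_one]
      simp

lemma BM.MM (hF : BM F) (e : ℝ²) : BM (MM e F) := by
  obtain ⟨B, hB⟩ := hF.bdd
  exact ⟨meas_MM hF.meas e, 2 * B, fun q => by simpa using MM_le_const hB q⟩

lemma BM.rpow (hF : BM F) {a : ℝ} (ha : 0 ≤ a) : BM (fun q => F q ^ a) := by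
  obtain ⟨B, hB⟩ := hF.bdd
  refine ⟨hF.meas.pow_const a, B ^ a, fun q => ?_⟩
  rw [coe_rpow_of_nonneg _ ha]
  exact rpow_le_rpow (hB q) ha

lemma BM.sum {ι : Type*} {s : Finset ι} {F : ι → ℝ² → ℝ≥0∞} (hF : ∀ i, BM (F i)) :
    BM (fun q => ∑ i ∈ s, F i q) := by
  choose B hB using fun i => (hF i).bdd
  refine ⟨measurable_sum s fun i _ => (hF i).meas, ∑ i ∈ s, B i, fun q => ?_⟩
  push_cast
  exact sum_le_sum fun i _ => hB i q

lemma BM.sq (hF : BM F) : BM (fun q => F q ^ 2) := by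
  simpa only [rpow_two] using hF.rpow zero_le_two

lemma BM.vsq {ι : Type*} {s : Finset ι} {F : ι → ℝ² → ℝ≥0∞} (hF : ∀ i, BM (F i)) :
    BM (vsq s F) := (BM.sum fun i => (hF i).sq).rpow (by norm_num)

lemma BM.lt_top (hF : BM F) (q : ℝ²) : F q < ⊤ := by
  obtain ⟨B, hB⟩ := hF.bdd
  exact (hB q).trans_lt ENNReal.coe_lt_top

/-- The maximal function over a finite set of directions. -/
def MD (D : Finset ℝ²) (F : ℝ² → ℝ≥0∞) (q : ℝ²) : ℝ≥0∞ :=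
  ⨆ e ∈ D, MM e F q

lemma meas_MD (D : Finset ℝ²) (hF : Measurable F) : Measurable (MD D F) :=
  .biSup _ D.countable_toSet fun e _ => meas_MM hF e

lemma MM_le_MD (he : e ∈ D) (F : ℝ² → ℝ≥0∞) (q : ℝ²) :
    MM e F q ≤ MD D F q := le_iSup₂ (f := fun e _ => MM e F q) e he

lemma BM.MD (hF : BM F) (D : Finset ℝ²) : BM (MD D F) := by
  obtain ⟨B, hB⟩ := hF.bdd
  exact ⟨meas_MD D hF.meas, 2 * B, fun q => iSup₂_le fun e _ => by simpa using MM_le_const hB q⟩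

/-- Boundedness of the maximal function over a finite set of directions. -/
def MB (p : ℝ) (D : Finset ℝ²) (C : ℝ≥0) : Prop :=
  ∀ F, BM F → nrm p (MD D F) ≤ C * nrm p F

/-- Vector-valued maximal inequality for families of directions. -/
def VV (p : ℝ) (D : Finset ℝ²) (C : ℝ≥0) : Prop :=
  ∀ (ι : Type) (s : Finset ι) (e : ι → ℝ²) (F : ι → ℝ² → ℝ≥0∞), (∀ i, e i ∈ D) →
    (∀ i, BM (F i)) → nrm p (vsq s fun i => MM (e i) (F i)) ≤ C * nrm p (vsq s F)

lemma MM_const_one_le (e q : ℝ²) : MM e (fun _ => 1) q ≤ 2 := by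
  simpa using MM_le_const (e := e) (F := fun _ => 1) (B := 1) (fun _ => le_rfl) q

lemma strong_type_one (hp : 1 < p) : ∃ C : ℝ≥0, ∀ e, Sl e → ∀ F : ℝ² → ℝ≥0∞,
    Measurable F → ∫⁻ x, MM e F x ^ p ≤ C * ∫⁻ x, F x ^ p := by
  obtain ⟨C, hC⟩ := strong_type_dir hp
  refine ⟨2 * C, fun e he F hF => ?_⟩
  have := hC e he F (fun _ => 1) hF measurable_const
  simp only [mul_one] at this
  refine this.trans ?_
  push_cast
  rw [mul_comm 2 (C : ℝ≥0∞), mul_assoc]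
  gcongr
  rw [← lintegral_const_mul' _ _ (by norm_num)]
  refine lintegral_mono fun q => ?_
  rw [mul_comm]
  exact mul_le_mul_left (MM_const_one_le e q) _

lemma mb_single (hp : 1 < p) : ∃ C : ℝ≥0, ∀ e, Sl e → ∀ F : ℝ² → ℝ≥0∞,
    Measurable F → nrm p (MM e F) ≤ C * nrm p F := by
  obtain ⟨C, hC⟩ := strong_type_one hp
  have hp0 : 0 < p := by linarith
  refine ⟨C ^ (1 / p), fun e he F hF => ?_⟩
  rw [coe_rpow_of_nonneg _ (by positivity), nrm, nrm,
    ← mul_rpow_of_nonneg _ _ (by positivity)]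
  exact rpow_le_rpow (hC e he F hF) (by positivity)

lemma MD_singleton (e : ℝ²) (F : ℝ² → ℝ≥0∞) : MD {e} F = MM e F := by
  ext q; simp [MD]

/-- On `L²` the vector-valued inequality holds for arbitrary families of directions. -/
lemma vv_two : ∃ C : ℝ≥0, ∀ D : Finset ℝ², (∀ e ∈ D, Sl e) → VV 2 D C := by
  obtain ⟨C, hC⟩ := strong_type_one one_lt_two
  refine ⟨C ^ (1 / 2 : ℝ), fun D hD ι s e F he hF => ?_⟩
  rw [coe_rpow_of_nonneg _ (by positivity), nrm, nrm,
    ← mul_rpow_of_nonneg _ _ (by positivity)]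
  refine rpow_le_rpow ?_ (by positivity)
  simp only [rpow_two, vsq_sq]
  rw [lintegral_finsetSum _ fun i _ => ((meas_MM (hF i).meas (e i)).pow_const 2),
    lintegral_finsetSum _ fun i _ => ((hF i).meas.pow_const 2), mul_sum]
  refine sum_le_sum fun i _ => ?_
  simpa only [rpow_two] using hC (e i) (hD _ (he i)) (F i) (hF i).meas

lemma vsq_le_sum {X ι : Type*} [MeasureSpace X] (s : Finset ι) (F : ι → X → ℝ≥0∞) (q : X) :
    vsq s F q ≤ ∑ i ∈ s, F i q :=
  le_of_sq_le_sq_ennreal (by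
    rw [vsq_sq, sq, sum_mul]
    refine sum_le_sum fun i hi => ?_
    rw [sq]
    gcongr
    exact single_le_sum (f := fun i => F i q) (fun _ _ => bot_le) hi)

/-- The vector-valued inequality above `L²`. -/
lemma vv_gt (hp : 2 < p) (C : ℝ≥0) : ∃ C' : ℝ≥0, ∀ D : Finset ℝ², (∀ e ∈ D, Sl e) →
    MB (p / (p - 2)) D C → VV p D C' := by
  obtain ⟨C₁, hC₁⟩ := strong_type_dir one_lt_two
  obtain ⟨C₂, hC₂⟩ := mb_single (p := p) (by linarith)
  have hp0 : 0 < p := by linarith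
  have hpq : (p / 2).HolderConjugate (p / (p - 2)) := by
    rw [Real.holderConjugate_iff]
    refine ⟨by linarith, ?_⟩
    have : p - 2 ≠ 0 := by linarith
    field_simp
    ring
  refine ⟨(C₁ * C) ^ (1 / 2 : ℝ) + 1, fun D hD hMB ι s e F he hF => ?_⟩
  by_cases hfin : nrm p (vsq s F) = ⊤
  · rw [hfin, mul_top (by positivity)]; exact le_top
  set A : ℝ² → ℝ≥0∞ := fun q => ∑ i ∈ s, MM (e i) (F i) q ^ 2 with hA
  have hABM : BM A := BM.sum fun i => ((hF i).MM _).sq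
  set S : ℝ² → ℝ≥0∞ := fun q => ∑ i ∈ s, F i q ^ 2 with hS
  have hSBM : BM S := BM.sum fun i => (hF i).sq
  set w : ℝ² → ℝ≥0∞ := fun q => A q ^ (p / 2 - 1) with hw
  have hwBM : BM w := hABM.rpow (by linarith)
  have hvA : ∀ q, vsq s (fun i => MM (e i) (F i)) q ^ p = A q ^ (p / 2) := fun q => by
    rw [vsq, ← rpow_mul]; congr 1; ring
  have hvS : ∀ q, vsq s F q ^ p = S q ^ (p / 2) := fun q => by
    rw [vsq, ← rpow_mul]; congr 1; ring
  have hX : ∫⁻ q, A q ^ (p / 2) ≠ ⊤ := by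
    have h2 : ∑ i ∈ s, nrm p (MM (e i) (F i)) ≠ ⊤ := ENNReal.sum_ne_top.2 fun i hi =>
      ne_top_of_le_ne_top (mul_ne_top coe_ne_top (ne_top_of_le_ne_top hfin
        (nrm_mono hp0 fun q => le_vsq hi F q))) (hC₂ (e i) (hD _ (he i)) (F i) (hF i).meas)
    have h3 := ne_top_of_le_ne_top h2 ((nrm_mono hp0 fun q => vsq_le_sum s _ q).trans
      (nrm_sum_le (by linarith) (fun i => meas_MM (hF i).meas (e i)) s))
    rw [← lintegral_congr hvA, ← nrm_rpow hp0]
    exact rpow_ne_top_of_nonneg hp0.le h3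
  have hmain : ∫⁻ q, A q ^ (p / 2) ≤
      (C₁ * C * nrm (p / 2) S) * (∫⁻ q, A q ^ (p / 2)) ^ (1 / (p / (p - 2))) := by
    calc ∫⁻ q, A q ^ (p / 2) = ∫⁻ q, ∑ i ∈ s, MM (e i) (F i) q ^ (2 : ℝ) * w q := by
          refine lintegral_congr fun q => ?_
          simp only [rpow_two]
          rw [← sum_mul, hw]
          have : A q ^ (p / 2) = A q ^ (1 + (p / 2 - 1)) := by congr 1; ring
          rw [this, rpow_add_of_nonneg _ _ zero_le_one (by linarith), rpow_one]
      _ = ∑ i ∈ s, ∫⁻ q, MM (e i) (F i) q ^ (2 : ℝ) * w q :=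
        lintegral_finsetSum _ fun i _ => ((meas_MM (hF i).meas (e i)).pow_const _).mul hwBM.meas
      _ ≤ ∑ i ∈ s, C₁ * ∫⁻ q, F i q ^ (2 : ℝ) * MD D w q := by
        refine sum_le_sum fun i _ => (hC₁ (e i) (hD _ (he i)) (F i) w (hF i).meas
          hwBM.meas).trans ?_
        gcongr with q
        exact MM_le_MD (he i) w q
      _ = C₁ * ∫⁻ q, S q * MD D w q := by
        rw [← mul_sum, ← lintegral_finsetSum (f := fun i q => F i q ^ (2 : ℝ) * MD D w q) _
          fun i _ => ((hF i).meas.pow_const _).mul (meas_MD D hwBM.meas)]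
        congr 1
        refine lintegral_congr fun q => ?_
        simp only [rpow_two]
        rw [← sum_mul]
      _ ≤ C₁ * (nrm (p / 2) S * (C * nrm (p / (p - 2)) w)) := by
        gcongr
        exact (lintegral_mul_le_nrm hpq hSBM.meas (meas_MD D hwBM.meas)).trans (by
          gcongr; exact hMB w hwBM)
      _ = _ := by
        have : nrm (p / (p - 2)) w = (∫⁻ q, A q ^ (p / 2)) ^ (1 / (p / (p - 2))) := by
          rw [nrm]
          congr! 3 with q
          rw [hw, ← rpow_mul, hpq.sub_one_mul_conj]
        rw [this]; ring
  have hfinal := rpow_division hpq hX hmain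
  have e1 : nrm p (vsq s fun i => MM (e i) (F i)) =
      ((∫⁻ q, A q ^ (p / 2)) ^ (1 / (p / 2))) ^ (1 / 2 : ℝ) := by
    rw [nrm, lintegral_congr hvA, ← rpow_mul]; congr 1; field_simp
  have e2 : nrm p (vsq s F) = nrm (p / 2) S ^ (1 / 2 : ℝ) := by
    rw [nrm, nrm, lintegral_congr hvS, ← rpow_mul]; congr 1; field_simp
  rw [e1, e2]
  calc _ ≤ (C₁ * C * nrm (p / 2) S) ^ (1 / 2 : ℝ) := rpow_le_rpow hfinal (by norm_num)
    _ = ((C₁ * C : ℝ≥0) ^ (1 / 2 : ℝ) : ℝ≥0) * nrm (p / 2) S ^ (1 / 2 : ℝ) := by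
      rw [mul_rpow_of_nonneg _ _ (by norm_num), coe_rpow_of_nonneg _ (by norm_num)]
      push_cast; rfl
    _ ≤ _ := by gcongr; exact le_self_add

lemma MM_holder {a : ℝ} (ha : 0 < a) (hb : 0 < b) (hab : a + b = 1)
    {U V : ℝ² → ℝ≥0∞} (hU : Measurable U) (hV : Measurable V) (q : ℝ²) :
    MM e (fun q => U q ^ a * V q ^ b) q ≤ MM e U q ^ a * MM e V q ^ b := by
  refine iSup_le fun l => ?_
  have hr : (0 : ℝ) < 2 ^ l := by positivity
  have h1 := ENNReal.lintegral_mul_norm_pow_le (μ := volume.restrict (Icc (-(2 : ℝ) ^ l) (2 ^ l)))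
    (f := fun t => U (q - t • e)) (g := fun t => V (q - t • e)) (p := a) (q := b)
    (hU.comp (by fun_prop)).aemeasurable (hV.comp (by fun_prop)).aemeasurable ha.le hb.le hab
  have h2 : ∀ x : ℝ≥0∞, x = x ^ a * x ^ b := fun x => by
    rw [← rpow_add_of_nonneg _ _ ha.le hb.le, hab, rpow_one]
  calc av ((2 : ℝ) ^ l) e (fun q => U q ^ a * V q ^ b) q
      ≤ av (2 ^ l) e U q ^ a * av (2 ^ l) e V q ^ b := by
        simp only [av]
        rw [mul_rpow_of_nonneg _ _ ha.le, mul_rpow_of_nonneg _ _ hb.le,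
          mul_mul_mul_comm, ← h2]
        gcongr
    _ ≤ _ := by
      gcongr
      · exact le_iSup (fun l : ℤ => av ((2 : ℝ) ^ l) e U q) l
      · exact le_iSup (fun l : ℤ => av ((2 : ℝ) ^ l) e V q) l

/-- The vector-valued inequality below `L²`. -/
lemma vv_lt {q : ℝ} (hp : 1 < p) (hp2 : p < 2) (hq : 1 < q) (hqp : q < p / (2 - p)) (C : ℝ≥0) :
    ∃ C' : ℝ≥0, ∀ D : Finset ℝ², (∀ e ∈ D, Sl e) → MB q D C → VV p D C' := by
  have h2p : 0 < 2 - p := by linarith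
  have hp0 : 0 < p := by linarith
  have hl : 0 ≤ 1 - p / 2 := by linarith
  have hq0 : 0 < q := by linarith
  rw [lt_div_iff₀ h2p] at hqp
  obtain ⟨a, ha⟩ : ∃ a, a = q * (2 - p) / (2 * p) := ⟨_, rfl⟩
  have ha0 : 0 < a := by rw [ha]; positivity
  have ha1 : a < 1 / 2 := by rw [ha, div_lt_iff₀ (by positivity)]; linarith
  obtain ⟨b, hb⟩ : ∃ b, b = 1 - a := ⟨_, rfl⟩
  have hb0 : 0 < b := by linarith
  obtain ⟨C₂, hC₂⟩ := strong_type_one (p := 2 * b) (by linarith)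
  have hpa : a * p = q * (1 - p / 2) := by rw [ha]; field_simp
  have hua : p / q * a = (2 - p) / 2 := by rw [ha]; field_simp
  refine ⟨(((C ^ q) ^ (1 - p / 2)) * C₂ ^ (p / 2)) ^ (1 / p), fun D hD hMB ι s e F he hF => ?_⟩
  set Φ := vsq s F with hΦ
  have hΦBM : BM Φ := BM.vsq hF
  set u : ℝ² → ℝ≥0∞ := fun x => Φ x ^ (p / q) with hu
  have huBM : BM u := hΦBM.rpow (by positivity)
  set v : ι → ℝ² → ℝ≥0∞ := fun i x => F i x ^ (1 / b) * Φ x ^ (-((2 - p) / (2 * b))) with hv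
  have hvm : ∀ i, Measurable (v i) := fun i =>
    ((hF i).meas.pow_const _).mul (hΦBM.meas.pow_const _)
  have hvb : ∀ i x t, 0 < t → v i x ^ (t * b) = F i x ^ t * Φ x ^ (-((2 - p) / 2 * t)) := by
    intro i x t ht
    rw [hv, mul_rpow_of_nonneg _ _ (by positivity), ← rpow_mul, ← rpow_mul]
    congr 2 <;> field_simp
  have hFuv : ∀ i ∈ s, ∀ x, F i x = u x ^ a * v i x ^ b := by
    intro i hi x
    have h1 := hvb i x 1 one_pos
    rw [one_mul, rpow_one, mul_one] at h1
    rw [h1, hu, ← rpow_mul, hua, mul_left_comm]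
    rcases eq_or_ne (Φ x) 0 with h0 | h0
    · have : F i x = 0 := le_antisymm (h0 ▸ le_vsq hi F x) bot_le
      simp [this]
    · rw [← rpow_add _ _ h0 (hΦBM.lt_top x).ne]
      simp
  have hvs : ∀ x, ∑ i ∈ s, v i x ^ (2 * b) ≤ Φ x ^ p := by
    intro x
    rw [sum_congr rfl fun i _ => hvb i x 2 two_pos, ← sum_mul]
    simp only [rpow_two]
    rw [← vsq_sq, ← hΦ, ← rpow_two]
    rcases eq_or_ne (Φ x) 0 with h0 | h0
    · simp [h0]
    · rw [← rpow_add _ _ h0 (hΦBM.lt_top x).ne]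
      exact Eq.le (by congr 1; ring)
  have hMM : ∀ i ∈ s, ∀ x, MM (e i) (F i) x ≤ MD D u x ^ a * MM (e i) (v i) x ^ b := by
    intro i hi x
    rw [show F i = fun x => u x ^ a * v i x ^ b from funext (hFuv i hi)]
    refine (MM_holder ha0 hb0 (by linarith) huBM.meas (hvm i) x).trans ?_
    gcongr
    exact MM_le_MD (he i) u x
  have hpt : ∀ x, vsq s (fun i => MM (e i) (F i)) x ^ p ≤
      (MD D u x ^ q) ^ (1 - p / 2) * (∑ i ∈ s, MM (e i) (v i) x ^ (2 * b)) ^ (p / 2) := by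
    intro x
    have h1 : vsq s (fun i => MM (e i) (F i)) x ^ p =
        (∑ i ∈ s, MM (e i) (F i) x ^ 2) ^ (p / 2) := by
      rw [vsq, ← rpow_mul]; congr 1; ring
    have h2 : ∑ i ∈ s, MM (e i) (F i) x ^ 2 ≤
        MD D u x ^ (2 * a) * ∑ i ∈ s, MM (e i) (v i) x ^ (2 * b) := by
      rw [mul_sum]
      refine sum_le_sum fun i hi => (pow_le_pow_left' (hMM i hi x) 2).trans (Eq.le ?_)
      rw [mul_pow, ← rpow_two, ← rpow_two, ← rpow_mul, ← rpow_mul,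
        mul_comm a, mul_comm b]
    rw [h1]
    refine (rpow_le_rpow h2 (by positivity)).trans (Eq.le ?_)
    rw [mul_rpow_of_nonneg _ _ (by positivity), ← rpow_mul, ← rpow_mul,
      ← hpa]
    congr 2
    ring
  have hint : ∫⁻ x, vsq s (fun i => MM (e i) (F i)) x ^ p ≤
      (((C ^ q) ^ (1 - p / 2)) * C₂ ^ (p / 2) : ℝ≥0) * ∫⁻ x, Φ x ^ p := by
    calc _ ≤ ∫⁻ x, (MD D u x ^ q) ^ (1 - p / 2) *
          (∑ i ∈ s, MM (e i) (v i) x ^ (2 * b)) ^ (p / 2) := lintegral_mono hpt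
      _ ≤ (∫⁻ x, MD D u x ^ q) ^ (1 - p / 2) *
          (∫⁻ x, ∑ i ∈ s, MM (e i) (v i) x ^ (2 * b)) ^ (p / 2) :=
        ENNReal.lintegral_mul_norm_pow_le ((meas_MD D huBM.meas).pow_const q).aemeasurable
          (measurable_sum s fun i _ => (meas_MM (hvm i) (e i)).pow_const _).aemeasurable
          hl (by linarith) (by ring)
      _ ≤ (C ^ q * ∫⁻ x, Φ x ^ p) ^ (1 - p / 2) * (C₂ * ∫⁻ x, Φ x ^ p) ^ (p / 2) := by
        gcongr ?_ ^ _ * ?_ ^ _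
        · have h1 := rpow_le_rpow (hMB u huBM) hq0.le
          rw [nrm_rpow hq0, mul_rpow_of_nonneg _ _ hq0.le, nrm_rpow hq0] at h1
          refine h1.trans (Eq.le ?_)
          congr! 3 with x
          rw [hu, ← rpow_mul, div_mul_cancel₀ _ hq0.ne']
        · rw [lintegral_finsetSum _ fun i _ => (meas_MM (hvm i) (e i)).pow_const _]
          calc _ ≤ ∑ i ∈ s, C₂ * ∫⁻ x, v i x ^ (2 * b) :=
                sum_le_sum fun i _ => hC₂ (e i) (hD _ (he i)) (v i) (hvm i)
            _ = C₂ * ∫⁻ x, ∑ i ∈ s, v i x ^ (2 * b) := by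
              rw [lintegral_finsetSum _ fun i _ => (hvm i).pow_const _, mul_sum]
            _ ≤ _ := by gcongr with x; exact hvs x
      _ = _ := by
        have h2 : ∀ x : ℝ≥0∞, x ^ (1 - p / 2) * x ^ (p / 2) = x := fun x => by
          rw [← rpow_add_of_nonneg _ _ hl (by positivity), sub_add_cancel, rpow_one]
        rw [mul_rpow_of_nonneg _ _ hl, mul_rpow_of_nonneg _ _ (by positivity),
          mul_mul_mul_comm, h2, coe_mul, coe_rpow_of_nonneg _ hl,
          coe_rpow_of_nonneg _ hq0.le, coe_rpow_of_nonneg _ (by positivity)]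
  rw [nrm, nrm, coe_rpow_of_nonneg _ (by positivity),
    ← mul_rpow_of_nonneg _ _ (by positivity)]
  exact rpow_le_rpow hint (by positivity)

/-- The Fefferman-Stein inequality in a single direction. -/
lemma vv_single (hp : 1 < p) : ∃ C : ℝ≥0, ∀ e, Sl e → VV p {e} C := by
  have key : ∀ q : ℝ, 1 < q → ∃ C : ℝ≥0, ∀ e, Sl e → MB q {e} C := fun q hq => by
    obtain ⟨C, hC⟩ := mb_single hq
    exact ⟨C, fun e he F hF => by rw [MD_singleton]; exact hC e he F hF.meas⟩
  have hs : ∀ e, Sl e → ∀ e' ∈ ({e} : Finset ℝ²), Sl e' := fun e he e' he' => by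
    rwa [Finset.mem_singleton.1 he']
  rcases lt_trichotomy p 2 with h | h | h
  · have h1 : 1 < p / (2 - p) := by rw [lt_div_iff₀ (by linarith)]; linarith
    obtain ⟨q, hq, hqp⟩ := exists_between h1
    obtain ⟨C, hC⟩ := key q hq
    obtain ⟨C', hC'⟩ := vv_lt hp h hq hqp C
    exact ⟨C', fun e he => hC' _ (hs e he) (hC e he)⟩
  · obtain ⟨C, hC⟩ := vv_two
    exact ⟨C, fun e he => h ▸ hC _ (hs e he)⟩
  · have h1 : 1 < p / (p - 2) := by rw [lt_div_iff₀ (by linarith)]; linarith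
    obtain ⟨C, hC⟩ := key _ h1
    obtain ⟨C', hC'⟩ := vv_gt h C
    exact ⟨C', fun e he => hC' _ (hs e he) (hC e he)⟩

lemma LK.of_nice (h : Nice κ) (hl : ∃ K : ℝ, 0 ≤ K ∧ ∀ s t, |κ s - κ t| ≤ K * |s - t|) :
    LK κ := by
  obtain ⟨R, hR, hR'⟩ := h.supp
  exact ⟨hl, R, hR, fun t ht => hR' t (by rwa [norm_eq_abs])⟩

lemma LK.add (h : LK κ) (h' : LK κ') : LK (fun t => κ t + κ' t) := by
  obtain ⟨K, hK, hK'⟩ := h.lip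
  obtain ⟨L, hL, hL'⟩ := h'.lip
  refine .of_nice (h.nice.add h'.nice) ⟨K + L, by positivity, fun s t => ?_⟩
  calc |κ s + κ' s - (κ t + κ' t)| = |(κ s - κ t) + (κ' s - κ' t)| := by ring_nf
    _ ≤ _ := (abs_add_le _ _).trans (by rw [add_mul]; exact add_le_add (hK' s t) (hL' s t))

lemma LK.const_mul (h : LK κ) (c : ℝ) : LK (fun t => c * κ t) := by
  obtain ⟨K, hK, hK'⟩ := h.lip
  refine .of_nice (h.nice.const_mul c) ⟨|c| * K, by positivity, fun s t => ?_⟩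
  rw [← mul_sub, abs_mul, mul_assoc]
  exact mul_le_mul_of_nonneg_left (hK' s t) (abs_nonneg c)

lemma LK.sub (h : LK κ) (h' : LK κ') : LK (fun t => κ t - κ' t) := by
  have := h.add (h'.const_mul (-1))
  simpa [sub_eq_add_neg] using this

lemma LK.dil (h : LK κ) (j : ℤ) : LK (dil j κ) := by
  obtain ⟨K, hK, hK'⟩ := h.lip
  refine .of_nice (h.nice.dil j) ⟨(2 : ℝ) ^ j * (K * 2 ^ j), by positivity, fun s t => ?_⟩
  have h2 : (0 : ℝ) < 2 ^ j := by positivity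
  simp only [LacHilbert.dil]
  rw [← mul_sub, abs_mul, abs_of_pos h2, mul_assoc]
  refine mul_le_mul_of_nonneg_left ((hK' _ _).trans (Eq.le ?_)) h2.le
  rw [← mul_sub, abs_mul, abs_of_pos h2, mul_assoc]

lemma LK.reflect (h : LK κ) : LK (fun t => κ (-t)) := by
  obtain ⟨K, hK, hK'⟩ := h.lip
  refine .of_nice h.nice.reflect ⟨K, hK, fun s t => (hK' _ _).trans (Eq.le ?_)⟩
  rw [neg_sub_neg, abs_sub_comm]

lemma LK.cv (h : Nice κ) (h' : LK κ') : LK (cv κ 1 κ') := by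
  obtain ⟨K, hK, hK'⟩ := h'.lip
  refine .of_nice (h.cv h'.nice 1) ⟨K * ∫ t, |κ t|, mul_nonneg hK (integral_nonneg fun t => abs_nonneg _),
    fun s t => ?_⟩
  simp only [LacHilbert.cv]
  rw [← integral_sub (h.cv_integrand h'.nice (1 : ℝ) s).integrable
    (h.cv_integrand h'.nice (1 : ℝ) t).integrable]
  have hi : Integrable (fun u => |κ u|) := h.abs.integrable
  calc |∫ u, (κ u * κ' (s - u • 1) - κ u * κ' (t - u • 1))|
      ≤ ∫ u, |κ u| * (K * |s - t|) := by
        rw [← norm_eq_abs]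
        refine norm_integral_le_of_norm_le (hi.mul_const _) (.of_forall fun u => ?_)
        rw [← mul_sub, norm_eq_abs, abs_mul]
        refine mul_le_mul_of_nonneg_left ((hK' _ _).trans (Eq.le ?_)) (abs_nonneg _)
        ring_nf
    _ = _ := by rw [integral_mul_const]; ring

lemma lk_tri : LK tri := by
  refine .of_nice nice_tri ⟨1, zero_le_one, fun s t => ?_⟩
  unfold tri
  rw [one_mul]
  rw [max_comm 0, max_comm 0]
  refine (abs_max_sub_max_le_abs _ _ _).trans ?_
  rw [sub_sub_sub_cancel_left, abs_sub_comm]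
  exact abs_abs_sub_abs_le_abs_sub _ _

lemma integral_tri : ∫ t, tri t = 1 := by
  have h1 : ∫ t, tri t = ∫ t in (-1 : ℝ)..1, tri t := by
    rw [intervalIntegral.integral_of_le (by norm_num), ← integral_Icc_eq_integral_Ioc,
      setIntegral_eq_integral_of_forall_compl_eq_zero]
    intro t ht
    refine tri_supp ?_
    by_contra h
    exact ht ⟨by linarith [(abs_lt.1 (not_le.1 h)).1], (abs_lt.1 (not_le.1 h)).2.le⟩
  rw [h1, ← intervalIntegral.integral_add_adjacent_intervals (b := 0)
    (continuous_tri.intervalIntegrable _ _) (continuous_tri.intervalIntegrable _ _)]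
  have h2 : ∫ t in (-1 : ℝ)..0, tri t = ∫ t in (-1 : ℝ)..0, (1 + t) := by
    refine intervalIntegral.integral_congr fun t ht => ?_
    rw [Set.uIcc_of_le (by norm_num)] at ht
    simp only [tri]
    rw [abs_of_nonpos ht.2, max_eq_right (by linarith [ht.1])]; ring
  have h3 : ∫ t in (0 : ℝ)..1, tri t = ∫ t in (0 : ℝ)..1, (1 - t) := by
    refine intervalIntegral.integral_congr fun t ht => ?_
    rw [Set.uIcc_of_le (by norm_num)] at ht
    simp only [tri]
    rw [abs_of_nonneg ht.1, max_eq_right (by linarith [ht.2])]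
  rw [h2, h3, intervalIntegral.integral_add (by simp) (by simp),
    intervalIntegral.integral_sub (by simp) (by simp)]
  norm_num

lemma dil_reflect (j : ℤ) (κ : ℝ → ℝ) : (fun t => dil j κ (-t)) = dil j fun t => κ (-t) := by
  funext t; simp [dil]

lemma integral_reflect (κ : ℝ → ℝ) : ∫ t, κ (-t) = ∫ t, κ t := integral_neg_eq_self κ volume

lemma two_zpow_le_geo_ofReal {C : ℝ} (hC : 0 ≤ C) (h : n ≤ m) :
    ofReal (2 * (C * (2 : ℝ) ^ (n - m))) = (2 * C).toNNReal * geo (n - m) := by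
  obtain ⟨k, hk⟩ := Int.eq_ofNat_of_zero_le (sub_nonneg.2 h)
  have e1 : n - m = -(k : ℤ) := by omega
  rw [e1, geo_neg, geo, Int.natAbs_natCast, zpow_neg, zpow_natCast, ← mul_assoc,
    ofReal_mul (by positivity), ofReal]
  congr 1
  rw [← ENNReal.inv_pow, ofReal_inv_of_pos (by positivity),
    ofReal_pow zero_le_two]
  simp

/-- A mean zero kernel is small against a Lipschitz kernel at a coarser scale. -/
lemma cv_fine_coarse (hR : Nice R) (hQ : LK Q) (hR0 : ∫ t, R t = 0) :
    ∃ C : ℝ≥0, ∀ (j n : ℤ), n ≤ j → ∀ (e : ℝ²) (f : ℝ² → ℝ), Nice f → ∀ F : ℝ² → ℝ≥0∞,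
      (∀ q, ‖f q‖ₑ ≤ F q) → ∀ q,
      ‖cv (dil j R) e (cv (dil n Q) e f) q‖ₑ ≤ C * geo (n - j) * MM e F q := by
  obtain ⟨C, c, hC, hc, h⟩ := cv_dil_dil_bound hR hQ
  refine ⟨(2 * C).toNNReal, fun j n hnj e f hf F hF q => ?_⟩
  have hb := h j n hnj
  simp only [hR0, zero_mul, sub_zero] at hb
  rw [← cv_cv (hR.dil j) (hQ.nice.dil n) hf, ← two_zpow_le_geo_ofReal hC hnj]
  exact enorm_cv_le_MM hb e hF q

lemma cross_bound (hR : LK R) (hQ : LK Q) (hR0 : ∫ t, R t = 0)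
    (hQ0 : ∫ t, Q t = 0) :
    ∃ C : ℝ≥0, ∀ (j n : ℤ) (e : ℝ²) (f : ℝ² → ℝ), Nice f → ∀ F : ℝ² → ℝ≥0∞,
      (∀ q, ‖f q‖ₑ ≤ F q) → ∀ q,
      ‖cv (dil j R) e (cv (dil n Q) e f) q‖ₑ ≤ C * geo (n - j) * MM e F q := by
  obtain ⟨C₁, h₁⟩ := cv_fine_coarse hR.nice hQ hR0
  obtain ⟨C₂, h₂⟩ := cv_fine_coarse hQ.nice hR hQ0
  refine ⟨C₁ + C₂, fun j n e f hf F hF q => ?_⟩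
  rcases le_total n j with h | h
  · refine (h₁ j n h e f hf F hF q).trans ?_
    gcongr
    exact le_self_add
  · rw [cv_comm (hR.nice.dil j) (hQ.nice.dil n) hf]
    refine (h₂ n j h e f hf F hF q).trans ?_
    rw [← geo_neg (n - j), neg_sub]
    gcongr
    exact le_add_self

/-- A kernel at a coarse scale hardly feels a normalised kernel at a finer scale. -/
lemma cv_sub_cv_fine (hR : LK R) (hW : Nice W) (hW1 : ∫ t, W t = 1) :
    ∃ C : ℝ≥0, ∀ (j n : ℤ), j ≤ n → ∀ (e : ℝ²) (f : ℝ² → ℝ), Nice f → ∀ F : ℝ² → ℝ≥0∞,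
      (∀ q, ‖f q‖ₑ ≤ F q) → ∀ q,
      ‖cv (dil j R) e f q - cv (dil j R) e (cv (dil n W) e f) q‖ₑ ≤
        C * geo (j - n) * MM e F q := by
  obtain ⟨C, c, hC, hc, h⟩ := cv_dil_dil_bound hW hR
  refine ⟨(2 * C).toNNReal, fun j n hnj e f hf F hF q => ?_⟩
  have hb := h n j hnj
  simp only [hW1, one_mul] at hb
  rw [cv_comm (hR.nice.dil j) (hW.dil n) hf, ← cv_cv (hW.dil n) (hR.nice.dil j) hf,
    ← enorm_neg, neg_sub, ← cv_sub_left ((hW.dil n).cv (hR.nice.dil j) 1) (hR.nice.dil j) hf,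
    ← two_zpow_le_geo_ofReal hC hnj]
  exact enorm_cv_le_MM hb e hF q

/-- A normalised reproducing kernel built from the triangle kernel. -/
def triW (t : ℝ) : ℝ := 3 * cv tri 1 tri t - 2 * cv tri 1 (cv tri 1 tri) t

/-- The cofactor in `dil 1 triW - triW = triD 0 ⋆ triQ`. -/
def triQ (t : ℝ) : ℝ :=
  3 * (dil 1 tri t + tri t) - 2 * (cv (dil 1 tri) 1 (dil 1 tri) t + cv (dil 1 tri) 1 tri t +
    cv tri 1 tri t)

lemma lk_triW : LK triW :=
  ((LK.cv nice_tri lk_tri).const_mul 3).sub ((LK.cv nice_tri (LK.cv nice_tri lk_tri)).const_mul 2)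

lemma lk_triQ : LK triQ :=
  (((lk_tri.dil 1).add lk_tri).const_mul 3).sub
    ((((LK.cv (nice_tri.dil 1) (lk_tri.dil 1)).add (LK.cv (nice_tri.dil 1) lk_tri)).add
      (LK.cv nice_tri lk_tri)).const_mul 2)

lemma integral_triW : ∫ t, triW t = 1 := by
  have h1 := nice_tri.cv nice_tri 1
  have h2 := nice_tri.cv h1 1
  have := integral_sub (f := fun t => 3 * cv tri 1 tri t)
    (g := fun t => 2 * cv tri 1 (cv tri 1 tri) t)
    (h1.const_mul 3).integrable (h2.const_mul 2).integrable
  unfold triW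
  rw [this, integral_const_mul, integral_const_mul, integral_cv_one nice_tri nice_tri,
    integral_cv_one nice_tri h1, integral_cv_one nice_tri nice_tri, integral_tri]
  norm_num

lemma integral_triQ : ∫ t, triQ t = 0 := by
  have hA := nice_tri.dil 1
  have h1 := hA.cv hA 1
  have h2 := hA.cv nice_tri 1
  have h3 := nice_tri.cv nice_tri 1
  have e1 := integral_sub (f := fun t => 3 * (dil 1 tri t + tri t))
    (g := fun t => 2 * (cv (dil 1 tri) 1 (dil 1 tri) t + cv (dil 1 tri) 1 tri t +
    cv tri 1 tri t)) ((hA.add nice_tri).const_mul 3).integrable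
    (((h1.add h2).add h3).const_mul 2).integrable
  have e2 := integral_add (f := dil 1 tri) (g := tri) hA.integrable nice_tri.integrable
  have e3 := integral_add (f := fun t => cv (dil 1 tri) 1 (dil 1 tri) t + cv (dil 1 tri) 1 tri t)
    (g := cv tri 1 tri) (h1.add h2).integrable h3.integrable
  have e4 := integral_add (f := cv (dil 1 tri) 1 (dil 1 tri)) (g := cv (dil 1 tri) 1 tri)
    h1.integrable h2.integrable
  unfold triQ
  rw [e1, integral_const_mul, integral_const_mul, e2, e3, e4, integral_cv_one hA hA,
    integral_cv_one hA nice_tri, integral_cv_one nice_tri nice_tri, integral_dil, integral_tri]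
  norm_num

lemma dil_zero (κ : ℝ → ℝ) : dil 0 κ = κ := by funext t; simp [dil]

lemma dil_one_triW_sub (t : ℝ) : dil 1 triW t - triW t = cv (triD 0) 1 triQ t := by
  have hB := nice_tri
  have hA := nice_tri.dil 1
  have hAA := hA.cv hA (1 : ℝ)
  have hAB := hA.cv hB (1 : ℝ)
  have hBB := hB.cv hB (1 : ℝ)
  have eD : triD 0 = fun t => dil 1 tri t - tri t := by
    funext t; simp [triD, dil_zero]
  have eW : dil 1 triW t = 3 * cv (dil 1 tri) 1 (dil 1 tri) t -
      2 * cv (dil 1 tri) 1 (cv (dil 1 tri) 1 (dil 1 tri)) t := by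
    rw [← dil_cv, ← dil_cv]
    simp only [dil, triW]
    ring
  have hQ : ∀ κ : ℝ → ℝ, Nice κ → cv κ 1 triQ t = 3 * (cv κ 1 (dil 1 tri) t + cv κ 1 tri t) -
      2 * (cv κ 1 (cv (dil 1 tri) 1 (dil 1 tri)) t + cv κ 1 (cv (dil 1 tri) 1 tri) t +
        cv κ 1 (cv tri 1 tri) t) := by
    intro κ hκ
    unfold triQ
    rw [cv_sub hκ ((hA.add hB).const_mul 3) (((hAA.add hAB).add hBB).const_mul 2), cv_const_mul,
      cv_const_mul, cv_add hκ hA hB, cv_add hκ (hAA.add hAB) hBB, cv_add hκ hAA hAB]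
  rw [eW, eD, cv_sub_left hA hB lk_triQ.nice, hQ _ hA, hQ _ hB, cv_comm hB hA hA,
    cv_comm hB hA hB, cv_one_comm tri (dil 1 tri), triW]
  ring

lemma cv_triW_succ (i : ℤ) (hf : Nice f) (e q : ℝ²) :
    cv (dil (i + 1) triW) e f q =
      cv (dil i triW) e f q + cv (triD i) e (cv (dil i triQ) e f) q := by
  have h1 : dil i (triD 0) = triD i := by
    funext t
    have h := fun m => congrFun (dil_dil i m tri) t
    simp only [dil] at h
    simp only [dil, triD, mul_sub, zero_add, h, add_zero]
  have h2 : (fun t => dil (i + 1) triW t - dil i triW t) = cv (triD i) 1 (dil i triQ) := by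
    rw [← h1, ← dil_cv]
    funext t
    rw [← dil_dil]
    simp only [dil, ← mul_sub]
    congr 1
    exact dil_one_triW_sub _
  rw [← cv_cv (nice_triD i) (lk_triQ.nice.dil i) hf, ← h2,
    cv_sub_left (lk_triW.nice.dil _) (lk_triW.nice.dil _) hf]
  ring

lemma cv_triW_telescope (l : ℤ) (N : ℕ) (hf : Nice f) (e q : ℝ²) :
    cv (dil (l + N) triW) e f q = cv (dil l triW) e f q +
      ∑ n ∈ range N, cv (triD (l + n)) e (cv (dil (l + n) triQ) e f) q := by
  induction N with
  | zero => simp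
  | succ N ih =>
    rw [sum_range_succ, ← add_assoc, ← ih, ← cv_triW_succ _ hf]
    push_cast
    rw [add_assoc]

lemma tendsto_geo {f : ℕ → ℤ} (c : ℤ) (h : ∀ M : ℕ, (M : ℤ) ≤ (f M).natAbs + c) :
    Tendsto (fun M => geo (f M)) atTop (nhds 0) := by
  have h1 := ENNReal.tendsto_pow_atTop_nhds_zero_of_lt_one (r := 2⁻¹) (by simp)
  refine h1.comp (tendsto_atTop.2 fun b => ?_)
  filter_upwards [eventually_ge_atTop (b + c.natAbs)] with M hM
  have := h M
  omega

/-- Littlewood-Paley estimate in a single direction, in dual form. -/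
lemma lp_pair (hR : LK R) (hR0 : ∫ t, R t = 0) : ∃ K : ℝ≥0, ∀ (e : ℝ²), Sl e →
    ∀ (f : ℝ² → ℝ) (g : ℤ → ℝ² → ℝ) (T : Finset ℤ), Nice f → (∀ j, Nice (g j)) →
    ‖∑ j ∈ T, ∫ q, cv (dil j R) e f q * g j q‖ₑ ≤
      K * ∫⁻ q, MM e (en f) q * MM e (vsq T fun j => MM e (en (g j))) q := by
  have hRr := hR.reflect
  have hQr := lk_triQ.reflect
  obtain ⟨C, hC⟩ := cross_bound hQr hRr (by rw [integral_reflect, integral_triQ])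
    (by rw [integral_reflect, hR0])
  obtain ⟨C₁, hC₁⟩ := cv_fine_coarse hR.nice lk_triW hR0
  obtain ⟨C₂, hC₂⟩ := cv_sub_cv_fine hR lk_triW.nice integral_triW
  refine ⟨3 * (C * 4), fun e he f g T hf hg => ?_⟩
  have hRn : ∀ j, Nice (dil j R) := fun j => hR.nice.dil j
  have hQn : ∀ j, Nice (dil j triQ) := fun j => lk_triQ.nice.dil j
  have hWn : ∀ j, Nice (dil j triW) := fun j => lk_triW.nice.dil j
  set I : ℤ → ℝ≥0∞ := fun j => ∫⁻ q, MM e (en f) q * en (g j) q with hI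
  have hIfin : ∀ j, I j ≠ ⊤ := by
    intro j
    obtain ⟨B, hB⟩ := (hf.bm.MM e).bdd
    refine ne_top_of_le_ne_top (b := B * ∫⁻ q, en (g j) q)
      (mul_ne_top coe_ne_top (hg j).integrable.hasFiniteIntegral.ne) ?_
    rw [← lintegral_const_mul' _ _ coe_ne_top]
    exact lintegral_mono fun q => mul_le_mul_left (hB q) _
  set rem : ℕ → ℝ≥0∞ := fun M => ∑ j ∈ T, (C₂ * geo (j - M) + C₁ * geo (-M - j)) * I j with hrem
  have hlim : Tendsto rem atTop (nhds 0) := by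
    have : Tendsto rem atTop (nhds (∑ j ∈ T, (C₂ * 0 + C₁ * 0) * I j)) := by
      refine tendsto_finsetSum _ fun j _ => ?_
      refine ENNReal.Tendsto.mul_const ?_ (Or.inr (hIfin j))
      refine Tendsto.add (ENNReal.Tendsto.const_mul (tendsto_geo j.natAbs fun M => by omega)
        (Or.inr coe_ne_top)) (ENNReal.Tendsto.const_mul
          (tendsto_geo j.natAbs fun M => by omega) (Or.inr coe_ne_top))
    simpa using this
  have key : ∀ M : ℕ, (∀ j ∈ T, -(M : ℤ) ≤ j ∧ j ≤ M) →
      ‖∑ j ∈ T, ∫ q, cv (dil j R) e f q * g j q‖ₑ ≤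
      3 * (C * 4) * (∫⁻ q, MM e (en f) q * MM e (vsq T fun j => MM e (en (g j))) q) + rem M := by
    intro M hM
    set l : ℤ := -M with hl
    set N : ℕ := 2 * M with hN
    have hlN : l + N = M := by rw [hl, hN]; push_cast; ring
    set G : ℤ → ℝ² → ℝ := fun j => cv (dil j fun t => R (-t)) e (g j) with hG
    have hGn : ∀ j, Nice (G j) := fun j => (hRr.nice.dil j).cv (hg j) e
    set h : ℕ → ℝ² → ℝ := fun n q => ∑ j ∈ T, cv (dil (l + n) fun t => triQ (-t)) e (G j) q with hh
    have hhn : ∀ n, Nice (h n) := fun n => Nice.sum _ fun j _ => (hQr.nice.dil _).cv (hGn j) e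
    set Z : ℕ → ℝ² → ℝ := fun n => cv (triD (l + n)) e (cv (dil (l + n) triQ) e f) with hZ
    have hZn : ∀ n, Nice (Z n) := fun n => (nice_triD _).cv ((hQn _).cv hf e) e
    set Y : ℤ → ℕ → ℝ² → ℝ := fun j n => cv (dil j R) e (Z n)
    have hYn : ∀ j n, Nice (Y j n) := fun j n => (hRn j).cv (hZn n) e
    set X : ℤ → ℝ² → ℝ := fun j q => cv (dil j R) e f q - ∑ n ∈ range N, Y j n q with hX
    have hXn : ∀ j, Nice (X j) := fun j =>
      ((hRn j).cv hf e).sub (Nice.sum (f := Y j) _ fun n _ => hYn j n)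
    have hXb : ∀ j ∈ T, ∀ q, ‖X j q‖ₑ ≤ (C₂ * geo (j - M) + C₁ * geo (-M - j)) * MM e (en f) q := by
      intro j hj q
      have h1 : X j q = (cv (dil j R) e f q - cv (dil j R) e (cv (dil M triW) e f) q) +
          cv (dil j R) e (cv (dil l triW) e f) q := by
        have h2 : cv (dil M triW) e f = fun q => cv (dil l triW) e f q + ∑ n ∈ range N, Z n q := by
          funext q; rw [← hlN]; exact cv_triW_telescope l N hf e q
        rw [h2, cv_add (hRn j) ((hWn l).cv hf e) (Nice.sum (f := Z) _ fun n _ => hZn n),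
          cv_sum (f := Z) _ (hRn j) fun n _ => hZn n, hX]
        ring
      rw [h1, add_mul]
      exact (enorm_add_le _ _).trans (add_le_add
        (hC₂ j M (hM j hj).2 e f hf (en f) (fun _ => le_rfl) q)
        (hC₁ j l (hM j hj).1 e f hf (en f) (fun _ => le_rfl) q))
    have hsplit : ∑ j ∈ T, ∫ q, cv (dil j R) e f q * g j q =
        (∑ n ∈ range N, ∫ q, cv (triD (l + n)) e f q * h n q) +
          ∑ j ∈ T, ∫ q, X j q * g j q := by
      have h1 : ∀ j ∈ T, ∫ q, cv (dil j R) e f q * g j q = (∑ n ∈ range N,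
          ∫ q, cv (triD (l + n)) e f q * cv (dil (l + n) fun t => triQ (-t)) e (G j) q) +
            ∫ q, X j q * g j q := by
        intro j _
        have h2 : ∀ n : ℕ, ∫ q, cv (triD (l + n)) e f q *
            cv (dil (l + n) fun t => triQ (-t)) e (G j) q = ∫ q, Y j n q * g j q := by
          intro n
          simp only [Y, hZ]
          rw [cv_comm (nice_triD _) (hQn _) hf,
            integral_cv_mul (hRn j) ((hQn _).cv ((nice_triD _).cv hf e) e) (hg j),
            integral_cv_mul (hQn _) ((nice_triD _).cv hf e) ((hRn j).reflect.cv (hg j) e),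
            dil_reflect, dil_reflect]
        rw [sum_congr rfl fun n _ => h2 n, ← integral_finsetSum (f := fun n q => Y j n q * g j q) _
          fun n _ => ((hYn j n).mul (hg j)).integrable, ← integral_add (Nice.sum
            (f := fun n q => Y j n q * g j q) _ fun n _ => (hYn j n).mul (hg j)).integrable
          ((hXn j).mul (hg j)).integrable]
        congr 1
        funext q
        rw [hX, ← sum_mul]
        ring
      rw [sum_congr rfl h1, sum_add_distrib, sum_comm]
      congr 1
      refine sum_congr rfl fun n _ => ?_
      rw [← integral_finsetSum _ fun j _ => (((nice_triD _).cv hf e).mul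
        ((hQr.nice.dil _).cv (hGn j) e)).integrable]
      simp only [hh, mul_sum]
    rw [hsplit]
    refine (enorm_add_le _ _).trans (add_le_add ?_ ?_)
    · refine (pair_triD_dir he N hf hhn l).trans ?_
      rw [mul_assoc]
      refine mul_le_mul_right ?_ _
      rw [← lintegral_const_mul' _ _ (mul_ne_top coe_ne_top (by norm_num))]
      refine lintegral_mono fun q => ?_
      rw [mul_left_comm]
      refine mul_le_mul_right ?_ _
      rw [← MM_const_mul _ (mul_ne_top coe_ne_top (by norm_num))]
      refine MM_mono (fun q => ?_) e q
      refine (vsq_mono (F := fun n : ℕ => en (h n)) (G := fun n q =>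
        ∑ j ∈ T, (C * geo (j - (l + (n : ℤ)))) * MM e (en (g j)) q)
        (fun n _ q => ?_) q).trans (schur_sq (fun (n : ℕ) j => C * geo (j - (l + (n : ℤ))))
          (C * 4) (fun n _ => ?_) (fun j _ => ?_) _ q)
      · simp only [en, hh]
        refine (enorm_sum_le _ _).trans (sum_le_sum fun j _ => ?_)
        exact hC (l + n) j e (g j) (hg j) _ (fun _ => le_rfl) q
      · rw [← mul_sum]
        gcongr
        exact geo_sum_le' _ _
      · rw [← mul_sum]
        gcongr
        have := geo_sum_le ((range N).map ⟨fun n : ℕ => l + (n : ℤ), fun a b hab => by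
          simpa using hab⟩) j
        rw [Finset.sum_map] at this
        exact this
    · refine (enorm_sum_le _ _).trans (sum_le_sum fun j hj => ?_)
      refine (enorm_integral_le_lintegral_enorm _).trans ?_
      change _ ≤ (C₂ * geo (j - M) + C₁ * geo (-M - j)) * ∫⁻ q, MM e (en f) q * en (g j) q
      rw [← lintegral_const_mul (f := fun q => MM e (en f) q * en (g j) q) _
        (((meas_MM hf.en_meas e)).mul (hg j).en_meas)]
      refine lintegral_mono fun q => ?_
      rw [enorm_mul, ← mul_assoc]
      exact mul_le_mul_left (hXb j hj q) _
  have hlim2 := (tendsto_const_nhds (x := 3 * (C * 4) *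
    (∫⁻ q, MM e (en f) q * MM e (vsq T fun j => MM e (en (g j))) q))).add hlim
  rw [add_zero] at hlim2
  push_cast
  refine ge_of_tendsto hlim2 ?_
  have : ∀ᶠ M : ℕ in atTop, ∀ j ∈ T, -(M : ℤ) ≤ j ∧ j ≤ M := by
    rw [Finset.eventually_all]
    intro j _
    filter_upwards [eventually_ge_atTop j.natAbs] with M hM
    omega
  filter_upwards [this] with M hM using key M hM

/-- Vector-valued Littlewood-Paley square function estimate for a family of directions. -/
lemma lp_sq (hR : LK R) (hR0 : ∫ t, R t = 0) (hpq : p.HolderConjugate p')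
    (C : ℝ≥0) : ∃ K : ℝ≥0, ∀ D : Finset ℝ², (∀ e ∈ D, Sl e) → VV p D C → VV p' D C →
    ∀ (ι : Type) (s : Finset ι) (e : ι → ℝ²) (f : ι → ℝ² → ℝ) (T : Finset ℤ),
    (∀ i, e i ∈ D) → (∀ i, Nice (f i)) →
    nrm p (vsq (s ×ˢ T) fun x => en (cv (dil x.2 R) (e x.1) (f x.1))) ≤
      K * nrm p (vsq s fun i => en (f i)) := by
  obtain ⟨K, hK⟩ := lp_pair hR hR0
  refine ⟨K * (C * (C * C)), fun D hD hV hV' ι s e f T he hf => ?_⟩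
  refine nrm_vsq_le_of_dual (s := s ×ˢ T) (U := fun x => cv (dil x.2 R) (e x.1) (f x.1))
    (fun x => (hR.nice.dil x.2).cv (hf x.1) (e x.1)) hpq fun g hg => ?_
  rw [sum_product]
  refine (enorm_sum_le _ _).trans ?_
  have h1 : ∀ i ∈ s, ‖∑ j ∈ T, ∫ q, cv (dil j R) (e i) (f i) q * g (i, j) q‖ₑ ≤
      K * ∫⁻ q, MM (e i) (en (f i)) q * MM (e i) (vsq T fun j => MM (e i) (en (g (i, j)))) q :=
    fun i _ => hK (e i) (hD _ (he i)) (f i) (fun j => g (i, j)) T (hf i) fun j => hg (i, j)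
  have hb : ∀ i, BM (vsq T fun j => MM (e i) (en (g (i, j)))) :=
    fun i => BM.vsq fun j => (hg (i, j)).bm.MM _
  refine (sum_le_sum h1).trans ?_
  rw [← mul_sum]
  have h2 := sum_lintegral_mul_le hpq (F := fun i => MM (e i) (en (f i)))
    (G := fun i => MM (e i) (vsq T fun j => MM (e i) (en (g (i, j)))))
    (fun i => meas_MM (hf i).en_meas _) (fun i => meas_MM (hb i).meas _) s
  have h3 := hV ι s e (fun i => en (f i)) he fun i => (hf i).bm
  have h4 := hV' ι s e (fun i => vsq T fun j => MM (e i) (en (g (i, j)))) he hb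
  have h5 := hV' (ι × ℤ) (s ×ˢ T) (fun x => e x.1) (fun x => en (g x)) (fun x => he x.1)
    fun x => (hg x).bm
  have h6 : vsq (s ×ˢ T) (fun x : ι × ℤ => MM (e x.1) (en (g x))) =
      vsq s fun i => vsq T fun j => MM (e i) (en (g (i, j))) :=
    funext fun q => vsq_prod s T (fun x : ι × ℤ => MM (e x.1) (en (g x))) q
  rw [h6] at h5
  calc (K : ℝ≥0∞) * ∑ i ∈ s, ∫⁻ q, MM (e i) (en (f i)) q *
        MM (e i) (vsq T fun j => MM (e i) (en (g (i, j)))) q ≤ K * ((C * nrm p (vsq s fun i => en (f i))) *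
        (C * (C * nrm p' (vsq (s ×ˢ T) fun x => en (g x))))) := by
        refine mul_le_mul_right (h2.trans (mul_le_mul' h3 (h4.trans ?_))) _
        exact mul_le_mul_right h5 _
    _ = _ := by push_cast; ring

/-- Littlewood-Paley estimate in one direction. -/
lemma lp_sq_single (hR : LK R) (hR0 : ∫ t, R t = 0) (hp : 1 < p) :
    ∃ K : ℝ≥0, ∀ e : ℝ², Sl e →
    ∀ (ι : Type) (s : Finset ι) (f : ι → ℝ² → ℝ) (T : Finset ℤ), (∀ i, Nice (f i)) →
    nrm p (vsq (s ×ˢ T) fun x => en (cv (dil x.2 R) e (f x.1))) ≤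
      K * nrm p (vsq s fun i => en (f i)) := by
  have hpq := HolderConjugate.conjExponent hp
  obtain ⟨C₁, h₁⟩ := vv_single hp
  obtain ⟨C₂, h₂⟩ := vv_single hpq.symm.lt
  obtain ⟨K, hK⟩ := lp_sq hR hR0 hpq (C₁ + C₂)
  refine ⟨K, fun e he ι s f T hf => hK {e} (by simpa using he) ?_ ?_ ι s (fun _ => e) f T
    (by simp) hf⟩
  · intro ι s e' F he' hF
    refine (h₁ e he ι s e' F he' hF).trans (mul_le_mul_left ?_ _)
    gcongr; exact le_self_add
  · intro ι s e' F he' hF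
    refine (h₂ e he ι s e' F he' hF).trans (mul_le_mul_left ?_ _)
    gcongr; exact le_add_self

lemma vsq_le_of_injOn {X ι κ : Type*} [MeasureSpace X] {s : Finset ι} {t : Finset κ}
    {F : ι → X → ℝ≥0∞}
    {G : κ → X → ℝ≥0∞} {q : X} (φ : ι → κ) (hφ : Set.InjOn φ s) (hst : ∀ i ∈ s, φ i ∈ t)
    (h : ∀ i ∈ s, F i q ≤ G (φ i) q) : vsq s F q ≤ vsq t G q := by
  classical
  refine le_of_sq_le_sq_ennreal ?_
  rw [vsq_sq, vsq_sq]
  calc ∑ i ∈ s, F i q ^ 2 ≤ ∑ i ∈ s, G (φ i) q ^ 2 :=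
        sum_le_sum fun i hi => by have := h i hi; gcongr
    _ = ∑ x ∈ s.image φ, G x q ^ 2 := (sum_image (f := fun x => G x q ^ 2) hφ).symm
    _ ≤ ∑ x ∈ t, G x q ^ 2 := sum_le_sum_of_subset fun x hx => by
        obtain ⟨i, hi, rfl⟩ := mem_image.1 hx
        exact hst i hi

/-- Two-parameter Littlewood-Paley estimate. -/
lemma lp_sq_two (hα : LK α) (hα0 : ∫ t, α t = 0) (hγ : LK γ) (hγ0 : ∫ t, γ t = 0) (hp : 1 < p) :
    ∃ K : ℝ≥0, ∀ (ι : Type) (s : Finset ι) (f : ι → ℝ² → ℝ)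
    (T T' : Finset ℤ), (∀ i, Nice (f i)) →
    nrm p (vsq ((s ×ˢ T') ×ˢ T) fun x =>
      en (cv (dil x.2 α) (1, 0) (cv (dil x.1.2 γ) (0, 1) (f x.1.1)))) ≤
      K * nrm p (vsq s fun i => en (f i)) := by
  obtain ⟨K₁, h₁⟩ := lp_sq_single hα hα0 hp
  obtain ⟨K₂, h₂⟩ := lp_sq_single hγ hγ0 hp
  refine ⟨K₁ * K₂, fun ι s f T T' hf => ?_⟩
  refine (h₁ (1, 0) (sl_one 0) (ι × ℤ) (s ×ˢ T') (fun x => cv (dil x.2 γ) (0, 1) (f x.1)) T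
    fun x => (hγ.nice.dil _).cv (hf _) _).trans ?_
  rw [coe_mul, mul_assoc]
  exact mul_le_mul_right (h₂ (0, 1) sl_y ι s f T' hf) _

/-- Uniform vector-valued bound for single-scale convolutions. -/
lemma vv_cv (hκ : Nice κ) (hp : 1 < p) : ∃ K : ℝ≥0, ∀ e : ℝ², Sl e →
    ∀ (ι : Type) (s : Finset ι) (n : ι → ℤ) (f : ι → ℝ² → ℝ), (∀ i, Nice (f i)) →
    nrm p (vsq s fun i => en (cv (dil (n i) κ) e (f i))) ≤ K * nrm p (vsq s fun i => en (f i)) := by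
  obtain ⟨C, hC⟩ := vv_single hp
  obtain ⟨B, r, hB⟩ := hκ.bd
  refine ⟨(2 * B).toNNReal * C, fun e he ι s n f hf => ?_⟩
  calc _ ≤ nrm p (fun q => (2 * B).toNNReal * vsq s (fun i => MM e (en (f i))) q) := by
        refine nrm_mono (by linarith) fun q => ?_
        rw [← vsq_const_mul]
        exact vsq_mono (fun i _ q => enorm_cv_le_MM (hB.dil (n i)) e (fun _ => le_rfl) q) q
    _ = (2 * B).toNNReal * nrm p (vsq s fun i => MM e (en (f i))) := nrm_const_mul (by linarith) _ _
    _ ≤ _ := by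
        rw [coe_mul, mul_assoc]
        exact mul_le_mul_right (hC e he ι s (fun _ => e) (fun i => en (f i)) (by simp)
          fun i => (hf i).bm) _

/-- Littlewood-Paley estimate along the curve of scales `(n, σ + n)`. -/
lemma lp_sq_shift (hα : LK α) (hγ : LK γ) (h0 : ∫ t, α t = 0 ∨ ∫ t, γ t = 0) (hp : 1 < p) :
    ∃ K : ℝ≥0, ∀ (ι : Type) (s : Finset ι) (f : ι → ℝ² → ℝ) (σ : ι → ℤ)
    (T : Finset ℤ), (∀ i, Nice (f i)) →
    nrm p (vsq (s ×ˢ T) fun x =>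
      en (cv (dil x.2 α) (1, 0) (cv (dil (σ x.1 + x.2) γ) (0, 1) (f x.1)))) ≤
      K * nrm p (vsq s fun i => en (f i)) := by
  rcases h0 with h0 | h0
  · obtain ⟨K₁, h₁⟩ := lp_sq_single hα h0 hp
    obtain ⟨K₂, h₂⟩ := vv_cv hγ.nice hp
    refine ⟨K₂ * K₁, fun ι s f σ T hf => ?_⟩
    have h3 := h₂ (0, 1) sl_y (ι × ℤ) (s ×ˢ T) (fun x => σ x.1 + x.2)
      (fun x => cv (dil x.2 α) (1, 0) (f x.1)) fun x => (hα.nice.dil _).cv (hf _) _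
    simp only [cv_comm (hγ.nice.dil _) (hα.nice.dil _) (hf _)] at h3
    refine h3.trans ?_
    rw [coe_mul, mul_assoc]
    exact mul_le_mul_right (h₁ (1, 0) (sl_one 0) ι s f T hf) _
  · obtain ⟨K₁, h₁⟩ := lp_sq_single hγ h0 hp
    obtain ⟨K₂, h₂⟩ := vv_cv hα.nice hp
    refine ⟨K₂ * K₁, fun ι s f σ T hf => ?_⟩
    refine (h₂ (1, 0) (sl_one 0) (ι × ℤ) (s ×ˢ T) (fun x => x.2)
      (fun x => cv (dil (σ x.1 + x.2) γ) (0, 1) (f x.1))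
      fun x => (hγ.nice.dil _).cv (hf _) _).trans ?_
    rw [coe_mul, mul_assoc]
    refine mul_le_mul_right ?_ _
    refine le_trans (nrm_mono (by linarith) fun q => ?_) (h₁ (0, 1) sl_y ι s f
      ((s ×ˢ T).image fun x => σ x.1 + x.2) hf)
    refine vsq_le_of_injOn (F := fun x : ι × ℤ => en (cv (dil (σ x.1 + x.2) γ) (0, 1) (f x.1)))
      (G := fun x : ι × ℤ => en (cv (dil x.2 γ) (0, 1) (f x.1)))
      (fun x : ι × ℤ => (x.1, σ x.1 + x.2)) ?_ ?_ fun y _ => le_rfl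
    · rintro ⟨a, n⟩ _ ⟨a', n'⟩ _ h
      simp only [Prod.mk.injEq] at h ⊢
      obtain ⟨rfl, h⟩ := h
      exact ⟨rfl, add_left_cancel h⟩
    · rintro ⟨a, n⟩ h
      exact mem_product.2 ⟨(mem_product.1 h).1, mem_image.2 ⟨(a, n), h, rfl⟩⟩

lemma integral_cv_cv_mul (h₁ : Nice α₁) (h₂ : Nice α₂) (h₃ : Nice γ₁)
    (h₄ : Nice γ₂) {g : ℝ² → ℝ} (hf : Nice f) (hg : Nice g) (e e' : ℝ²) :
    ∫ q, cv (cv α₁ 1 α₂) e (cv (cv γ₁ 1 γ₂) e' f) q * g q =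
      ∫ q, cv α₂ e (cv γ₂ e' f) q * cv (fun t => α₁ (-t)) e (cv (fun t => γ₁ (-t)) e' g) q := by
  rw [cv_cv h₃ h₄ hf, cv_cv h₁ h₂ (h₃.cv (h₄.cv hf e') e'),
    integral_cv_mul h₁ (h₂.cv (h₃.cv (h₄.cv hf e') e') e) hg,
    cv_comm h₂ h₃ (h₄.cv hf e'),
    integral_cv_mul h₃ (h₂.cv (h₄.cv hf e') e) (h₁.reflect.cv hg e),
    cv_comm h₃.reflect h₁.reflect hg]

/-- The paraproduct-like operator adapted to the direction of slope `2^(-k)`. -/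
def Pk (α γ : ℝ → ℝ) (T : Finset ℤ) (k : ℤ) (f : ℝ² → ℝ) (q : ℝ²) : ℝ :=
  ∑ n ∈ T, cv (dil n α) (1, 0) (cv (dil (k + n) γ) (0, 1) f) q

lemma Nice.pk (hα : Nice α) (hγ : Nice γ) (T : Finset ℤ) (k : ℤ)
    (hf : Nice f) : Nice (Pk α γ T k f) :=
  Nice.sum T fun n _ => (hα.dil n).cv ((hγ.dil (k + n)).cv hf _) _

lemma pk_sq (h₁ : LK α₁) (h₂ : LK α₂) (h₃ : LK γ₁) (h₄ : LK γ₂)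
    (h₁0 : ∫ t, α₁ t = 0 ∨ ∫ t, γ₁ t = 0) (h₂0 : ∫ t, α₂ t = 0) (h₄0 : ∫ t, γ₂ t = 0)
    (hp : 1 < p) : ∃ K : ℝ≥0, ∀ (ι : Type) (s : Finset ι) (f : ι → ℝ² → ℝ)
    (S T : Finset ℤ), (∀ i, Nice (f i)) →
    nrm p (vsq (s ×ˢ S) fun x => en (Pk (cv α₁ 1 α₂) (cv γ₁ 1 γ₂) T x.2 (f x.1))) ≤
      K * nrm p (vsq s fun i => en (f i)) := by
  have hpq := HolderConjugate.conjExponent hp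
  obtain ⟨K₁, hK₁⟩ := lp_sq_two h₂ h₂0 h₄ h₄0 hp
  obtain ⟨K₂, hK₂⟩ := lp_sq_shift h₁.reflect h₃.reflect
    (by rwa [integral_reflect, integral_reflect]) hpq.symm.lt
  refine ⟨K₁ * K₂, fun ι s f S T hf => ?_⟩
  have hα := h₁.nice.cv h₂.nice (1 : ℝ)
  have hγ := h₃.nice.cv h₄.nice (1 : ℝ)
  refine nrm_vsq_le_of_dual (s := s ×ˢ S)
    (U := fun x => Pk (cv α₁ 1 α₂) (cv γ₁ 1 γ₂) T x.2 (f x.1))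
    (fun x => Nice.pk hα hγ T x.2 (hf x.1)) hpq fun g hg => ?_
  set T' : Finset ℤ := (S ×ˢ T).image fun x => x.1 + x.2 with hT'
  set A : (ι × ℤ) × ℤ → ℝ² → ℝ := fun x =>
    cv (dil x.2 α₂) (1, 0) (cv (dil (x.1.2 + x.2) γ₂) (0, 1) (f x.1.1)) with hA
  set B : (ι × ℤ) × ℤ → ℝ² → ℝ := fun x =>
    cv (dil x.2 fun t => α₁ (-t)) (1, 0)
      (cv (dil (x.1.2 + x.2) fun t => γ₁ (-t)) (0, 1) (g x.1)) with hB
  have hAn : ∀ x, Nice (A x) := fun x => (h₂.nice.dil _).cv ((h₄.nice.dil _).cv (hf _) _) _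
  have hBn : ∀ x, Nice (B x) := fun x =>
    (h₁.reflect.nice.dil _).cv ((h₃.reflect.nice.dil _).cv (hg _) _) _
  have hsum : ∑ x ∈ s ×ˢ S, ∫ q, Pk (cv α₁ 1 α₂) (cv γ₁ 1 γ₂) T x.2 (f x.1) q * g x q =
      ∑ y ∈ (s ×ˢ S) ×ˢ T, ∫ q, A y q * B y q := by
    rw [sum_product (s ×ˢ S) T]
    refine sum_congr rfl fun x _ => ?_
    simp only [Pk, sum_mul]
    rw [integral_finsetSum _ fun n _ => ?_]
    · refine sum_congr rfl fun n _ => ?_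
      rw [dil_cv, dil_cv, integral_cv_cv_mul (h₁.nice.dil n) (h₂.nice.dil n) (h₃.nice.dil _)
        (h₄.nice.dil _) (hf x.1) (hg x), dil_reflect, dil_reflect]
    · exact (((hα.dil _).cv ((hγ.dil _).cv (hf _) _) _).mul (hg x)).integrable
  rw [hsum]
  have hstep : ‖∑ y ∈ (s ×ˢ S) ×ˢ T, ∫ q, A y q * B y q‖ₑ ≤
      ∑ y ∈ (s ×ˢ S) ×ˢ T, ∫⁻ q, en (A y) q * en (B y) q := by
    refine (enorm_sum_le _ _).trans (sum_le_sum fun y _ => ?_)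
    refine (enorm_integral_le_lintegral_enorm _).trans (Eq.le ?_)
    simp only [enorm_mul, en]
  refine hstep.trans ((sum_lintegral_mul_le hpq (F := fun y => en (A y)) (G := fun y => en (B y))
    (fun y => (hAn y).en_meas) (fun y => (hBn y).en_meas) _).trans ?_)
  have hmemT : ∀ k ∈ S, ∀ n ∈ T, k + n ∈ T' := fun k hk n hn =>
    mem_image.2 ⟨(k, n), mem_product.2 ⟨hk, hn⟩, rfl⟩
  have hAb : nrm p (vsq ((s ×ˢ S) ×ˢ T) fun y => en (A y)) ≤
      K₁ * nrm p (vsq s fun i => en (f i)) := by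
    refine le_trans (nrm_mono hpq.pos fun q => ?_) (hK₁ ι s f T T' hf)
    refine vsq_le_of_injOn (F := fun y => en (A y)) (G := fun x : (ι × ℤ) × ℤ =>
      en (cv (dil x.2 α₂) (1, 0) (cv (dil x.1.2 γ₂) (0, 1) (f x.1.1))))
      (fun y : (ι × ℤ) × ℤ => ((y.1.1, y.1.2 + y.2), y.2)) ?_ ?_ fun y _ => le_rfl
    · rintro ⟨⟨a, k⟩, n⟩ _ ⟨⟨a', k'⟩, n'⟩ _ h
      simp only [Prod.mk.injEq] at h ⊢
      obtain ⟨⟨rfl, h⟩, rfl⟩ := h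
      exact ⟨⟨rfl, add_right_cancel h⟩, rfl⟩
    · rintro ⟨⟨a, k⟩, n⟩ h
      simp only [mem_product] at h ⊢
      exact ⟨⟨h.1.1, hmemT k h.1.2 n h.2⟩, h.2⟩
  have hBb : nrm p.conjExponent (vsq ((s ×ˢ S) ×ˢ T) fun y => en (B y)) ≤
      K₂ * nrm p.conjExponent (vsq (s ×ˢ S) fun i => en (g i)) :=
    hK₂ (ι × ℤ) (s ×ˢ S) g (fun x => x.2) T hg
  refine (mul_le_mul' hAb hBb).trans (Eq.le ?_)
  push_cast
  ring

/-- A smooth step function from `0` to `1`. -/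
def stp (t : ℝ) : ℝ := smoothTransition ((t + 1) / 2)

lemma contDiff_stp : ContDiff ℝ ∞ stp :=
  smoothTransition.contDiff.comp (by fun_prop)

lemma stp_neg (h : t ≤ -1) : stp t = 0 :=
  smoothTransition.zero_of_nonpos (by linarith)

lemma stp_pos (h : 1 ≤ t) : stp t = 1 :=
  smoothTransition.one_of_one_le (by linarith)

/-- The base mollifier. -/
def phi : ℝ → ℝ := deriv stp

lemma sk_of_zero (h : ContDiff ℝ ∞ κ) (R : ℝ) (hR : ∀ t, R < |t| → κ t = 0) : SK κ :=
  ⟨h, HasCompactSupport.of_support_subset_isCompact (isCompact_Icc (a := -R) (b := R)) fun t ht => by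
    by_contra hc
    refine ht (hR t ?_)
    by_contra hc'
    exact hc (Set.mem_Icc.2 (abs_le.1 (not_lt.1 hc')))⟩

lemma deriv_stp_eq_zero (h : 1 < |t|) : deriv stp t = 0 := by
  rcases lt_abs.1 h with h | h
  · have : stp =ᶠ[nhds t] fun _ => 1 := by
      filter_upwards [lt_mem_nhds h] with s hs using stp_pos hs.le
    rw [this.deriv_eq, deriv_const]
  · have : stp =ᶠ[nhds t] fun _ => 0 := by
      filter_upwards [gt_mem_nhds (show t < -1 by linarith)] with s hs using stp_neg hs.le
    rw [this.deriv_eq, deriv_const]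

lemma sk_phi : SK phi :=
  sk_of_zero (ContDiff.deriv' (n := ∞) contDiff_stp) 1 fun _ h => deriv_stp_eq_zero h

lemma integral_phi : ∫ t, phi t = 1 := by
  have h := integral_of_hasDerivAt_of_tendsto (f := stp) (f' := phi) (m := 0) (n := 1)
    (fun t => (contDiff_stp.differentiable (by simp) t).hasDerivAt) sk_phi.nice.integrable
    (tendsto_const_nhds.congr' (by
      filter_upwards [eventually_le_atBot (-1)] with t ht using (stp_neg ht).symm))
    (tendsto_const_nhds.congr' (by
      filter_upwards [eventually_ge_atTop 1] with t ht using (stp_pos ht).symm))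
  simpa using h

/-- The difference of two consecutive mollifiers. -/
def vpi (t : ℝ) : ℝ := dil 1 phi t - phi t

/-- A compactly supported primitive of `vpi`. -/
def ppi (t : ℝ) : ℝ := stp (2 * t) - stp t

lemma sk_vpi : SK vpi := (sk_phi.dil 1).sub sk_phi

lemma integral_vpi : ∫ t, vpi t = 0 := by
  unfold vpi
  rw [integral_sub (sk_phi.dil 1).nice.integrable sk_phi.nice.integrable, integral_dil, sub_self]

lemma sk_ppi : SK ppi := by
  refine sk_of_zero ((contDiff_stp.comp (by fun_prop)).sub contDiff_stp) 1 fun t h => ?_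
  rcases lt_abs.1 h with h | h
  · rw [ppi, stp_pos (by linarith), stp_pos h.le, sub_self]
  · rw [ppi, stp_neg (by linarith), stp_neg (by linarith), sub_self]

lemma deriv_ppi : deriv ppi = vpi := by
  funext t
  have h1 : HasDerivAt (fun t => stp (2 * t)) (phi (2 * t) * 2) t :=
    HasDerivAt.comp (h₂ := stp) (h := fun t => 2 * t) t (contDiff_stp.differentiable (by simp) (2 * t)).hasDerivAt
      (by simpa using (hasDerivAt_id t).const_mul 2)
  have h2 : HasDerivAt ppi (phi (2 * t) * 2 - phi t) t :=
    h1.sub (contDiff_stp.differentiable (by simp) t).hasDerivAt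
  rw [h2.deriv, vpi, dil, zpow_one, mul_comm]

lemma ppi_odd (t : ℝ) : ppi (-t) = -ppi t := by
  have h : ∀ t, stp (-t) = 1 - stp t := by
    intro t
    have hpos : 0 < expNegInvGlue ((t + 1) / 2) + expNegInvGlue (1 - (t + 1) / 2) :=
      smoothTransition.pos_denom _
    have h1 : (-t + 1) / 2 = 1 - (t + 1) / 2 := by ring
    simp only [stp, smoothTransition]
    rw [h1, sub_sub_cancel, eq_sub_iff_add_eq, add_comm (expNegInvGlue (1 - (t + 1) / 2)), ← add_div,
      add_comm, div_self hpos.ne']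
  rw [ppi, ppi, mul_neg, h, h]
  ring

lemma integral_ppi : ∫ t, ppi t = 0 := by
  have h := integral_reflect ppi
  simp only [ppi_odd, integral_neg] at h
  linarith

local notation "𝔞" => dil 1 phi
local notation "𝔟" => phi

/-- The mollifier whose dyadic differences factor. -/
def Om (t : ℝ) : ℝ := 3 * cv 𝔟 1 𝔟 t - 2 * cv 𝔟 1 (cv 𝔟 1 𝔟) t

/-- The cofactor of `vpi` in the dyadic difference of `Om`. -/
def vpt (t : ℝ) : ℝ :=
  3 * (𝔞 t + 𝔟 t) - 2 * (cv 𝔞 1 𝔞 t + cv 𝔞 1 𝔟 t + cv 𝔟 1 𝔟 t)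

/-- The primitive of the dyadic difference of `Om`. -/
def pip : ℝ → ℝ := cv ppi 1 vpt

lemma sk_bb : SK (cv 𝔟 1 𝔟) := sk_phi.cv sk_phi

lemma sk_Om : SK Om := (sk_bb.const_mul 3).sub ((sk_phi.cv sk_bb).const_mul 2)

lemma sk_vpt : SK vpt :=
  (((sk_phi.dil 1).add sk_phi).const_mul 3).sub (((((sk_phi.dil 1).cv (sk_phi.dil 1)).add
    ((sk_phi.dil 1).cv sk_phi)).add sk_bb).const_mul 2)

lemma sk_pip : SK pip := sk_ppi.cv sk_vpt

lemma integral_Om : ∫ t, Om t = 1 := by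
  unfold Om
  rw [integral_sub (sk_bb.nice.integrable.const_mul 3)
    ((sk_phi.cv sk_bb).nice.integrable.const_mul 2), integral_const_mul, integral_const_mul,
    integral_cv_one sk_phi.nice sk_bb.nice, integral_cv_one sk_phi.nice sk_phi.nice, integral_phi]
  norm_num

lemma integral_vpt : ∫ t, vpt t = 0 := by
  have ha := sk_phi.dil 1
  have haa := ha.cv ha
  have hab := ha.cv sk_phi
  unfold vpt
  rw [integral_sub ((ha.add sk_phi).nice.integrable.const_mul 3)
    (((haa.add hab).add sk_bb).nice.integrable.const_mul 2), integral_const_mul, integral_const_mul,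
    integral_add ha.nice.integrable sk_phi.nice.integrable,
    integral_add (haa.add hab).nice.integrable sk_bb.nice.integrable,
    integral_add haa.nice.integrable hab.nice.integrable,
    integral_cv_one ha.nice ha.nice, integral_cv_one ha.nice sk_phi.nice,
    integral_cv_one sk_phi.nice sk_phi.nice, integral_dil, integral_phi]
  norm_num

lemma integral_pip : ∫ t, pip t = 0 := by
  rw [pip, integral_cv_one sk_ppi.nice sk_vpt.nice, integral_ppi, zero_mul]

lemma dil_one_Om_sub (t : ℝ) : dil 1 Om t - Om t = cv vpi 1 vpt t := by
  have ha := (sk_phi.dil 1).nice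
  have hb := sk_phi.nice
  have haa := ha.cv ha (1 : ℝ)
  have hab := ha.cv hb (1 : ℝ)
  have hba := hb.cv ha (1 : ℝ)
  have hbb := hb.cv hb (1 : ℝ)
  have h1 : dil 1 Om t = 3 * cv 𝔞 1 𝔞 t - 2 * cv 𝔞 1 (cv 𝔞 1 𝔞) t := by
    rw [← dil_cv, ← dil_cv]
    simp only [dil, Om]
    ring
  have hc : cv 𝔟 1 𝔞 = cv 𝔞 1 𝔟 := cv_one_comm _ _
  have h2 : cv 𝔟 1 (cv 𝔞 1 𝔞) = cv 𝔞 1 (cv 𝔞 1 𝔟) := by rw [cv_comm hb ha ha, hc]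
  have h3 : cv 𝔟 1 (cv 𝔞 1 𝔟) = cv 𝔞 1 (cv 𝔟 1 𝔟) := by rw [cv_comm hb ha hb]
  have e : ∀ {κ : ℝ → ℝ}, Nice κ → cv κ 1 vpt t = 3 * (cv κ 1 𝔞 t + cv κ 1 𝔟 t) -
      2 * (cv κ 1 (cv 𝔞 1 𝔞) t + cv κ 1 (cv 𝔞 1 𝔟) t + cv κ 1 (cv 𝔟 1 𝔟) t) := by
    intro κ hκ
    unfold vpt
    rw [cv_sub hκ ((ha.add hb).const_mul 3) (((haa.add hab).add hbb).const_mul 2), cv_const_mul,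
      cv_const_mul, cv_add hκ ha hb, cv_add hκ (haa.add hab) hbb, cv_add hκ haa hab]
  have h4 : cv vpi 1 vpt t = cv 𝔞 1 vpt t - cv 𝔟 1 vpt t := by
    unfold vpi
    exact cv_sub_left ha hb sk_vpt.nice 1 t
  rw [h4, e ha, e hb, h1, Om, h2, h3, hc]
  ring

lemma deriv_pip : deriv pip = fun t => dil 1 Om t - Om t := by
  funext t
  rw [dil_one_Om_sub, pip, deriv_cv' sk_ppi sk_vpt.nice, deriv_ppi]

/-- The second factor of the derivative of `Om`. -/
def omt (t : ℝ) : ℝ := 3 * 𝔟 t - 2 * cv 𝔟 1 𝔟 t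

lemma sk_omt : SK omt := (sk_phi.const_mul 3).sub (sk_bb.const_mul 2)

lemma deriv_Om : deriv Om = cv omt 1 (deriv phi) := by
  have hb := sk_phi.nice
  have hd := sk_phi.deriv.nice
  funext t
  have h1 : HasDerivAt (cv 𝔟 1 𝔟) (cv (deriv 𝔟) 1 𝔟 t) t := by
    have := sk_bb.hasDerivAt t
    rwa [deriv_cv' sk_phi hb] at this
  have h2 : HasDerivAt (cv 𝔟 1 (cv 𝔟 1 𝔟)) (cv (deriv 𝔟) 1 (cv 𝔟 1 𝔟) t) t := by
    have := (sk_phi.cv sk_bb).hasDerivAt t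
    rwa [deriv_cv' sk_phi sk_bb.nice] at this
  have h3 := (h1.const_mul 3).sub (h2.const_mul 2)
  have h4 : deriv Om t = _ := h3.deriv
  rw [h4, cv_one_comm omt]
  unfold omt
  rw [cv_sub hd (hb.const_mul 3) (sk_bb.nice.const_mul 2), cv_const_mul, cv_const_mul]

/-- The coordinate directions and the direction of slope `2^(-k)`. -/
abbrev ex : ℝ² := (1, 0)

/-- The vertical direction. -/
abbrev ey : ℝ² := (0, 1)

/-- The direction of slope `2^(-k)`. -/
def ek (k : ℤ) : ℝ² := (1, (2 : ℝ) ^ (-k))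

lemma ek_eq (k : ℤ) : ek k = ex + (2 : ℝ) ^ (-k) • ey := by simp [ek]

lemma sl_ek (k : ℤ) : Sl (ek k) := sl_one _

/-- The strong maximal function. -/
def MS (F : ℝ² → ℝ≥0∞) : ℝ² → ℝ≥0∞ := MM ex (MM ey F)

lemma enorm_cv_le_of_ball (h : Bd κ B r) (hM : ∀ s, |s| ≤ r → ‖f (q - s • e)‖ₑ ≤ M) :
    ‖cv κ e f q‖ₑ ≤ ofReal (2 * B) * M := by
  have hr := h.pos
  have h1 : ∀ t, ‖κ t * f (q - t • e)‖ₑ ≤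
      (Icc (-r) r).indicator (fun _ => ofReal (B / r) * M) t := by
    intro t
    by_cases ht : |t| ≤ r
    · rw [indicator_of_mem (Set.mem_Icc.2 (abs_le.1 ht)), enorm_mul]
      refine mul_le_mul' ?_ (hM t ht)
      rw [enorm_eq_ofReal_abs]
      exact ofReal_le_ofReal (h.le t)
    · rw [h.supp t (not_le.1 ht)]
      simp
  refine (enorm_integral_le_lintegral_enorm _).trans ((lintegral_mono h1).trans (Eq.le ?_))
  rw [lintegral_indicator measurableSet_Icc, setLIntegral_const, volume_Icc, mul_right_comm,
    ← ofReal_mul (div_nonneg h.nonneg hr.le)]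
  congr 2
  field_simp
  ring

lemma slope_shift {c₁ c₂ : ℝ} (hc₁ : 0 < c₁) (hc₂ : 0 < c₂) (hρ : 0 ≤ ρ) (hnm : n ≤ m)
    (h₁ : Bd κ₁ B₁ (c₁ * (2 : ℝ) ^ (-n)))
    (h₂ : Bd κ₂ B₂ (c₂ * (2 : ℝ) ^ (-(k + n))))
    (hF : ∀ q, ‖f q‖ₑ ≤ F q) (hs : |s| ≤ ρ * (2 : ℝ) ^ (-m)) (q : ℝ²) :
    ‖cv κ₁ ex (cv κ₂ ey f) (q - s • ek k)‖ₑ ≤ ofReal (2 * (1 + (ρ / c₁ + ρ / c₂)) * B₁) *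
      ofReal (2 * (1 + (ρ / c₁ + ρ / c₂)) * B₂) * MS F q := by
  have h2 : (2 : ℝ) ^ (-m) ≤ (2 : ℝ) ^ (-n) := zpow_le_zpow_right₀ (by norm_num) (by omega)
  have hq : q - s • ek k = q - s • ex - (s * (2 : ℝ) ^ (-k)) • ey := by
    rw [ek_eq, smul_add, smul_smul, sub_add_eq_sub_sub]
  have hk : (0 : ℝ) < (2 : ℝ) ^ (-k) := by positivity
  have hn : (0 : ℝ) < (2 : ℝ) ^ (-n) := by positivity
  have hs' : |s| ≤ ρ * (2 : ℝ) ^ (-n) := hs.trans (mul_le_mul_of_nonneg_left h2 hρ)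
  rw [hq]
  refine enorm_cv_cv_shift_le h₁ h₂ ex ey hF (τ := ρ / c₁ + ρ / c₂) ?_ ?_ q
  · calc |s| ≤ ρ * (2 : ℝ) ^ (-n) := hs'
      _ = (ρ / c₁) * (c₁ * (2 : ℝ) ^ (-n)) := by field_simp
      _ ≤ _ := by
        gcongr
        exact le_add_of_nonneg_right (by positivity)
  · rw [abs_mul, abs_of_pos hk, neg_add, zpow_add₀ (by norm_num : (2 : ℝ) ≠ 0)]
    calc |s| * (2 : ℝ) ^ (-k) ≤ ρ * (2 : ℝ) ^ (-n) * (2 : ℝ) ^ (-k) := by gcongr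
      _ = (ρ / c₂) * (c₂ * ((2 : ℝ) ^ (-k) * (2 : ℝ) ^ (-n))) := by field_simp
      _ ≤ _ := by
        gcongr
        exact le_add_of_nonneg_left (by positivity)

/-- A product of two convolutions at scales `n` and `k + n`. -/
def bx (u w : ℝ → ℝ) (k n : ℤ) (f : ℝ² → ℝ) : ℝ² → ℝ :=
  cv (dil n u) ex (cv (dil (k + n) w) ey f)

lemma Nice.bx {u : ℝ → ℝ} (hu : Nice u) (hw : Nice w) (k n : ℤ) (hf : Nice f) :
    Nice (bx u w k n f) := (hu.dil n).cv ((hw.dil (k + n)).cv hf _) _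

/-- Single-scale operators are bounded by the strong maximal function, stably under shifts. -/
lemma bx_shift {u : ℝ → ℝ} (hu : Nice u) (hw : Nice w) (hρ : 0 ≤ ρ) : ∃ C : ℝ≥0,
    ∀ (k n m : ℤ), n ≤ m → ∀ (f : ℝ² → ℝ) (F : ℝ² → ℝ≥0∞), (∀ q, ‖f q‖ₑ ≤ F q) →
    ∀ (s : ℝ), |s| ≤ ρ * (2 : ℝ) ^ (-m) → ∀ q, ‖bx u w k n f (q - s • ek k)‖ₑ ≤ C * MS F q := by
  obtain ⟨B₁, r₁, h₁⟩ := hu.bd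
  obtain ⟨B₂, r₂, h₂⟩ := hw.bd
  refine ⟨(2 * (1 + (ρ / r₁ + ρ / r₂)) * B₁).toNNReal * (2 * (1 + (ρ / r₁ + ρ / r₂)) * B₂).toNNReal,
    fun k n m hnm f F hF s hs q => ?_⟩
  rw [coe_mul]
  exact slope_shift h₁.pos h₂.pos hρ hnm (h₁.dil n) (h₂.dil (k + n)) hF hs q

lemma bx_bx {u u' w' : ℝ → ℝ} (hu : Nice u) (hw : Nice w) (hu' : Nice u') (hw' : Nice w')
    (hf : Nice f) :
    bx u w k m (bx u' w' k n f) = cv (cv (dil m u) 1 (dil n u')) ex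
      (cv (cv (dil (k + m) w) 1 (dil (k + n) w')) ey f) := by
  have h1 := (hw'.dil (k + n)).cv hf ey
  rw [bx, bx, cv_comm (hw.dil _) (hu'.dil _) h1, cv_cv (hu.dil m) (hu'.dil n)
    (((hw.dil _).cv (hw'.dil _) (1 : ℝ)).cv hf ey), cv_cv (hw.dil _) (hw'.dil _) hf]

lemma ofReal_mul_geo (hA : 0 ≤ A) (h : n ≤ m) :
    ofReal (A * (2 : ℝ) ^ (n - m)) = A.toNNReal * geo (n - m) := by
  have := two_zpow_le_geo_ofReal (C := A / 2) (by positivity) h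
  rw [← mul_assoc, mul_div_cancel₀ _ (two_ne_zero)] at this
  exact this

lemma geo_le_one (n : ℤ) : geo n ≤ 1 := pow_le_one' (by simp) _

/-- Comparison of a fine mollification of a coarse single-scale operator. -/
lemma bx_sub_shift {u : ℝ → ℝ} (hΩ : Nice Ω) (hΩ1 : ∫ t, Ω t = 1) (hu : LK u) (hw : LK w)
    (hρ : 0 ≤ ρ) : ∃ C : ℝ≥0, ∀ (k n m : ℤ), n ≤ m → ∀ (f : ℝ² → ℝ), Nice f →
    ∀ (F : ℝ² → ℝ≥0∞), (∀ q, ‖f q‖ₑ ≤ F q) →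
    ∀ (s : ℝ), |s| ≤ ρ * (2 : ℝ) ^ (-m) → ∀ q,
    ‖bx Ω Ω k m (bx u w k n f) (q - s • ek k) - bx u w k n f (q - s • ek k)‖ₑ ≤
      C * geo (n - m) * MS F q := by
  obtain ⟨B₁, r₁, h₁⟩ := hu.nice.bd
  obtain ⟨B₂, r₂, h₂⟩ := hw.nice.bd
  obtain ⟨A₁, c₁, hA₁, hc₁, h₁'⟩ := cv_dil_dil_bound hΩ hu
  obtain ⟨A₂, c₂, hA₂, hc₂, h₂'⟩ := cv_dil_dil_bound hΩ hw
  simp only [hΩ1, one_mul] at h₁' h₂'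
  set a₁ := 2 * (1 + (ρ / c₁ + ρ / r₂)) with ha₁
  set a₂ := 2 * (1 + (ρ / r₁ + ρ / c₂)) with ha₂
  set a₃ := 2 * (1 + (ρ / c₁ + ρ / c₂)) with ha₃
  have hr₁ := h₁.pos
  have hr₂ := h₂.pos
  have hB₁ := h₁.nonneg
  have hB₂ := h₂.nonneg
  have p₁ : 0 ≤ a₁ := by positivity
  have p₂ : 0 ≤ a₂ := by positivity
  have p₃ : 0 ≤ a₃ := by positivity
  refine ⟨(a₁ * A₁).toNNReal * (a₁ * B₂).toNNReal + (a₂ * B₁).toNNReal * (a₂ * A₂).toNNReal +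
    (a₃ * A₁).toNNReal * (a₃ * A₂).toNNReal, fun k n m hnm f hf F hF s hs q => ?_⟩
  have hd₁ := h₁' m n hnm
  have hd₂ := h₂' (k + m) (k + n) (by omega)
  set x := q - s • ek k with hx
  set U := dil n u with hU
  set W := dil (k + n) w with hW
  set U' := fun t => cv (dil m Ω) 1 (dil n u) t - dil n u t with hU'
  set W' := fun t => cv (dil (k + m) Ω) 1 (dil (k + n) w) t - dil (k + n) w t with hW'
  have nU : Nice U := hu.nice.dil n
  have nW : Nice W := hw.nice.dil _
  have nU2 : Nice (cv (dil m Ω) 1 (dil n u)) := (hΩ.dil m).cv nU _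
  have nW2 : Nice (cv (dil (k + m) Ω) 1 (dil (k + n) w)) := (hΩ.dil _).cv nW _
  have nU' : Nice U' := nU2.sub nU
  have nW' : Nice W' := nW2.sub nW
  have e1 : cv (cv (dil (k + m) Ω) 1 (dil (k + n) w)) ey f =
      fun q => cv W ey f q + cv W' ey f q := by
    funext q
    rw [hW', cv_sub_left nW2 nW hf]
    ring
  have e2 : cv U' ex (cv W ey f) x + cv U ex (cv W' ey f) x + cv U' ex (cv W' ey f) x =
      bx Ω Ω k m (bx u w k n f) x - bx u w k n f x := by
    rw [bx_bx hΩ hΩ hu.nice hw.nice hf, e1, cv_add nU2 (nW.cv hf _) (nW'.cv hf _), hU',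
      cv_sub_left nU2 nU (nW.cv hf _), cv_sub_left nU2 nU (nW'.cv hf _), bx]
    ring
  rw [← e2]
  have t1 := slope_shift hc₁ hr₂ hρ hnm hd₁ (h₂.dil (k + n)) hF hs q
  have t2 := slope_shift hr₁ hc₂ hρ hnm (h₁.dil n) hd₂ hF hs q
  have t3 := slope_shift hc₁ hc₂ hρ hnm hd₁ hd₂ hF hs q
  have hkk : k + n - (k + m) = n - m := by ring
  rw [hkk] at t2 t3
  rw [← ha₁, ← mul_assoc, ofReal_mul_geo (by positivity) hnm] at t1
  rw [← ha₂, ← mul_assoc a₂ A₂, ofReal_mul_geo (by positivity) hnm] at t2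
  rw [← ha₃, ← mul_assoc a₃ A₁, ← mul_assoc a₃ A₂, ofReal_mul_geo (by positivity) hnm,
    ofReal_mul_geo (by positivity) hnm] at t3
  refine (enorm_add_le _ _).trans ((add_le_add ((enorm_add_le _ _).trans
    (add_le_add t1 t2)) t3).trans ?_)
  have hg : geo (n - m) * geo (n - m) ≤ geo (n - m) := by
    simpa using mul_le_mul_right (geo_le_one (n - m)) (geo (n - m))
  calc _ = ((a₁ * A₁).toNNReal * (a₁ * B₂).toNNReal) * geo (n - m) * MS F q +
        ((a₂ * B₁).toNNReal * (a₂ * A₂).toNNReal) * geo (n - m) * MS F q +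
        ((a₃ * A₁).toNNReal * (a₃ * A₂).toNNReal) * (geo (n - m) * geo (n - m)) * MS F q := by
        simp only [ofReal]; ring
    _ ≤ ((a₁ * A₁).toNNReal * (a₁ * B₂).toNNReal) * geo (n - m) * MS F q +
        ((a₂ * B₁).toNNReal * (a₂ * A₂).toNNReal) * geo (n - m) * MS F q +
        ((a₃ * A₁).toNNReal * (a₃ * A₂).toNNReal) * geo (n - m) * MS F q := by gcongr
    _ = _ := by push_cast; ring

/-- A coarse mollification of a fine single-scale operator is small. -/
lemma bx_bx_shift {u : ℝ → ℝ} (hΩ : LK Ω) (hu : Nice u) (hw : Nice w) (hu0 : ∫ t, u t = 0)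
    (hw0 : ∫ t, w t = 0) (hρ : 0 ≤ ρ) : ∃ C : ℝ≥0, ∀ (k n m : ℤ), m ≤ n →
    ∀ (f : ℝ² → ℝ), Nice f → ∀ (F : ℝ² → ℝ≥0∞), (∀ q, ‖f q‖ₑ ≤ F q) →
    ∀ (s : ℝ), |s| ≤ ρ * (2 : ℝ) ^ (-m) → ∀ q,
    ‖bx Ω Ω k m (bx u w k n f) (q - s • ek k)‖ₑ ≤ C * geo (n - m) * MS F q := by
  obtain ⟨A₁, c₁, hA₁, hc₁, h₁⟩ := cv_dil_dil_bound hu hΩ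
  obtain ⟨A₂, c₂, hA₂, hc₂, h₂⟩ := cv_dil_dil_bound hw hΩ
  simp only [hu0, hw0, zero_mul, sub_zero] at h₁ h₂
  set a := 2 * (1 + (ρ / c₁ + ρ / c₂)) with ha
  have p : 0 ≤ a := by positivity
  refine ⟨(a * A₁).toNNReal * (a * A₂).toNNReal, fun k n m hnm f hf F hF s hs q => ?_⟩
  have hd₁ := h₁ n m hnm
  have hd₂ := h₂ (k + n) (k + m) (by omega)
  have hkk : k + m - (k + n) = m - n := by ring
  rw [hkk] at hd₂
  have t := slope_shift hc₁ hc₂ hρ le_rfl hd₁ hd₂ hF hs q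
  rw [← ha, ← mul_assoc a A₁, ← mul_assoc a A₂, ofReal_mul_geo (by positivity) hnm,
    ofReal_mul_geo (by positivity) hnm, ← geo_neg, neg_sub] at t
  have hg : geo (n - m) * geo (n - m) ≤ geo (n - m) := by
    simpa using mul_le_mul_right (geo_le_one (n - m)) (geo (n - m))
  have e1 : cv (dil m Ω) (1 : ℝ) (dil n u) = cv (dil n u) 1 (dil m Ω) := by
    exact cv_one_comm _ _
  have e2 : cv (dil (k + m) Ω) (1 : ℝ) (dil (k + n) w) = cv (dil (k + n) w) 1 (dil (k + m) Ω) := by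
    exact cv_one_comm _ _
  rw [bx_bx hΩ.nice hΩ.nice hu hw hf, e1, e2]
  refine t.trans ?_
  calc _ = ((a * A₁).toNNReal * (a * A₂).toNNReal) * (geo (n - m) * geo (n - m)) * MS F q := by ring
    _ ≤ ((a * A₁).toNNReal * (a * A₂).toNNReal) * geo (n - m) * MS F q := by gcongr
    _ = _ := by push_cast; ring

lemma bx_sum {u : ℝ → ℝ} (hu : Nice u) (hw : Nice w) (k n : ℤ) (T : Finset ℤ)
    {f : ℤ → ℝ² → ℝ} (hf : ∀ i, Nice (f i)) (q : ℝ²) :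
    bx u w k n (fun q => ∑ i ∈ T, f i q) q = ∑ i ∈ T, bx u w k n (f i) q := by
  have h : cv (dil (k + n) w) ey (fun q => ∑ i ∈ T, f i q) =
      fun q => ∑ i ∈ T, cv (dil (k + n) w) ey (f i) q :=
    funext fun q => cv_sum T (hw.dil _) (fun i _ => hf i) ey q
  rw [bx, h, cv_sum T (hu.dil n) (fun i _ => (hw.dil _).cv (hf i) ey)]
  rfl

/-- The tail of a sum of single-scale operators, compared with the full sum. -/
lemma tail_shift {u : ℝ → ℝ} (hu : LK u) (hw : LK w) (hu0 : ∫ t, u t = 0) (hw0 : ∫ t, w t = 0)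
    (hρ : 0 ≤ ρ) : ∃ C : ℝ≥0, ∀ (k m : ℤ) (T : Finset ℤ) (f : ℝ² → ℝ), Nice f →
    ∀ (s : ℝ), |s| ≤ ρ * (2 : ℝ) ^ (-m) → ∀ q,
    ‖∑ n ∈ T with m ≤ n, bx u w k n f (q - s • ek k) - Pk u w T k f (q - s • ek k)‖ₑ ≤
      C * (MS (en (Pk u w T k f)) q + MS (en f) q) := by
  obtain ⟨C₁, h₁⟩ := bx_shift sk_Om.nice sk_Om.nice hρ
  obtain ⟨C₂, h₂⟩ := bx_sub_shift sk_Om.nice integral_Om hu hw hρ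
  obtain ⟨C₃, h₃⟩ := bx_bx_shift sk_Om.lk hu.nice hw.nice hu0 hw0 hρ
  refine ⟨C₁ + (C₂ * 4 + C₃ * 4), fun k m T f hf s hs q => ?_⟩
  set x := q - s • ek k with hx
  have hU : ∀ n, Nice (bx u w k n f) := fun n => hu.nice.bx hw.nice k n hf
  have hP : Nice (Pk u w T k f) := hu.nice.pk hw.nice T k hf
  have e1 : bx Om Om k m (Pk u w T k f) x = ∑ n ∈ T, bx Om Om k m (bx u w k n f) x :=
    bx_sum sk_Om.nice sk_Om.nice k m T hU x
  have e2 : Pk u w T k f x = ∑ n ∈ T, bx u w k n f x := rfl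
  have e3 : ∑ n ∈ T with m ≤ n, bx u w k n f x - Pk u w T k f x =
      - bx Om Om k m (Pk u w T k f) x +
      (∑ n ∈ T with ¬ m ≤ n, (bx Om Om k m (bx u w k n f) x - bx u w k n f x) +
      ∑ n ∈ T with m ≤ n, bx Om Om k m (bx u w k n f) x) := by
    rw [e1, e2, ← Finset.sum_filter_add_sum_filter_not T (fun n => m ≤ n) (fun n => bx u w k n f x),
      ← Finset.sum_filter_add_sum_filter_not T (fun n => m ≤ n)
        (fun n => bx Om Om k m (bx u w k n f) x), sum_sub_distrib]
    ring
  have b1 : ‖- bx Om Om k m (Pk u w T k f) x‖ₑ ≤ C₁ * MS (en (Pk u w T k f)) q := by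
    rw [enorm_neg]
    exact h₁ k m m le_rfl _ (en (Pk u w T k f)) (fun _ => le_rfl) s hs q
  have b2 : ‖∑ n ∈ T with ¬ m ≤ n, (bx Om Om k m (bx u w k n f) x - bx u w k n f x)‖ₑ ≤
      C₂ * 4 * MS (en f) q := by
    refine (enorm_sum_le _ _).trans ?_
    calc _ ≤ ∑ n ∈ T with ¬ m ≤ n, C₂ * geo (n - m) * MS (en f) q :=
          sum_le_sum fun n hn => h₂ k n m (by
            have := (mem_filter.1 hn).2; omega) f hf (en f) (fun _ => le_rfl) s hs q
      _ = C₂ * (∑ n ∈ T with ¬ m ≤ n, geo (n - m)) * MS (en f) q := by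
          rw [mul_sum, sum_mul]
      _ ≤ _ := by gcongr; exact geo_sum_le' _ _
  have b3 : ‖∑ n ∈ T with m ≤ n, bx Om Om k m (bx u w k n f) x‖ₑ ≤
      C₃ * 4 * MS (en f) q := by
    refine (enorm_sum_le _ _).trans ?_
    calc _ ≤ ∑ n ∈ T with m ≤ n, C₃ * geo (n - m) * MS (en f) q :=
          sum_le_sum fun n hn => h₃ k n m (mem_filter.1 hn).2 f hf (en f)
            (fun _ => le_rfl) s hs q
      _ = C₃ * (∑ n ∈ T with m ≤ n, geo (n - m)) * MS (en f) q := by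
          rw [mul_sum, sum_mul]
      _ ≤ _ := by gcongr; exact geo_sum_le' _ _
  rw [e3]
  refine (enorm_add_le _ _).trans ((add_le_add b1 ((enorm_add_le _ _).trans
    (add_le_add b2 b3))).trans ?_)
  set P := MS (en (Pk u w T k f)) q
  set F := MS (en f) q
  push_cast
  calc (C₁ : ℝ≥0∞) * P + (C₂ * 4 * F + C₃ * 4 * F) = C₁ * P + (C₂ * 4 + C₃ * 4) * F := by ring
    _ ≤ (C₁ + (C₂ * 4 + C₃ * 4)) * P + (C₁ + (C₂ * 4 + C₃ * 4)) * F := by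
      exact add_le_add (mul_le_mul_left le_self_add _) (mul_le_mul_left le_add_self _)
    _ = _ := by ring

/-- Directional mollification of the tail of a sum of single-scale operators. -/
lemma cv_tail {u : ℝ → ℝ} (ha : Nice a) (hu : LK u) (hw : LK w) (hu0 : ∫ t, u t = 0)
    (hw0 : ∫ t, w t = 0) (d : ℕ) : ∃ C : ℝ≥0, ∀ (k l : ℤ) (T : Finset ℤ) (f : ℝ² → ℝ), Nice f →
    ∀ q, ‖cv (dil l a) (ek k) (fun q => ∑ n ∈ T with l + d ≤ n, bx u w k n f q) q‖ₑ ≤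
      C * (MM (ek k) (en (Pk u w T k f)) q + (MS (en (Pk u w T k f)) q + MS (en f) q)) := by
  obtain ⟨B, r, hB⟩ := ha.bd
  have hr := hB.pos
  obtain ⟨C, h⟩ := tail_shift hu hw hu0 hw0 (ρ := r * 2 ^ d) (by positivity)
  refine ⟨(2 * B).toNNReal + (2 * B).toNNReal * C, fun k l T f hf q => ?_⟩
  have hP : Nice (Pk u w T k f) := hu.nice.pk hw.nice T k hf
  have hV : Nice (fun q => ∑ n ∈ T with l + d ≤ n, bx u w k n f q) :=
    Nice.sum _ fun n _ => hu.nice.bx hw.nice k n hf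
  have e1 : (fun q => ∑ n ∈ T with l + d ≤ n, bx u w k n f q) =
      fun q => Pk u w T k f q + (∑ n ∈ T with l + d ≤ n, bx u w k n f q - Pk u w T k f q) := by
    funext q; ring
  rw [e1, cv_add (ha.dil l) hP (hV.sub hP)]
  have b1 := enorm_cv_le_MM (hB.dil l) (ek k) (f := Pk u w T k f) (F := en (Pk u w T k f))
    (fun _ => le_rfl) q
  have b2 := enorm_cv_le_of_ball (hB.dil l) (e := ek k) (q := q)
    (f := fun q => ∑ n ∈ T with l + d ≤ n, bx u w k n f q - Pk u w T k f q)
    (M := C * (MS (en (Pk u w T k f)) q + MS (en f) q)) (fun s hs => h k (l + d) T f hf s (by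
      refine hs.trans (Eq.le ?_)
      rw [neg_add, zpow_add₀ (by norm_num : (2 : ℝ) ≠ 0), zpow_neg _ (d : ℤ), zpow_natCast]
      field_simp) q)
  refine (enorm_add_le _ _).trans ((add_le_add b1 b2).trans ?_)
  set P := MS (en (Pk u w T k f)) q
  set F := MS (en f) q
  set M := MM (ek k) (en (Pk u w T k f)) q
  change ((2 * B).toNNReal : ℝ≥0∞) * M + ((2 * B).toNNReal : ℝ≥0∞) * (C * (P + F)) ≤ _
  push_cast
  rw [← mul_assoc, mul_add _ M]
  exact add_le_add (mul_le_mul_left le_self_add _) (mul_le_mul_left le_add_self _)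

/-- Directional mollification of a coarse single-scale operator. -/
lemma cv_bx {u : ℝ → ℝ} (ha : Nice a) (hu : Nice u) (hw : Nice w) (d : ℕ) : ∃ C : ℝ≥0,
    ∀ (k l : ℤ) (f : ℝ² → ℝ) (q : ℝ²),
      ‖cv (dil l a) (ek k) (bx u w k (l + d) f) q‖ₑ ≤ C * MS (en f) q := by
  obtain ⟨B, r, hB⟩ := ha.bd
  have hr := hB.pos
  obtain ⟨C, h⟩ := bx_shift hu hw (ρ := r * 2 ^ d) (by positivity)
  refine ⟨(2 * B).toNNReal * C, fun k l f q => ?_⟩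
  have b2 := enorm_cv_le_of_ball (hB.dil l) (e := ek k) (q := q)
    (f := bx u w k (l + d) f) (M := C * MS (en f) q)
    (fun s hs => h k (l + d) (l + d) le_rfl f (en f) (fun _ => le_rfl) s (by
      refine hs.trans (Eq.le ?_)
      rw [neg_add, zpow_add₀ (by norm_num : (2 : ℝ) ≠ 0), zpow_neg _ (d : ℤ), zpow_natCast]
      field_simp) q)
  refine b2.trans (Eq.le ?_)
  push_cast
  rw [mul_assoc]
  rfl

/-- Directional mollification of a single-scale operator, without loss in the scales. -/
lemma cv_bx_le_MM {u : ℝ → ℝ} (ha : Nice a) (hu : Nice u) (hw : Nice w) : ∃ C : ℝ≥0,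
    ∀ (k l n : ℤ) (f : ℝ² → ℝ) (q : ℝ²),
      ‖cv (dil l a) (ek k) (bx u w k n f) q‖ₑ ≤ C * MM (ek k) (MS (en f)) q := by
  obtain ⟨B, r, hB⟩ := ha.bd
  obtain ⟨C, h⟩ := bx_shift hu hw (ρ := 0) le_rfl
  refine ⟨(2 * B).toNNReal * C, fun k l n f q => ?_⟩
  have h0 : ∀ q, ‖bx u w k n f q‖ₑ ≤ C * MS (en f) q := fun q => by
    simpa using h k n n le_rfl f (en f) (fun _ => le_rfl) 0 (by simp) q
  refine (enorm_cv_le_MM (hB.dil l) (ek k) h0 q).trans (Eq.le ?_)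
  rw [MM_const_mul _ coe_ne_top]
  push_cast
  rw [mul_assoc]
  rfl

lemma sum_Ico_telescope (g : ℤ → ℝ) {N : ℤ} (h : m ≤ N) :
    ∑ n ∈ Ico m N, (g (n + 1) - g n) = g N - g m := by
  induction N, h using Int.leInduction with
  | base => simp
  | succ N h ih =>
    have : Ico m (N + 1) = insert N (Ico m N) := by
      ext x; simp only [mem_Ico, mem_insert]; omega
    rw [this, sum_insert (by simp), ih]
    ring

lemma bx_succ_sub (k n : ℤ) (hf : Nice f) (q : ℝ²) :
    bx Om Om k (n + 1) f q - bx Om Om k n f q =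
      bx (deriv pip) (dil 1 Om) k n f q + bx Om (deriv pip) k n f q := by
  have hO := sk_Om.nice
  have h1 : ∀ j, dil j (deriv pip) = fun t => dil j (dil 1 Om) t - dil j Om t := by
    intro j
    rw [deriv_pip]
    funext t
    simp only [dil]
    ring
  have h2 : dil (n + 1) Om = dil n (dil 1 Om) := (dil_dil n 1 Om).symm
  have h3 : dil (k + (n + 1)) Om = dil (k + n) (dil 1 Om) := by
    rw [dil_dil]; congr 1; ring
  have h4 : cv (dil (k + n) (deriv pip)) ey f =
      fun q => cv (dil (k + n) (dil 1 Om)) ey f q - cv (dil (k + n) Om) ey f q := by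
    funext q
    rw [h1, cv_sub_left ((hO.dil 1).dil _) (hO.dil _) hf]
  simp only [bx]
  rw [h2, h3, h4, cv_sub (hO.dil n) (((hO.dil 1).dil _).cv hf _) ((hO.dil _).cv hf _), h1,
    cv_sub_left ((hO.dil 1).dil _) (hO.dil _) (((hO.dil 1).dil _).cv hf _)]
  ring

lemma bx_parts {u : ℝ → ℝ} (ha : SK a) (hu : SK u) (hw : SK w) (k l n : ℤ)
    (hf : Nice f) (q : ℝ²) :
    cv (dil l a) (ek k) (bx (deriv u) w k n f) q + cv (dil l a) (ek k) (bx u (deriv w) k n f) q =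
      (2 : ℝ) ^ (l - n) * cv (dil l (deriv a)) (ek k) (bx u w k n f) q := by
  have h := cv_deriv_by_parts (ha.dil l) (hu.dil n) (hw.dil (k + n)) ((2 : ℝ) ^ (-k)) hf ex ey q
  rw [← ek_eq, deriv_dil ha, deriv_dil hu, deriv_dil hw] at h
  have e1 : cv (fun t => (2 : ℝ) ^ n * dil n (deriv u) t) ex (cv (dil (k + n) w) ey f) =
      fun q => (2 : ℝ) ^ n * bx (deriv u) w k n f q := funext fun q => cv_const_mul_left _ _ _ _ _
  have e2 : cv (fun t => (2 : ℝ) ^ (k + n) * dil (k + n) (deriv w) t) ey f =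
      fun q => (2 : ℝ) ^ (k + n) * cv (dil (k + n) (deriv w)) ey f q :=
    funext fun q => cv_const_mul_left _ _ _ _ _
  have e3 : cv (dil n u) ex (fun q => (2 : ℝ) ^ (k + n) * cv (dil (k + n) (deriv w)) ey f q) =
      fun q => (2 : ℝ) ^ (k + n) * bx u (deriv w) k n f q := funext fun q => cv_const_mul _ _ _ _ _
  rw [cv_const_mul_left, e1, e2, e3, cv_const_mul, cv_const_mul] at h
  have h2 : (2 : ℝ) ≠ 0 := by norm_num
  have h3 : (2 : ℝ) ^ n ≠ 0 := by positivity
  change (2 : ℝ) ^ l * cv (dil l (deriv a)) (ek k) (bx u w k n f) q = _ at h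
  rw [zpow_sub₀ h2, div_mul_eq_mul_div, h, eq_div_iff h3, zpow_add₀ h2, zpow_neg]
  field_simp

/-- The vertical kernel of the second paraproduct. -/
def Omd : ℝ → ℝ := deriv (dil 1 Om)

lemma sk_Omd : SK Omd := (sk_Om.dil 1).deriv

lemma tail_parts {u : ℝ → ℝ} (ha : SK a) (hu : SK u) (hw : SK w) : ∃ C : ℝ≥0,
    ∀ (k l : ℤ) (d : ℕ) (N : ℤ) (f : ℝ² → ℝ), Nice f → ∀ q,
    ‖∑ n ∈ Ico (l + d) N, (2 : ℝ) ^ (l - n) * cv (dil l (deriv a)) (ek k) (bx u w k n f) q‖ₑ ≤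
      C * 2⁻¹ ^ d * MM (ek k) (MS (en f)) q := by
  obtain ⟨C, h⟩ := cv_bx_le_MM ha.deriv.nice hu.nice hw.nice
  refine ⟨C * 4, fun k l d N f hf q => (enorm_sum_le _ _).trans ?_⟩
  set X := MM (ek k) (MS (en f)) q
  calc _ ≤ ∑ n ∈ Ico (l + d) N, 2⁻¹ ^ d * geo (l + d - n) * (C * X) := by
        refine sum_le_sum fun n hn => ?_
        rw [enorm_mul]
        refine mul_le_mul' (Eq.le ?_) (h k l n f q)
        have hn' := (mem_Ico.1 hn).1
        have h1 := ofReal_mul_geo (zero_le_one) hn'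
        rw [one_mul, toNNReal_one, coe_one, one_mul] at h1
        have h2 : (2 : ℝ) ^ (l - n) = (2 : ℝ)⁻¹ ^ d * (2 : ℝ) ^ (l + d - n) := by
          rw [inv_pow, ← zpow_natCast, ← zpow_neg, ← zpow_add₀ (by norm_num : (2 : ℝ) ≠ 0)]
          congr 1; ring
        rw [enorm_of_nonneg (by positivity), h2, ofReal_mul (by positivity), h1,
          ofReal_pow (by norm_num), ofReal_inv_of_pos (by norm_num)]
        simp
    _ = C * 2⁻¹ ^ d * (∑ n ∈ Ico (l + d) N, geo (l + d - n)) * X := by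
        rw [← sum_mul, ← mul_sum]; ring
    _ ≤ C * 2⁻¹ ^ d * 4 * X := by gcongr; exact geo_sum_le _ _
    _ = _ := by push_cast; ring

/-- The two paraproducts controlling the maximal functions along `ek k`. -/
def PP (T : Finset ℤ) (k : ℤ) (f : ℝ² → ℝ) (q : ℝ²) : ℝ≥0∞ :=
  MM (ek k) (en (Pk (deriv Om) pip T k f)) q + MS (en (Pk (deriv Om) pip T k f)) q +
    (MM (ek k) (en (Pk pip Omd T k f)) q + MS (en (Pk pip Omd T k f)) q)

lemma integral_deriv_Om : ∫ t, deriv Om t = 0 := sk_Om.integral_deriv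
lemma integral_Omd : ∫ t, Omd t = 0 := (sk_Om.dil 1).integral_deriv

/-- Pointwise control of single averages in the direction `ek k`. -/
lemma cv_pointwise (ha : SK a) : ∃ C₀ : ℝ≥0, ∀ d : ℕ, ∃ C₁ : ℝ≥0,
    ∀ (k l m N : ℤ), m ≤ l + d → l + d ≤ N → ∀ (f : ℝ² → ℝ), Nice f → ∀ q,
    ‖cv (dil l a) (ek k) f q‖ₑ ≤ C₀ * 2⁻¹ ^ d * MM (ek k) (MS (en f)) q +
      (C₁ * (MS (en f) q + PP (Ico m N) k f q) +
      C₀ * MM (ek k) (en fun q => f q - bx Om Om k N f q) q) := by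
  have hO := sk_Om
  obtain ⟨E₁, hE₁⟩ := tail_parts ha sk_pip (sk_Om.dil 1)
  obtain ⟨E₂, hE₂⟩ := tail_parts ha sk_Om sk_pip
  obtain ⟨B, r, hB⟩ := ha.nice.bd
  refine ⟨E₁ + E₂ + (2 * B).toNNReal, fun d => ?_⟩
  obtain ⟨D₀, h₀⟩ := cv_bx ha.nice sk_Om.nice sk_Om.nice d
  obtain ⟨D₁, h₁⟩ := cv_tail ha.nice sk_Om.deriv.lk sk_pip.lk integral_deriv_Om integral_pip d
  obtain ⟨D₂, h₂⟩ := cv_tail ha.nice sk_pip.lk sk_Omd.lk integral_pip integral_Omd d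
  refine ⟨D₀ + D₁ + D₂, fun k l m N hm hN f hf q => ?_⟩
  have hT : (Ico m N).filter (fun n => l + d ≤ n) = Ico (l + d) N := by
    ext x; simp only [mem_Ico, mem_filter]; omega
  have hU : ∀ {u w : ℝ → ℝ}, SK u → SK w → ∀ n, Nice (bx u w k n f) :=
    fun hu hw n => hu.nice.bx hw.nice k n hf
  set V := cv (dil l a) (ek k)
  set Z : (ℝ → ℝ) → (ℝ → ℝ) → ℝ² → ℝ := fun u w q => ∑ n ∈ Ico (l + d) N, bx u w k n f q
  have hZ : ∀ {u w : ℝ → ℝ}, SK u → SK w → Nice (Z u w) :=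
    fun hu hw => Nice.sum _ fun n _ => hU hu hw n
  have hA := ha.nice.dil l
  have hcs : ∀ {u w : ℝ → ℝ}, SK u → SK w →
      V (Z u w) q = ∑ n ∈ Ico (l + d) N, V (bx u w k n f) q :=
    fun hu hw => cv_sum _ hA (fun n _ => hU hu hw n) _ _
  have e0 : f = fun q => bx Om Om k (l + d) f q +
      (Z (deriv pip) (dil 1 Om) q + Z Om (deriv pip) q + (f q - bx Om Om k N f q)) := by
    funext q
    rw [← sum_add_distrib]
    simp only [← bx_succ_sub k _ hf q]
    rw [sum_Ico_telescope (fun n => bx Om Om k n f q) hN]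
    ring
  have n1 := hZ sk_pip.deriv (hO.dil 1)
  have n2 := hZ hO sk_pip.deriv
  have n3 : Nice fun q => f q - bx Om Om k N f q := hf.sub (hU hO hO N)
  have e1 : V f q = V (bx Om Om k (l + d) f) q + (V (Z (deriv pip) (dil 1 Om)) q +
      V (Z Om (deriv pip)) q + V (fun q => f q - bx Om Om k N f q) q) := by
    conv_lhs => rw [e0]
    simp only [V]
    rw [cv_add hA (hU hO hO _) ((n1.add n2).add n3), cv_add hA (n1.add n2) n3, cv_add hA n1 n2]
  have e2 : V (Z (deriv pip) (dil 1 Om)) q = ∑ n ∈ Ico (l + d) N, (2 : ℝ) ^ (l - n) *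
      cv (dil l (deriv a)) (ek k) (bx pip (dil 1 Om) k n f) q - V (Z pip Omd) q := by
    rw [hcs sk_pip.deriv (hO.dil 1), hcs sk_pip sk_Omd, ← sum_sub_distrib]
    refine sum_congr rfl fun n _ => ?_
    rw [← bx_parts ha sk_pip (hO.dil 1) k l n hf q, Omd]
    ring
  have e3 : V (Z Om (deriv pip)) q = ∑ n ∈ Ico (l + d) N, (2 : ℝ) ^ (l - n) *
      cv (dil l (deriv a)) (ek k) (bx Om pip k n f) q - V (Z (deriv Om) pip) q := by
    rw [hcs hO sk_pip.deriv, hcs hO.deriv sk_pip, ← sum_sub_distrib]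
    refine sum_congr rfl fun n _ => ?_
    rw [← bx_parts ha hO sk_pip k l n hf q]
    ring
  have b0 := h₀ k l f q
  have b1 := h₁ k l (Ico m N) f hf q
  have b2 := h₂ k l (Ico m N) f hf q
  rw [hT] at b1 b2
  have c1 := hE₁ k l d N f hf q
  have c2 := hE₂ k l d N f hf q
  have b3 := enorm_cv_le_MM (hB.dil l) (ek k) (f := fun q => f q - bx Om Om k N f q)
    (F := en fun q => f q - bx Om Om k N f q) (fun _ => le_rfl) q
  rw [e1, e2, e3]
  have tri : ∀ x y z v w u : ℝ, ‖x + (y - z + (v - w) + u)‖ₑ ≤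
      ‖y‖ₑ + ‖v‖ₑ + (‖x‖ₑ + ‖z‖ₑ + ‖w‖ₑ + ‖u‖ₑ) := by
    intro x y z v w u
    refine (enorm_add_le _ _).trans ((add_le_add_right ((enorm_add_le _ _).trans (add_le_add_left
      ((enorm_add_le _ _).trans (add_le_add enorm_sub_le enorm_sub_le)) _)) _).trans
      (le_of_eq (by ring)))
  refine (tri _ _ _ _ _ _).trans ((add_le_add (add_le_add c1 c2) (add_le_add (add_le_add
    (add_le_add b0 b2) b1) b3)).trans ?_)
  rw [PP]
  set X := MM (ek k) (MS (en f)) q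
  set F := MS (en f) q
  set P₁ := MS (en (Pk (deriv Om) pip (Ico m N) k f)) q
  set P₂ := MS (en (Pk pip Omd (Ico m N) k f)) q
  set M₁ := MM (ek k) (en (Pk (deriv Om) pip (Ico m N) k f)) q
  set M₂ := MM (ek k) (en (Pk pip Omd (Ico m N) k f)) q
  set R := MM (ek k) (en fun q => f q - bx Om Om k N f q) q
  change E₁ * 2⁻¹ ^ d * X + E₂ * 2⁻¹ ^ d * X + (D₀ * F + D₂ * (M₂ + (P₂ + F)) +
    D₁ * (M₁ + (P₁ + F)) + ((2 * B).toNNReal : ℝ≥0∞) * R) ≤ _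
  generalize (2 * B).toNNReal = B'
  push_cast
  have g1 : (E₁ : ℝ≥0∞) * 2⁻¹ ^ d * X + E₂ * 2⁻¹ ^ d * X ≤ (E₁ + E₂ + B') * 2⁻¹ ^ d * X := by
    rw [← add_mul, ← add_mul]
    exact mul_le_mul_left (mul_le_mul_left le_self_add _) _
  have g2 : (D₀ : ℝ≥0∞) * F + D₂ * (M₂ + (P₂ + F)) + D₁ * (M₁ + (P₁ + F)) ≤
      (D₀ + D₁ + D₂) * (F + (M₁ + P₁ + (M₂ + P₂))) := by
    have k1 : M₂ + (P₂ + F) ≤ F + (M₁ + P₁ + (M₂ + P₂)) := by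
      rw [← add_assoc, add_comm]
      exact add_le_add_right le_add_self _
    have k2 : M₁ + (P₁ + F) ≤ F + (M₁ + P₁ + (M₂ + P₂)) := by
      rw [← add_assoc, add_comm]
      exact add_le_add_right le_self_add _
    rw [add_mul, add_mul, add_right_comm]
    gcongr
    exact le_self_add
  have g3 : (B' : ℝ≥0∞) * R ≤ (E₁ + E₂ + B') * R := mul_le_mul_left le_add_self _
  exact add_le_add g1 (add_le_add g2 g3)

lemma nrm_le_of_iSup {X : Type*} [MeasureSpace X] (hp : 0 < p) {F : ℕ → X → ℝ≥0∞}
    (hF : ∀ n, Measurable (F n)) (hm : ∀ q, Monotone fun n => F n q) {G : X → ℝ≥0∞}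
    (hG : ∀ q, G q ≤ ⨆ n, F n q) (h : ∀ n, nrm p (F n) ≤ K) : nrm p G ≤ K := by
  have h1 : ∫⁻ q, G q ^ p ≤ K ^ p := by
    calc ∫⁻ q, G q ^ p ≤ ∫⁻ q, ⨆ n, F n q ^ p := by
          refine lintegral_mono fun q => ?_
          have := (ENNReal.orderIsoRpow p hp).map_iSup fun n => F n q
          simp only [ENNReal.orderIsoRpow_apply] at this
          rw [← this]
          exact rpow_le_rpow (hG q) hp.le
      _ = ⨆ n, ∫⁻ q, F n q ^ p := lintegral_iSup (fun n => (hF n).pow_const p)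
          fun m n hmn q => rpow_le_rpow (hm q hmn) hp.le
      _ ≤ _ := iSup_le fun n => by
          rw [← nrm_rpow hp]
          exact rpow_le_rpow (h n) hp.le
  rw [nrm, one_div, ENNReal.rpow_inv_le_iff hp]
  exact h1

lemma tendsto_nrm_sub_cv (hκ : Nice κ) (h1 : ∫ t, κ t = 1)
    (hf : Continuous f) (hfs : HasCompactSupport f) (hp : 0 < p) (e : ℝ²) :
    Tendsto (fun n : ℤ => nrm p (en fun q => f q - cv (dil n κ) e f q)) atTop (nhds 0) := by
  have hn : Nice f := Nice.of_cc hf hfs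
  obtain ⟨M, hM0, hM⟩ := hn.bdd
  obtain ⟨R, hR0, hR⟩ := hn.supp
  obtain ⟨r, hr0, hr⟩ := hκ.supp
  set A := ∫ t, |κ t| with hA
  have hA0 : 0 ≤ A := integral_nonneg fun t => abs_nonneg _
  have hb : ∀ (n : ℤ) q, |cv (dil n κ) e f q| ≤ A * M := by
    intro n q
    rw [cv_dil, hA, ← integral_mul_const]
    refine (abs_integral_le_integral_abs).trans (integral_mono_of_nonneg
      (.of_forall fun t => abs_nonneg _) (hκ.abs.integrable.mul_const M)
      (.of_forall fun t => ?_))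
    simp only [abs_mul]
    exact mul_le_mul_of_nonneg_left (hM _) (abs_nonneg _)
  have hs : ∀ n : ℤ, 0 ≤ n → ∀ q, R + r * ‖e‖ < ‖q‖ → cv (dil n κ) e f q = 0 := by
    intro n hn q hq
    rw [cv_dil]
    refine integral_eq_zero_of_ae (.of_forall fun t => ?_)
    by_cases ht : r < ‖t‖
    · simp [hr t ht]
    · change κ t * f _ = 0
      rw [hR _ ?_, mul_zero]
      have h2 : ‖((2 : ℝ) ^ (-n) * t) • e‖ ≤ r * ‖e‖ := by
        rw [norm_smul, norm_mul, Real.norm_of_nonneg (by positivity : (0 : ℝ) ≤ (2 : ℝ) ^ (-n))]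
        have h3 : (2 : ℝ) ^ (-n) ≤ 1 := zpow_le_one_of_nonpos₀ (by norm_num) (by omega)
        gcongr
        calc _ ≤ 1 * ‖t‖ := by gcongr
          _ ≤ r := by rw [one_mul]; exact not_lt.1 ht
      have := norm_sub_norm_le q (((2 : ℝ) ^ (-n) * t) • e)
      linarith
  have hpt : ∀ q, Tendsto (fun n : ℤ => cv (dil n κ) e f q) atTop (nhds (f q)) := by
    intro q
    simp only [cv_dil]
    have e1 : f q = ∫ t, κ t * f q := by rw [integral_mul_const, h1, one_mul]
    rw [e1]
    refine tendsto_integral_filter_of_dominated_convergence (fun t => |κ t| * M)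
      (.of_forall fun n => ?_) (.of_forall fun n => .of_forall
        fun t => ?_) (hκ.abs.integrable.mul_const M) (.of_forall fun t => ?_)
    · exact (hκ.meas.mul (hf.measurable.comp (by fun_prop))).aestronglyMeasurable
    · rw [norm_eq_abs, abs_mul]
      exact mul_le_mul_of_nonneg_left (hM _) (abs_nonneg _)
    · refine Tendsto.const_mul _ ?_
      have h0 : Tendsto (fun n : ℤ => (2 : ℝ) ^ (-n)) atTop (nhds 0) := by
        have hz := (tendsto_rpow_atTop_of_base_lt_one (2⁻¹ : ℝ) (by norm_num)
          (by norm_num)).comp tendsto_intCast_atTop_atTop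
        simpa [Function.comp_def, Real.rpow_intCast] using hz
      have h2 := ((h0.mul_const t).smul_const e).const_sub q
      rw [zero_mul, zero_smul, sub_zero] at h2
      exact (hf.tendsto q).comp h2
  have hlin : Tendsto (fun n : ℤ => ∫⁻ q, (en fun q => f q - cv (dil n κ) e f q) q ^ p) atTop
      (nhds (∫⁻ _ : ℝ², 0)) := by
    refine tendsto_lintegral_filter_of_dominated_convergence
      ((closedBall (0 : ℝ²) (R + r * ‖e‖)).indicator fun _ =>
        ofReal (M + A * M) ^ p) ?_ ?_ ?_ ?_
    · exact .of_forall fun n =>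
        (Nice.en_meas (hn.sub ((hκ.dil n).cv hn e))).pow_const p
    · filter_upwards [eventually_ge_atTop 0] with n hn0
      refine .of_forall fun q => ?_
      by_cases hq : q ∈ closedBall (0 : ℝ²) (R + r * ‖e‖)
      · rw [indicator_of_mem hq, en, enorm_eq_ofReal_abs]
        refine rpow_le_rpow (ofReal_le_ofReal ?_) hp.le
        exact (abs_sub _ _).trans (add_le_add (hM q) (hb n q))
      · rw [indicator_of_notMem hq, en]
        rw [mem_closedBall_zero_iff, not_le] at hq
        rw [hs n hn0 q hq, hR q (lt_of_le_of_lt (le_add_of_nonneg_right (by positivity)) hq)]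
        simp [hp]
    · rw [lintegral_indicator measurableSet_closedBall, setLIntegral_const]
      exact mul_ne_top (rpow_ne_top_of_nonneg hp.le ofReal_ne_top)
        (isCompact_closedBall _ _).measure_lt_top.ne
    · refine .of_forall fun q => ?_
      have h2 := (hpt q).const_sub (f q)
      rw [sub_self] at h2
      have h3 := (ENNReal.continuous_rpow_const (y := p)).tendsto _ |>.comp
        ((continuous_enorm.tendsto _).comp h2)
      simpa [hp, Function.comp_def, en] using h3
  have h4 := (ENNReal.continuous_rpow_const (y := 1 / p)).tendsto _ |>.comp hlin
  simpa [hp, Function.comp_def, nrm] using h4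

lemma tendsto_nrm_sub_bx (hf : Continuous f) (hfs : HasCompactSupport f)
    (hp : 1 < p) (k : ℤ) :
    Tendsto (fun n : ℤ => nrm p (en fun q => f q - bx Om Om k n f q)) atTop (nhds 0) := by
  have hO := sk_Om.nice
  have hn : Nice f := Nice.of_cc hf hfs
  obtain ⟨C, hC⟩ := mb_single hp
  obtain ⟨B, r, hB⟩ := hO.bd
  have hp0 : 0 < p := by linarith
  have t1 := tendsto_nrm_sub_cv hO integral_Om hf hfs hp0 ex
  have t2 := (tendsto_nrm_sub_cv hO integral_Om hf hfs hp0 ey).comp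
    (tendsto_atTop_add_const_left atTop k tendsto_id)
  have t3 := t1.add (ENNReal.Tendsto.const_mul (a := ((2 * B).toNNReal * C : ℝ≥0)) t2
    (Or.inr coe_ne_top))
  rw [mul_zero, add_zero] at t3
  refine tendsto_of_tendsto_of_tendsto_of_le_of_le tendsto_const_nhds t3 (fun n => zero_le) fun n => ?_
  have n1 : Nice (fun q => f q - cv (dil (k + n) Om) ey f q) := hn.sub ((hO.dil _).cv hn _)
  have h1 : ∀ q, en (fun q => f q - bx Om Om k n f q) q ≤
      en (fun q => f q - cv (dil n Om) ex f q) q +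
        ((2 * B).toNNReal : ℝ≥0∞) * MM ex (en fun q => f q - cv (dil (k + n) Om) ey f q) q := by
    intro q
    have e1 : f q - bx Om Om k n f q = (f q - cv (dil n Om) ex f q) +
        cv (dil n Om) ex (fun q => f q - cv (dil (k + n) Om) ey f q) q := by
      rw [cv_sub (hO.dil n) hn ((hO.dil _).cv hn _), bx]
      ring
    rw [en, e1]
    exact (enorm_add_le _ _).trans (add_le_add_right (enorm_cv_le_MM (hB.dil n) ex
      (fun _ => le_rfl) q) _)
  calc _ ≤ nrm p (fun q => en (fun q => f q - cv (dil n Om) ex f q) q +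
        ((2 * B).toNNReal : ℝ≥0∞) * MM ex (en fun q => f q - cv (dil (k + n) Om) ey f q) q) :=
        nrm_mono hp0 h1
    _ ≤ nrm p (en (fun q => f q - cv (dil n Om) ex f q)) + nrm p (fun q =>
        ((2 * B).toNNReal : ℝ≥0∞) * MM ex (en fun q => f q - cv (dil (k + n) Om) ey f q) q) :=
        nrm_add_le hp.le (Nice.en_meas (hn.sub ((hO.dil _).cv hn _)))
          ((meas_MM n1.en_meas ex).const_mul _)
    _ ≤ _ := by
        rw [nrm_const_mul hp0]
        refine add_le_add_right ?_ _
        push_cast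
        rw [mul_assoc]
        exact mul_le_mul_right (hC ex (sl_one 0) _ n1.en_meas) _

/-- Vector-valued inequality for the full maximal function over a family of directions. -/
def VS (p : ℝ) (D : Finset ℝ²) (C : ℝ≥0) : Prop :=
  ∀ (ι : Type) (s : Finset ι) (F : ι → ℝ² → ℝ≥0∞), (∀ i, BM (F i)) →
    nrm p (vsq s fun i => MD D (F i)) ≤ C * nrm p (vsq s F)

lemma VS.vv (hp : 0 < p) (h : VS p D C) : VV p D C :=
  fun ι s e F he hF => (nrm_mono hp (vsq_mono (F := fun i => MM (e i) (F i))
    (G := fun i => MD D (F i)) fun i _ q => MM_le_MD (he i) _ q)).trans (h ι s F hF)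

lemma VS.mb (h : VS p D C) : MB p D C := fun F hF => by
  have := h Unit {()} (fun _ => F) (fun _ => hF)
  have e1 : ∀ G : ℝ² → ℝ≥0∞, vsq {()} (fun _ : Unit => G) = G :=
    fun G => funext fun q => vsq_singleton () (fun _ => G) q
  rwa [e1, e1] at this

lemma VS.mono (h : VS p D C) (hC : C ≤ C') : VS p D C' :=
  fun ι s F hF => (h ι s F hF).trans (mul_le_mul_left (by exact_mod_cast hC) _)

lemma MM_add_le_dir {G : ℝ² → ℝ≥0∞} (hF : Measurable F) (q : ℝ²) :
    MM e (fun q => F q + G q) q ≤ MM e F q + MM e G q := by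
  refine iSup_le fun l => ?_
  have h : Measurable fun t : ℝ => F (q - t • e) := hF.comp (by fun_prop)
  rw [av, lintegral_add_left h, mul_add]
  exact add_le_add (le_iSup (fun l : ℤ => av ((2 : ℝ) ^ l) e F q) l)
    (le_iSup (fun l : ℤ => av ((2 : ℝ) ^ l) e G q) l)

lemma MD_le_sum (D : Finset ℝ²) (F : ℝ² → ℝ≥0∞) (q : ℝ²) :
    MD D F q ≤ ∑ e ∈ D, MM e F q :=
  iSup₂_le fun e he => single_le_sum (f := fun e => MM e F q) (fun _ _ => zero_le) he

lemma MD_mono {G : ℝ² → ℝ≥0∞} (h : ∀ q, F q ≤ G q) (q : ℝ²) :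
    MD D F q ≤ MD D G q := iSup₂_mono fun e _ => MM_mono h e q

lemma MD_add_le (D : Finset ℝ²) {G : ℝ² → ℝ≥0∞} (hF : Measurable F) (q : ℝ²) :
    MD D (fun q => F q + G q) q ≤ MD D F q + MD D G q :=
  iSup₂_le fun e he => (MM_add_le_dir hF q).trans (add_le_add (MM_le_MD he F q) (MM_le_MD he G q))

lemma nrm_MD_le (hp : 1 < p) : ∃ C : ℝ≥0, ∀ D : Finset ℝ², (∀ e ∈ D, Sl e) →
    ∀ F, Measurable F → nrm p (MD D F) ≤ (D.card * C : ℝ≥0) * nrm p F := by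
  obtain ⟨C, hC⟩ := mb_single hp
  refine ⟨C, fun D hD F hF => ?_⟩
  calc nrm p (MD D F) ≤ nrm p (fun q => ∑ e ∈ D, MM e F q) :=
        nrm_mono (by linarith) (MD_le_sum D F)
    _ ≤ ∑ e ∈ D, nrm p (MM e F) := nrm_sum_le hp.le (fun e => meas_MM hF e) D
    _ ≤ ∑ e ∈ D, C * nrm p F := sum_le_sum fun e he => hC e (hD e he) F hF
    _ = _ := by simp [mul_assoc]

lemma vs_exists (hp : 1 < p) (D : Finset ℝ²) (hD : ∀ e ∈ D, Sl e) :
    ∃ C, VS p D C := by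
  obtain ⟨C, hC⟩ := vv_single hp
  refine ⟨D.card * C, fun ι s F hF => ?_⟩
  calc nrm p (vsq s fun i => MD D (F i))
      ≤ nrm p (fun q => ∑ e ∈ D, vsq s (fun i => MM e (F i)) q) :=
        nrm_mono (by linarith) fun q => (vsq_mono (F := fun i => MD D (F i))
          (G := fun i q => ∑ e ∈ D, MM e (F i) q) (fun i _ q => MD_le_sum D (F i) q) q).trans
          (vsq_sum_le s D (fun e i => MM e (F i)) q)
    _ ≤ ∑ e ∈ D, nrm p (vsq s fun i => MM e (F i)) :=
        nrm_sum_le hp.le (fun e => meas_vsq (fun i => meas_MM (hF i).meas e) s) D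
    _ ≤ ∑ e ∈ D, C * nrm p (vsq s F) := sum_le_sum fun e he =>
        hC e (hD e he) ι s (fun _ => e) F (fun _ => Finset.mem_singleton_self e) hF
    _ = _ := by simp [mul_assoc]

lemma nrm_eq_eLpNorm (hp : 0 < p) (f : ℝ² → ℝ) :
    nrm p (en f) = eLpNorm f (ofReal p) volume := by
  rw [eLpNorm_eq_lintegral_rpow_enorm_toReal (by simpa using hp) ofReal_ne_top,
    toReal_ofReal hp.le]
  rfl

lemma exists_cc_approx (hp : 1 < p) (hF : BM F) (hn : nrm p F < ⊤)
    {δ : ℝ≥0∞} (hδ : δ ≠ 0) : ∃ f g : ℝ² → ℝ, Continuous f ∧ HasCompactSupport f ∧ (∀ q, 0 ≤ f q) ∧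
      Measurable g ∧ (∀ q, F q ≤ en f q + en g q) ∧ (∀ q, en f q ≤ F q + en g q) ∧
      nrm p (en g) ≤ δ := by
  have hp0 : 0 < p := by linarith
  set r : ℝ² → ℝ := fun q => (F q).toReal with hr
  have er : en r = F := by
    funext q
    rw [en, enorm_of_nonneg toReal_nonneg, ENNReal.ofReal_toReal (hF.lt_top q).ne]
  have hrm : Measurable r := hF.meas.ennreal_toReal
  have hL : MemLp r (ofReal p) volume :=
    ⟨hrm.aestronglyMeasurable, by rw [← nrm_eq_eLpNorm hp0, er]; exact hn⟩
  obtain ⟨g, hgs, hg, hgc, -⟩ := hL.exists_hasCompactSupport_eLpNorm_sub_le ofReal_ne_top hδ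
  refine ⟨fun q => |g q|, fun q => r q - |g q|, hgc.abs, hgs.comp_left (g := fun x : ℝ => |x|) abs_zero,
    fun q => abs_nonneg _, hrm.sub hgc.abs.measurable, fun q => ?_, fun q => ?_, ?_⟩
  · rw [← er]
    refine le_trans (Eq.le ?_) (enorm_add_le _ _)
    rw [en]; congr 1; ring
  · rw [← er]
    refine le_trans (Eq.le ?_) (enorm_sub_le)
    rw [en]; congr 1; ring
  · rw [← nrm_eq_eLpNorm hp0] at hg
    refine (nrm_mono hp0 fun q => ?_).trans hg
    rw [en, en, enorm_eq_ofReal_abs, enorm_eq_ofReal_abs]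
    refine ofReal_le_ofReal ?_
    have h0 : 0 ≤ r q := toReal_nonneg
    have := abs_abs_sub_abs_le (r q) (g q)
    rw [abs_of_nonneg h0] at this
    exact this

/-- It suffices to prove the vector-valued inequality for continuous functions. -/
lemma nrm_vsq_le_add {ι : Type} {s : Finset ι} {F G H : ι → ℝ² → ℝ≥0∞} (hp : 1 < p)
    (hG : ∀ i, Measurable (G i)) (hH : ∀ i, Measurable (H i))
    (h : ∀ i ∈ s, ∀ q, F i q ≤ G i q + H i q) (hK : ∀ i ∈ s, nrm p (H i) ≤ K) :
    nrm p (vsq s F) ≤ nrm p (vsq s G) + s.card * K := by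
  have hp0 : 0 < p := by linarith
  calc _ ≤ nrm p (fun q => vsq s G q + ∑ i ∈ s, H i q) := nrm_mono hp0 fun q =>
        (vsq_mono h q).trans ((vsq_add_le s G H q).trans (add_le_add_right (vsq_le_sum s H q) _))
    _ ≤ nrm p (vsq s G) + nrm p (fun q => ∑ i ∈ s, H i q) :=
        nrm_add_le hp.le (meas_vsq hG s) (measurable_sum s fun i _ => hH i)
    _ ≤ nrm p (vsq s G) + ∑ i ∈ s, K := add_le_add_right
        ((nrm_sum_le hp.le hH s).trans (sum_le_sum hK)) _
    _ = _ := by simp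

lemma vs_of_cc (hp : 1 < p) (hD : ∀ e ∈ D, Sl e)
    (hC : 1 ≤ C) (h : ∀ (ι : Type) (s : Finset ι) (f : ι → ℝ² → ℝ), (∀ i, Continuous (f i)) →
      (∀ i, HasCompactSupport (f i)) → (∀ i q, 0 ≤ f i q) →
      nrm p (vsq s fun i => MD D (en (f i))) ≤ C * nrm p (vsq s fun i => en (f i))) :
    VS p D C := by
  classical
  have hp0 : 0 < p := by linarith
  obtain ⟨A, hA⟩ := nrm_MD_le hp
  intro ι s F hF
  by_cases hn : nrm p (vsq s F) = ⊤
  · rw [hn, mul_top (by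
      have : (0 : ℝ≥0) < C := lt_of_lt_of_le one_pos hC
      exact_mod_cast this.ne')]
    exact le_top
  have hfin : ∀ i ∈ s, nrm p (F i) < ⊤ := fun i hi =>
    (nrm_mono hp0 (le_vsq hi F)).trans_lt (lt_top_iff_ne_top.2 hn)
  set K : ℝ≥0 := C * s.card + s.card * (D.card * A) with hK
  refine ENNReal.le_of_forall_pos_le_add fun ε hε _ => ?_
  set δ : ℝ≥0 := ε / (K + 1) with hδ
  have hδ0 : (δ : ℝ≥0∞) ≠ 0 := by
    have : δ ≠ 0 := (div_pos hε (by positivity)).ne'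
    exact_mod_cast this
  have hex : ∀ i, ∃ f g : ℝ² → ℝ, Continuous f ∧ HasCompactSupport f ∧ (∀ q, 0 ≤ f q) ∧
      Measurable g ∧ (i ∈ s → (∀ q, F i q ≤ en f q + en g q) ∧ (∀ q, en f q ≤ F i q + en g q) ∧
      nrm p (en g) ≤ δ) := by
    intro i
    by_cases hi : i ∈ s
    · obtain ⟨f, g, h1, h2, h3, h4, h5⟩ := exists_cc_approx hp (hF i) (hfin i hi) hδ0
      exact ⟨f, g, h1, h2, h3, h4, fun _ => h5⟩
    · exact ⟨fun _ => 0, fun _ => 0, continuous_const, HasCompactSupport.zero, fun _ => le_rfl,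
        measurable_const, fun h => absurd h hi⟩
  choose f g h1 h2 h3 h4 h5 using hex
  have hfm : ∀ i, Measurable (en (f i)) := fun i => (h1 i).measurable.enorm
  have hgm : ∀ i, Measurable (en (g i)) := fun i => (h4 i).enorm
  have b1 : nrm p (vsq s fun i => en (f i)) ≤ nrm p (vsq s F) + s.card * δ :=
    nrm_vsq_le_add hp (fun i => (hF i).meas) hgm (fun i hi => (h5 i hi).2.1) fun i hi => (h5 i hi).2.2
  have b2 : nrm p (vsq s fun i => MD D (F i)) ≤
      nrm p (vsq s fun i => MD D (en (f i))) + s.card * ((D.card * A : ℝ≥0) * δ) :=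
    nrm_vsq_le_add hp (fun i => meas_MD D (hfm i)) (fun i => meas_MD D (hgm i))
      (fun i hi q => (MD_mono (h5 i hi).1 q).trans (MD_add_le D (hfm i) q))
      fun i hi => (hA D hD _ (hgm i)).trans (mul_le_mul_right (h5 i hi).2.2 _)
  have b3 : ((K * δ : ℝ≥0) : ℝ≥0∞) ≤ ε := by
    have : K * δ ≤ ε := by
      rw [hδ, mul_div_assoc', div_le_iff₀ (by positivity), mul_comm]
      gcongr
      exact le_self_add
    exact_mod_cast this
  calc _ ≤ _ := b2
    _ ≤ C * (nrm p (vsq s F) + s.card * δ) + s.card * ((D.card * A : ℝ≥0) * δ) :=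
        add_le_add_left ((h ι s f h1 h2 h3).trans (mul_le_mul_right b1 _)) _
    _ = C * nrm p (vsq s F) + ((K * δ : ℝ≥0) : ℝ≥0∞) := by rw [hK]; push_cast; ring
    _ ≤ _ := add_le_add_right b3 _

/-! ### The maximal function along the lacunary directions -/

lemma VV.of_mem (hp : 0 < p) (h : VV p D C) {ι : Type}
    (s : Finset ι) (e : ι → ℝ²) (F : ι → ℝ² → ℝ≥0∞) (he : ∀ i ∈ s, e i ∈ D)
    (hF : ∀ i, BM (F i)) : nrm p (vsq s fun i => MM (e i) (F i)) ≤ C * nrm p (vsq s F) := by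
  classical
  rcases s.eq_empty_or_nonempty with rfl | ⟨i₀, hi₀⟩
  · have : (vsq (∅ : Finset ι) fun i => MM (e i) (F i)) = fun _ => 0 := by
      funext q
      simp [vsq]
    rw [this, nrm_zero hp]
    exact zero_le
  have := h ι s (fun i => if e i ∈ D then e i else e i₀) F
    (fun i => by split_ifs with hi; exacts [hi, he i₀ hi₀]) hF
  refine le_trans (nrm_mono hp (vsq_mono (F := fun i => MM (e i) (F i)) fun i hi q => ?_)) this
  rw [if_pos (he i hi)]

lemma vv_ms (hp : 1 < p) : ∃ C : ℝ≥0, ∀ (ι : Type) (s : Finset ι)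
    (F : ι → ℝ² → ℝ≥0∞), (∀ i, BM (F i)) →
    nrm p (vsq s fun i => MS (F i)) ≤ C * nrm p (vsq s F) := by
  obtain ⟨C, hC⟩ := vv_single hp
  refine ⟨C * C, fun ι s F hF => ?_⟩
  calc nrm p (vsq s fun i => MS (F i))
      ≤ C * nrm p (vsq s fun i => MM ey (F i)) :=
        hC ex (sl_one 0) ι s (fun _ => ex) (fun i => MM ey (F i)) (fun _ => by simp)
          fun i => (hF i).MM ey
    _ ≤ C * (C * nrm p (vsq s F)) :=
        mul_le_mul_right (hC ey sl_y ι s (fun _ => ey) F (fun _ => by simp) hF) _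
    _ = (C * C : ℝ≥0) * nrm p (vsq s F) := by push_cast; ring

lemma BM.MS (hF : BM F) : BM (MS F) := (hF.MM ey).MM ex

lemma BM.add {G : ℝ² → ℝ≥0∞} (hF : BM F) (hG : BM G) : BM (fun q => F q + G q) := by
  obtain ⟨B, hB⟩ := hF.bdd
  obtain ⟨B', hB'⟩ := hG.bdd
  exact ⟨hF.meas.add hG.meas, B + B', fun q => by push_cast; exact add_le_add (hB q) (hB' q)⟩

lemma BM.vsq_nrm_add (hp : 1 ≤ p) {ι : Type} {s : Finset ι} {F G : ι → ℝ² → ℝ≥0∞}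
    (hF : ∀ i, Measurable (F i)) (hG : ∀ i, Measurable (G i)) :
    nrm p (LacHilbert.vsq s fun i q => F i q + G i q) ≤
      nrm p (LacHilbert.vsq s F) + nrm p (LacHilbert.vsq s G) :=
  (nrm_mono (by linarith) (vsq_add_le s F G)).trans
    (nrm_add_le hp (meas_vsq hF s) (meas_vsq hG s))

lemma vv_pk (hp : 1 < p) (hα : Nice α) (hγ : Nice γ) (K C : ℝ≥0)
    (hK : ∀ (ι : Type) (s : Finset ι) (f : ι → ℝ² → ℝ) (S T : Finset ℤ), (∀ i, Nice (f i)) →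
      nrm p (vsq (s ×ˢ S) fun x => en (Pk α γ T x.2 (f x.1))) ≤
      K * nrm p (vsq s fun i => en (f i))) :
    ∃ K' : ℝ≥0, ∀ (S : Finset ℤ), VV p (S.image ek) C → ∀ (ι : Type) (s : Finset ι)
      (f : ι → ℝ² → ℝ) (T : Finset ℤ), (∀ i, Nice (f i)) →
      nrm p (vsq (s ×ˢ S) fun x q => MM (ek x.2) (en (Pk α γ T x.2 (f x.1))) q +
        MS (en (Pk α γ T x.2 (f x.1))) q) ≤ K' * nrm p (vsq s fun i => en (f i)) := by
  obtain ⟨M, hM⟩ := vv_ms hp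
  refine ⟨(C + M) * K, fun S hS ι s f T hf => ?_⟩
  have hn : ∀ x : ι × ℤ, BM (en (Pk α γ T x.2 (f x.1))) := fun x =>
    (Nice.pk hα hγ T x.2 (hf x.1)).bm
  have key : ∀ F : ι × ℤ → ℝ² → ℝ≥0∞, (∀ x, BM (F x)) →
      nrm p (vsq (s ×ˢ S) F) ≤ K * nrm p (vsq s fun i => en (f i)) →
      nrm p (vsq (s ×ˢ S) fun x q => MM (ek x.2) (F x) q + MS (F x) q) ≤
        ((C + M) * K : ℝ≥0) * nrm p (vsq s fun i => en (f i)) := by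
    intro F hF h
    have e1 := BM.vsq_nrm_add hp.le (s := s ×ˢ S) (F := fun x => MM (ek x.2) (F x))
      (G := fun x => MS (F x)) (fun x => ((hF x).MM _).meas) fun x => (hF x).MS.meas
    have e2 := hS.of_mem (by linarith) (s ×ˢ S) (fun x => ek x.2) F
          (fun x hx => mem_image_of_mem _ (mem_product.1 hx).2) hF
    have e3 := hM _ (s ×ˢ S) F hF
    refine e1.trans ((add_le_add e2 e3).trans ?_)
    rw [← add_mul]
    refine (mul_le_mul_right h _).trans (Eq.le ?_)
    push_cast
    ring
  exact key (fun x => en (Pk α γ T x.2 (f x.1))) hn (hK ι s f S T hf)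

lemma Omd_eq : Omd = cv (fun t => 2 * dil 1 omt t) 1 (dil 1 (deriv phi)) := by
  funext t
  have h : Omd t = 2 * dil 1 (deriv Om) t := by
    rw [Omd, deriv_dil]
    · norm_num
    · exact sk_Om
  rw [h, deriv_Om, cv_const_mul_left, dil_cv]

lemma vv_pp (hp : 1 < p) (C : ℝ≥0) :
    ∃ K : ℝ≥0, ∀ (S : Finset ℤ), VV p (S.image ek) C → ∀ (ι : Type) (s : Finset ι)
      (f : ι → ℝ² → ℝ) (T : Finset ℤ), (∀ i, Nice (f i)) →
      nrm p (vsq s fun i => vsq S fun k => PP T k (f i)) ≤ K * nrm p (vsq s fun i => en (f i)) := by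
  have i1 : ∫ t, deriv phi t = 0 := sk_phi.integral_deriv
  have i2 : ∫ t, dil 1 (deriv phi) t = 0 := by rw [integral_dil, i1]
  obtain ⟨K₁, h₁⟩ := pk_sq (α₁ := omt) (α₂ := deriv phi) (γ₁ := ppi) (γ₂ := vpt) sk_omt.lk
    sk_phi.deriv.lk sk_ppi.lk sk_vpt.lk (Or.inr integral_ppi) i1 integral_vpt hp
  obtain ⟨K₂, h₂⟩ := pk_sq (α₁ := ppi) (α₂ := vpt) (γ₁ := fun t => 2 * dil 1 omt t)
    (γ₂ := dil 1 (deriv phi)) sk_ppi.lk sk_vpt.lk ((sk_omt.dil 1).const_mul 2).lk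
    (sk_phi.deriv.dil 1).lk (Or.inl integral_ppi) integral_vpt i2 hp
  rw [← deriv_Om] at h₁
  rw [← Omd_eq] at h₂
  obtain ⟨K₁, h₁⟩ := vv_pk hp sk_Om.deriv.nice sk_pip.nice K₁ C h₁
  obtain ⟨K₂, h₂⟩ := vv_pk hp sk_pip.nice sk_Omd.nice K₂ C h₂
  refine ⟨K₁ + K₂, fun S hS ι s f T hf => ?_⟩
  have e₁ := h₁ S hS ι s f T hf
  have e₂ := h₂ S hS ι s f T hf
  have hn₁ : ∀ x : ι × ℤ, BM (en (Pk (deriv Om) pip T x.2 (f x.1))) := fun x =>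
    (Nice.pk sk_Om.deriv.nice sk_pip.nice T x.2 (hf x.1)).bm
  have hn₂ : ∀ x : ι × ℤ, BM (en (Pk pip Omd T x.2 (f x.1))) := fun x =>
    (Nice.pk sk_pip.nice sk_Omd.nice T x.2 (hf x.1)).bm
  have hv : (vsq s fun i => vsq S fun k => PP T k (f i)) = vsq (s ×ˢ S) fun x => PP T x.2 (f x.1) :=
    funext fun q => (vsq_prod s S (fun x => PP T x.2 (f x.1)) q).symm
  rw [hv]
  have e₃ := BM.vsq_nrm_add hp.le (s := s ×ˢ S)
        (F := fun x q => MM (ek x.2) (en (Pk (deriv Om) pip T x.2 (f x.1))) q +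
          MS (en (Pk (deriv Om) pip T x.2 (f x.1))) q)
        (G := fun x q => MM (ek x.2) (en (Pk pip Omd T x.2 (f x.1))) q +
          MS (en (Pk pip Omd T x.2 (f x.1))) q)
        (fun x => (((hn₁ x).MM _).add (hn₁ x).MS).meas) fun x => (((hn₂ x).MM _).add (hn₂ x).MS).meas
  refine e₃.trans ((add_le_add e₁ e₂).trans (Eq.le ?_))
  push_cast
  ring

lemma exists_sk_ge_one : ∃ a : ℝ → ℝ, SK a ∧ (∀ t, 0 ≤ a t) ∧ ∀ t, |t| ≤ 1 → a t = 1 := by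
  let b : ContDiffBump (0 : ℝ) := ⟨1, 2, by norm_num, by norm_num⟩
  refine ⟨b, ⟨b.contDiff, b.hasCompactSupport⟩, fun t => b.nonneg, fun t ht => ?_⟩
  exact b.one_of_mem_closedBall (by simpa [b] using ht)

lemma av_le_enorm_cv (ha : Nice a) (ha0 : ∀ t, 0 ≤ a t) (ha1 : ∀ t, |t| ≤ 1 → a t = 1)
    (hf : Nice f) (hf0 : ∀ q, 0 ≤ f q) (l : ℤ) (e q : ℝ²) :
    av ((2 : ℝ) ^ l) e (en f) q ≤ ‖cv (dil (-l) a) e f q‖ₑ := by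
  have h0 : ∀ t, 0 ≤ dil (-l) a t * f (q - t • e) := fun t =>
    mul_nonneg (mul_nonneg (by positivity) (ha0 _)) (hf0 _)
  have h2 : (0 : ℝ) < 2 ^ l := by positivity
  have hm : Measurable fun t : ℝ => en f (q - t • e) :=
    hf.en_meas.comp (measurable_const.sub (measurable_id.smul_const e))
  rw [cv, Real.enorm_eq_ofReal (integral_nonneg h0), ofReal_integral_eq_lintegral_ofReal
    ((ha.dil (-l)).cv_integrand hf e q).integrable (.of_forall h0), av,
    ← lintegral_const_mul _ hm]
  refine le_trans ?_ (setLIntegral_le_lintegral (Icc (-(2 : ℝ) ^ l) (2 ^ l)) _)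
  refine setLIntegral_mono' measurableSet_Icc fun t ht => ?_
  have h1 : dil (-l) a t = (2 ^ l)⁻¹ := by
    rw [dil, ha1, mul_one, zpow_neg]
    rw [zpow_neg, abs_mul, abs_inv, abs_of_pos h2, inv_mul_le_iff₀ h2, mul_one]
    exact abs_le.2 ht
  rw [h1, ofReal_mul (by positivity), ofReal_inv_of_pos h2, en,
    Real.enorm_eq_ofReal (hf0 _)]

/-- Truncation of the directional maximal function to finitely many scales. -/
def tMD (S : Finset ℤ) (L : ℕ) (F : ℝ² → ℝ≥0∞) (q : ℝ²) : ℝ≥0∞ :=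
  ⨆ k ∈ S, ⨆ l ∈ Finset.Icc (-(L : ℤ)) L, av ((2 : ℝ) ^ l) (ek k) F q

lemma meas_tMD (S : Finset ℤ) (L : ℕ) (hF : Measurable F) :
    Measurable (tMD S L F) :=
  Measurable.biSup _ (Finset.countable_toSet S) fun k _ =>
    Measurable.biSup _ (Finset.countable_toSet _) fun l _ => meas_av hF _ _

lemma tMD_mono (S : Finset ℤ) (F : ℝ² → ℝ≥0∞) (q : ℝ²) : Monotone fun L => tMD S L F q := by
  intro L L' h
  refine iSup₂_mono fun k _ => biSup_mono fun l hl => ?_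
  simp only [mem_Icc] at hl ⊢
  omega

lemma MD_eq_iSup_tMD (S : Finset ℤ) (F : ℝ² → ℝ≥0∞) (q : ℝ²) :
    MD (S.image ek) F q = ⨆ L, tMD S L F q := by
  apply le_antisymm
  · refine iSup₂_le fun e he => iSup_le fun l => ?_
    obtain ⟨k, hk, rfl⟩ := mem_image.1 he
    refine le_iSup_of_le l.natAbs (le_iSup₂_of_le k hk (le_iSup₂_of_le l ?_ le_rfl))
    simp only [mem_Icc]
    omega
  · refine iSup_le fun L => iSup₂_le fun k hk => iSup₂_le fun l _ => ?_
    exact (le_iSup (fun l : ℤ => av ((2 : ℝ) ^ l) (ek k) F q) l).trans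
      (MM_le_MD (mem_image_of_mem _ hk) F q)

lemma vsq_iSup_le {ι : Type} (s : Finset ι) (F : ℕ → ι → ℝ² → ℝ≥0∞)
    (hm : ∀ i q, Monotone fun n => F n i q) (q : ℝ²) :
    vsq s (fun i q => ⨆ n, F n i q) q ≤ ⨆ n, vsq s (F n) q := by
  have ht : Tendsto (fun n => vsq s (F n) q) atTop (nhds (vsq s (fun i q => ⨆ n, F n i q) q)) := by
    refine (ENNReal.continuous_rpow_const.tendsto _).comp (tendsto_finsetSum s fun i _ => ?_)
    exact ((ENNReal.continuous_pow 2).tendsto _).comp (tendsto_atTop_iSup (hm i q))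
  exact le_of_tendsto' ht fun n => le_iSup (fun n => vsq s (F n) q) n

lemma tMD_le (ha : SK a) (ha0 : ∀ t, 0 ≤ a t) (ha1 : ∀ t, |t| ≤ 1 → a t = 1) :
    ∃ C₀ : ℝ≥0, ∀ d : ℕ, ∃ C₁ : ℝ≥0, ∀ (S : Finset ℤ) (L : ℕ) (N : ℤ), L + d ≤ N →
    ∀ f : ℝ² → ℝ, Nice f → (∀ q, 0 ≤ f q) → ∀ q, tMD S L (en f) q ≤
      C₀ * 2⁻¹ ^ d * MD (S.image ek) (MS (en f)) q +
      (C₁ * (MS (en f) q + vsq S (fun k => PP (Ico (-(L : ℤ)) N) k f) q) +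
      C₀ * ∑ k ∈ S, MM (ek k) (en fun q => f q - bx Om Om k N f q) q) := by
  obtain ⟨C₀, h⟩ := cv_pointwise ha
  refine ⟨C₀, fun d => ?_⟩
  obtain ⟨C₁, h⟩ := h d
  refine ⟨C₁, fun S L N hN f hf hf0 q => iSup₂_le fun k hk => iSup₂_le fun l hl => ?_⟩
  simp only [mem_Icc] at hl
  refine (av_le_enorm_cv ha.nice ha0 ha1 hf hf0 l (ek k) q).trans
    ((h k (-l) (-L) N (by omega) (by omega) f hf q).trans ?_)
  refine add_le_add (mul_le_mul_right (MM_le_MD (mem_image_of_mem _ hk) _ q) _)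
    (add_le_add (mul_le_mul_right (add_le_add le_rfl ?_) _) (mul_le_mul_right ?_ _))
  · exact le_vsq hk (fun k => PP (Ico (-(L : ℤ)) N) k f) q
  · exact single_le_sum (f := fun k => MM (ek k) (en fun q => f q - bx Om Om k N f q) q)
      (fun _ _ => zero_le) hk

lemma nrm_vsq_const_mul (hp : 0 < p) (c : ℝ≥0) {ι : Type} (s : Finset ι)
    (F : ι → ℝ² → ℝ≥0∞) : nrm p (vsq s fun i q => c * F i q) = c * nrm p (vsq s F) := by
  rw [← nrm_const_mul hp]
  exact congrArg _ (funext fun q => vsq_const_mul _ s F q)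

lemma nrm_vsq_le_sum (hp : 1 ≤ p) {ι : Type} (s : Finset ι) {F : ι → ℝ² → ℝ≥0∞}
    (hF : ∀ i, Measurable (F i)) : nrm p (vsq s F) ≤ ∑ i ∈ s, nrm p (F i) :=
  (nrm_mono (by linarith) (vsq_le_sum s F)).trans (nrm_sum_le hp hF s)

lemma tendsto_rem (hp : 1 < p) {ι : Type} (s : Finset ι) {f : ι → ℝ² → ℝ}
    (hf : ∀ i, Continuous (f i)) (hfs : ∀ i, HasCompactSupport (f i)) (S : Finset ℤ) :
    Tendsto (fun N : ℤ => nrm p (vsq s fun i q =>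
      ∑ k ∈ S, MM (ek k) (en fun q => f i q - bx Om Om k N (f i) q) q)) atTop (nhds 0) := by
  obtain ⟨C, hC⟩ := mb_single hp
  have hn : ∀ i, Nice (f i) := fun i => Nice.of_cc (hf i) (hfs i)
  have hm : ∀ (N : ℤ) i k, Nice fun q => f i q - bx Om Om k N (f i) q := fun N i k =>
    (hn i).sub (Nice.bx sk_Om.nice sk_Om.nice k N (hn i))
  have h0 : Tendsto (fun N : ℤ => ∑ i ∈ s, ∑ k ∈ S, (C : ℝ≥0∞) *
      nrm p (en fun q => f i q - bx Om Om k N (f i) q)) atTop (nhds 0) := by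
    have : (0 : ℝ≥0∞) = ∑ i ∈ s, ∑ k ∈ S, (C : ℝ≥0∞) * 0 := by simp
    rw [this]
    exact tendsto_finsetSum _ fun i _ => tendsto_finsetSum _ fun k _ =>
      ENNReal.Tendsto.const_mul (tendsto_nrm_sub_bx (hf i) (hfs i) hp k) (Or.inr coe_ne_top)
  refine tendsto_of_tendsto_of_tendsto_of_le_of_le tendsto_const_nhds h0 (fun _ => zero_le)
    fun N => ?_
  refine (nrm_vsq_le_sum hp.le s (F := fun i q =>
      ∑ k ∈ S, MM (ek k) (en fun q => f i q - bx Om Om k N (f i) q) q) fun i =>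
      Finset.measurable_fun_sum _ fun k _ => meas_MM (hm N i k).en_meas _).trans ?_
  refine sum_le_sum fun i _ => ?_
  refine (nrm_sum_le hp.le
    (F := fun k q => MM (ek k) (en fun q => f i q - bx Om Om k N (f i) q) q)
    (fun k => meas_MM (hm N i k).en_meas _) S).trans (sum_le_sum fun k _ => ?_)
  exact hC _ (sl_ek k) _ (hm N i k).en_meas

lemma meas_PP (T : Finset ℤ) (k : ℤ) (hf : Nice f) : Measurable (PP T k f) := by
  have h1 := (Nice.pk sk_Om.deriv.nice sk_pip.nice T k hf).bm
  have h2 := (Nice.pk sk_pip.nice sk_Omd.nice T k hf).bm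
  exact (((h1.MM _).add h1.MS).add ((h2.MM _).add h2.MS)).meas

lemma nrm_vsq_comb (hp : 1 ≤ p) (a b c : ℝ≥0) {ι : Type} (s : Finset ι)
    {T F₁ F₂ F₃ F₄ : ι → ℝ² → ℝ≥0∞} (h₁ : ∀ i, Measurable (F₁ i)) (h₂ : ∀ i, Measurable (F₂ i))
    (h₃ : ∀ i, Measurable (F₃ i)) (h₄ : ∀ i, Measurable (F₄ i))
    (h : ∀ i q, T i q ≤ a * F₁ i q + (b * (F₂ i q + F₃ i q) + c * F₄ i q)) :
    nrm p (vsq s T) ≤ a * nrm p (vsq s F₁) +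
      (b * (nrm p (vsq s F₂) + nrm p (vsq s F₃)) + c * nrm p (vsq s F₄)) := by
  have hp0 : 0 < p := by linarith
  have hm2 : ∀ i, Measurable fun q => (b : ℝ≥0∞) * (F₂ i q + F₃ i q) := fun i =>
    ((h₂ i).add (h₃ i)).const_mul _
  have hm4 : ∀ i, Measurable fun q => (c : ℝ≥0∞) * F₄ i q := fun i => (h₄ i).const_mul _
  refine (nrm_mono hp0 (vsq_mono (F := T)
    (G := fun i q => a * F₁ i q + (b * (F₂ i q + F₃ i q) + c * F₄ i q)) fun i _ q => h i q)).trans ?_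
  refine (BM.vsq_nrm_add hp (F := fun i q => a * F₁ i q)
    (G := fun i q => b * (F₂ i q + F₃ i q) + c * F₄ i q) (fun i => (h₁ i).const_mul _)
    fun i => (hm2 i).add (hm4 i)).trans ?_
  refine add_le_add (nrm_vsq_const_mul hp0 a s F₁).le ?_
  refine (BM.vsq_nrm_add hp (F := fun i q => b * (F₂ i q + F₃ i q))
    (G := fun i q => c * F₄ i q) hm2 hm4).trans ?_
  refine add_le_add ?_ (nrm_vsq_const_mul hp0 c s F₄).le
  rw [nrm_vsq_const_mul hp0 b s fun i q => F₂ i q + F₃ i q]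
  exact mul_le_mul_right (BM.vsq_nrm_add hp h₂ h₃) _

lemma nrm_tMD_le (hp : 1 < p) (C : ℝ≥0) : ∃ A : ℝ≥0, ∀ S : Finset ℤ,
    VV p (S.image ek) C → ∀ C' : ℝ≥0, VS p (S.image ek) C' → ∃ B : ℝ≥0,
    ∀ (ι : Type) (s : Finset ι) (f : ι → ℝ² → ℝ), (∀ i, Nice (f i)) → (∀ i q, 0 ≤ f i q) →
    ∀ L : ℕ, ∃ N₀ : ℤ, ∀ N ≥ N₀, nrm p (vsq s fun i => tMD S L (en (f i))) ≤
      ((A + 2⁻¹ * C' : ℝ≥0) : ℝ≥0∞) * nrm p (vsq s fun i => en (f i)) +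
      B * nrm p (vsq s fun i q =>
        ∑ k ∈ S, MM (ek k) (en fun q => f i q - bx Om Om k N (f i) q) q) := by
  obtain ⟨a, ha, ha0, ha1⟩ := exists_sk_ge_one
  obtain ⟨C₀, h⟩ := tMD_le ha ha0 ha1
  obtain ⟨M, hM⟩ := vv_ms hp
  obtain ⟨K, hK⟩ := vv_pp hp C
  obtain ⟨d, hd⟩ : ∃ d : ℕ, C₀ * 2⁻¹ ^ d * M ≤ (2⁻¹ : ℝ≥0) := by
    have ht : Tendsto (fun d : ℕ => C₀ * 2⁻¹ ^ d * M) atTop (nhds (C₀ * 0 * M)) :=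
      ((tendsto_pow_atTop_nhds_zero_of_lt_one (by norm_num)
        (by rw [← NNReal.coe_lt_coe]; norm_num)).const_mul C₀).mul_const M
    rw [mul_zero, zero_mul] at ht
    exact (ht.eventually_le_const (by positivity)).exists
  obtain ⟨C₁, h⟩ := h d
  refine ⟨C₁ * (M + K), fun S hS C' hC' => ⟨C₀, fun ι s f hn hf0 L => ⟨L + d, fun N hN => ?_⟩⟩⟩
  have hMS : ∀ i, BM (MS (en (f i))) := fun i => (hn i).bm.MS
  have hm : ∀ i k, Nice fun q => f i q - bx Om Om k N (f i) q := fun i k =>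
    (hn i).sub (Nice.bx sk_Om.nice sk_Om.nice k N (hn i))
  have e0 := nrm_vsq_comb hp.le (C₀ * 2⁻¹ ^ d) C₁ C₀ s (T := fun i => tMD S L (en (f i)))
    (F₁ := fun i => MD (S.image ek) (MS (en (f i)))) (F₂ := fun i => MS (en (f i)))
    (F₃ := fun i => vsq S fun k => PP (Ico (-(L : ℤ)) N) k (f i))
    (F₄ := fun i q => ∑ k ∈ S, MM (ek k) (en fun q => f i q - bx Om Om k N (f i) q) q)
    (fun i => meas_MD _ (hMS i).meas) (fun i => (hMS i).meas)
    (fun i => meas_vsq (fun k => meas_PP _ k (hn i)) S)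
    (fun i => Finset.measurable_fun_sum _ fun k _ => meas_MM (hm i k).en_meas _)
    fun i q => by
      have e : ((C₀ * 2⁻¹ ^ d : ℝ≥0) : ℝ≥0∞) = C₀ * 2⁻¹ ^ d := by
        rw [coe_mul, coe_pow, coe_inv two_ne_zero]
        rfl
      rw [e]
      exact h S L N hN (f i) (hn i) (hf0 i) q
  refine e0.trans ?_
  have e1 := hC' ι s (fun i => MS (en (f i))) hMS
  have e2 := hM ι s (fun i => en (f i)) fun i => (hn i).bm
  have e3 := hK S hS ι s f (Ico (-(L : ℤ)) N) hn
  rw [← add_assoc]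
  refine add_le_add ?_ le_rfl
  generalize nrm p (vsq s fun i => en (f i)) = X at *
  refine (add_le_add (mul_le_mul_right (e1.trans (mul_le_mul_right e2 _)) _)
    (mul_le_mul_right (add_le_add e2 e3) _)).trans ?_
  calc ((C₀ * 2⁻¹ ^ d : ℝ≥0) : ℝ≥0∞) * (C' * (M * X)) + C₁ * (M * X + K * X)
      = ((C₀ * 2⁻¹ ^ d * M * C' + C₁ * (M + K) : ℝ≥0) : ℝ≥0∞) * X := by push_cast; ring
    _ ≤ _ := mul_le_mul_left (coe_le_coe.2 ?_) X
  rw [add_comm]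
  exact add_le_add le_rfl (mul_le_mul_left hd C')

lemma sl_image_ek (S : Finset ℤ) : ∀ e ∈ S.image ek, Sl e := by
  intro e he
  obtain ⟨k, -, rfl⟩ := mem_image.1 he
  exact sl_ek k

lemma vsq_MD_le_iSup (S : Finset ℤ) {ι : Type} (s : Finset ι) (F : ι → ℝ² → ℝ≥0∞) (q : ℝ²) :
    vsq s (fun i => MD (S.image ek) (F i)) q ≤ ⨆ L : ℕ, vsq s (fun i => tMD S L (F i)) q := by
  have e : (fun i => MD (S.image ek) (F i)) = fun i q => ⨆ L, tMD S L (F i) q :=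
    funext fun i => funext fun q => MD_eq_iSup_tMD S _ q
  rw [e]
  exact vsq_iSup_le s (fun L i => tMD S L (F i)) (fun i q => tMD_mono S _ q) q

lemma vsq_tMD_mono (S : Finset ℤ) {ι : Type} (s : Finset ι) (F : ι → ℝ² → ℝ≥0∞) (q : ℝ²) :
    Monotone fun L : ℕ => vsq s (fun i => tMD S L (F i)) q := fun L L' hL => by
  refine rpow_le_rpow (sum_le_sum fun i _ => ?_) (by norm_num)
  exact pow_le_pow_left' (tMD_mono S _ q hL) 2

lemma le_of_tendsto_rem {a b : ℝ≥0∞} {c : ℝ≥0} {R : ℤ → ℝ≥0∞} (hR : Tendsto R atTop (nhds 0))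
    (h : ∃ N₀, ∀ N ≥ N₀, a ≤ b + c * R N) : a ≤ b := by
  obtain ⟨N₀, h⟩ := h
  have hRt := (ENNReal.Tendsto.const_mul hR (Or.inr (coe_ne_top (r := c)))).const_add b
  rw [mul_zero, add_zero] at hRt
  exact ge_of_tendsto hRt ((eventually_ge_atTop N₀).mono fun N hN => h N hN)

lemma vs_step (hp : 1 < p) (C : ℝ≥0) : ∃ A : ℝ≥0, ∀ S : Finset ℤ,
    VV p (S.image ek) C → ∀ C' : ℝ≥0, VS p (S.image ek) C' →
    VS p (S.image ek) (A + 2⁻¹ * C') := by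
  obtain ⟨A, h⟩ := nrm_tMD_le hp C
  refine ⟨A + 1, fun S hS C' hC' => ?_⟩
  obtain ⟨B, h⟩ := h S hS C' hC'
  have hA : A + 2⁻¹ * C' ≤ A + 1 + 2⁻¹ * C' := add_le_add (le_add_of_nonneg_right zero_le) le_rfl
  have h1 : 1 ≤ A + 1 + 2⁻¹ * C' := le_trans le_add_self (le_add_of_nonneg_right zero_le)
  refine vs_of_cc hp (sl_image_ek S) h1 fun ι s f hf hfs hf0 => ?_
  have hn : ∀ i, Nice (f i) := fun i => Nice.of_cc (hf i) (hfs i)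
  refine nrm_le_of_iSup (by linarith) (F := fun (L : ℕ) => vsq s fun i => tMD S L (en (f i)))
    (fun L => meas_vsq (fun i => meas_tMD S L (hn i).en_meas) s)
    (vsq_tMD_mono S s fun i => en (f i)) (vsq_MD_le_iSup S s fun i => en (f i)) fun L => ?_
  exact (le_of_tendsto_rem (tendsto_rem hp s hf hfs S) (h ι s f hn hf0 L)).trans
    (mul_le_mul_left (coe_le_coe.2 hA) _)

lemma vs_of_vv (hp : 1 < p) (C : ℝ≥0) : ∃ A : ℝ≥0, ∀ S : Finset ℤ,
    VV p (S.image ek) C → VS p (S.image ek) A := by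
  obtain ⟨A, hA⟩ := vs_step hp C
  refine ⟨2 * A + 1, fun S hS => ?_⟩
  obtain ⟨C', hC'⟩ := vs_exists hp (S.image ek) (sl_image_ek S)
  have hit : ∀ n : ℕ, VS p (S.image ek) (2 * A + C' * 2⁻¹ ^ n) := by
    intro n
    induction n with
    | zero => exact hC'.mono (by simp)
    | succ n ih =>
      refine (hA S hS _ ih).mono (Eq.le ?_)
      rw [pow_succ]
      rw [← NNReal.coe_inj]
      push_cast
      ring
  have ht : Tendsto (fun n : ℕ => C' * 2⁻¹ ^ n) atTop (nhds (C' * 0)) :=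
    (tendsto_pow_atTop_nhds_zero_of_lt_one (by norm_num)
        (by rw [← NNReal.coe_lt_coe]; norm_num)).const_mul C'
  rw [mul_zero] at ht
  obtain ⟨n, hn⟩ := (ht.eventually_le_const (show (0 : ℝ≥0) < 1 by norm_num)).exists
  exact (hit n).mono (add_le_add le_rfl hn)

lemma nrm_rpow_fun {X : Type*} [MeasureSpace X] (hr : 0 < r) (F : X → ℝ≥0∞) :
    nrm p (fun q => F q ^ r) = nrm (p * r) F ^ r := by
  unfold nrm
  simp_rw [← rpow_mul]
  rw [mul_comm r p]
  congr 1
  by_cases hp : p = 0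
  · simp [hp]
  field_simp

lemma MD_le_rpow (hr : 1 < r) (hF : Measurable F)
    (q : ℝ²) : MD D F q ≤ 2 * MD D (fun q => F q ^ r) q ^ r⁻¹ := by
  have hr0 : 0 < r := by linarith
  have hi : r⁻¹ < 1 := inv_lt_one_of_one_lt₀ hr
  refine iSup₂_le fun e he => ?_
  have h := MM_holder (e := e) (inv_pos.2 hr0) (sub_pos.2 hi) (add_sub_cancel _ _)
    (U := fun q => F q ^ r) (V := fun _ => 1) (hF.pow_const r) measurable_const q
  have e1 : (fun q => (F q ^ r) ^ r⁻¹ * 1 ^ (1 - r⁻¹)) = F := by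
    funext q
    rw [one_rpow, mul_one, ENNReal.rpow_rpow_inv hr0.ne']
  rw [e1, mul_comm] at h
  refine h.trans (mul_le_mul' ?_ (rpow_le_rpow (MM_le_MD he _ q) (inv_pos.2 hr0).le))
  calc MM e (fun _ => 1) q ^ (1 - r⁻¹) ≤ 2 ^ (1 - r⁻¹) :=
        rpow_le_rpow (MM_const_one_le e q) (sub_pos.2 hi).le
    _ ≤ 2 ^ (1 : ℝ) := ENNReal.rpow_le_rpow_of_exponent_le (by norm_num)
        (by have := inv_pos.2 hr0; linarith)
    _ = 2 := rpow_one 2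

lemma MB.of_two (h : MB 2 D C) (hp : 2 < p) :
    MB p D (2 * C ^ (p / 2)⁻¹) := by
  intro F hF
  have hr : 1 < p / 2 := by linarith
  have hr0 : 0 < p / 2 := by linarith
  have hi := inv_pos.2 hr0
  have hpr : p * (p / 2)⁻¹ = 2 := by field_simp
  calc nrm p (MD D F) ≤ nrm p fun q => ((2 : ℝ≥0) : ℝ≥0∞) * MD D (fun q => F q ^ (p / 2)) q ^ (p / 2)⁻¹ :=
        nrm_mono (by linarith) (MD_le_rpow hr hF.meas)
    _ = 2 * nrm 2 (MD D fun q => F q ^ (p / 2)) ^ (p / 2)⁻¹ := by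
        rw [nrm_const_mul (by linarith), nrm_rpow_fun hi, hpr]
        rfl
    _ ≤ 2 * (C * nrm 2 fun q => F q ^ (p / 2)) ^ (p / 2)⁻¹ :=
        mul_le_mul_right (rpow_le_rpow (h _ (hF.rpow hr0.le)) hi.le) _
    _ = _ := by
        rw [mul_rpow_of_nonneg _ _ hi.le, nrm_rpow_fun hr0, ← rpow_mul,
          mul_inv_cancel₀ hr0.ne', rpow_one, mul_div_cancel₀ p two_ne_zero, coe_mul,
          coe_rpow_of_nonneg _ hi.le, mul_assoc]
        rfl

lemma vs_two : ∃ C : ℝ≥0, ∀ S : Finset ℤ, VS 2 (S.image ek) C := by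
  obtain ⟨C, hC⟩ := vv_two
  obtain ⟨A, hA⟩ := vs_of_vv (by norm_num : (1 : ℝ) < 2) C
  exact ⟨A, fun S => hA S (hC _ (sl_image_ek S))⟩

lemma vs_lt {q : ℝ} (hp : 1 < p) (hp2 : p < 2) (hq : 1 < q) (hqp : q < p / (2 - p))
    (h : ∃ C : ℝ≥0, ∀ S : Finset ℤ, VS q (S.image ek) C) :
    ∃ C : ℝ≥0, ∀ S : Finset ℤ, VS p (S.image ek) C := by
  obtain ⟨C, hC⟩ := h
  obtain ⟨C', hC'⟩ := vv_lt hp hp2 hq hqp C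
  obtain ⟨A, hA⟩ := vs_of_vv hp C'
  exact ⟨A, fun S => hA S (hC' _ (sl_image_ek S) (hC S).mb)⟩

lemma vs_dyadic (n : ℕ) : ∃ C : ℝ≥0, ∀ S : Finset ℤ, VS (1 + 2⁻¹ ^ n) (S.image ek) C := by
  induction n with
  | zero => simpa [one_add_one_eq_two] using vs_two
  | succ n ih =>
    have h1 : (0 : ℝ) < 2⁻¹ ^ n := by positivity
    have h2 : (2⁻¹ : ℝ) ^ n ≤ 1 := pow_le_one₀ (by norm_num) (by norm_num)
    rw [pow_succ]
    refine vs_lt (by linarith) (by linarith) (by linarith) ?_ ih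
    rw [lt_div_iff₀ (by linarith)]
    nlinarith

/-- The maximal function along the directions `(1, 2 ^ (-k))` is bounded, with values in `ℓ²`. -/
theorem vs_ek (hp : 1 < p) : ∃ C : ℝ≥0, ∀ S : Finset ℤ, VS p (S.image ek) C := by
  have hlt : ∀ {p : ℝ}, 1 < p → p < 2 → ∃ C : ℝ≥0, ∀ S : Finset ℤ, VS p (S.image ek) C := by
    intro p hp hp2
    have h1 : 1 < p / (2 - p) := by
      rw [lt_div_iff₀ (by linarith)]
      linarith
    obtain ⟨n, hn⟩ := exists_pow_lt_of_lt_one (sub_pos.2 h1) (by norm_num : (2⁻¹ : ℝ) < 1)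
    have h2 : (0 : ℝ) < 2⁻¹ ^ n := by positivity
    exact vs_lt hp hp2 (by linarith) (by linarith) (vs_dyadic n)
  rcases lt_trichotomy p 2 with h | rfl | h
  · exact hlt hp h
  · exact vs_two
  have h1 : 1 < p / (p - 2) := by
    rw [lt_div_iff₀ (by linarith)]
    linarith
  have hmb : ∃ C : ℝ≥0, ∀ S : Finset ℤ, MB (p / (p - 2)) (S.image ek) C := by
    rcases lt_trichotomy (p / (p - 2)) 2 with h | h | h
    · obtain ⟨C, hC⟩ := hlt h1 h
      exact ⟨C, fun S => (hC S).mb⟩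
    · obtain ⟨C, hC⟩ := vs_two
      exact ⟨C, fun S => by rw [h]; exact (hC S).mb⟩
    · obtain ⟨C, hC⟩ := vs_two
      exact ⟨_, fun S => (hC S).mb.of_two h⟩
  obtain ⟨C, hC⟩ := hmb
  obtain ⟨C', hC'⟩ := vv_gt h C
  obtain ⟨A, hA⟩ := vs_of_vv hp C'
  exact ⟨A, fun S => hA S (hC' _ (sl_image_ek S) (hC S))⟩

lemma vv_ek (hp : 1 < p) : ∃ C : ℝ≥0, ∀ (ι : Type) (s : Finset ι) (k : ι → ℤ)
    (F : ι → ℝ² → ℝ≥0∞), (∀ i, BM (F i)) →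
    nrm p (vsq s fun i => MM (ek (k i)) (F i)) ≤ C * nrm p (vsq s F) := by
  obtain ⟨C, hC⟩ := vs_ek hp
  refine ⟨C, fun ι s k F hF => ?_⟩
  have h0 := zero_lt_one.trans hp
  exact VV.of_mem h0 ((hC (s.image k)).vv h0) s (fun i => ek (k i)) F
    (fun i hi => mem_image_of_mem _ (mem_image_of_mem _ hi)) hF

lemma lp_ek (hR : LK R) (hR0 : ∫ t, R t = 0) (hp : 1 < p) :
    ∃ K : ℝ≥0, ∀ (ι : Type) (s : Finset ι) (k : ι → ℤ) (f : ι → ℝ² → ℝ) (T : Finset ℤ),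
    (∀ i, Nice (f i)) →
    nrm p (vsq (s ×ˢ T) fun x => en (cv (dil x.2 R) (ek (k x.1)) (f x.1))) ≤
      K * nrm p (vsq s fun i => en (f i)) := by
  have hpq := HolderConjugate.conjExponent hp
  obtain ⟨C₁, h₁⟩ := vs_ek hp
  obtain ⟨C₂, h₂⟩ := vs_ek hpq.symm.lt
  obtain ⟨K, hK⟩ := lp_sq hR hR0 hpq (C₁ + C₂)
  refine ⟨K, fun ι s k f T hf => ?_⟩
  classical
  rcases s.eq_empty_or_nonempty with rfl | ⟨i₀, hi₀⟩
  · have : (vsq ((∅ : Finset ι) ×ˢ T) fun x => en (cv (dil x.2 R) (ek (k x.1)) (f x.1))) =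
        fun _ => 0 := by funext q; simp [vsq]
    rw [this, nrm_zero hpq.pos]
    exact bot_le
  have h := hK ((s.image k).image ek) (sl_image_ek _) (((h₁ _).mono le_self_add).vv hpq.pos)
    (((h₂ _).mono le_add_self).vv hpq.symm.pos) ι s (fun i => ek (k (if i ∈ s then i else i₀))) f T
    (fun i => mem_image_of_mem _ (mem_image_of_mem _ (by split_ifs <;> assumption))) hf
  refine le_trans (nrm_mono hpq.pos (vsq_mono
    (F := fun x : ι × ℤ => en (cv (dil x.2 R) (ek (k x.1)) (f x.1)))
    (G := fun x : ι × ℤ => en (cv (dil x.2 R) (ek (k (if x.1 ∈ s then x.1 else i₀))) (f x.1)))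
    fun x hx q => ?_)) h
  rw [if_pos (mem_product.1 hx).1]

/-- Truncated directional Hilbert transform: the sum of the dilates of `ψ` over the scales `T`. -/
def Hs (ψ : ℝ → ℝ) (e : ℝ²) (T : Finset ℤ) (f : ℝ² → ℝ) (q : ℝ²) : ℝ :=
  ∑ l ∈ T, cv (dil l ψ) e f q

lemma Nice.hs (hψ : Nice ψ) (e : ℝ²) (T : Finset ℤ) (hf : Nice f) :
    Nice (Hs ψ e T f) := Nice.sum T fun l _ => (hψ.dil l).cv hf e

/-- Duality: square function bounds for two factors bound the sum over scales. -/
lemma hs_dual (h₁ : Nice θ₁) (h₂ : Nice θ₂) (hpq : p.HolderConjugate p') {ι : Type} (s : Finset ι)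
    (e : ι → ℝ²) (T : ι → Finset ℤ)
    (f : ι → ℝ² → ℝ) (hf : ∀ i, Nice (f i))
    (hK₁ : ∀ T : Finset ℤ, nrm p (vsq (s ×ˢ T) fun x => en (cv (dil x.2 θ₂) (e x.1) (f x.1))) ≤
      K₁ * nrm p (vsq s fun i => en (f i)))
    (hK₂ : ∀ (g : ι → ℝ² → ℝ) (T : Finset ℤ), (∀ i, Nice (g i)) →
      nrm p' (vsq (s ×ˢ T) fun x => en (cv (dil x.2 fun t => θ₁ (-t)) (e x.1) (g x.1))) ≤
      K₂ * nrm p' (vsq s fun i => en (g i))) :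
    nrm p (vsq s fun i => en (Hs (cv θ₁ 1 θ₂) (e i) (T i) (f i))) ≤
      (K₁ * K₂ : ℝ≥0) * nrm p (vsq s fun i => en (f i)) := by
  classical
  have hψ := h₁.cv h₂ (1 : ℝ)
  refine nrm_vsq_le_of_dual (s := s) (U := fun i => Hs (cv θ₁ 1 θ₂) (e i) (T i) (f i))
    (fun i => hψ.hs _ _ (hf i)) hpq fun g hg => ?_
  set A : ι × ℤ → ℝ² → ℝ := fun x => cv (dil x.2 θ₂) (e x.1) (f x.1) with hA
  set B : ι × ℤ → ℝ² → ℝ := fun x => cv (dil x.2 fun t => θ₁ (-t)) (e x.1) (g x.1) with hB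
  have hAn : ∀ x, Nice (A x) := fun x => (h₂.dil _).cv (hf _) _
  have hBn : ∀ x, Nice (B x) := fun x => (h₁.reflect.dil _).cv (hg _) _
  have hsum : ∀ i, ∫ q, Hs (cv θ₁ 1 θ₂) (e i) (T i) (f i) q * g i q =
      ∑ l ∈ T i, ∫ q, A (i, l) q * B (i, l) q := by
    intro i
    simp only [Hs, sum_mul]
    rw [integral_finsetSum _ fun n _ => (((hψ.dil _).cv (hf _) _).mul (hg i)).integrable]
    refine sum_congr rfl fun l _ => ?_
    rw [dil_cv, cv_cv (h₁.dil l) (h₂.dil l) (hf i),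
      integral_cv_mul (h₁.dil l) ((h₂.dil l).cv (hf i) _) (hg i), dil_reflect]
  have hstep : ‖∑ i ∈ s, ∫ q, Hs (cv θ₁ 1 θ₂) (e i) (T i) (f i) q * g i q‖ₑ ≤
      ∑ y ∈ s ×ˢ s.biUnion T, ∫⁻ q, en (A y) q * en (B y) q := by
    rw [sum_product]
    refine (enorm_sum_le _ _).trans (sum_le_sum fun i hi => ?_)
    rw [hsum i]
    refine (enorm_sum_le _ _).trans ((sum_le_sum fun l _ => ?_).trans
      (sum_le_sum_of_subset (Finset.subset_biUnion_of_mem T hi)))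
    refine (enorm_integral_le_lintegral_enorm _).trans (Eq.le ?_)
    simp only [enorm_mul, en]
  refine hstep.trans ((sum_lintegral_mul_le hpq (F := fun y => en (A y)) (G := fun y => en (B y))
    (fun y => (hAn y).en_meas) (fun y => (hBn y).en_meas) _).trans ?_)
  refine (mul_le_mul' (hK₁ _) (hK₂ g _ hg)).trans (Eq.le ?_)
  push_cast
  ring

lemma hs_ek (h₁ : LK θ₁) (h₂ : LK θ₂) (h₁0 : ∫ t, θ₁ t = 0) (h₂0 : ∫ t, θ₂ t = 0) (hp : 1 < p) :
    ∃ K : ℝ≥0, ∀ (ι : Type) (s : Finset ι) (k : ι → ℤ) (T : ι → Finset ℤ)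
    (f : ι → ℝ² → ℝ), (∀ i, Nice (f i)) →
    nrm p (vsq s fun i => en (Hs (cv θ₁ 1 θ₂) (ek (k i)) (T i) (f i))) ≤
      K * nrm p (vsq s fun i => en (f i)) := by
  have hpq := HolderConjugate.conjExponent hp
  obtain ⟨K₁, hK₁⟩ := lp_ek h₂ h₂0 hp
  obtain ⟨K₂, hK₂⟩ := lp_ek h₁.reflect (by rwa [integral_reflect]) hpq.symm.lt
  exact ⟨K₁ * K₂, fun ι s k T f hf => hs_dual h₁.nice h₂.nice hpq s (fun i => ek (k i)) T f hf
    (fun T => hK₁ ι s k f T hf) fun g T hg => hK₂ ι s k g T hg⟩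

lemma hs_sl (h₁ : LK θ₁) (h₂ : LK θ₂) (h₁0 : ∫ t, θ₁ t = 0) (h₂0 : ∫ t, θ₂ t = 0) (hp : 1 < p) :
    ∃ K : ℝ≥0, ∀ e, Sl e → ∀ (ι : Type) (s : Finset ι)
    (T : ι → Finset ℤ) (f : ι → ℝ² → ℝ), (∀ i, Nice (f i)) →
    nrm p (vsq s fun i => en (Hs (cv θ₁ 1 θ₂) e (T i) (f i))) ≤
      K * nrm p (vsq s fun i => en (f i)) := by
  have hpq := HolderConjugate.conjExponent hp
  obtain ⟨K₁, hK₁⟩ := lp_sq_single h₂ h₂0 hp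
  obtain ⟨K₂, hK₂⟩ := lp_sq_single h₁.reflect (by rwa [integral_reflect]) hpq.symm.lt
  exact ⟨K₁ * K₂, fun e he ι s T f hf => hs_dual h₁.nice h₂.nice hpq s (fun _ => e) T f hf
    (fun T => hK₁ e he ι s f T hf) fun g T hg => hK₂ e he ι s g T hg⟩

lemma lintegral_mul_le_av (h : Bd κ B r) (e : ℝ²) (F : ℝ² → ℝ≥0∞)
    (q : ℝ²) : ∫⁻ t, ‖κ t‖ₑ * F (q - t • e) ≤ ofReal B * av r e F q := by
  unfold av
  rw [← mul_assoc, ← div_eq_mul_inv, ← ofReal_div_of_pos h.pos,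
    ← lintegral_const_mul' _ _ ofReal_ne_top, ← lintegral_indicator measurableSet_Icc]
  refine lintegral_mono fun t => ?_
  by_cases ht : t ∈ Icc (-r) r
  · rw [indicator_of_mem ht]
    refine mul_le_mul' ?_ le_rfl
    rw [enorm_eq_ofReal_abs]
    exact ofReal_le_ofReal (h.le t)
  · have : r < |t| := by
      by_contra h'
      exact ht (abs_le.1 (not_lt.1 h'))
    rw [h.supp t this]
    simp

lemma hasDerivAt_cv (h : SK κ) (h' : Nice g) (x : ℝ) :
    HasDerivAt (cv κ 1 g) (cv (deriv κ) 1 g x) x := by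
  rw [cv_one_comm κ, cv_one_comm (deriv κ), cv_one_eq_conv, cv_one_eq_conv]
  exact h.cs.hasDerivAt_convolution_right _ h'.integrable.locallyIntegrable
    (h.smooth.of_le (by simp)) x

lemma enorm_cv_shift_sub_le (h : SK κ) (hf : Nice f)
    (he : e ≠ 0) {a : ℝ} (hA : 0 < A) (ha : |a| ≤ A) (q : ℝ²) :
    ‖cv κ e f (q - a • e) - cv κ e f q‖ₑ ≤
      ofReal A * (2 * MM e (en (cv (deriv κ) e f)) q) := by
  have hg := hf.slice he q
  set g : ℝ → ℝ := fun t => f (q + t • e) with hgd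
  have hs : ∀ (κ : ℝ → ℝ) (t : ℝ), cv κ e f (q - t • e) = cv κ 1 g (-t) := fun κ t => by
    rw [← cv_slice, neg_smul, sub_eq_add_neg]
  have hd : ∀ t : ℝ, HasDerivAt (fun t => cv κ e f (q - t • e))
      (-(cv (deriv κ) e f (q - t • e))) t := fun t => by
    simp only [hs]
    have := (hasDerivAt_cv h hg (-t)).scomp t (hasDerivAt_neg t)
    rw [neg_one_smul] at this
    exact this
  have hc : Continuous fun t : ℝ => -(cv (deriv κ) e f (q - t • e)) := by
    simp only [hs]
    have : Continuous (cv (deriv κ) 1 g) :=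
      continuous_iff_continuousAt.2 fun x => (hasDerivAt_cv h.deriv hg x).continuousAt
    exact (this.comp continuous_neg).neg
  have hi := intervalIntegral.integral_eq_sub_of_hasDerivAt (a := 0) (b := a)
    (fun t _ => hd t) (hc.intervalIntegrable _ _)
  simp only [zero_smul, sub_zero] at hi
  rw [← hi]
  have hsub : uIoc 0 a ⊆ Icc (-A) A := fun t ht => by
    have := abs_le.1 ha
    rcases Set.mem_uIoc.1 ht with h | h <;> constructor <;> linarith
  have h1 : ‖∫ t in (0 : ℝ)..a, -(cv (deriv κ) e f (q - t • e))‖ₑ ≤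
      ∫⁻ t in Icc (-A) A, en (cv (deriv κ) e f) (q - t • e) := by
    have h0 : ‖∫ t in (0 : ℝ)..a, -(cv (deriv κ) e f (q - t • e))‖ₑ =
        ‖∫ t in uIoc 0 a, -(cv (deriv κ) e f (q - t • e))‖ₑ := by
      rw [← ofReal_norm, ← ofReal_norm,
        intervalIntegral.norm_intervalIntegral_eq]
    rw [h0]
    refine (enorm_integral_le_lintegral_enorm _).trans ((lintegral_mono_set hsub).trans_eq ?_)
    simp only [enorm_neg, en]
  refine h1.trans ?_
  have h2 := av_le_MM (F := en (cv (deriv κ) e f)) hA e q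
  refine le_trans (Eq.le ?_) (mul_le_mul_right h2 _)
  rw [av, ← mul_assoc, ENNReal.mul_inv_cancel (by simpa using hA) ofReal_ne_top, one_mul]

/-- Replacing the direction `(1, 2⁻ᵏ)` by the horizontal one on functions of bounded vertical
frequency. -/
lemma cv_dir_diff (hψ : Nice ψ) (hκ : SK κ) : ∃ C : ℝ≥0, ∀ (l k j : ℤ)
    (f : ℝ² → ℝ), Nice f → ∀ q,
    ‖cv (dil l ψ) (ek k) (cv (dil j κ) ey f) q - cv (dil l ψ) ex (cv (dil j κ) ey f) q‖ₑ ≤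
      C * ofReal (2 ^ (j - l - k)) * MS (en (cv (dil j (deriv κ)) ey f)) q := by
  obtain ⟨B, r, hB⟩ := hψ.bd
  refine ⟨(4 * B * r).toNNReal, fun l k j f hf q => ?_⟩
  have hr := hB.pos
  have hB0 := hB.nonneg
  have hBl := hB.dil l
  set G := cv (dil j κ) ey f with hG
  have hGn : Nice G := (hκ.nice.dil j).cv hf ey
  have hψl := hψ.dil l
  set A : ℝ := 2 ^ (-k) * (r * 2 ^ (-l)) with hAd
  have hA : 0 < A := by positivity
  have hd : cv (deriv (dil j κ)) ey f = fun q => 2 ^ j * cv (dil j (deriv κ)) ey f q := by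
    funext q
    rw [deriv_dil hκ, cv_const_mul_left]
  have hM : ∀ q, MM ey (en (cv (deriv (dil j κ)) ey f)) q =
      ofReal (2 ^ j) * MM ey (en (cv (dil j (deriv κ)) ey f)) q := fun q => by
    rw [hd, ← MM_const_mul _ ofReal_ne_top]
    congr 1
    funext q
    rw [en, enorm_mul, enorm_of_nonneg (by positivity)]
    rfl
  have hey : ey ≠ (0 : ℝ²) := by simp [ey]
  have h1 : cv (dil l ψ) (ek k) G q - cv (dil l ψ) ex G q =
      ∫ t, dil l ψ t * (G (q - t • ek k) - G (q - t • ex)) := by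
    rw [cv, cv, ← integral_sub]
    · simp only [mul_sub]
    · exact (hψl.cv_integrand hGn _ q).integrable
    · exact (hψl.cv_integrand hGn _ q).integrable
  rw [h1]
  refine (enorm_integral_le_lintegral_enorm _).trans ?_
  have h2 : ∀ t, ‖dil l ψ t * (G (q - t • ek k) - G (q - t • ex))‖ₑ ≤
      ‖dil l ψ t‖ₑ * (ofReal (A * 2 * 2 ^ j) *
        MM ey (en (cv (dil j (deriv κ)) ey f)) (q - t • ex)) := fun t => by
    rw [enorm_mul]
    by_cases ht : r * 2 ^ (-l) < |t|
    · rw [hBl.supp t ht]; simp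
    refine mul_le_mul_right ?_ _
    have e1 : q - t • ek k = q - t • ex - (2 ^ (-k) * t) • ey := by
      rw [ek_eq, smul_add, smul_smul, mul_comm t, sub_sub]
    rw [e1]
    refine (enorm_cv_shift_sub_le (hκ.dil j) hf hey hA ?_ _).trans (Eq.le ?_)
    · rw [abs_mul, abs_of_pos (by positivity : (0 : ℝ) < 2 ^ (-k))]
      exact mul_le_mul_of_nonneg_left (not_lt.1 ht) (by positivity)
    · rw [hM, show ofReal (A * 2 * 2 ^ j) = ofReal A * ofReal 2 *
        ofReal (2 ^ j) by
          rw [ofReal_mul (by positivity), ofReal_mul hA.le]]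
      simp only [ofReal_ofNat]
      ring
  refine (lintegral_mono h2).trans ?_
  refine (lintegral_mul_le_av hBl ex (fun q => ofReal (A * 2 * 2 ^ j) *
        MM ey (en (cv (dil j (deriv κ)) ey f)) q) q).trans ?_
  refine (mul_le_mul_right (av_le_MM (hBl.pos) ex q) _).trans (Eq.le ?_)
  rw [MM_const_mul _ ofReal_ne_top]
  have h3 : ((4 * B * r).toNNReal : ℝ≥0∞) * ofReal (2 ^ (j - l - k)) =
      ofReal B * 2 * ofReal (A * 2 * 2 ^ j) := by
    rw [← ofReal_ofNat (n := 2), ← ofReal_mul (by positivity),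
      ← ofReal_mul (by positivity), ← ofReal, ← ofReal_mul (by positivity)]
    congr 1
    have : (2 : ℝ) ^ (j - l - k) = 2 ^ j * 2 ^ (-l) * 2 ^ (-k) := by
      rw [← zpow_add₀ two_ne_zero, ← zpow_add₀ two_ne_zero]; ring_nf
    rw [this, hAd]; simp; ring
  rw [h3, MS]
  ring

/-- Cotlar-type inequality for truncations of a sum over scales. -/
lemma cotlar (hκ : LK κ) (hκ0 : ∫ t, κ t = 0) : ∃ C : ℝ≥0, ∀ (e : ℝ²) (m : ℤ)
    (T : Finset ℤ) (F : ℤ → ℝ² → ℝ), (∀ j, Nice (F j)) → ∀ q,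
    ‖∑ j ∈ T with m ≤ j, cv (dil j κ) e (F j) q‖ₑ ≤
      C * (en (fun q => ∑ j ∈ T, cv (dil j κ) e (F j) q) q +
        MM e (en fun q => ∑ j ∈ T, cv (dil j κ) e (F j) q) q +
        ∑ j ∈ T, geo (j - m) * MM e (en (F j)) q) := by
  obtain ⟨C₁, h₁⟩ := cv_fine_coarse hκ.nice sk_Om.lk hκ0
  obtain ⟨C₂, h₂⟩ := cv_sub_cv_fine hκ sk_Om.nice integral_Om
  obtain ⟨B, r, hB⟩ := sk_Om.nice.bd
  refine ⟨1 + (2 * B).toNNReal + (C₁ + C₂), fun e m T F hF q => ?_⟩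
  set G : ℝ² → ℝ := fun q => ∑ j ∈ T, cv (dil j κ) e (F j) q with hG
  have hcv : ∀ j, Nice (cv (dil j κ) e (F j)) := fun j => (hκ.nice.dil j).cv (hF j) e
  have hWG : cv (dil m Om) e G q = ∑ j ∈ T, cv (dil m Om) e (cv (dil j κ) e (F j)) q :=
    cv_sum T (sk_Om.nice.dil m) (fun j _ => hcv j) e q
  have hkey : ∑ j ∈ T with m ≤ j, cv (dil j κ) e (F j) q = G q - cv (dil m Om) e G q +
      ∑ j ∈ T, (if m ≤ j then cv (dil m Om) e (cv (dil j κ) e (F j)) q else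
        -(cv (dil j κ) e (F j) q - cv (dil m Om) e (cv (dil j κ) e (F j)) q)) := by
    rw [hWG, hG, ← sum_sub_distrib, ← sum_add_distrib, Finset.sum_filter]
    refine sum_congr rfl fun j _ => ?_
    split_ifs <;> ring
  have hterm : ∀ j, ‖(if m ≤ j then cv (dil m Om) e (cv (dil j κ) e (F j)) q else
      -(cv (dil j κ) e (F j) q - cv (dil m Om) e (cv (dil j κ) e (F j)) q))‖ₑ ≤
      (C₁ + C₂ : ℝ≥0) * (geo (j - m) * MM e (en (F j)) q) := fun j => by
    rw [coe_add, add_mul]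
    have hc : cv (dil m Om) e (cv (dil j κ) e (F j)) = cv (dil j κ) e (cv (dil m Om) e (F j)) :=
      cv_comm (sk_Om.nice.dil m) (hκ.nice.dil j) (hF j) e e
    rw [hc]
    split_ifs with h
    · refine ((h₁ j m h e (F j) (hF j) _ (fun _ => le_rfl) q).trans (Eq.le ?_)).trans le_self_add
      rw [← geo_neg, neg_sub, mul_assoc]; rfl
    · rw [enorm_neg]
      refine ((h₂ j m (by omega) e (F j) (hF j) _ (fun _ => le_rfl) q).trans
        (Eq.le ?_)).trans le_add_self
      rw [mul_assoc]; rfl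
  rw [hkey]
  have hW := enorm_cv_le_MM (hB.dil m) e (f := G) (F := en G) (fun _ => le_rfl) q
  calc _ ≤ (‖G q‖ₑ + ‖cv (dil m Om) e G q‖ₑ) + ∑ j ∈ T,
          (C₁ + C₂ : ℝ≥0) * (geo (j - m) * MM e (en (F j)) q) := by
        refine (enorm_add_le _ _).trans (add_le_add enorm_sub_le ?_)
        exact (enorm_sum_le _ _).trans (sum_le_sum fun j _ => hterm j)
    _ ≤ (en G q + (2 * B).toNNReal * MM e (en G) q) +
          (C₁ + C₂ : ℝ≥0) * ∑ j ∈ T, geo (j - m) * MM e (en (F j)) q := by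
        rw [← mul_sum]
        gcongr
        · exact le_rfl
        · exact hW
    _ ≤ _ := by
        generalize (∑ j ∈ T, geo (j - m) * MM e (en (F j)) q) = Z
        generalize MM e (en G) q = Y
        generalize en G q = X
        generalize (C₁ + C₂) = c
        generalize (2 * B).toNNReal = b
        rw [mul_add, mul_add]
        gcongr
        · refine le_trans (one_mul X).ge (mul_le_mul_left ?_ _)
          push_cast
          exact le_add_right le_self_add
        · exact le_add_right le_add_self
        · exact le_add_self

lemma lp_one (hR : LK R) (hR0 : ∫ t, R t = 0) (hp : 1 < p) :
    ∃ K : ℝ≥0, ∀ e, Sl e → ∀ (f : ℝ² → ℝ) (T : Finset ℤ), Nice f →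
    nrm p (vsq T fun j => en (cv (dil j R) e f)) ≤ K * nrm p (en f) := by
  obtain ⟨K, hK⟩ := lp_sq_single hR hR0 hp
  have h0 := zero_lt_one.trans hp
  refine ⟨K, fun e he f T hf => ?_⟩
  have h := hK e he Unit {()} (fun _ => f) T (fun _ => hf)
  have e1 : nrm p (vsq {()} fun _ : Unit => en f) = nrm p (en f) := by
    congr 1; funext q; exact vsq_singleton _ _ _
  rw [e1] at h
  refine le_trans (nrm_mono h0 fun q => ?_) h
  exact vsq_le_of_injOn (F := fun j => en (cv (dil j R) e f))
    (G := fun x : Unit × ℤ => en (cv (dil x.2 R) e f)) (fun j => ((), j))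
    (fun a _ b _ h => by simpa using h) (fun i hi => by simpa using hi) fun _ _ => le_rfl

/-- A product of one horizontal and one vertical single-scale operator. -/
def bz (u w : ℝ → ℝ) (n j : ℤ) (f : ℝ² → ℝ) : ℝ² → ℝ :=
  cv (dil n u) ex (cv (dil j w) ey f)

lemma Nice.bz {u : ℝ → ℝ} (hu : Nice u) (hw : Nice w) (n j : ℤ) (hf : Nice f) :
    Nice (bz u w n j f) := (hu.dil n).cv ((hw.dil j).cv hf _) _

lemma bz_eq_bx (u w : ℝ → ℝ) (k j : ℤ) (s : ℕ) (f : ℝ² → ℝ) :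
    bz u w (j - k + s) j f = bx u (dil (-s) w) k (j - k + s) f := by
  rw [bz, bx, dil_dil]
  congr 3
  ring

lemma lp_bz {u : ℝ → ℝ} (hu : LK u) (hw : LK w) (hu0 : ∫ t, u t = 0) (hw0 : ∫ t, w t = 0)
    (hp : 1 < p) : ∃ K : ℝ≥0, ∀ (Q : Finset (ℤ × ℤ)) (s : ℕ) (f : ℝ² → ℝ), Nice f →
    nrm p (vsq Q fun x => en (bz u w (x.1 - x.2 + s) x.1 f)) ≤ K * nrm p (en f) := by
  obtain ⟨K, hK⟩ := lp_sq_two hu hu0 hw hw0 hp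
  have h0 := zero_lt_one.trans hp
  refine ⟨K, fun Q s f hf => ?_⟩
  have h := hK Unit {()} (fun _ => f) (Q.image fun x => x.1 - x.2 + s) (Q.image fun x => x.1)
    (fun _ => hf)
  have e1 : nrm p (vsq {()} fun _ : Unit => en f) = nrm p (en f) := by
    congr 1; funext q; exact vsq_singleton _ _ _
  rw [e1] at h
  refine le_trans (nrm_mono h0 fun q => ?_) h
  refine vsq_le_of_injOn (F := fun x : ℤ × ℤ => en (bz u w (x.1 - x.2 + s) x.1 f))
    (G := fun x : (Unit × ℤ) × ℤ => en (cv (dil x.2 u) (1, 0) (cv (dil x.1.2 w) (0, 1) f)))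
    (fun x => (((), x.1), x.1 - x.2 + s)) ?_ ?_ fun _ _ => le_rfl
  · rintro ⟨a, b⟩ _ ⟨c, d⟩ _ h
    simp only [Prod.mk.injEq, true_and] at h ⊢
    omega
  · intro x hx
    simp only [mem_product, Finset.mem_singleton, true_and]
    exact ⟨mem_image_of_mem (fun x : ℤ × ℤ => x.1) hx,
      mem_image_of_mem (fun x : ℤ × ℤ => x.1 - x.2 + (s : ℤ)) hx⟩

lemma hs_fine (hψ : LK ψ) (hψ0 : ∫ t, ψ t = 0) (hκ : SK κ) : ∃ C : ℝ≥0,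
    ∀ (j k : ℤ) (T : Finset ℤ) (f : ℝ² → ℝ), Nice f → ∀ q,
    ‖Hs ψ (ek k) {l ∈ T | j - k ≤ l} (cv (dil j κ) ey f) q‖ₑ ≤
      C * ((en (Hs ψ ex T (cv (dil j κ) ey f)) q + MM ex (en (Hs ψ ex T (cv (dil j κ) ey f))) q) +
        (MM ex (en (cv (dil j κ) ey f)) q + MS (en (cv (dil j (deriv κ)) ey f)) q)) := by
  obtain ⟨C₁, h₁⟩ := cv_dir_diff hψ.nice hκ
  obtain ⟨C₂, h₂⟩ := cotlar hψ hψ0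
  refine ⟨C₂ * 4 + C₂ + C₁ * 4, fun j k T f hf q => ?_⟩
  set g := cv (dil j κ) ey f with hg
  have hgn : Nice g := (hκ.nice.dil j).cv hf ey
  have h2 := h₂ ex (j - k) T (fun _ => g) (fun _ => hgn) q
  have h1 : ‖Hs ψ (ek k) {l ∈ T | j - k ≤ l} g q - ∑ l ∈ T with j - k ≤ l, cv (dil l ψ) ex g q‖ₑ ≤
      C₁ * 4 * MS (en (cv (dil j (deriv κ)) ey f)) q := by
    rw [Hs, ← sum_sub_distrib]
    refine (enorm_sum_le _ _).trans ?_
    have : ∀ l ∈ T.filter (j - k ≤ ·), ‖cv (dil l ψ) (ek k) g q - cv (dil l ψ) ex g q‖ₑ ≤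
        geo (j - k - l) * (C₁ * MS (en (cv (dil j (deriv κ)) ey f)) q) := fun l hl => by
      have h3 := ofReal_mul_geo zero_le_one (mem_filter.1 hl).2
      rw [one_mul, toNNReal_one, coe_one, one_mul] at h3
      refine (h₁ l k j f hf q).trans (Eq.le ?_)
      rw [← h3, show j - l - k = j - k - l by ring]
      ring
    refine (sum_le_sum this).trans ?_
    rw [← sum_mul]
    refine (mul_le_mul_left (geo_sum_le _ _) _).trans (Eq.le ?_)
    ring
  have h3 : ∑ l ∈ T, geo (l - (j - k)) * MM ex (en g) q ≤ 4 * MM ex (en g) q := by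
    rw [← sum_mul]
    exact mul_le_mul_left (geo_sum_le' _ _) _
  have h4 := (add_le_add h1 (h2.trans (mul_le_mul_right (add_le_add_right h3 _) _)))
  refine le_trans ?_ (h4.trans ?_)
  · refine le_trans (Eq.le ?_) (enorm_add_le _ _)
    rw [sub_add_cancel]
  change _ * _ * _ + _ * (en (Hs ψ ex T g) q + MM ex (en (Hs ψ ex T g)) q + _) ≤ _
  generalize en (Hs ψ ex T g) q + MM ex (en (Hs ψ ex T g)) q = X
  generalize MM ex (en g) q = Y
  generalize MS (en (cv (dil j (deriv κ)) ey f)) q = Z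
  push_cast
  calc _ = C₂ * X + (C₂ * 4 * Y + C₁ * 4 * Z) := by ring
    _ ≤ (C₂ * 4 + C₂ + C₁ * 4) * X + ((C₂ * 4 + C₂ + C₁ * 4) * Y + (C₂ * 4 + C₂ + C₁ * 4) * Z) :=
        add_le_add (mul_le_mul_left (le_add_right le_add_self) _)
          (add_le_add (mul_le_mul_left (le_add_right le_self_add) _)
            (mul_le_mul_left le_add_self _))
    _ = _ := by ring

lemma hs_parts {u : ℝ → ℝ} (hψ : SK ψ) (hu : SK u) (hw : SK w) : ∃ C : ℝ≥0,
    ∀ (j k : ℤ) (s : ℕ) (T : Finset ℤ), (∀ l ∈ T, l ≤ j - k) → ∀ f : ℝ² → ℝ, Nice f → ∀ q,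
    ‖2 ^ s * Hs ψ (ek k) T (bz (deriv u) w (j - k + s) j f) q +
      Hs ψ (ek k) T (bz u (deriv w) (j - k + s) j f) q‖ₑ ≤
      C * MM (ek k) (en (bz u w (j - k + s) j f)) q := by
  obtain ⟨B, r, hB⟩ := hψ.deriv.nice.bd
  refine ⟨4 * (2 * B).toNNReal, fun j k s T hT f hf q => ?_⟩
  have hd : bx u (deriv (dil (-s) w)) k (j - k + s) f =
      fun q => 2 ^ (-s : ℤ) * bz u (deriv w) (j - k + s) j f q := by
    funext q
    rw [bz_eq_bx, deriv_dil hw]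
    have : ∀ m, dil m (fun t => (2 : ℝ) ^ (-s : ℤ) * dil (-s) (deriv w) t) =
        fun t => (2 : ℝ) ^ (-s : ℤ) * dil m (dil (-s) (deriv w)) t := fun m => by
      funext t; simp only [dil]; ring
    have h2 : cv (dil (k + (j - k + s)) fun t => (2 : ℝ) ^ (-s : ℤ) * dil (-s) (deriv w) t) ey f =
      fun q => (2 : ℝ) ^ (-s : ℤ) * cv (dil (k + (j - k + s)) (dil (-s) (deriv w))) ey f q := by
      funext q
      rw [this, cv_const_mul_left]
    rw [bx, h2, cv_const_mul, bx]
  have h2 : (2 : ℝ) ≠ 0 := two_ne_zero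
  have hl : ∀ l, 2 ^ s * cv (dil l ψ) (ek k) (bz (deriv u) w (j - k + s) j f) q +
      cv (dil l ψ) (ek k) (bz u (deriv w) (j - k + s) j f) q =
      2 ^ (l - (j - k)) * cv (dil l (deriv ψ)) (ek k) (bz u w (j - k + s) j f) q := fun l => by
    have h := bx_parts hψ hu (hw.dil (-s)) k l (j - k + s) hf q
    rw [hd, cv_const_mul, ← bz_eq_bx, ← bz_eq_bx] at h
    have e : (2 : ℝ) ^ (l - (j - k)) = 2 ^ s * 2 ^ (l - (j - k + s)) := by
      rw [← zpow_natCast, ← zpow_add₀ h2]; ring_nf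
    rw [e, mul_assoc, ← h, mul_add, ← mul_assoc, zpow_neg, zpow_natCast,
      mul_inv_cancel₀ (by positivity), one_mul]
  rw [Hs, Hs, mul_sum, ← sum_add_distrib]
  set X := MM (ek k) (en (bz u w (j - k + s) j f)) q
  have hb : ∀ l ∈ T, ‖2 ^ s * cv (dil l ψ) (ek k) (bz (deriv u) w (j - k + s) j f) q +
      cv (dil l ψ) (ek k) (bz u (deriv w) (j - k + s) j f) q‖ₑ ≤
      geo (l - (j - k)) * ((2 * B).toNNReal * X) := fun l hlT => by
    rw [hl, enorm_mul]
    refine mul_le_mul' (Eq.le ?_) (enorm_cv_le_MM (hB.dil l) (ek k) (fun _ => le_rfl) q)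
    have h3 := ofReal_mul_geo zero_le_one (hT l hlT)
    rw [one_mul, toNNReal_one, coe_one, one_mul] at h3
    rw [← h3, enorm_of_nonneg (by positivity)]
  refine (enorm_sum_le _ _).trans ((sum_le_sum hb).trans ?_)
  rw [← sum_mul]
  refine (mul_le_mul_left (geo_sum_le' _ _) _).trans (Eq.le ?_)
  push_cast
  ring

lemma hs_add (hψ : Nice ψ) (e : ℝ²) (T : Finset ℤ) {g : ℝ² → ℝ} (hf : Nice f)
    (hg : Nice g) (q : ℝ²) :
    Hs ψ e T (fun q => f q + g q) q = Hs ψ e T f q + Hs ψ e T g q := by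
  simp only [Hs, ← sum_add_distrib]
  exact sum_congr rfl fun l _ => cv_add (hψ.dil l) hf hg e q

lemma hs_sub (hψ : Nice ψ) (e : ℝ²) (T : Finset ℤ) {g : ℝ² → ℝ} (hf : Nice f)
    (hg : Nice g) (q : ℝ²) :
    Hs ψ e T (fun q => f q - g q) q = Hs ψ e T f q - Hs ψ e T g q := by
  simp only [Hs, ← sum_sub_distrib]
  exact sum_congr rfl fun l _ => cv_sub (hψ.dil l) hf hg e q

lemma hs_bz_telescope (hψ : Nice ψ) (e : ℝ²) (T : Finset ℤ)
    (hf : Nice f) (i j : ℤ) (m : ℕ) (q : ℝ²) :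
    Hs ψ e T (bz Om vpi (i + m) j f) q = Hs ψ e T (bz Om vpi i j f) q +
      ∑ s ∈ range m, Hs ψ e T (bz (deriv pip) vpi (i + s) j f) q := by
  induction m with
  | zero => simp
  | succ m ih =>
    rw [sum_range_succ, ← add_assoc, ← ih]
    have hO := sk_Om.nice
    have hg : Nice (cv (dil j vpi) ey f) := (sk_vpi.nice.dil j).cv hf _
    have h : bz (deriv pip) vpi (i + m) j f =
        fun q => bz Om vpi (i + (m + 1 : ℕ)) j f q - bz Om vpi (i + m) j f q := by
      funext q
      rw [bz, bz, bz, ← cv_sub_left (hO.dil _) (hO.dil _) hg, deriv_pip]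
      congr 1
      funext t
      have h1 := congrFun (dil_dil (i + m) 1 Om) t
      rw [Nat.cast_add, Nat.cast_one, ← add_assoc, ← h1]
      simp only [dil]; ring
    rw [h, hs_sub hψ e T (hO.bz sk_vpi.nice _ _ hf) (hO.bz sk_vpi.nice _ _ hf)]
    ring

def tz (T : Finset ℤ) (x : ℤ × ℤ) : Finset ℤ := {l ∈ T | l < x.1 - x.2}

def bb (C : ℝ≥0) (ψ : ℝ → ℝ) (T : Finset ℤ) (f : ℝ² → ℝ) (s : ℕ) (x : ℤ × ℤ)
    (q : ℝ²) : ℝ≥0∞ :=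
  C * MM (ek x.2) (en (bz pip vpi (x.1 - x.2 + s) x.1 f)) q +
    en (Hs ψ (ek x.2) (tz T x) (bz pip (deriv vpi) (x.1 - x.2 + s) x.1 f)) q

lemma enorm_le_of_parts {a : ℝ} (s : ℕ) (h : ‖2 ^ s * a + b‖ₑ ≤ Y) :
    ‖a‖ₑ ≤ 2⁻¹ ^ s * (Y + ‖b‖ₑ) := by
  have h1 : ‖2 ^ s * a‖ₑ ≤ Y + ‖b‖ₑ := by
    have : 2 ^ s * a = (2 ^ s * a + b) - b := by ring
    rw [this]
    exact enorm_sub_le.trans (add_le_add_left h _)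
  rw [enorm_mul, enorm_pow] at h1
  have h2 : ‖(2 : ℝ)‖ₑ = 2 := by simp [Real.enorm_eq_ofReal]
  rw [h2] at h1
  calc ‖a‖ₑ = 2⁻¹ ^ s * (2 ^ s * ‖a‖ₑ) := by
        rw [← mul_assoc, ← mul_pow, ENNReal.inv_mul_cancel (by simp) (by simp), one_pow, one_mul]
    _ ≤ _ := mul_le_mul_right h1 _

lemma hs_coarse (hψ : SK ψ) : ∃ C : ℝ≥0, ∀ (x : ℤ × ℤ) (T : Finset ℤ) (N : ℤ) (M : ℕ),
    x.1 - x.2 ≤ N → N - (x.1 - x.2) ≤ M → ∀ f : ℝ² → ℝ, Nice f → ∀ q,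
    ‖Hs ψ (ek x.2) (tz T x) (cv (dil x.1 vpi) ey f) q‖ₑ ≤
      C * MM (ek x.2) (en (bz Om ppi (x.1 - x.2) x.1 f)) q +
      (en (Hs ψ (ek x.2) (tz T x) (bz (deriv Om) ppi (x.1 - x.2) x.1 f)) q +
        ∑ s ∈ range M, 2⁻¹ ^ s * bb C ψ T f s x q) +
      en (Hs ψ (ek x.2) (tz T x)
        (cv (dil x.1 vpi) ey fun q => f q - cv (dil N Om) ex f q)) q := by
  obtain ⟨C₁, h₁⟩ := hs_parts hψ sk_Om sk_ppi
  obtain ⟨C₂, h₂⟩ := hs_parts hψ sk_pip sk_vpi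
  refine ⟨C₁ + C₂, fun x T N M hN hM f hf q => ?_⟩
  obtain ⟨j, k⟩ := x
  simp only at hN hM ⊢
  set U := tz T (j, k)
  have hU : ∀ l ∈ U, l ≤ j - k := fun l hl => by
    simp only [U, tz, mem_filter] at hl; omega
  obtain ⟨m, hm⟩ := Int.eq_ofNat_of_zero_le (sub_nonneg.2 hN)
  have hmN : j - k + m = N := by omega
  have hmM : m ≤ M := by omega
  have hO := sk_Om.nice
  have hv := sk_vpi.nice
  have hd := hψ.nice
  have hW : Nice (cv (dil N Om) ex f) := (hO.dil N).cv hf _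
  have e1 : Hs ψ (ek k) U (cv (dil j vpi) ey f) q =
      Hs ψ (ek k) U (cv (dil j vpi) ey fun q => f q - cv (dil N Om) ex f q) q +
      Hs ψ (ek k) U (bz Om vpi (j - k + m) j f) q := by
    rw [← hs_add hd _ _ ((hv.dil j).cv (hf.sub hW) _) (hO.bz hv _ _ hf)]
    congr 1
    funext q
    rw [cv_sub (hv.dil j) hf hW, hmN, bz, cv_comm (hO.dil N) (hv.dil j) hf, sub_add_cancel]
  rw [hs_bz_telescope hd _ _ hf] at e1
  have a0 := h₁ j k 0 U hU f hf q
  rw [deriv_ppi, Nat.cast_zero, add_zero, add_comm (2 ^ 0 * _)] at a0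
  have a1 : ‖Hs ψ (ek k) U (bz Om vpi (j - k) j f) q‖ₑ ≤
      C₁ * MM (ek k) (en (bz Om ppi (j - k) j f)) q +
        en (Hs ψ (ek k) U (bz (deriv Om) ppi (j - k) j f)) q := by
    have := enorm_le_of_parts 0 (a := Hs ψ (ek k) U (bz Om vpi (j - k) j f) q)
      (b := Hs ψ (ek k) U (bz (deriv Om) ppi (j - k) j f) q) (by simpa using a0)
    rwa [pow_zero, one_mul] at this
  have a2 : ∀ s : ℕ, ‖Hs ψ (ek k) U (bz (deriv pip) vpi (j - k + s) j f) q‖ₑ ≤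
      2⁻¹ ^ s * bb (C₁ + C₂) ψ T f s (j, k) q := fun s => by
    refine (enorm_le_of_parts s (h₂ j k s U hU f hf q)).trans (mul_le_mul_right ?_ _)
    exact add_le_add_left (mul_le_mul_left (by push_cast; exact le_add_self) _) _
  rw [e1]
  refine (enorm_add_le _ _).trans ?_
  rw [add_comm]
  refine add_le_add ?_ le_rfl
  refine (enorm_add_le _ _).trans ?_
  rw [← add_assoc]
  refine add_le_add (a1.trans (add_le_add_left (mul_le_mul_left ?_ _) _)) ?_
  · push_cast; exact le_self_add
  · refine (enorm_sum_le _ _).trans ((sum_le_sum fun s _ => a2 s).trans ?_)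
    exact sum_le_sum_of_subset (Finset.range_mono hmM)

lemma vv_one (hp : 1 < p) : ∃ C : ℝ≥0, ∀ e, Sl e → ∀ (ι : Type) (s : Finset ι)
    (F : ι → ℝ² → ℝ≥0∞), (∀ i, BM (F i)) →
    nrm p (vsq s fun i => MM e (F i)) ≤ C * nrm p (vsq s F) := by
  obtain ⟨C, hC⟩ := vv_single hp
  exact ⟨C, fun e he ι s F hF => (hC e he).of_mem (zero_lt_one.trans hp) s (fun _ => e) F
    (fun _ _ => Finset.mem_singleton_self e) hF⟩

/-- The majorant of the part of `Hs` at scales finer than `j - k`. -/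
def aa (ψ : ℝ → ℝ) (T : Finset ℤ) (f : ℝ² → ℝ) (j : ℤ) (q : ℝ²) : ℝ≥0∞ :=
  (en (Hs ψ ex T (cv (dil j vpi) ey f)) q + MM ex (en (Hs ψ ex T (cv (dil j vpi) ey f))) q) +
    (MM ex (en (cv (dil j vpi) ey f)) q + MS (en (cv (dil j (deriv vpi)) ey f)) q)

lemma meas_aa (hψ : Nice ψ) (T : Finset ℤ) (hf : Nice f) (j : ℤ) :
    Measurable (aa ψ T f j) := by
  have h1 : Nice (cv (dil j vpi) ey f) := (sk_vpi.nice.dil j).cv hf _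
  have h2 : Nice (cv (dil j (deriv vpi)) ey f) := (sk_vpi.deriv.nice.dil j).cv hf _
  have h3 := hψ.hs ex T h1
  exact (h3.en_meas.add (meas_MM h3.en_meas _)).add
    ((meas_MM h1.en_meas _).add h2.bm.MS.meas)

lemma nrm_aa (hψ : Nice ψ) (hp : 1 < p)
    (hK : ∀ e, Sl e → ∀ (ι : Type) (s : Finset ι) (T : ι → Finset ℤ) (f : ι → ℝ² → ℝ),
      (∀ i, Nice (f i)) → nrm p (vsq s fun i => en (Hs ψ e (T i) (f i))) ≤
      K₀ * nrm p (vsq s fun i => en (f i))) :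
    ∃ K : ℝ≥0, ∀ (J T : Finset ℤ) (f : ℝ² → ℝ), Nice f →
    nrm p (vsq J (aa ψ T f)) ≤ K * nrm p (en f) := by
  obtain ⟨C, hC⟩ := vv_one hp
  obtain ⟨C', hC'⟩ := vv_ms hp
  obtain ⟨K₁, h₁⟩ := lp_one sk_vpi.lk integral_vpi hp
  obtain ⟨K₂, h₂⟩ := lp_one sk_vpi.deriv.lk sk_vpi.integral_deriv hp
  have hex : Sl ex := sl_one 0
  refine ⟨K₀ * K₁ + C * (K₀ * K₁) + (C * K₁ + C' * K₂), fun J T f hf => ?_⟩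
  have n1 : ∀ j, Nice (cv (dil j vpi) ey f) := fun j => (sk_vpi.nice.dil j).cv hf _
  have n2 : ∀ j, Nice (cv (dil j (deriv vpi)) ey f) := fun j =>
    (sk_vpi.deriv.nice.dil j).cv hf _
  have n3 : ∀ j, Nice (Hs ψ ex T (cv (dil j vpi) ey f)) := fun j => hψ.hs ex T (n1 j)
  have b1 := h₁ ey sl_y f J hf
  have b2 := h₂ ey sl_y f J hf
  have b3 := (hK ex hex ℤ J (fun _ => T) _ n1).trans (mul_le_mul_right b1 _)
  have b4 := (hC ex hex ℤ J _ fun j => (n3 j).bm).trans (mul_le_mul_right b3 _)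
  have b5 := (hC ex hex ℤ J _ fun j => (n1 j).bm).trans (mul_le_mul_right b1 _)
  have b6 := (hC' ℤ J _ fun j => (n2 j).bm).trans (mul_le_mul_right b2 _)
  have m1 := fun j => (n1 j).en_meas
  have m3 := fun j => (n3 j).en_meas
  refine (BM.vsq_nrm_add hp.le
    (F := fun j q => en (Hs ψ ex T (cv (dil j vpi) ey f)) q +
      MM ex (en (Hs ψ ex T (cv (dil j vpi) ey f))) q)
    (G := fun j q => MM ex (en (cv (dil j vpi) ey f)) q +
      MS (en (cv (dil j (deriv vpi)) ey f)) q)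
    (fun j => (m3 j).add (meas_MM (m3 j) _))
    (fun j => (meas_MM (m1 j) _).add (n2 j).bm.MS.meas)).trans ?_
  refine (add_le_add (BM.vsq_nrm_add hp.le m3 fun j => meas_MM (m3 j) ex)
    (BM.vsq_nrm_add hp.le (fun j => meas_MM (m1 j) ex) fun j => (n2 j).bm.MS.meas)).trans ?_
  refine (add_le_add (add_le_add b3 b4) (add_le_add b5 b6)).trans (Eq.le ?_)
  push_cast
  ring

lemma nrm_bb (hψ : Nice ψ) (hp : 1 < p)
    (hK : ∀ (ι : Type) (s : Finset ι) (k : ι → ℤ) (T : ι → Finset ℤ) (f : ι → ℝ² → ℝ),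
      (∀ i, Nice (f i)) → nrm p (vsq s fun i => en (Hs ψ (ek (k i)) (T i) (f i))) ≤
      K₀ * nrm p (vsq s fun i => en (f i))) (C₀ : ℝ≥0) :
    ∃ K : ℝ≥0, ∀ (Q : Finset (ℤ × ℤ)) (T : Finset ℤ) (f : ℝ² → ℝ), Nice f → ∀ s : ℕ,
    (∀ x, Measurable (bb C₀ ψ T f s x)) ∧ nrm p (vsq Q (bb C₀ ψ T f s)) ≤ K * nrm p (en f) := by
  obtain ⟨C, hC⟩ := vv_ek hp
  obtain ⟨K₁, h₁⟩ := lp_bz sk_pip.lk sk_vpi.lk integral_pip integral_vpi hp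
  obtain ⟨K₂, h₂⟩ := lp_bz sk_pip.lk sk_vpi.deriv.lk integral_pip sk_vpi.integral_deriv hp
  have hp0 := zero_lt_one.trans hp
  refine ⟨C₀ * (C * K₁) + K₀ * K₂, fun Q T f hf s => ?_⟩
  have n1 : ∀ x : ℤ × ℤ, Nice (bz pip vpi (x.1 - x.2 + s) x.1 f) := fun x =>
    sk_pip.nice.bz sk_vpi.nice _ _ hf
  have n2 : ∀ x : ℤ × ℤ, Nice (bz pip (deriv vpi) (x.1 - x.2 + s) x.1 f) := fun x =>
    sk_pip.nice.bz sk_vpi.deriv.nice _ _ hf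
  have m1 : ∀ x : ℤ × ℤ, Measurable (MM (ek x.2) (en (bz pip vpi (x.1 - x.2 + s) x.1 f))) :=
    fun x => meas_MM (n1 x).en_meas _
  have m2 := fun x : ℤ × ℤ => (hψ.hs (ek x.2) (tz T x) (n2 x)).en_meas
  refine ⟨fun x => ((m1 x).const_mul _).add (m2 x), ?_⟩
  have b1 := (hC _ Q (fun x => x.2) _ fun x => (n1 x).bm).trans
    (mul_le_mul_right (h₁ Q s f hf) _)
  have b2 := (hK _ Q (fun x => x.2) (tz T) _ n2).trans (mul_le_mul_right (h₂ Q s f hf) _)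
  refine (BM.vsq_nrm_add hp.le
    (F := fun x q => C₀ * MM (ek x.2) (en (bz pip vpi (x.1 - x.2 + s) x.1 f)) q)
    (G := fun x => en (Hs ψ (ek x.2) (tz T x) (bz pip (deriv vpi) (x.1 - x.2 + s) x.1 f)))
    (fun x => (m1 x).const_mul _) m2).trans ?_
  rw [nrm_vsq_const_mul hp0]
  refine (add_le_add (mul_le_mul_right b1 _) b2).trans (Eq.le ?_)
  push_cast
  ring

/-- The square-summable part of the coarse-scale majorant. -/
def bc (C : ℝ≥0) (ψ : ℝ → ℝ) (T : Finset ℤ) (f : ℝ² → ℝ) (M : ℕ) (x : ℤ × ℤ)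
    (q : ℝ²) : ℝ≥0∞ :=
  en (Hs ψ (ek x.2) (tz T x) (bz (deriv Om) ppi (x.1 - x.2) x.1 f)) q +
    ∑ s ∈ range M, 2⁻¹ ^ s * bb C ψ T f s x q

lemma nrm_bc (hψ : Nice ψ) (hp : 1 < p)
    (hK : ∀ (ι : Type) (s : Finset ι) (k : ι → ℤ) (T : ι → Finset ℤ) (f : ι → ℝ² → ℝ),
      (∀ i, Nice (f i)) → nrm p (vsq s fun i => en (Hs ψ (ek (k i)) (T i) (f i))) ≤
      K₀ * nrm p (vsq s fun i => en (f i))) (C₀ : ℝ≥0) :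
    ∃ K : ℝ≥0, ∀ (Q : Finset (ℤ × ℤ)) (T : Finset ℤ) (f : ℝ² → ℝ), Nice f → ∀ M : ℕ,
    (∀ x, Measurable (bc C₀ ψ T f M x)) ∧ nrm p (vsq Q (bc C₀ ψ T f M)) ≤ K * nrm p (en f) := by
  obtain ⟨K₁, h₁⟩ := nrm_bb hψ hp hK C₀
  obtain ⟨K₂, h₂⟩ := lp_bz sk_Om.deriv.lk sk_ppi.lk sk_Om.integral_deriv integral_ppi hp
  have hp0 := zero_lt_one.trans hp
  refine ⟨K₀ * K₂ + 2 * K₁, fun Q T f hf M => ?_⟩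
  have n1 : ∀ x : ℤ × ℤ, Nice (bz (deriv Om) ppi (x.1 - x.2) x.1 f) := fun x =>
    sk_Om.deriv.nice.bz sk_ppi.nice _ _ hf
  have m1 := fun x : ℤ × ℤ => (hψ.hs (ek x.2) (tz T x) (n1 x)).en_meas
  have m2 : ∀ (s : ℕ) (x : ℤ × ℤ), Measurable fun q => 2⁻¹ ^ s * bb C₀ ψ T f s x q := fun s x =>
    ((h₁ Q T f hf s).1 x).const_mul _
  have m3 : ∀ x : ℤ × ℤ, Measurable fun q => ∑ s ∈ range M, 2⁻¹ ^ s * bb C₀ ψ T f s x q :=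
    fun x => Finset.measurable_fun_sum _ fun s _ => m2 s x
  refine ⟨fun x => (m1 x).add (m3 x), ?_⟩
  have b0 := h₂ Q 0 f hf
  simp only [Nat.cast_zero, add_zero] at b0
  have b1 := (hK _ Q (fun x => x.2) (tz T) _ n1).trans (mul_le_mul_right b0 _)
  have hs : ∀ s : ℕ, nrm p (vsq Q fun x q => 2⁻¹ ^ s * bb C₀ ψ T f s x q) ≤
      2⁻¹ ^ s * (K₁ * nrm p (en f)) := fun s => by
    have h := nrm_vsq_const_mul hp0 ((2⁻¹ : ℝ≥0) ^ s) Q (bb C₀ ψ T f s)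
    rw [coe_pow, coe_inv two_ne_zero, ENNReal.coe_ofNat] at h
    rw [h]
    exact mul_le_mul_right (h₁ Q T f hf s).2 _
  have b2 : nrm p (vsq Q fun x q => ∑ s ∈ range M, 2⁻¹ ^ s * bb C₀ ψ T f s x q) ≤
      2 * (K₁ * nrm p (en f)) := by
    refine (nrm_mono hp0 (vsq_sum_le Q (range M)
      fun s x q => 2⁻¹ ^ s * bb C₀ ψ T f s x q)).trans ?_
    refine (nrm_sum_le hp.le (F := fun s => vsq Q fun x q => 2⁻¹ ^ s * bb C₀ ψ T f s x q)
      (fun s => meas_vsq (m2 s) Q) _).trans ?_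
    refine (sum_le_sum fun s _ => hs s).trans ?_
    rw [← sum_mul]
    exact mul_le_mul_left (geo_sum_inj _ id Function.injective_id.injOn) _
  refine (BM.vsq_nrm_add hp.le
    (F := fun x => en (Hs ψ (ek x.2) (tz T x) (bz (deriv Om) ppi (x.1 - x.2) x.1 f)))
    (G := fun x q => ∑ s ∈ range M, 2⁻¹ ^ s * bb C₀ ψ T f s x q) m1 m3).trans ?_
  refine (add_le_add b1 b2).trans (Eq.le ?_)
  push_cast
  ring

lemma mm_bz_le : ∃ C : ℝ≥0, ∀ (S : Finset ℤ) (n j k : ℤ), k ∈ S → ∀ (f : ℝ² → ℝ) (q : ℝ²),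
    MM (ek k) (en (bz Om ppi n j f)) q ≤
      C * MD (S.image ek) (MM ex (en (cv (dil j ppi) ey f))) q := by
  obtain ⟨B, r, hB⟩ := sk_Om.nice.bd
  refine ⟨(2 * B).toNNReal, fun S n j k hk f q => ?_⟩
  refine (MM_mono (fun q => enorm_cv_le_MM (hB.dil n) ex (fun _ => le_rfl) q) (ek k) q).trans ?_
  refine (MM_const_mul _ ofReal_ne_top _ _).le.trans ?_
  exact mul_le_mul_right (MM_le_MD (mem_image_of_mem ek hk) _ q) _

lemma hs_split (ψ : ℝ → ℝ) (e : ℝ²) (T : Finset ℤ) (x : ℤ × ℤ) (g : ℝ² → ℝ) (q : ℝ²) :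
    Hs ψ e T g q = Hs ψ e {l ∈ T | x.1 - x.2 ≤ l} g q + Hs ψ e (tz T x) g q := by
  simp only [Hs, tz, ← not_le]
  exact (Finset.sum_filter_add_sum_filter_not _ _ _).symm

def rr (ψ : ℝ → ℝ) (T : Finset ℤ) (f : ℝ² → ℝ) (N : ℤ) (x : ℤ × ℤ) : ℝ² → ℝ :=
  Hs ψ (ek x.2) (tz T x) (cv (dil x.1 vpi) ey fun q => f q - cv (dil N Om) ex f q)

lemma nrm_rr (hψ : Nice ψ) (hp : 1 < p)
    (hK : ∀ (ι : Type) (s : Finset ι) (k : ι → ℤ) (T : ι → Finset ℤ) (f : ι → ℝ² → ℝ),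
      (∀ i, Nice (f i)) → nrm p (vsq s fun i => en (Hs ψ (ek (k i)) (T i) (f i))) ≤
      K₀ * nrm p (vsq s fun i => en (f i))) (Q : Finset (ℤ × ℤ)) :
    ∃ K : ℝ≥0, ∀ (T : Finset ℤ) (f : ℝ² → ℝ), Nice f → ∀ N : ℤ,
    (∀ x, Nice (rr ψ T f N x)) ∧ nrm p (vsq Q fun x => en (rr ψ T f N x)) ≤
      K * nrm p (en fun q => f q - cv (dil N Om) ex f q) := by
  obtain ⟨K₁, h₁⟩ := lp_one sk_vpi.lk integral_vpi hp
  have hp0 := zero_lt_one.trans hp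
  refine ⟨K₀ * (Q.card * K₁), fun T f hf N => ?_⟩
  have n0 : Nice (fun q => f q - cv (dil N Om) ex f q) :=
    hf.sub ((sk_Om.nice.dil N).cv hf _)
  have n1 : ∀ x : ℤ × ℤ, Nice (cv (dil x.1 vpi) ey fun q => f q - cv (dil N Om) ex f q) :=
    fun x => (sk_vpi.nice.dil x.1).cv n0 _
  refine ⟨fun x => hψ.hs _ _ (n1 x), (hK _ Q (fun x => x.2) (tz T) _ n1).trans ?_⟩
  rw [coe_mul, mul_assoc]
  refine mul_le_mul_right ((nrm_vsq_le_sum hp.le Q fun x => (n1 x).en_meas).trans ?_) _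
  have h2 : ∀ x ∈ Q, nrm p (en (cv (dil x.1 vpi) ey fun q => f q - cv (dil N Om) ex f q)) ≤
      K₁ * nrm p (en fun q => f q - cv (dil N Om) ex f q) := fun x _ =>
    (nrm_mono hp0 fun q => le_vsq (Finset.mem_singleton_self x.1)
      (fun j => en (cv (dil j vpi) ey fun q => f q - cv (dil N Om) ex f q)) q).trans
      (h₁ ey sl_y _ {x.1} n0)
  refine (sum_le_sum h2).trans (Eq.le ?_)
  rw [sum_const, nsmul_eq_mul]; push_cast; ring

lemma hs_pointwise (hψ : SK ψ) (hψ0 : ∫ t, ψ t = 0) : ∃ C C₀ : ℝ≥0,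
    ∀ (S T : Finset ℤ) (x : ℤ × ℤ), x.2 ∈ S → ∀ (N : ℤ) (M : ℕ),
    x.1 - x.2 ≤ N → N - (x.1 - x.2) ≤ M → ∀ f : ℝ² → ℝ, Nice f → ∀ q,
    en (Hs ψ (ek x.2) T (cv (dil x.1 vpi) ey f)) q ≤
      C * (aa ψ T f x.1 q + MD (S.image ek) (MM ex (en (cv (dil x.1 ppi) ey f))) q) +
      (bc C₀ ψ T f M x q + en (rr ψ T f N x) q) := by
  obtain ⟨C₁, h₁⟩ := hs_fine hψ.lk hψ0 sk_vpi
  obtain ⟨C₂, h₂⟩ := hs_coarse hψ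
  obtain ⟨C₃, h₃⟩ := mm_bz_le
  refine ⟨C₁ + C₂ * C₃, C₂, fun S T x hx N M hN hM f hf q => ?_⟩
  have a1 := h₁ x.1 x.2 T f hf q
  have a2 := h₂ x T N M hN hM f hf q
  have a3 := mul_le_mul_right (h₃ S (x.1 - x.2) x.1 x.2 hx f q) (C₂ : ℝ≥0∞)
  rw [en, hs_split ψ _ T x]
  refine (enorm_add_le _ _).trans ((add_le_add a1 (a2.trans (add_le_add
    (add_le_add a3 le_rfl) le_rfl))).trans ?_)
  change C₁ * aa ψ T f x.1 q + (C₂ * (C₃ * _) + bc C₂ ψ T f M x q + en (rr ψ T f N x) q) ≤ _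
  generalize aa ψ T f x.1 q = A
  generalize MD (S.image ek) (MM ex (en (cv (dil x.1 ppi) ey f))) q = D
  generalize bc C₂ ψ T f M x q = B
  generalize en (rr ψ T f N x) q = R
  push_cast
  calc _ = C₁ * A + C₂ * C₃ * D + (B + R) := by ring
    _ ≤ _ := by
      refine add_le_add ?_ le_rfl
      rw [mul_add]
      exact add_le_add (mul_le_mul_left le_self_add _) (mul_le_mul_left le_add_self _)

lemma iSup_le_vsq_add (S : Finset ℤ) {G : ℤ → ℝ≥0∞} {A : ℝ≥0∞} {B R : ℤ → ℝ² → ℝ≥0∞}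
    (q : ℝ²) (h : ∀ k ∈ S, G k ≤ A + (B k q + R k q)) :
    ⨆ k ∈ S, G k ≤ A + (vsq S B q + vsq S R q) :=
  iSup₂_le fun k hk => (h k hk).trans
    (add_le_add le_rfl (add_le_add (le_vsq hk B q) (le_vsq hk R q)))

lemma nrm_vsq_sup (hp : 1 ≤ p) (C : ℝ≥0) (J S : Finset ℤ) {G : ℤ → ℤ → ℝ² → ℝ≥0∞}
    {A D : ℤ → ℝ² → ℝ≥0∞} {B R : ℤ × ℤ → ℝ² → ℝ≥0∞} (hA : ∀ j, Measurable (A j))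
    (hD : ∀ j, Measurable (D j)) (hB : ∀ x, Measurable (B x)) (hR : ∀ x, Measurable (R x))
    (h : ∀ j ∈ J, ∀ k ∈ S, ∀ q, G j k q ≤ C * (A j q + D j q) + (B (j, k) q + R (j, k) q)) :
    nrm p (vsq J fun j q => ⨆ k ∈ S, G j k q) ≤
      C * (nrm p (vsq J A) + nrm p (vsq J D)) + (nrm p (vsq (J ×ˢ S) B) + nrm p (vsq (J ×ˢ S) R)) := by
  have hp0 := zero_lt_one.trans_le hp
  have mB : ∀ j, Measurable (vsq S fun k => B (j, k)) := fun j => meas_vsq (fun k => hB _) S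
  have mR : ∀ j, Measurable (vsq S fun k => R (j, k)) := fun j => meas_vsq (fun k => hR _) S
  refine (nrm_mono hp0 fun q => vsq_mono (F := fun j q => ⨆ k ∈ S, G j k q)
    (G := fun j q => C * (A j q + D j q) +
      (vsq S (fun k => B (j, k)) q + vsq S (fun k => R (j, k)) q))
    (fun j hj q => iSup_le_vsq_add S (G := fun k => G j k q) (B := fun k => B (j, k))
      (R := fun k => R (j, k)) q fun k hk => h j hj k hk q) q).trans ?_
  refine (BM.vsq_nrm_add hp (F := fun j q => C * (A j q + D j q))
    (G := fun j q => vsq S (fun k => B (j, k)) q + vsq S (fun k => R (j, k)) q)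
    (fun j => ((hA j).add (hD j)).const_mul _) fun j => (mB j).add (mR j)).trans ?_
  refine add_le_add ?_ ?_
  · refine (nrm_vsq_const_mul hp0 C J fun j q => A j q + D j q).le.trans ?_
    exact mul_le_mul_right (BM.vsq_nrm_add hp hA hD) _
  · refine (BM.vsq_nrm_add hp (F := fun j => vsq S fun k => B (j, k))
      (G := fun j => vsq S fun k => R (j, k)) mB mR).trans (Eq.le ?_)
    congr 2
    · funext q; exact (vsq_prod J S B q).symm
    · funext q; exact (vsq_prod J S R q).symm

/-- The maximal estimate for the directional operators applied to vertical frequency pieces. -/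
lemma hs_sup_sq (h₁ : SK θ₁) (h₂ : SK θ₂) (h₁0 : ∫ t, θ₁ t = 0)
    (h₂0 : ∫ t, θ₂ t = 0) (hp : 1 < p) : ∃ K : ℝ≥0, ∀ (S J T : Finset ℤ) (f : ℝ² → ℝ),
    Continuous f → HasCompactSupport f →
    nrm p (vsq J fun j q => ⨆ k ∈ S, en (Hs (cv θ₁ 1 θ₂) (ek k) T (cv (dil j vpi) ey f)) q) ≤
      K * nrm p (en f) := by
  have hψ : SK (cv θ₁ 1 θ₂) := h₁.cv h₂
  have hψ0 : ∫ t, cv θ₁ 1 θ₂ t = 0 := by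
    rw [integral_cv_one h₁.nice h₂.nice, h₁0, zero_mul]
  obtain ⟨K₀, hK₀⟩ := hs_ek h₁.lk h₂.lk h₁0 h₂0 hp
  obtain ⟨K₀', hK₀'⟩ := hs_sl h₁.lk h₂.lk h₁0 h₂0 hp
  generalize cv θ₁ 1 θ₂ = ψ at *
  obtain ⟨C, C₀, hC⟩ := hs_pointwise hψ hψ0
  obtain ⟨Ka, ha⟩ := nrm_aa hψ.nice hp hK₀'
  obtain ⟨Kb, hb⟩ := nrm_bc hψ.nice hp hK₀ C₀
  obtain ⟨Cd, hd⟩ := vs_ek hp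
  obtain ⟨Cx, hx⟩ := vv_one hp
  obtain ⟨Kp, hp'⟩ := lp_one sk_ppi.lk integral_ppi hp
  refine ⟨C * (Ka + Cd * (Cx * Kp)) + Kb, fun S J T f hf hfs => ?_⟩
  have hn := Nice.of_cc hf hfs
  have n1 : ∀ j, Nice (cv (dil j ppi) ey f) := fun j => (sk_ppi.nice.dil j).cv hn _
  have hD : nrm p (vsq J fun j => MD (S.image ek) (MM ex (en (cv (dil j ppi) ey f)))) ≤
      Cd * (Cx * (Kp * nrm p (en f))) :=
    (hd S ℤ J _ fun j => (n1 j).bm.MM ex).trans (mul_le_mul_right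
      ((hx ex (sl_one 0) ℤ J _ fun j => (n1 j).bm).trans (mul_le_mul_right
        (hp' ey sl_y f J hn) _)) _)
  obtain ⟨Kr, hr⟩ := nrm_rr hψ.nice hp hK₀ (J ×ˢ S)
  refine le_of_tendsto_rem (c := Kr)
    (tendsto_nrm_sub_cv sk_Om.nice integral_Om hf hfs (zero_lt_one.trans hp) ex)
    ⟨∑ x ∈ J ×ˢ S, |x.1 - x.2|, fun N hN => ?_⟩
  have hle : ∀ j ∈ J, ∀ k ∈ S, |j - k| ≤ ∑ x ∈ J ×ˢ S, |x.1 - x.2| := fun j hj k hk =>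
    single_le_sum (f := fun x : ℤ × ℤ => |x.1 - x.2|) (fun _ _ => abs_nonneg _)
      (Finset.mk_mem_product hj hk)
  set A := ∑ x ∈ J ×ˢ S, |x.1 - x.2|
  have hmain := nrm_vsq_sup hp.le C J S
    (G := fun j k => en (Hs ψ (ek k) T (cv (dil j vpi) ey f))) (A := aa ψ T f)
    (D := fun j => MD (S.image ek) (MM ex (en (cv (dil j ppi) ey f))))
    (B := bc C₀ ψ T f (N + A).toNat) (R := fun x => en (rr ψ T f N x))
    (meas_aa hψ.nice T hn) (fun j => (((n1 j).bm.MM ex).MD _).meas) (hb ∅ T f hn _).1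
    (fun x => ((hr T f hn N).1 x).en_meas) fun j hj k hk q =>
      hC S T (j, k) hk N _ (by have := abs_le.1 (hle j hj k hk); dsimp only; omega)
        (by have := abs_le.1 (hle j hj k hk); dsimp only; omega) f hn q
  refine hmain.trans ((add_le_add (mul_le_mul_right (add_le_add (ha J T f hn) hD) _)
    (add_le_add (hb _ T f hn _).2 (hr T f hn N).2)).trans (Eq.le ?_))
  push_cast
  ring

lemma nrm_sum_cv (hR : LK R) (hR0 : ∫ t, R t = 0) (hp : 1 < p) :
    ∃ K : ℝ≥0, ∀ e, Sl e → ∀ (J : Finset ℤ) (F : ℤ → ℝ² → ℝ), (∀ j, Nice (F j)) →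
    nrm p (en fun q => ∑ j ∈ J, cv (dil j R) e (F j) q) ≤ K * nrm p (vsq J fun j => en (F j)) := by
  have hpq := HolderConjugate.conjExponent hp
  obtain ⟨K, hK⟩ := lp_one hR.reflect (by rwa [integral_reflect]) hpq.symm.lt
  refine ⟨K, fun e he J F hF => ?_⟩
  have hn : ∀ j, Nice (cv (dil j R) e (F j)) := fun j => (hR.nice.dil j).cv (hF j) _
  have hU : Nice fun q => ∑ j ∈ J, cv (dil j R) e (F j) q := Nice.sum J fun j _ => hn j
  have e1 : nrm p (vsq {()} fun _ : Unit => en fun q => ∑ j ∈ J, cv (dil j R) e (F j) q) =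
      nrm p (en fun q => ∑ j ∈ J, cv (dil j R) e (F j) q) := by
    congr 1; funext q; exact vsq_singleton _ _ _
  rw [← e1]
  refine nrm_vsq_le_of_dual (s := {()})
    (U := fun _ : Unit => fun q => ∑ j ∈ J, cv (dil j R) e (F j) q) (fun _ => hU) hpq
    fun g hg => ?_
  have hB : ∀ j, Nice (cv (dil j fun t => R (-t)) e (g ())) := fun j =>
    (hR.nice.reflect.dil j).cv (hg ()) _
  have e2 : vsq {()} (fun i => en (g i)) = en (g ()) := by funext q; exact vsq_singleton _ _ _
  rw [sum_singleton, e2]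
  have hsum : ∫ q, (∑ j ∈ J, cv (dil j R) e (F j) q) * g () q =
      ∑ j ∈ J, ∫ q, F j q * cv (dil j fun t => R (-t)) e (g ()) q := by
    simp only [sum_mul]
    rw [integral_finsetSum _ fun j _ => ((hn j).mul (hg ())).integrable]
    refine sum_congr rfl fun j _ => ?_
    rw [integral_cv_mul (hR.nice.dil j) (hF j) (hg ()), dil_reflect]
  rw [hsum]
  refine (enorm_sum_le _ _).trans ((sum_le_sum (g := fun j =>
    ∫⁻ q, en (F j) q * en (cv (dil j fun t => R (-t)) e (g ())) q) fun j _ => ?_).trans ?_)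
  · refine (enorm_integral_le_lintegral_enorm _).trans (Eq.le ?_)
    simp only [enorm_mul, en]
  refine (sum_lintegral_mul_le hpq (F := fun j => en (F j))
    (G := fun j => en (cv (dil j fun t => R (-t)) e (g ()))) (fun j => (hF j).en_meas)
    (fun j => (hB j).en_meas) _).trans ?_
  refine (mul_le_mul_right (hK e he (g ()) J (hg ())) _).trans (Eq.le ?_)
  ring

/-- Selecting the direction at each point. -/
def sel (κ : ℝ² → ℤ) (S : Finset ℤ) (G : ℤ → ℝ² → ℝ) (q : ℝ²) : ℝ :=
  ∑ k ∈ S, G k q * (if κ q = k then 1 else 0)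

lemma Nice.sel {κ : ℝ² → ℤ} (hκ : Measurable κ) (S : Finset ℤ)
    (hG : ∀ k, Nice (G k)) : Nice (sel κ S G) :=
  Nice.sum S fun k _ => (hG k).mul_bdd (Measurable.ite (hκ (measurableSet_singleton k))
    measurable_const measurable_const) 1 fun q => by split_ifs <;> simp

lemma sel_eq {κ : ℝ² → ℤ} (h : κ q ∈ S) :
    sel κ S G q = G (κ q) q := by
  rw [sel, Finset.sum_eq_single (κ q) (fun k _ hk => by simp [hk.symm]) (fun h' => absurd h h')]
  simp

lemma en_sel_le (κ : ℝ² → ℤ) (S : Finset ℤ) (G : ℤ → ℝ² → ℝ) (q : ℝ²) :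
    en (sel κ S G) q ≤ ⨆ k ∈ S, en (G k) q := by
  by_cases h : κ q ∈ S
  · rw [en, sel_eq h]
    exact le_iSup₂ (f := fun k _ => en (G k) q) _ h
  · have : sel κ S G q = 0 := Finset.sum_eq_zero fun k hk => by
      rw [if_neg (fun e : κ q = k => h (e ▸ hk)), mul_zero]
    rw [en, this, enorm_zero]; exact bot_le

/-- Points around which `κ` is constant on a vertical segment of length comparable to
`2 ^ (-κ)`. -/
def Good (κ : ℝ² → ℤ) (S : Finset ℤ) (q : ℝ²) : Prop :=
  κ q ∈ S ∧ ∀ s : ℝ, |s| ≤ 2 ^ (-κ q) / 4 → κ (q - s • ey) = κ q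

lemma cv_sel {κ : ℝ² → ℤ} (hq : Good κ S q) (hR : ∀ t, 2 ^ (-κ q) / 4 < |t| → R t = 0) :
    cv R ey (sel κ S G) q = cv R ey (G (κ q)) q := by
  unfold cv
  congr 1
  funext t
  by_cases ht : 2 ^ (-κ q) / 4 < |t|
  · rw [hR t ht, zero_mul, zero_mul]
  · have h := hq.2 t (not_lt.1 ht)
    rw [sel_eq (h ▸ hq.1), h]

lemma hs_cv (hψ : Nice ψ) (hR : Nice R) (e e' : ℝ²) (T : Finset ℤ) (hf : Nice f) : Hs ψ e T
    (cv R e' f) = cv R e' (Hs ψ e T f) := by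
  funext q
  have : Hs ψ e T f = fun q => ∑ l ∈ T, cv (dil l ψ) e f q := rfl
  rw [this, cv_sum T hR fun l _ => (hψ.dil l).cv hf e]
  exact sum_congr rfl fun l _ => by rw [cv_comm (hψ.dil l) hR hf]

lemma hs_telescope (hψ : Nice ψ) (e : ℝ²) (T : Finset ℤ)
    (hf : Nice f) (i : ℤ) (m : ℕ) (q : ℝ²) :
    Hs ψ e T (cv (dil (i + m) Om) ey f) q = Hs ψ e T (cv (dil i Om) ey f) q +
      ∑ j ∈ Ico i (i + m), cv (dil j vpt) ey (Hs ψ e T (cv (dil j vpi) ey f)) q := by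
  induction m with
  | zero => simp
  | succ m ih =>
    have hO := sk_Om.nice
    have hI : Ico i (i + (m + 1 : ℕ)) = insert (i + (m : ℤ)) (Ico i (i + m)) := by
      ext a; simp only [mem_Ico, mem_insert]; push_cast; omega
    rw [hI, sum_insert (by simp), add_left_comm, ← ih]
    have h : cv (dil (i + m) vpt) ey (cv (dil (i + m) vpi) ey f) =
        fun q => cv (dil (i + (m + 1 : ℕ)) Om) ey f q - cv (dil (i + m) Om) ey f q := by
      funext q
      rw [← cv_sub_left (hO.dil _) (hO.dil _) hf, cv_comm (sk_vpt.nice.dil _) (sk_vpi.nice.dil _) hf,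
        ← cv_cv (sk_vpi.nice.dil _) (sk_vpt.nice.dil _) hf, ← dil_cv]
      congr 1
      funext t
      have h1 := congrFun (dil_dil (i + m) 1 Om) t
      rw [Nat.cast_add, Nat.cast_one, ← add_assoc, ← h1]
      simp only [dil, ← dil_one_Om_sub]; ring
    rw [← hs_cv hψ (sk_vpt.nice.dil _) e ey T ((sk_vpi.nice.dil _).cv hf _), h,
      hs_sub hψ e T ((hO.dil _).cv hf _) ((hO.dil _).cv hf _)]
    ring

lemma two_zpow_sum_le (hT : ∀ l ∈ T, 0 ≤ l) (c : ℤ) :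
    ∑ l ∈ T, ofReal (2 ^ (c - l)) ≤ ofReal (2 ^ c) * 4 := by
  have h : ∀ l ∈ T, ofReal (2 ^ (c - l)) ≤ ofReal (2 ^ c) * geo (0 - l) := by
    intro l hl
    have h := ofReal_mul_geo (zero_le_one' ℝ) (hT l hl)
    rw [one_mul, toNNReal_one, coe_one, one_mul] at h
    rw [← h, ← ofReal_mul (by positivity), ← zpow_add₀ two_ne_zero]
    exact le_of_eq (by congr 2; ring)
  refine (sum_le_sum h).trans ?_
  rw [← mul_sum]
  exact mul_le_mul_right (geo_sum_le T 0) _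

lemma hs_low (hψ : Nice ψ) (c₀ : ℤ) : ∃ C : ℝ≥0, ∀ (k : ℤ) (T : Finset ℤ),
    (∀ l ∈ T, 0 ≤ l) → ∀ f : ℝ² → ℝ, Nice f → ∀ q,
    ‖Hs ψ (ek k) T (cv (dil (k + c₀) Om) ey f) q‖ₑ ≤
      C * (MS (MM ey (en f)) q + MM ey (en (Hs ψ ex T f)) q) := by
  obtain ⟨C₁, h₁⟩ := cv_dir_diff hψ sk_Om
  obtain ⟨B, r, hB⟩ := sk_Om.nice.bd
  obtain ⟨B', r', hB'⟩ := sk_Om.deriv.nice.bd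
  refine ⟨C₁ * ((2 ^ c₀ : ℝ).toNNReal * 4) * (2 * B').toNNReal + (2 * B).toNNReal,
    fun k T hT f hf q => ?_⟩
  have e1 : Hs ψ (ek k) T (cv (dil (k + c₀) Om) ey f) q =
      ∑ l ∈ T, (cv (dil l ψ) (ek k) (cv (dil (k + c₀) Om) ey f) q -
        cv (dil l ψ) ex (cv (dil (k + c₀) Om) ey f) q) +
      cv (dil (k + c₀) Om) ey (Hs ψ ex T f) q := by
    rw [← hs_cv hψ (sk_Om.nice.dil _) ex ey T hf, sum_sub_distrib]
    simp [Hs]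
  have h2 : MS (en (cv (dil (k + c₀) (deriv Om)) ey f)) q ≤
      (2 * B').toNNReal * MS (MM ey (en f)) q := by
    have h3 := fun q => enorm_cv_le_MM (hB'.dil (k + c₀)) ey (f := f) (fun _ => le_rfl) q
    refine (MM_mono (MM_mono h3 ey) ex q).trans (Eq.le ?_)
    have h4 : MM ey (fun q => ofReal (2 * B') * MM ey (fun q => ‖f q‖ₑ) q) =
        fun q => ofReal (2 * B') * MM ey (MM ey (en f)) q := by
      funext q; exact MM_const_mul _ ofReal_ne_top _ _
    rw [h4]
    exact MM_const_mul _ ofReal_ne_top _ _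
  rw [e1]
  refine (enorm_add_le _ _).trans ?_
  have h5 := (enorm_sum_le T fun l => cv (dil l ψ) (ek k) (cv (dil (k + c₀) Om) ey f) q -
    cv (dil l ψ) ex (cv (dil (k + c₀) Om) ey f) q).trans
    (sum_le_sum fun l _ => h₁ l k (k + c₀) f hf q)
  rw [← sum_mul, ← mul_sum] at h5
  have h6 : ∀ l, k + c₀ - l - k = c₀ - l := fun l => by ring
  simp only [h6] at h5
  refine (add_le_add (h5.trans (mul_le_mul' (mul_le_mul_right (two_zpow_sum_le hT c₀) _) h2))
    (enorm_cv_le_MM (hB.dil _) ey (fun _ => le_rfl) q)).trans ?_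
  change _ + (2 * B).toNNReal * MM ey (en (Hs ψ ex T f)) q ≤ _
  have h7 : ofReal (2 ^ c₀) = (2 ^ c₀ : ℝ).toNNReal := rfl
  rw [h7]
  generalize MS (MM ey (en f)) q = X
  generalize MM ey (en (Hs ψ ex T f)) q = Y
  generalize (2 ^ c₀ : ℝ).toNNReal = a
  generalize (2 * B).toNNReal = b
  generalize (2 * B').toNNReal = b'
  rw [mul_add, ← mul_assoc]
  push_cast
  exact add_le_add (mul_le_mul_left le_self_add _) (mul_le_mul_left le_add_self _)

lemma exists_vpt_scale : ∃ c₀ : ℤ, ∀ k j : ℤ, k + c₀ ≤ j → ∀ t : ℝ, 2 ^ (-k) / 4 < |t| →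
    dil j vpt t = 0 := by
  obtain ⟨B, r, hB⟩ := sk_vpt.nice.bd
  obtain ⟨n, hn⟩ := pow_unbounded_of_one_lt (4 * r) one_lt_two
  refine ⟨n, fun k j hj t ht => (hB.dil j).supp t (lt_of_le_of_lt ?_ ht)⟩
  have h1 : (2 : ℝ) ^ (-j) ≤ 2 ^ (-k) * 2 ^ (-(n : ℤ)) := by
    rw [← zpow_add₀ two_ne_zero]
    exact zpow_le_zpow_right₀ one_le_two (by omega)
  have h2 : r * (2 : ℝ) ^ (-(n : ℤ)) ≤ 1 / 4 := by
    rw [zpow_neg, zpow_natCast, ← div_eq_mul_inv, div_le_iff₀ (by positivity)]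
    linarith
  have h3 : (0 : ℝ) < 2 ^ (-k) := by positivity
  nlinarith [mul_le_mul_of_nonneg_left h1 hB.pos.le]

/-- The pieces of the selected singular integral at frequency `2 ^ j`. -/
def fs (ψ : ℝ → ℝ) (κ : ℝ² → ℤ) (S T : Finset ℤ) (f : ℝ² → ℝ) (j : ℤ) :
    ℝ² → ℝ := sel κ S fun k => Hs ψ (ek k) T (cv (dil j vpi) ey f)

/-- The resummation of the pieces `fs`. -/
def gs (ψ : ℝ → ℝ) (κ : ℝ² → ℤ) (S T J : Finset ℤ) (f : ℝ² → ℝ)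
    (q : ℝ²) : ℝ := ∑ j ∈ J, cv (dil j vpt) ey (fs ψ κ S T f j) q

lemma Nice.fs (hψ : Nice ψ) {κ : ℝ² → ℤ} (hκ : Measurable κ) (S T : Finset ℤ) (hf : Nice f)
    (j : ℤ) : Nice (fs ψ κ S T f j) :=
  Nice.sel hκ S fun k => hψ.hs (ek k) T ((sk_vpi.nice.dil j).cv hf ey)

lemma Nice.gs (hψ : Nice ψ) {κ : ℝ² → ℤ} (hκ : Measurable κ) (S T J : Finset ℤ)
    (hf : Nice f) : Nice (gs ψ κ S T J f) :=
  Nice.sum J fun j _ => (sk_vpt.nice.dil j).cv (hψ.fs hκ S T hf j) ey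

lemma hs_good (hψ : Nice ψ) : ∃ (C : ℝ≥0) (c₀ : ℤ), ∀ (κ : ℝ² → ℤ)
    (S T : Finset ℤ), Measurable κ → (∀ l ∈ T, 0 ≤ l) → ∀ f : ℝ² → ℝ, Nice f →
    ∀ J₀ N : ℤ, (∀ k ∈ S, J₀ ≤ k + c₀ ∧ k + c₀ ≤ N) → ∀ q, Good κ S q →
    ‖Hs ψ (ek (κ q)) T f q‖ₑ ≤
      C * (MS (MM ey (en f)) q + MM ey (en (Hs ψ ex T f)) q) +
      C * (en (gs ψ κ S T (Ico J₀ N) f) q + MM ey (en (gs ψ κ S T (Ico J₀ N) f)) q +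
        4 * vsq (Ico J₀ N) (fun j => MM ey (en (fs ψ κ S T f j))) q) +
      ∑ k ∈ S, en (Hs ψ (ek k) T fun q => f q - cv (dil N Om) ey f q) q := by
  obtain ⟨c₀, hc₀⟩ := exists_vpt_scale
  obtain ⟨C₁, h₁⟩ := hs_low hψ c₀
  obtain ⟨C₂, h₂⟩ := cotlar sk_vpt.lk integral_vpt
  refine ⟨max C₁ C₂, c₀, fun κ S T hκ hT f hf J₀ N hJ q hq => ?_⟩
  set k := κ q with hk
  obtain ⟨hJ1, hJ2⟩ := hJ k hq.1
  obtain ⟨n, hn⟩ := Int.le.dest hJ2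
  have hO := sk_Om.nice.dil N
  have e1 := hs_sub hψ (ek k) T hf (hO.cv hf ey) q
  have e2 := hs_telescope hψ (ek k) T hf (k + c₀) n q
  rw [hn] at e2
  have e3 : ∑ j ∈ Ico (k + c₀) N, cv (dil j vpt) ey
      (Hs ψ (ek k) T (cv (dil j vpi) ey f)) q =
      ∑ j ∈ Ico J₀ N with k + c₀ ≤ j, cv (dil j vpt) ey (fs ψ κ S T f j) q := by
    refine sum_congr ?_ fun j hj => ?_
    · ext j; simp only [mem_Ico, mem_filter]; omega
    · exact (cv_sel (G := fun k => Hs ψ (ek k) T (cv (dil j vpi) ey f)) hq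
        (hc₀ k j (mem_filter.1 hj).2)).symm
  have e4 : Hs ψ (ek k) T f q = Hs ψ (ek k) T (cv (dil (k + c₀) Om) ey f) q +
      ∑ j ∈ Ico J₀ N with k + c₀ ≤ j, cv (dil j vpt) ey (fs ψ κ S T f j) q +
      Hs ψ (ek k) T (fun q => f q - cv (dil N Om) ey f q) q := by
    rw [e1, e2, ← e3]; ring
  rw [e4]
  refine (enorm_add_le _ _).trans (add_le_add ((enorm_add_le _ _).trans (add_le_add ?_ ?_)) ?_)
  · exact (h₁ k T hT f hf q).trans
      (mul_le_mul_left (coe_le_coe.2 (le_max_left _ _)) _)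
  · refine (h₂ ey (k + c₀) _ _ (hψ.fs hκ S T hf) q).trans
      (mul_le_mul' (coe_le_coe.2 (le_max_right _ _)) (add_le_add_right ?_ _))
    have h5 : ∀ j ∈ Ico J₀ N, geo (j - (k + c₀)) * MM ey (en (fs ψ κ S T f j)) q ≤
        geo (j - (k + c₀)) * vsq (Ico J₀ N) (fun j => MM ey (en (fs ψ κ S T f j))) q :=
      fun j hj => mul_le_mul_right (le_vsq hj (fun j => MM ey (en (fs ψ κ S T f j))) q) _
    refine (sum_le_sum h5).trans ?_
    rw [← sum_mul]
    exact mul_le_mul_left (geo_sum_le' _ _) _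
  · exact single_le_sum (f := fun k =>
      en (Hs ψ (ek k) T fun q => f q - cv (dil N Om) ey f q) q) (fun _ _ => bot_le) hq.1

lemma hs_one (h₁ : LK θ₁) (h₂ : LK θ₂) (h₁0 : ∫ t, θ₁ t = 0) (h₂0 : ∫ t, θ₂ t = 0) (hp : 1 < p) :
    ∃ K : ℝ≥0, ∀ e, Sl e → ∀ (T : Finset ℤ) (f : ℝ² → ℝ), Nice f →
    nrm p (en (Hs (cv θ₁ 1 θ₂) e T f)) ≤ K * nrm p (en f) := by
  obtain ⟨K, hK⟩ := hs_sl h₁ h₂ h₁0 h₂0 hp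
  refine ⟨K, fun e he T f hf => ?_⟩
  have h := hK e he Unit {()} (fun _ => T) (fun _ => f) fun _ => hf
  have e1 : vsq {()} (fun _ : Unit => en (Hs (cv θ₁ 1 θ₂) e T f)) =
      en (Hs (cv θ₁ 1 θ₂) e T f) := funext fun q => vsq_singleton _ _ _
  have e2 : vsq {()} (fun _ : Unit => en f) = en f := funext fun q => vsq_singleton _ _ _
  rwa [e1, e2] at h

lemma nrm_comb (hp : 1 ≤ p) (c : ℝ≥0) {A₁ A₂ A₃ A₄ A₅ A₆ : ℝ² → ℝ≥0∞}
    (h₁ : Measurable A₁) (h₂ : Measurable A₂) (h₃ : Measurable A₃) (h₄ : Measurable A₄)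
    (h₅ : Measurable A₅) (h₆ : Measurable A₆)
    (h : ∀ q, F q ≤ c * (A₁ q + A₂ q) + c * (A₃ q + A₄ q + 4 * A₅ q) + A₆ q) :
    nrm p F ≤ c * (nrm p A₁ + nrm p A₂) + c * (nrm p A₃ + nrm p A₄ + 4 * nrm p A₅) + nrm p A₆ := by
  have hp0 : 0 < p := by linarith
  have e : nrm p (fun q => 4 * A₅ q) = 4 * nrm p A₅ := nrm_const_mul hp0 4 A₅
  have n1 := nrm_const_mul hp0 c fun q => A₁ q + A₂ q
  have n2 := nrm_const_mul hp0 c fun q => A₃ q + A₄ q + 4 * A₅ q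
  have h45 := (h₃.add h₄).add (h₅.const_mul 4)
  refine (nrm_mono hp0 h).trans ((nrm_add_le hp
    (((h₁.add h₂).const_mul _).add (h45.const_mul _)) h₆).trans (add_le_add_left
    ((nrm_add_le hp ((h₁.add h₂).const_mul _) (h45.const_mul _)).trans ?_) _))
  refine add_le_add (n1.le.trans (mul_le_mul_right (nrm_add_le hp h₁ h₂) _))
    (n2.le.trans (mul_le_mul_right ?_ _))
  refine (nrm_add_le hp (h₃.add h₄) (h₅.const_mul 4)).trans (add_le_add (nrm_add_le hp h₃ h₄) e.le)

/-- The norm bound for the singular integral along a field of directions taking finitely many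
values, at the points around which the field is vertically locally constant. -/
lemma main_good (h₁ : SK θ₁) (h₂ : SK θ₂) (h₁0 : ∫ t, θ₁ t = 0)
    (h₂0 : ∫ t, θ₂ t = 0) (hp : 1 < p) : ∃ C : ℝ≥0, ∀ (κ : ℝ² → ℤ) (S T : Finset ℤ),
    Measurable κ → (∀ l ∈ T, 0 ≤ l) → ∀ f : ℝ² → ℝ, Continuous f → HasCompactSupport f →
    ∀ F : ℝ² → ℝ≥0∞,
    (∀ q, F q ≠ 0 → Good κ S q ∧ F q ≤ ‖Hs (cv θ₁ 1 θ₂) (ek (κ q)) T f q‖ₑ) →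
    nrm p F ≤ C * nrm p (en f) := by
  have hp0 : 0 < p := by linarith
  obtain ⟨K₁, hK₁⟩ := hs_one h₁.lk h₂.lk h₁0 h₂0 hp
  obtain ⟨K₂, hK₂⟩ := nrm_sum_cv sk_vpt.lk integral_vpt hp
  obtain ⟨K₃, hK₃⟩ := hs_sup_sq h₁ h₂ h₁0 h₂0 hp
  obtain ⟨K₄, hK₄⟩ := vv_one hp
  obtain ⟨B, hB⟩ := mb_single hp
  have hψ : Nice (cv θ₁ 1 θ₂) := (h₁.cv h₂).nice
  generalize cv θ₁ 1 θ₂ = ψ at *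
  obtain ⟨C, c₀, hC⟩ := hs_good hψ
  refine ⟨C * (B * (B * B) + B * K₁) + C * (K₂ * K₃ + B * (K₂ * K₃) + 4 * (K₄ * K₃)),
    fun κ S T hκ hT f hf hfs F hF => ?_⟩
  have hn := Nice.of_cc hf hfs
  refine le_of_tendsto_rem (c := S.card * K₁) (tendsto_nrm_sub_cv sk_Om.nice integral_Om hf hfs hp0 ey) ?_
  obtain ⟨N₀, hN₀⟩ := (S.image fun k => k + c₀).bddAbove
  obtain ⟨J₀, hJ₀⟩ := (S.image fun k => k + c₀).bddBelow
  refine ⟨N₀, fun N hN => ?_⟩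
  have hJ : ∀ k ∈ S, J₀ ≤ k + c₀ ∧ k + c₀ ≤ N := fun k hk =>
    have h := Finset.mem_coe.2 (mem_image_of_mem (fun k => k + c₀) hk)
    ⟨hJ₀ h, (hN₀ h).trans hN⟩
  have hfs : ∀ j, Nice (fs ψ κ S T f j) := fun j => hψ.fs hκ S T hn j
  have hG := hψ.gs hκ S T (Ico J₀ N) hn
  set d : ℝ² → ℝ := fun q => f q - cv (dil N Om) ey f q
  have hd : Nice d := hn.sub ((sk_Om.nice.dil N).cv hn ey)
  have m1 : Measurable (MS (MM ey (en f))) := meas_MM (meas_MM (meas_MM hn.en_meas _) _) _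
  have m2 : Measurable (MM ey (en (Hs ψ ex T f))) := meas_MM (hψ.hs ex T hn).en_meas _
  have m3 := meas_MM hG.en_meas ey
  have m4 : Measurable (vsq (Ico J₀ N) fun j => MM ey (en (fs ψ κ S T f j))) :=
    meas_vsq (fun j => meas_MM (hfs j).en_meas _) _
  have b1 : nrm p (MS (MM ey (en f))) ≤ B * (B * (B * nrm p (en f))) :=
    (hB ex (sl_one 0) _ (meas_MM (meas_MM hn.en_meas _) _)).trans (mul_le_mul_right
      ((hB ey sl_y _ (meas_MM hn.en_meas _)).trans (mul_le_mul_right (hB ey sl_y _ hn.en_meas) _)) _)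
  have b2 : nrm p (MM ey (en (Hs ψ ex T f))) ≤ B * (K₁ * nrm p (en f)) :=
    (hB ey sl_y _ (hψ.hs ex T hn).en_meas).trans (mul_le_mul_right (hK₁ ex (sl_one 0) T f hn) _)
  have b3 : nrm p (vsq (Ico J₀ N) fun j => en (fs ψ κ S T f j)) ≤ K₃ * nrm p (en f) :=
    (nrm_mono hp0 fun q => vsq_mono (F := fun j => en (fs ψ κ S T f j))
      (G := fun j q => ⨆ k ∈ S, en (Hs ψ (ek k) T (cv (dil j vpi) ey f)) q)
      (fun j _ q => en_sel_le κ S _ q) q).trans (hK₃ S _ T f hf ‹_›)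
  have b4 : nrm p (en (gs ψ κ S T (Ico J₀ N) f)) ≤ K₂ * (K₃ * nrm p (en f)) :=
    (hK₂ ey sl_y _ _ hfs).trans (mul_le_mul_right b3 _)
  have b5 := (hB ey sl_y _ hG.en_meas).trans (mul_le_mul_right b4 _)
  have b6 := (hK₄ ey sl_y ℤ (Ico J₀ N) _ fun j => (hfs j).bm).trans (mul_le_mul_right b3 _)
  have b7 : ∀ k ∈ S, nrm p (en (Hs ψ (ek k) T d)) ≤ K₁ * nrm p (en d) := fun k _ => hK₁ _ (sl_ek k) T _ hd
  have m5 : ∀ k, Measurable (en (Hs ψ (ek k) T d)) := fun k =>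
    (hψ.hs (ek k) T hd).en_meas
  have b8 := (nrm_sum_le hp.le m5 S).trans (sum_le_sum b7)
  rw [sum_const, nsmul_eq_mul, ← mul_assoc] at b8
  have m7 : Measurable fun q => ∑ k ∈ S, en (Hs ψ (ek k) T d) q :=
    Finset.measurable_fun_sum _ fun k _ => m5 k
  refine (nrm_comb hp.le C m1 m2 hG.en_meas m3 m4 m7 fun q => ?_).trans ?_
  · by_cases h : F q = 0
    · rw [h]; exact bot_le
    · exact (hF q h).2.trans (hC κ S T hκ hT f hn J₀ N hJ q (hF q h).1)
  refine (add_le_add (add_le_add (mul_le_mul_right (add_le_add b1 b2) _)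
    (mul_le_mul_right (add_le_add (add_le_add b4 b5) (mul_le_mul_right b6 _)) _)) b8).trans
    (Eq.le ?_)
  push_cast
  ring

/-- The exponent congruent to `r` modulo `2` for which `u / 2 ^ (-k)` lies in `[3/4, 3)`. -/
def kap (u : ℝ² → ℝ) (r : ℤ) (q : ℝ²) : ℤ :=
  r - 2 * ⌊logb 4 (4 / 3 * (2 ^ r * u q))⌋

/-- The exponent of the rounded direction field. -/
def kp (u : ℝ² → ℝ) (q : ℝ²) : ℤ := -⌊logb 2 (u q)⌋

lemma meas_kap (hu : Continuous u) (r : ℤ) : Measurable (kap u r) := by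
  have h : Measurable fun q => logb 4 (4 / 3 * (2 ^ r * u q)) :=
    (Real.measurable_log.comp (by fun_prop)).div_const _
  exact (h.floor.const_mul 2).const_sub r

lemma meas_kp (hu : Continuous u) : Measurable (kp u) := by
  have h : Measurable fun q => logb 2 (u q) :=
    (Real.measurable_log.comp (by fun_prop)).div_const _
  exact h.floor.neg

lemma kap_eq (h1 : 3 / 4 * 2 ^ (-k) ≤ u q)
    (h2 : u q < 3 * 2 ^ (-k)) : kap u (k % 2) q = k := by
  have hk : (0 : ℝ) < 2 ^ (-k) := by positivity
  have e1 : ⌊logb 4 (4 / 3 * (2 ^ (k % 2) * u q))⌋ = -(k / 2) := by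
    have hu : 0 < u q := by linarith
    have e2 : (4 : ℝ) ^ (-(k / 2)) = 2 ^ (k % 2) * 2 ^ (-k) := by
      rw [← zpow_add₀ two_ne_zero, show (4 : ℝ) = 2 ^ (2 : ℤ) by norm_num, ← zpow_mul]
      congr 1; omega
    have hr : (0 : ℝ) < 2 ^ (k % 2) := by positivity
    have hx : 0 < 4 / 3 * (2 ^ (k % 2) * u q) := by positivity
    have h4 : (1 : ℝ) < 4 := by norm_num
    rw [Int.floor_eq_iff, Real.le_logb_iff_rpow_le h4 hx, Real.logb_lt_iff_lt_rpow h4 hx,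
      Real.rpow_add (by norm_num), Real.rpow_intCast, e2, Real.rpow_one]
    constructor <;> nlinarith
  rw [kap, e1]; omega

lemma two_zpow_kp (hu : 0 < u q) :
    (2 : ℝ) ^ (-kp u q) ≤ u q ∧ u q < 2 * 2 ^ (-kp u q) := by
  have h := Int.floor_eq_iff.1 (rfl : ⌊logb 2 (u q)⌋ = _)
  rw [Real.le_logb_iff_rpow_le one_lt_two hu, Real.logb_lt_iff_lt_rpow one_lt_two hu,
    Real.rpow_add two_pos, Real.rpow_intCast, Real.rpow_one, mul_comm] at h
  simpa [kp] using h

lemma good_kap (hu : ∀ q, 0 < u q) (hl : LipschitzWith 1 u) {r : ℤ} (hr : kp u q % 2 = r)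
    (hS : kp u q ∈ S) :
    Good (kap u r) S q ∧ kap u r q = kp u q := by
  subst hr
  obtain ⟨h1, h2⟩ := two_zpow_kp (hu q)
  have h3 : (0 : ℝ) < 2 ^ (-kp u q) := by positivity
  have e : kap u (kp u q % 2) q = kp u q := kap_eq (by linarith) (by linarith)
  refine ⟨⟨e.symm ▸ hS, fun s hs => ?_⟩, e⟩
  rw [e] at hs ⊢
  have h4 := hl.dist_le_mul (q - s • ey) q
  rw [dist_eq, dist_eq_norm, sub_sub_cancel_left, norm_neg, norm_smul] at h4
  have h5 : ‖ey‖ = 1 := by simp [Prod.norm_def]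
  rw [h5, norm_eq_abs] at h4
  rw [NNReal.coe_one, one_mul, mul_one] at h4
  have h6 := abs_le.1 (h4.trans hs)
  exact kap_eq (by linarith) (by linarith)

lemma meas_hs (hψ : Measurable ψ) {κ : ℝ² → ℤ} (hκ : Measurable κ) (T : Finset ℤ)
    (hf : Measurable f) :
    Measurable fun x : ℝ × ℝ² => Hs (fun t => ψ (x.1 * t)) (ek (κ x.2)) T f x.2 := by
  have hek : Measurable fun q => ek (κ q) :=
    (measurable_from_top (f := ek)).comp hκ
  refine Finset.measurable_fun_sum _ fun l _ => ?_
  unfold cv dil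
  refine StronglyMeasurable.measurable (StronglyMeasurable.integral_prod_right'
    (f := fun y : (ℝ × ℝ²) × ℝ => 2 ^ l * ψ (y.1.1 * (2 ^ l * y.2)) *
      f (y.1.2 - y.2 • ek (κ y.1.2))) (Measurable.stronglyMeasurable ?_))
  have h1 : Measurable fun y : (ℝ × ℝ²) × ℝ => ek (κ y.1.2) :=
    hek.comp (measurable_snd.comp measurable_fst)
  exact ((hψ.comp (by fun_prop)).const_mul _).mul (hf.comp (by fun_prop))

/-- The norm bound for the smooth singular integral along the rounded direction field. -/
lemma main_all (h₁ : SK θ₁) (h₂ : SK θ₂) (h₁0 : ∫ t, θ₁ t = 0)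
    (h₂0 : ∫ t, θ₂ t = 0) (hp : 1 < p) : ∃ C : ℝ≥0, ∀ u : ℝ² → ℝ, (∀ q, 0 < u q) →
    LipschitzWith 1 u → ∀ T : Finset ℤ, (∀ l ∈ T, 0 ≤ l) → ∀ f : ℝ² → ℝ, Continuous f →
    HasCompactSupport f →
    nrm p (fun q => ‖Hs (cv θ₁ 1 θ₂) (ek (kp u q)) T f q‖ₑ) ≤ C * nrm p (en f) := by
  have hp0 : 0 < p := by linarith
  obtain ⟨C, hC⟩ := main_good h₁ h₂ h₁0 h₂0 hp
  have hψ : Measurable (cv θ₁ 1 θ₂) := (h₁.cv h₂).nice.meas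
  generalize cv θ₁ 1 θ₂ = ψ at *
  refine ⟨2 * C, fun u hu hl T hT f hf hfs => ?_⟩
  have hk := meas_kp hl.continuous
  have hH : Measurable fun q => ‖Hs ψ (ek (kp u q)) T f q‖ₑ := by
    have := ((meas_hs hψ hk T hf.measurable).comp (measurable_prodMk_left (x := (1 : ℝ)))).enorm
    simpa [Function.comp_def] using this
  let F : ℤ → ℕ → ℝ² → ℝ≥0∞ := fun r n =>
    {q | kp u q % 2 = r ∧ kp u q ∈ Finset.Icc (-n : ℤ) n}.indicator
      fun q => ‖Hs ψ (ek (kp u q)) T f q‖ₑ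
  have hF : ∀ r n, Measurable (F r n) := fun r n => hH.indicator
    (hk (MeasurableSet.of_discrete (s := {k : ℤ | k % 2 = r ∧ k ∈ Finset.Icc (-n : ℤ) n})))
  have hm : ∀ r q, Monotone fun n => F r n q := fun r q m n hmn => by
    refine Set.indicator_le_indicator_of_subset (fun q hq => ?_) (fun _ => bot_le) q
    exact ⟨hq.1, Finset.Icc_subset_Icc (by omega) (by omega) hq.2⟩
  have hb : ∀ r n, nrm p (F r n) ≤ C * nrm p (en f) := fun r n =>
    hC (kap u r) (Finset.Icc (-n : ℤ) n) T (meas_kap hl.continuous r) hT f hf hfs _ fun q hq => by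
      have hq' := Set.mem_of_indicator_ne_zero hq
      obtain ⟨g1, g2⟩ := good_kap hu hl hq'.1 hq'.2
      refine ⟨g1, ?_⟩
      rw [g2]
      exact Set.indicator_le_self _ _ q
  refine nrm_le_of_iSup hp0 (F := fun n q => F 0 n q + F 1 n q) (fun n => (hF 0 n).add (hF 1 n))
    (fun q m n hmn => add_le_add (hm 0 q hmn) (hm 1 q hmn)) (fun q => ?_) fun n => ?_
  · refine le_trans ?_ (le_iSup _ (kp u q).natAbs)
    have hi : ∀ r, kp u q % 2 = r → ‖Hs ψ (ek (kp u q)) T f q‖ₑ ≤ F r (kp u q).natAbs q :=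
      fun r h => (indicator_of_mem (s := {q' | kp u q' % 2 = r ∧ kp u q' ∈ Finset.Icc
        (-((kp u q).natAbs : ℤ)) (kp u q).natAbs}) ⟨h, mem_Icc.2 (by omega)⟩
        fun q => ‖Hs ψ (ek (kp u q)) T f q‖ₑ).ge
    rcases Int.emod_two_eq (kp u q) with h | h
    · exact (hi _ h).trans le_self_add
    · exact (hi _ h).trans le_add_self
  · refine (nrm_add_le hp.le (hF 0 n) (hF 1 n)).trans ((add_le_add (hb 0 n) (hb 1 n)).trans ?_)
    push_cast
    rw [two_mul, add_mul]

lemma hs_dil_arg (ψ : ℝ → ℝ) (e : ℝ²) (T : Finset ℤ) (f : ℝ² → ℝ) (hδ : 0 < δ)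
    (q : ℝ²) : Hs (fun t => ψ (δ * t)) e T f q =
      δ⁻¹ * Hs ψ e T (fun x => f (δ⁻¹ • x)) (δ • q) := by
  rw [Hs, Hs, mul_sum]
  refine sum_congr rfl fun l _ => ?_
  have h := Measure.integral_comp_mul_left
    (fun s => dil l ψ s * f (δ⁻¹ • (δ • q - s • e))) δ
  rw [abs_of_pos (inv_pos.2 hδ), smul_eq_mul] at h
  unfold cv
  rw [← h]
  congr 1
  funext t
  rw [smul_sub, smul_smul, smul_smul, inv_mul_cancel₀ hδ.ne', one_smul, inv_mul_cancel_left₀ hδ.ne',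
    dil, dil, mul_left_comm δ]

lemma nrm_smul_le (hp : 0 < p) (hδ : δ ≠ 0) {G : ℝ² → ℝ≥0∞} {C : ℝ≥0∞}
    (h : nrm p F ≤ C * nrm p G) :
    nrm p (fun q => F (δ • q)) ≤ C * nrm p fun q => G (δ • q) := by
  have e : ∀ H : ℝ² → ℝ≥0∞, nrm p (fun q => H (δ • q)) =
      ofReal |(δ ^ Module.finrank ℝ ℝ²)⁻¹| ^ (1 / p) * nrm p H := fun H => by
    have h1 := (measurableEmbedding_const_smul₀ (α := ℝ²) hδ).lintegral_map (μ := volume)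
      fun q => H q ^ p
    rw [Measure.map_addHaar_smul _ hδ, lintegral_smul_measure, smul_eq_mul] at h1
    rw [nrm, ← h1, mul_rpow_of_nonneg _ _ (by positivity), nrm]
  rw [e, e, mul_left_comm]
  exact mul_le_mul_right h _

lemma main_dil (h₁ : SK θ₁) (h₂ : SK θ₂) (h₁0 : ∫ t, θ₁ t = 0)
    (h₂0 : ∫ t, θ₂ t = 0) (hp : 1 < p) : ∃ C : ℝ≥0, ∀ u : ℝ² → ℝ, (∀ q, 0 < u q) →
    LipschitzWith 1 u → ∀ T : Finset ℤ, (∀ l ∈ T, 0 ≤ l) → ∀ f : ℝ² → ℝ, Continuous f →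
    HasCompactSupport f → ∀ δ : ℝ, 1 ≤ δ →
    nrm p (fun q => ‖Hs (fun t => cv θ₁ 1 θ₂ (δ * t)) (ek (kp u q)) T f q‖ₑ) ≤
      C * nrm p (en f) := by
  have hp0 : 0 < p := by linarith
  obtain ⟨C, hC⟩ := main_all h₁ h₂ h₁0 h₂0 hp
  generalize cv θ₁ 1 θ₂ = ψ at *
  refine ⟨C, fun u hu hl T hT f hf hfs δ hδ => ?_⟩
  have hδ0 : 0 < δ := by linarith
  have hi : δ⁻¹ ≤ 1 := inv_le_one_of_one_le₀ hδ
  have hl' : LipschitzWith 1 fun x => u (δ⁻¹ • x) := by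
    refine LipschitzWith.of_dist_le_mul fun x y => (hl.dist_le_mul _ _).trans ?_
    rw [dist_smul₀, Real.norm_of_nonneg (by positivity), NNReal.coe_one, one_mul, one_mul]
    exact mul_le_of_le_one_left dist_nonneg hi
  have h := nrm_smul_le hp0 hδ0.ne' (hC (fun x => u (δ⁻¹ • x)) (fun x => hu _) hl' T hT
    (fun x => f (δ⁻¹ • x)) (by fun_prop)
    (hfs.comp_homeomorph (Homeomorph.smulOfNeZero δ⁻¹ (inv_ne_zero hδ0.ne'))))
  have e : ∀ q : ℝ², δ⁻¹ • δ • q = q := fun q => by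
    rw [smul_smul, inv_mul_cancel₀ hδ0.ne', one_smul]
  simp only [kp, en, e] at h
  refine le_trans (nrm_mono hp0 fun q => ?_) h
  rw [hs_dil_arg _ _ _ _ hδ0, enorm_mul]
  refine mul_le_of_le_one_left bot_le ?_
  rw [enorm_of_nonneg (by positivity)]
  exact ENNReal.ofReal_le_one.2 hi

lemma nrm_avg (hp : 1 < p) {G : ℝ → ℝ² → ℝ≥0∞} (hG : Measurable (Function.uncurry G))
    (h : ∀ δ ∈ Icc (1 : ℝ) 2, nrm p (G δ) ≤ K) :
    nrm p (fun q => ∫⁻ δ in Icc (1 : ℝ) 2, G δ q) ≤ K := by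
  have hp0 : 0 < p := by linarith
  have hpq := HolderConjugate.conjExponent hp
  have hv : (volume.restrict (Icc (1 : ℝ) 2)) Set.univ = 1 := by
    rw [Measure.restrict_apply_univ, volume_Icc]; norm_num
  have h1 : ∀ q, (∫⁻ δ in Icc (1 : ℝ) 2, G δ q) ^ p ≤
      ∫⁻ δ in Icc (1 : ℝ) 2, G δ q ^ p := fun q => by
    have h2 := ENNReal.lintegral_mul_le_Lp_mul_Lq (volume.restrict (Icc (1 : ℝ) 2)) hpq
      (f := fun δ => G δ q) (g := fun _ => 1) (hG.comp measurable_prodMk_right).aemeasurable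
      aemeasurable_const
    simp only [Pi.mul_def, mul_one, one_rpow, lintegral_const, hv] at h2
    refine (rpow_le_rpow h2 hp0.le).trans (Eq.le ?_)
    rw [← rpow_mul, one_div_mul_cancel hp0.ne', rpow_one]
  rw [nrm, one_div, ENNReal.rpow_inv_le_iff hp0]
  refine (lintegral_mono h1).trans ?_
  rw [lintegral_lintegral_swap ((hG.comp measurable_swap).pow_const p).aemeasurable]
  have h3 : ∀ δ ∈ Icc (1 : ℝ) 2, ∫⁻ q, G δ q ^ p ≤ K ^ p := fun δ hδ => by
    rw [← nrm_rpow hp0]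
    exact rpow_le_rpow (h δ hδ) hp0.le
  refine (setLIntegral_mono' measurableSet_Icc h3).trans ?_
  rw [setLIntegral_const, ← Measure.restrict_apply_univ, hv, mul_one]

/-- The norm bound for averages over dilations. -/
lemma main_avg (h₁ : SK θ₁) (h₂ : SK θ₂) (h₁0 : ∫ t, θ₁ t = 0)
    (h₂0 : ∫ t, θ₂ t = 0) (hp : 1 < p) : ∃ C : ℝ≥0, ∀ u : ℝ² → ℝ, (∀ q, 0 < u q) →
    LipschitzWith 1 u → ∀ T : Finset ℤ, (∀ l ∈ T, 0 ≤ l) → ∀ f : ℝ² → ℝ, Continuous f →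
    HasCompactSupport f → nrm p (fun q => ∫⁻ δ in Icc (1 : ℝ) 2,
      ‖Hs (fun t => cv θ₁ 1 θ₂ (δ * t)) (ek (kp u q)) T f q‖ₑ) ≤ C * nrm p (en f) := by
  obtain ⟨C, hC⟩ := main_dil h₁ h₂ h₁0 h₂0 hp
  exact ⟨C, fun u hu hl T hT f hf hfs => nrm_avg hp
    (G := fun δ q => ‖Hs (fun t => cv θ₁ 1 θ₂ (δ * t)) (ek (kp u q)) T f q‖ₑ)
    (meas_hs (h₁.cv h₂).nice.meas (meas_kp hl.continuous) T hf.measurable).enorm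
    fun δ hδ => hC u hu hl T hT f hf hfs δ hδ.1⟩

/-- An even smooth cutoff whose derivative factors into mean-zero kernels. -/
lemma exists_beta : ∃ β θ₁ θ₂ : ℝ → ℝ, SK β ∧ β 0 = 1 ∧ (∀ t, β (-t) = β t) ∧ SK θ₁ ∧ SK θ₂ ∧
    ∫ t, θ₁ t = 0 ∧ ∫ t, θ₂ t = 0 ∧ ∀ t, HasDerivAt β (-cv θ₁ 1 θ₂ t) t := by
  have hc : 0 < ∫ t, ppi t * ppi t := by
    refine (sk_ppi.smooth.continuous.mul sk_ppi.smooth.continuous).integral_pos_of_hasCompactSupport_nonneg_nonzero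
      sk_ppi.cs.mul_left (fun t => mul_self_nonneg _) (x := 1 / 2) (mul_self_ne_zero.2 ?_)
    have h1 : smoothTransition ((1 / 2 + 1) / 2) < 1 :=
      smoothTransition.lt_one_of_lt_one (by norm_num)
    rw [ppi, stp_pos (by norm_num), stp]
    linarith
  set c := ∫ t, ppi t * ppi t
  have hs := sk_ppi.cv sk_ppi
  refine ⟨fun t => -c⁻¹ * cv ppi 1 ppi t, vpi, fun t => c⁻¹ * ppi t, hs.const_mul _, ?_, fun t => ?_,
    sk_vpi, sk_ppi.const_mul _, integral_vpi, ?_, fun t => ?_⟩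
  · have h : cv ppi 1 ppi 0 = -c := by
      simp only [cv, zero_sub, smul_eq_mul, mul_one, ppi_odd, mul_neg, integral_neg, c]
    simp only [h]
    field_simp
  · have h : cv ppi 1 ppi (-t) = cv ppi 1 ppi t := by
      unfold cv
      rw [← integral_neg_eq_self]
      congr 1
      funext s
      simp only [smul_eq_mul, mul_one, ppi_odd, neg_mul]
      rw [← mul_neg, ← ppi_odd]
      congr 2
      ring
    simp only [h]
  · rw [integral_const_mul, integral_ppi, mul_zero]
  · have h := (hs.hasDerivAt t).const_mul (-c⁻¹)
    rw [deriv_cv' sk_ppi sk_ppi.nice, deriv_ppi] at h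
    have e : cv vpi 1 (fun t => c⁻¹ * ppi t) t = c⁻¹ * cv vpi 1 ppi t := by
      unfold cv
      rw [← integral_const_mul]
      simp only [mul_left_comm]
    rw [e, ← neg_mul]
    exact h

lemma avg_kernel (hψ : Continuous ψ) (h : ∀ t, HasDerivAt β (-ψ t) t) (L : ℕ) (ht : t ≠ 0) :
    ∑ l ∈ Ico (0 : ℤ) L, ∫ δ in Icc (1 : ℝ) 2, dil l (fun s => ψ (δ * s)) t =
      (β t - β (2 ^ L * t)) / t := by
  induction L with
  | zero => simp
  | succ L ih =>
    have hI : Ico (0 : ℤ) (L + 1 : ℕ) = insert (L : ℤ) (Ico (0 : ℤ) L) := by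
      ext a; simp only [mem_Ico, mem_insert]; push_cast; omega
    rw [hI, sum_insert (by simp), ih, integral_Icc_eq_integral_Ioc,
      ← intervalIntegral.integral_of_le one_le_two]
    simp only [dil, zpow_natCast]
    have hd : ∀ δ ∈ Set.uIcc (1 : ℝ) 2, HasDerivAt (fun δ => -β (δ * (2 ^ L * t)) / t)
        (2 ^ L * ψ (δ * (2 ^ L * t))) δ := fun δ _ => by
      have h1 := (((h _).comp δ ((hasDerivAt_id δ).mul_const (2 ^ L * t))).neg).div_const t
      refine HasDerivAt.congr_deriv (f := fun δ => -β (δ * (2 ^ L * t)) / t) h1 ?_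
      simp only [id]
      field_simp
    rw [intervalIntegral.integral_eq_sub_of_hasDerivAt hd
      (Continuous.intervalIntegrable (by fun_prop) _ _), one_mul, ← mul_assoc, ← pow_succ']
    ring

lemma avg_hs (hψ : Continuous ψ) (hb : Nice ψ) (h : ∀ t, HasDerivAt β (-ψ t) t) (L : ℕ)
    (hg : Nice fun t : ℝ => f (q - t • e)) :
    ∫ t, (β t - β (2 ^ L * t)) / t * f (q - t • e) =
      ∫ δ in Icc (1 : ℝ) 2, Hs (fun t => ψ (δ * t)) e (Ico (0 : ℤ) L) f q := by
  obtain ⟨B, hB, hB'⟩ := hb.bdd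
  have hi : ∀ l : ℤ, Integrable (Function.uncurry fun δ t => dil l (fun s => ψ (δ * s)) t *
      f (q - t • e)) ((volume.restrict (Icc (1 : ℝ) 2)).prod volume) := fun l => by
    have h1 := (integrable_const (μ := volume.restrict (Icc (1 : ℝ) 2)) (1 : ℝ)).mul_prod
      hg.integrable
    simp only [one_mul] at h1
    refine h1.bdd_mul (f := fun z : ℝ² => dil l (fun s => ψ (z.1 * s)) z.2) (c := 2 ^ l * B) ?_
      (.of_forall fun z => ?_)
    · exact Continuous.aestronglyMeasurable (by unfold dil; fun_prop)
    · rw [dil, norm_eq_abs, abs_mul, abs_of_pos (by positivity)]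
      exact mul_le_mul_of_nonneg_left (hB' _) (by positivity)
  unfold Hs cv
  have h3 : ∫ δ in Icc (1 : ℝ) 2, ∑ l ∈ Ico (0 : ℤ) L,
      ∫ t, dil l (fun s => ψ (δ * s)) t * f (q - t • e) = ∑ l ∈ Ico (0 : ℤ) L,
      ∫ δ in Icc (1 : ℝ) 2, ∫ t, dil l (fun s => ψ (δ * s)) t * f (q - t • e) :=
    integral_finsetSum _ fun l _ => (hi l).integral_prod_left
  rw [h3]
  have h2 : ∀ l, ∫ δ in Icc (1 : ℝ) 2, ∫ t, dil l (fun s => ψ (δ * s)) t * f (q - t • e) =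
      ∫ t, (∫ δ in Icc (1 : ℝ) 2, dil l (fun s => ψ (δ * s)) t) * f (q - t • e) := fun l => by
    rw [integral_integral_swap (hi l)]
    simp only [integral_mul_const]
  simp only [h2]
  rw [← integral_finsetSum _ fun l _ => ?_]
  · refine integral_congr_ae ?_
    filter_upwards [Measure.ae_ne volume (0 : ℝ)] with t ht
    rw [← avg_kernel hψ h L ht, sum_mul]
  · have := (hi l).integral_prod_right
    simpa only [Function.uncurry, integral_mul_const] using this

/-- The truncated principal value integral of `g t / t`, in symmetrised form. -/
def pv (g : ℝ → ℝ) : ℝ :=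
  1 / 2 * ∫ t, (Icc (-1) 1).indicator 1 t * ((g t - g (-t)) / t)

lemma pv_fold (hW : Measurable W) (he : ∀ t, W (-t) = W t) {C : ℝ}
    (hC : ∀ t, |W t / t| ≤ C) (hg : Nice g) :
    ∫ t, W t / t * g t = 1 / 2 * ∫ t, W t * ((g t - g (-t)) / t) := by
  have hi : Integrable fun t => W t / t * g t :=
    hg.integrable.bdd_mul (c := C) (hW.div measurable_id).aestronglyMeasurable
      (.of_forall hC)
  have h1 : ∫ t, W t * ((g t - g (-t)) / t) =
      (∫ t, W t / t * g t) + ∫ t, W (-t) / (-t) * g (-t) := by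
    rw [← integral_add hi hi.comp_neg]
    congr 1
    funext t
    rw [he, div_neg]
    ring
  rw [h1, integral_neg_eq_self (fun t => W t / t * g t)]
  ring

lemma pv_tendsto {ι : Type} {l : Filter ι} [l.IsCountablyGenerated] {W : ι → ℝ → ℝ} {A : ℝ → ℝ}
    {R : ℝ} (hg : LK g) (hW : ∀ᶠ i in l, Measurable (W i) ∧ (∀ t, W i (-t) = W i t) ∧
      (∃ C, ∀ t, |W i t / t| ≤ C) ∧ (∀ t, |W i t| ≤ B) ∧ ∀ t, R < |t| → W i t = 0)
    (hl : ∀ t ≠ 0, Tendsto (fun i => W i t) l (nhds (A t))) :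
    Tendsto (fun i => ∫ t, W i t / t * g t) l
      (nhds (1 / 2 * ∫ t, A t * ((g t - g (-t)) / t))) := by
  obtain ⟨K, hK, hK'⟩ := hg.lip
  have hm := hg.nice.meas
  have hh : ∀ t, |(g t - g (-t)) / t| ≤ 2 * K := fun t => by
    rw [abs_div]
    refine div_le_of_le_mul₀ (abs_nonneg _) (by positivity) ((hK' _ _).trans (Eq.le ?_))
    rw [sub_neg_eq_add, ← two_mul, abs_mul, abs_two]
    ring
  have hT : Tendsto (fun i => 1 / 2 * ∫ t, W i t * ((g t - g (-t)) / t)) l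
      (nhds (1 / 2 * ∫ t, A t * ((g t - g (-t)) / t))) := by
    refine (tendsto_integral_filter_of_dominated_convergence
      (F := fun i t => W i t * ((g t - g (-t)) / t)) (f := fun t => A t * ((g t - g (-t)) / t))
      ((Icc (-R) R).indicator fun _ => B * (2 * K)) ?_ ?_ ?_ ?_).const_mul (1 / 2)
    · filter_upwards [hW] with i hi
      exact (hi.1.mul ((hm.sub (hm.comp measurable_neg)).div measurable_id)).aestronglyMeasurable
    · filter_upwards [hW] with i hi
      obtain ⟨-, -, -, h4, h5⟩ := hi
      refine .of_forall fun t => ?_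
      by_cases ht : R < |t|
      · rw [h5 t ht, zero_mul, norm_zero]
        exact Set.indicator_nonneg (fun _ _ => mul_nonneg ((abs_nonneg _).trans (h4 t))
          (by positivity)) _
      · rw [indicator_of_mem (s := Icc (-R) R) (abs_le.1 (not_lt.1 ht)), norm_eq_abs, abs_mul]
        exact mul_le_mul (h4 t) (hh t) (abs_nonneg _) ((abs_nonneg _).trans (h4 t))
    · exact (integrable_indicator_iff measurableSet_Icc).2
        (integrableOn_const measure_Icc_lt_top.ne)
    · filter_upwards [Measure.ae_ne volume (0 : ℝ)] with t ht
      exact (hl t ht).mul_const _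
  refine hT.congr' ?_
  filter_upwards [hW] with i hi
  obtain ⟨h1, h2, ⟨C, h3⟩, -⟩ := hi
  exact (pv_fold h1 h2 h3 hg.nice).symm

lemma pv_trunc (hg : LK g) :
    Tendsto (fun ε : ℝ => ∫ t in {t : ℝ | ε ≤ |t| ∧ |t| ≤ 1}, g t / t) (nhdsWithin 0 (Ioi 0))
      (nhds (pv g)) := by
  have hm : ∀ ε : ℝ, MeasurableSet {t : ℝ | ε ≤ |t| ∧ |t| ≤ 1} := fun ε =>
    (measurableSet_le measurable_const measurable_norm).inter
      (measurableSet_le measurable_norm measurable_const)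
  refine (pv_tendsto (W := fun ε : ℝ => {t : ℝ | ε ≤ |t| ∧ |t| ≤ 1}.indicator 1) (B := 1) (R := 1)
    hg ?_ fun t ht => ?_).congr fun ε => ?_
  · filter_upwards [self_mem_nhdsWithin] with ε hε
    have hε0 : (0 : ℝ) < ε := hε
    refine ⟨measurable_one.indicator (hm ε), fun t => ?_, ⟨1 / ε, fun t => ?_⟩, fun t => ?_,
      fun t ht => ?_⟩
    · simp only [indicator, mem_ofPred_eq, abs_neg, Pi.one_apply]
    · by_cases h : ε ≤ |t| ∧ |t| ≤ 1
      · rw [indicator_of_mem (s := {t : ℝ | ε ≤ |t| ∧ |t| ≤ 1}) h, Pi.one_apply, abs_div, abs_one]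
        exact one_div_le_one_div_of_le hε0 h.1
      · rw [indicator_of_notMem (s := {t : ℝ | ε ≤ |t| ∧ |t| ≤ 1}) h, zero_div, abs_zero]
        positivity
    · simp only [indicator]; split_ifs <;> simp
    · exact indicator_of_notMem (fun h => ht.not_ge h.2) _
  · refine tendsto_const_nhds.congr' ?_
    have h0 : ∀ᶠ ε : ℝ in nhdsWithin 0 (Ioi 0), ε < |t| :=
      mem_nhdsWithin_of_mem_nhds (Iio_mem_nhds (abs_pos.2 ht))
    filter_upwards [h0] with ε hε
    simp only [indicator, mem_ofPred_eq, Set.mem_Icc, hε.le, true_and, abs_le, Pi.one_apply]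
  · rw [← integral_indicator (hm ε)]
    congr 1
    funext t
    simp only [indicator]
    split_ifs <;> simp [div_eq_inv_mul]

lemma pv_beta (hβ : LK β) (h0 : β 0 = 1) (he : ∀ t, β (-t) = β t) (hg : LK g) :
    Nice (fun t => ((Icc (-1) 1).indicator 1 t - β t) / t) ∧
    Tendsto (fun L : ℕ => (∫ t, (β t - β (2 ^ L * t)) / t * g t) +
      ∫ t, ((Icc (-1) 1).indicator 1 t - β t) / t * g t) atTop (nhds (pv g)) := by
  obtain ⟨K, hK, hK'⟩ := hβ.lip
  obtain ⟨R, hR, hR'⟩ := hβ.supp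
  obtain ⟨B, hB, hB'⟩ := hβ.nice.bdd
  have hm := hβ.nice.meas
  have hA : Measurable ((Icc (-1 : ℝ) 1).indicator (1 : ℝ → ℝ)) :=
    measurable_one.indicator measurableSet_Icc
  have hA1 : ∀ t : ℝ, |(Icc (-1 : ℝ) 1).indicator (1 : ℝ → ℝ) t| ≤ 1 := fun t => by
    simp only [indicator]; split_ifs <;> simp
  have hA0 : ∀ t : ℝ, 1 < |t| → (Icc (-1 : ℝ) 1).indicator (1 : ℝ → ℝ) t = 0 := fun t ht =>
    indicator_of_notMem (s := Icc (-1 : ℝ) 1) (fun h => ht.not_ge (abs_le.2 h)) _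
  have hE : ∀ t, |((Icc (-1) 1).indicator 1 t - β t) / t| ≤ K + (1 + B) := fun t => by
    rcases eq_or_ne t 0 with rfl | ht
    · rw [div_zero, abs_zero]; positivity
    by_cases h : |t| ≤ 1
    · rw [indicator_of_mem (s := Icc (-1 : ℝ) 1) (abs_le.1 h), Pi.one_apply, ← h0, abs_div,
        div_le_iff₀ (abs_pos.2 ht), abs_sub_comm]
      have := hK' t 0
      rw [sub_zero] at this
      nlinarith [abs_nonneg t]
    · rw [not_le] at h
      rw [abs_div, div_le_iff₀ (abs_pos.2 ht)]
      have := (abs_sub _ _).trans (add_le_add (hA1 t) (hB' t))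
      nlinarith
  have hEn : Nice (fun t => ((Icc (-1) 1).indicator 1 t - β t) / t) :=
    ⟨(hA.sub hm).div measurable_id, ⟨_, by positivity, hE⟩, max 1 R, by positivity, fun t ht => by
      rw [hA0 t ((le_max_left _ _).trans_lt ht), hR' t ((le_max_right _ _).trans_lt ht), sub_zero,
        zero_div]⟩
  refine ⟨hEn, ?_⟩
  have hD : ∀ (L : ℕ) (t : ℝ), |(β t - β (2 ^ L * t)) / t| ≤ K * |1 - 2 ^ L| := fun L t => by
    rw [abs_div]
    refine div_le_of_le_mul₀ (abs_nonneg _) (by positivity) ((hK' _ _).trans (Eq.le ?_))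
    rw [mul_assoc, ← abs_mul, sub_mul, one_mul]
  refine (pv_tendsto (W := fun (L : ℕ) t => (Icc (-1) 1).indicator 1 t - β (2 ^ L * t))
    (B := 1 + B) (R := max 1 R) hg (.of_forall fun L => ?_) fun t ht => ?_).congr
    fun L => ?_
  · refine ⟨hA.sub (hm.comp (measurable_const_mul _)), fun t => ?_, ⟨K * |1 - 2 ^ L| + (K + (1 + B)),
      fun t => ?_⟩, fun t => (abs_sub _ _).trans (add_le_add (hA1 t) (hB' _)), fun t ht => ?_⟩
    · rw [mul_neg, he]
      simp only [indicator, Set.mem_Icc, ← abs_le, abs_neg, Pi.one_apply]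
    · refine le_trans (Eq.le ?_) ((abs_add_le _ _).trans (add_le_add (hD L t) (hE t)))
      congr 1
      ring
    · rw [hA0 t ((le_max_left _ _).trans_lt ht), hR' _ ?_, sub_zero]
      rw [abs_mul, abs_of_pos (by positivity)]
      exact ((le_max_right _ _).trans_lt ht).trans_le
        (le_mul_of_one_le_left (abs_nonneg _) (one_le_pow₀ one_le_two))
  · have h1 : Tendsto (fun L : ℕ => (2 : ℝ) ^ L * |t|) atTop atTop :=
      (tendsto_pow_atTop_atTop_of_one_lt one_lt_two).atTop_mul_const (abs_pos.2 ht)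
    refine tendsto_const_nhds.congr' ?_
    filter_upwards [h1.eventually_gt_atTop R] with L hL
    rw [hR' _ (by rwa [abs_mul, abs_of_pos (by positivity)]), sub_zero]
  · rw [← integral_add]
    · congr 1
      funext t
      ring
    · exact hg.nice.integrable.bdd_mul (c := K * |1 - 2 ^ L|)
        ((hm.sub (hm.comp (measurable_const_mul _))).div measurable_id).aestronglyMeasurable
        (.of_forall (hD L))
    · exact hg.nice.integrable.bdd_mul hEn.meas.aestronglyMeasurable (.of_forall hE)

/-- Fatou's lemma for `nrm`. -/
lemma nrm_liminf {X : Type*} [MeasureSpace X] (hp : 0 < p) {F : ℕ → X → ℝ≥0∞}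
    (hF : ∀ n, Measurable (F n)) {G : X → ℝ≥0∞} (hG : ∀ q, G q ≤ liminf (fun n => F n q) atTop)
    (h : ∀ n, nrm p (F n) ≤ K) : nrm p G ≤ K :=
  nrm_le_of_iSup hp (F := fun n q => ⨅ m ≥ n, F m q)
    (fun n => .biInf _ (Set.to_countable _) fun m _ => hF m)
    (fun q a b hab => biInf_mono fun m hm => hab.trans hm)
    (fun q => (hG q).trans (by rw [liminf_eq_iSup_iInf_of_nat]))
    fun n => (nrm_mono hp fun q => iInf₂_le n le_rfl).trans (h n)

lemma meas_mm_kp (hu : Continuous u) (hF : Measurable F) :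
    Measurable fun q => MM (ek (kp u q)) F q :=
  (measurable_from_prod_countable_left (f := fun x : ℝ² × ℤ => MM (ek x.2) F x.1)
    fun k => meas_MM hF (ek k)).comp (measurable_id.prodMk (meas_kp hu))

lemma nrm_mm_kp (hp : 1 < p) : ∃ C : ℝ≥0, ∀ u : ℝ² → ℝ, Continuous u →
    ∀ F, BM F → nrm p (fun q => MM (ek (kp u q)) F q) ≤ C * nrm p F := by
  obtain ⟨C, hC⟩ := vs_ek hp
  have hp0 : 0 < p := by linarith
  refine ⟨C, fun u hu F hF => nrm_liminf hp0
    (F := fun n : ℕ => MD ((Finset.Icc (-n : ℤ) n).image ek) F) (fun n => meas_MD _ hF.meas)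
    (fun q => ?_) fun n => (hC _).mb F hF⟩
  refine le_liminf_of_le (by isBoundedDefault) ?_
  filter_upwards [eventually_ge_atTop (kp u q).natAbs] with n hn
  exact MM_le_MD (mem_image_of_mem _ (mem_Icc.2 (by omega))) F q

lemma lk_line (hf : Nice f) {K : ℝ≥0} (hl : LipschitzWith K f)
    (he : e ≠ 0) (q : ℝ²) : LK fun t => f (q - t • e) := by
  obtain ⟨R, hR, hR'⟩ := (hf.slice he q).supp
  refine ⟨⟨K * ‖e‖, by positivity, fun s t => ?_⟩, R, hR, fun t ht => ?_⟩
  · have h := hl.dist_le_mul (q - s • e) (q - t • e)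
    rwa [dist_eq, dist_sub_left, dist_eq_norm, ← sub_smul, norm_smul, norm_eq_abs,
      mul_comm |s - t|, ← mul_assoc] at h
  · have := hR' (-t) (by rwa [norm_eq_abs, abs_neg])
    rwa [neg_smul, ← sub_eq_add_neg] at this

lemma ek_ne (k : ℤ) : ek k ≠ 0 := fun h => one_ne_zero (congrArg Prod.fst h)

lemma meas_pv (hu : Continuous u) (hf : Measurable f) :
    Measurable fun q => pv fun t => f (q - t • ek (kp u q)) := by
  have hek : Measurable fun x : ℝ² × ℝ => ek (kp u x.1) :=
    ((measurable_from_top (f := ek)).comp (meas_kp hu)).comp measurable_fst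
  unfold pv
  refine (StronglyMeasurable.measurable (StronglyMeasurable.integral_prod_right'
    (f := fun x : ℝ² × ℝ => (Icc (-1 : ℝ) 1).indicator 1 x.2 *
      ((f (x.1 - x.2 • ek (kp u x.1)) - f (x.1 - (-x.2) • ek (kp u x.1))) / x.2))
    (Measurable.stronglyMeasurable ?_))).const_mul _
  exact ((measurable_one.indicator measurableSet_Icc).comp measurable_snd).mul
    (((hf.comp (by fun_prop)).sub (hf.comp (by fun_prop))).div measurable_snd)

/-- The norm bound for the truncated Hilbert transform on Lipschitz functions of compact support. -/
lemma nrm_pv (hp : 1 < p) : ∃ C : ℝ≥0, ∀ u : ℝ² → ℝ, (∀ q, 0 < u q) →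
    LipschitzWith 1 u → ∀ f : ℝ² → ℝ, HasCompactSupport f → (∃ K, LipschitzWith K f) →
    nrm p (fun q => ‖pv fun t => f (q - t • ek (kp u q))‖ₑ) ≤ C * nrm p (en f) := by
  obtain ⟨β, θ₁, θ₂, hβ, hβ0, hβe, h₁, h₂, h₁0, h₂0, hd⟩ := exists_beta
  obtain ⟨C, hC⟩ := main_avg h₁ h₂ h₁0 h₂0 hp
  obtain ⟨M, hM⟩ := nrm_mm_kp hp
  have hψ := h₁.cv h₂
  generalize cv θ₁ 1 θ₂ = ψ at *
  have hE := (pv_beta hβ.lk hβ0 hβe hβ.lk).1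
  set E : ℝ → ℝ := fun t => ((Icc (-1) 1).indicator 1 t - β t) / t
  obtain ⟨B, r, hB⟩ := hE.bd
  have hp0 : 0 < p := by linarith
  refine ⟨C + (2 * B).toNNReal * M, fun u hu hl f hfs ⟨K, hK⟩ => ?_⟩
  have hf := Nice.of_cc hK.continuous hfs
  have m1 : ∀ L : ℕ, Measurable fun q => ∫⁻ δ in Icc (1 : ℝ) 2,
      ‖Hs (fun t => ψ (δ * t)) (ek (kp u q)) (Ico (0 : ℤ) L) f q‖ₑ := fun L =>
    Measurable.lintegral_prod_left' (f := fun x : ℝ × ℝ² =>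
      ‖Hs (fun t => ψ (x.1 * t)) (ek (kp u x.2)) (Ico (0 : ℤ) L) f x.2‖ₑ)
      (meas_hs hψ.nice.meas (meas_kp hl.continuous) _ hf.meas).enorm
  have m2 : Measurable fun q => ((2 * B).toNNReal : ℝ≥0∞) * MM (ek (kp u q)) (en f) q :=
    (meas_mm_kp hl.continuous hf.en_meas).const_mul _
  refine nrm_liminf hp0 (F := fun (L : ℕ) q => (∫⁻ δ in Icc (1 : ℝ) 2,
      ‖Hs (fun t => ψ (δ * t)) (ek (kp u q)) (Ico (0 : ℤ) L) f q‖ₑ) +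
      ((2 * B).toNNReal : ℝ≥0∞) * MM (ek (kp u q)) (en f) q) (fun L => (m1 L).add m2)
      (fun q => ?_) fun L => ?_
  · have hg := lk_line hf hK (ek_ne (kp u q)) q
    rw [← ((pv_beta hβ.lk hβ0 hβe hg).2.enorm).liminf_eq]
    refine liminf_le_liminf (.of_forall fun L => ?_) (by isBoundedDefault)
      (by isBoundedDefault)
    refine (enorm_add_le _ _).trans (add_le_add ?_ (enorm_cv_le_MM hB _ (fun _ => le_rfl) q))
    rw [avg_hs hψ.smooth.continuous hψ.nice hd L hg.nice]
    exact enorm_integral_le_lintegral_enorm _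
  · refine (nrm_add_le hp.le (m1 L) m2).trans ?_
    rw [nrm_const_mul hp0, coe_add, coe_mul, add_mul, mul_assoc]
    exact add_le_add (hC u hu hl _ (fun l hl => (mem_Ico.1 hl).1) f hK.continuous hfs)
      (mul_le_mul_right (hM u hl.continuous _ hf.bm) _)

lemma exists_cutoff (n : ℕ) (hf : ContDiff ℝ ∞ f) : ∃ g : ℝ² → ℝ,
    HasCompactSupport g ∧ (∃ K, LipschitzWith K g) ∧ (∀ q, ‖g q‖ₑ ≤ ‖f q‖ₑ) ∧
    ∀ q, ‖q‖ ≤ n + 1 → g q = f q := by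
  let χ : ContDiffBump (0 : ℝ²) := ⟨n + 1, n + 2, by positivity, by linarith⟩
  have hs : HasCompactSupport fun q => χ q * f q := χ.hasCompactSupport.mul_right
  refine ⟨fun q => χ q * f q, hs, ?_, fun q => ?_, fun q hq => ?_⟩
  · exact (χ.contDiff.mul hf).lipschitzWith_of_hasCompactSupport hs (by simp)
  · rw [enorm_mul]
    refine mul_le_of_le_one_left bot_le ?_
    rw [enorm_of_nonneg χ.nonneg]
    exact ENNReal.ofReal_le_one.2 χ.le_one
  · simp only
    rw [χ.one_of_mem_closedBall (mem_closedBall_zero_iff.2 hq), one_mul]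

end

end LacHilbert

open LacHilbert

/-- Main theorem: if `u : ℝ² → (0,1]` is Lipschitz with constant at most `1` and
`v = 2^⌊log₂ u⌋` is its rounding down to integer powers of two, then the truncated
directional Hilbert transform `H_v f(x,y) = p.v. ∫_{-1}^{1} f(x-t, y - v(x,y)t) dt/t`
(the principal value existing pointwise) satisfies `‖H_v f‖_p ≤ C_p ‖f‖_p`
for every `1 < p < ∞` and every Schwartz function `f`, with `C_p` depending only on `p`. -/
theorem stmt_1 (p : ℝ) (hp : 1 < p) :
    ∃ C : ℝ, 0 < C ∧
      ∀ u : ℝ × ℝ → ℝ, (∀ q : ℝ × ℝ, u q ∈ Set.Ioc (0 : ℝ) 1) → LipschitzWith 1 u →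
        ∀ f : SchwartzMap (ℝ × ℝ) ℝ,
          ∃ Hvf : ℝ × ℝ → ℝ,
            (∀ q : ℝ × ℝ,
              Tendsto
                (fun ε : ℝ =>
                  ∫ t in {t : ℝ | ε ≤ |t| ∧ |t| ≤ 1},
                    f (q.1 - t, q.2 - (2 : ℝ) ^ (⌊Real.logb 2 (u q)⌋) * t) / t)
                (nhdsWithin 0 (Set.Ioi 0)) (nhds (Hvf q))) ∧
            eLpNorm Hvf (ENNReal.ofReal p) volume ≤
              ENNReal.ofReal C * eLpNorm (fun q => f q) (ENNReal.ofReal p) volume := by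
  obtain ⟨C, hC⟩ := nrm_pv hp
  have hp0 : 0 < p := by linarith
  refine ⟨C + 1, by positivity, fun u hu hl f => ?_⟩
  choose g hgs hgl hgf hge using fun n : ℕ => exists_cutoff n (f.smooth ⊤)
  have hloc : ∀ (q : ℝ × ℝ) (n : ℕ), ‖q‖ ≤ n → ∀ t : ℝ, |t| ≤ 1 →
      g n (q - t • ek (kp u q)) =
        f (q - t • ek (kp u q)) := fun q n hn t ht => by
    refine hge n _ ((norm_sub_le _ _).trans (add_le_add hn ?_))
    have h1 := (two_zpow_kp (hu q).1).1.trans (hu q).2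
    have h2 : ‖ek (kp u q)‖ ≤ 1 := by
      rw [ek, Prod.norm_def, max_le_iff, norm_one, Real.norm_of_nonneg (by positivity)]
      exact ⟨le_rfl, h1⟩
    rw [norm_smul]
    exact mul_le_one₀ ht (norm_nonneg _) h2
  have hpv : ∀ (q : ℝ × ℝ) (n : ℕ), ‖q‖ ≤ n →
      (pv fun t => g n (q - t • ek (kp u q))) =
        pv fun t => f (q - t • ek (kp u q)) := fun q n hn => by
    unfold pv
    congr 2
    funext t
    by_cases ht : |t| ≤ 1
    · simp only
      rw [hloc q n hn t ht, hloc q n hn (-t) (by rwa [abs_neg])]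
    · rw [Set.indicator_of_notMem (s := Set.Icc (-1 : ℝ) 1) fun h => ht (abs_le.2 h), zero_mul,
        zero_mul]
  refine ⟨fun q => pv fun t => f (q - t • ek (kp u q)),
    fun q => ?_, ?_⟩
  · obtain ⟨n, hn⟩ := exists_nat_ge ‖q‖
    obtain ⟨K, hK⟩ := hgl n
    have h := pv_trunc (lk_line (Nice.of_cc hK.continuous (hgs n)) hK
      (ek_ne (kp u q)) q)
    rw [hpv q n hn] at h
    refine h.congr fun ε => setIntegral_congr_fun ?_ fun t ht => ?_
    · exact (measurableSet_le measurable_const measurable_norm).inter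
        (measurableSet_le measurable_norm measurable_const)
    · simp only [hloc q n hn t ht.2]
      congr 2
      simp [ek, kp, Prod.ext_iff, mul_comm]
  · rw [← nrm_eq_eLpNorm hp0, ← nrm_eq_eLpNorm hp0]
    refine le_trans (nrm_liminf hp0 (F := fun n q =>
      ‖pv fun t => g n (q - t • ek (kp u q))‖ₑ)
      (K := C * nrm p (en f)) (fun n => ?_) (fun q => ?_) fun n => ?_)
      (mul_le_mul_left ?_ _)
    · obtain ⟨K, hK⟩ := hgl n
      exact (meas_pv hl.continuous hK.continuous.measurable).enorm
    · refine le_liminf_of_le (by isBoundedDefault) ?_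
      obtain ⟨m, hm⟩ := exists_nat_ge ‖q‖
      filter_upwards [eventually_ge_atTop m] with n hn
      rw [hpv q n (hm.trans (Nat.cast_le.2 hn))]
      exact le_rfl
    · exact (hC u (fun q => (hu q).1) hl _ (hgs n) (hgl n)).trans
        (mul_le_mul_right (nrm_mono hp0 (hgf n)) _)
    · rw [← ENNReal.ofReal_coe_nnreal]
      exact ENNReal.ofReal_le_ofReal (by linarith)
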